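/- Let p and q be distinct primes and let 𝐊 be a q-bounded (possibly infinite) algebraic extension of 𝔽_p(t). Then the set of all elements of 𝐊 that are algebraic over 𝔽_p (the constant field of 𝐊) is first-order definable over 𝐊 in the language of rings. -/

import Mathlib

noncomputable section

/-- A normalized (surjective onto `ℤ`) discrete valuation on a field `K`, i.e. a
"prime" of a global function field. -/
structure FFPrime (K : Type) [Field K] where
  ord : K → WithTop ℤ
  ord_zero : ord 0 = ⊤
  ord_ne_top : ∀ x : K, x ≠ 0 → ord x ≠ ⊤
  ord_one : ord 1 = 0
  ord_mul : ∀ x y : K, ord (x * y) = ord x + ord y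
  ord_add : ∀ x y : K, min (ord x) (ord y) ≤ ord (x + y)
  ord_surj : ∀ n : ℤ, ∃ x : K, ord x = (n : WithTop ℤ)

namespace FFPrime

variable {K L : Type} [Field K] [Field L]

/-- `w` lies over `v` along `φ`, with ramification index `e`. -/
def LiesOverWith (w : FFPrime L) (v : FFPrime K) (φ : K →+* L) (e : ℕ) : Prop :=
  0 < e ∧ ∀ x : K, w.ord (φ x) = ((e : ℤ) : WithTop ℤ) * v.ord x

/-- `w` lies over `v` along `φ`. -/
def LiesOver (w : FFPrime L) (v : FFPrime K) (φ : K →+* L) : Prop :=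
  ∃ e : ℕ, w.LiesOverWith v φ e

open Classical in
/-- The ramification index `e(w/v)`. -/
noncomputable def ramIdx (w : FFPrime L) (v : FFPrime K) (φ : K →+* L) : ℕ :=
  if h : ∃ e : ℕ, w.LiesOverWith v φ e then h.choose else 0

/-- The residue field of `v` has exactly `n` elements. -/
def HasResidueCard (v : FFPrime K) (n : ℕ) : Prop :=
  ∃ s : Finset K, s.card = n ∧ (∀ x ∈ s, 0 ≤ v.ord x) ∧
    (∀ x ∈ s, ∀ y ∈ s, x ≠ y → ¬ 0 < v.ord (x - y)) ∧
    (∀ z : K, 0 ≤ v.ord z → ∃ x ∈ s, 0 < v.ord (z - x))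

open Classical in
/-- The residue (relative) degree `f(w/v)`: the unique `f ≥ 1` with
`#κ_w = (#κ_v) ^ f` (residue fields of global function fields are finite). -/
noncomputable def resDeg (w : FFPrime L) (v : FFPrime K) : ℕ :=
  if h : ∃ f : ℕ, 0 < f ∧ ∃ m n : ℕ, 1 < m ∧ v.HasResidueCard m ∧
      w.HasResidueCard n ∧ n = m ^ f then h.choose else 0

/-- `v` splits completely in the extension given by `φ`: every prime above it has
ramification index and residue degree `1`. -/
def SplitsCompletely (v : FFPrime K) (φ : K →+* L) : Prop :=
  ∀ w : FFPrime L, w.LiesOver v φ → w.ramIdx v φ = 1 ∧ w.resDeg v = 1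

/-- `v` is inert in the finite extension `M/K`: there is a unique prime above it, with
ramification index `1` and residue degree `[M : K]`. -/
def IsInert (v : FFPrime K) (M : Type) [Field M] [Algebra K M] : Prop :=
  (∃! w : FFPrime M, w.LiesOver v (algebraMap K M)) ∧
    ∀ w : FFPrime M, w.LiesOver v (algebraMap K M) →
      w.ramIdx v (algebraMap K M) = 1 ∧ w.resDeg v = Module.finrank K M

/-- `v` ramifies in the extension given by `φ`: some prime above it has ramification
index `> 1`. -/
def Ramifies (v : FFPrime K) (φ : K →+* L) : Prop :=
  ∃ w : FFPrime L, w.LiesOver v φ ∧ 2 ≤ w.ramIdx v φ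

/-- `ord_v z ≡ 0 mod q`. -/
def OrdDvd (v : FFPrime K) (q : ℕ) (z : K) : Prop :=
  ∃ n : ℤ, v.ord z = (((q : ℤ) * n : ℤ) : WithTop ℤ)

end FFPrime

/-- A nontrivial (rank one) valuation on a possibly infinite algebraic extension of a
global function field, with values in `ℚ ∪ {∞}`. -/
structure FFVal (B : Type) [Field B] where
  ord : B → WithTop ℚ
  ord_zero : ord 0 = ⊤
  ord_ne_top : ∀ x : B, x ≠ 0 → ord x ≠ ⊤
  ord_one : ord 1 = 0
  ord_mul : ∀ x y : B, ord (x * y) = ord x + ord y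
  ord_add : ∀ x y : B, min (ord x) (ord y) ≤ ord (x + y)
  nontrivial : ∃ x : B, ord x ≠ 0 ∧ ord x ≠ ⊤

/-- The valuation `V` of the big field restricts, up to a normalization factor `c`, to
the (normalized discrete) prime `v` of `K` along `φ`; i.e. `v` is the prime of `K`
lying below `V`. -/
def FFVal.RestrictsTo {K B : Type} [Field K] [Field B] (V : FFVal B) (v : FFPrime K)
    (φ : K →+* B) : Prop :=
  ∃ c : ℚ, 0 < c ∧
    ∀ x : K, V.ord (φ x) = ((c : ℚ) : WithTop ℚ) * WithTop.map (fun n : ℤ => (n : ℚ)) (v.ord x)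

/-- The algebraic extension `B` of the rational function field `F0 = 𝔽_p(t)` is
`q`-bounded: for every valuation of `B`, the `q`-adic valuations of the ramification
indices and residue degrees along every finite subextension are bounded. -/
def IsQBounded (q : ℕ) (F0 B : Type) [Field F0] [Field B] [Algebra F0 B] : Prop :=
  ∀ V : FFVal B, ∃ C : ℕ,
    ∀ L : IntermediateField F0 B, FiniteDimensional F0 L →
      ∀ v0 : FFPrime F0, ∀ vL : FFPrime L,
        V.RestrictsTo v0 (algebraMap F0 B) →
        V.RestrictsTo vL L.val.toRingHom →
        padicValNat q (vL.ramIdx v0 (algebraMap F0 L)) ≤ C ∧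
        padicValNat q (vL.resDeg v0) ≤ C

/-- The prime `v` of `K` has uniformly `q`-bounded ramification in `B`. -/
def UnifQBoundedRam (q : ℕ) {K : Type} [Field K] (B : Type) [Field B] [Algebra K B]
    (v : FFPrime K) : Prop :=
  ∃ C : ℕ, ∀ F : IntermediateField K B, FiniteDimensional K F →
    ∀ w : FFPrime F, w.LiesOver v (algebraMap K F) →
      padicValNat q (w.ramIdx v (algebraMap K F)) ≤ C

/-- The prime `v` of `K` has uniformly absolutely bounded ramification in `B`. -/
def UnifAbsBoundedRam {K : Type} [Field K] (B : Type) [Field B] [Algebra K B]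
    (v : FFPrime K) : Prop :=
  ∃ C : ℕ, ∀ F : IntermediateField K B, FiniteDimensional K F →
    ∀ w : FFPrime F, w.LiesOver v (algebraMap K F) →
      w.ramIdx v (algebraMap K F) ≤ C

/-- The prime `v` of `K` has uniformly `q`-bounded relative (residue) degree in `B`. -/
def UnifQBoundedRes (q : ℕ) {K : Type} [Field K] (B : Type) [Field B] [Algebra K B]
    (v : FFPrime K) : Prop :=
  ∃ C : ℕ, ∀ F : IntermediateField K B, FiniteDimensional K F →
    ∀ w : FFPrime F, w.LiesOver v (algebraMap K F) →
      padicValNat q (w.resDeg v) ≤ C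

/-- The prime `v` of `K` is uniformly `q`-bounded in `B`. -/
def UniformlyQBoundedAt (q : ℕ) {K : Type} [Field K] (B : Type) [Field B] [Algebra K B]
    (v : FFPrime K) : Prop :=
  UnifQBoundedRam q B v ∧ UnifQBoundedRes q B v

/-- The integral closure in `B` of the valuation ring `O_v = {x ∈ K : ord_v x ≥ 0}`. -/
def valIntegralClosure {K : Type} [Field K] (v : FFPrime K) (B : Type) [Field B]
    [Algebra K B] : Set B :=
  {x : B | ∃ P : Polynomial K, P.Monic ∧ (∀ n : ℕ, 0 ≤ v.ord (P.coeff n)) ∧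
    Polynomial.aeval x P = 0}

/-- The integral closure in `B` of the ring `O_{K,S}` of `S`-integers of `K`. -/
def sIntegralClosure {K : Type} [Field K] (S : Set (FFPrime K)) (B : Type) [Field B]
    [Algebra K B] : Set B :=
  {x : B | ∃ P : Polynomial K, P.Monic ∧
    (∀ n : ℕ, ∀ v : FFPrime K, v ∉ S → 0 ≤ v.ord (P.coeff n)) ∧
    Polynomial.aeval x P = 0}

/-- Elements of `B` that are units at every prime of `B` lying over a prime of `S`. -/
def unitsAtS {K : Type} [Field K] (S : Set (FFPrime K)) (B : Type) [Field B]
    [Algebra K B] : Set B :=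
  {x : B | ∀ V : FFVal B, (∃ v ∈ S, V.RestrictsTo v (algebraMap K B)) → V.ord x = 0}

/-- Elements `x` of `B` with `ord (x - 1) > 0` at every prime of `B` lying over a
prime of `S`. -/
def onesAtS {K : Type} [Field K] (S : Set (FFPrime K)) (B : Type) [Field B]
    [Algebra K B] : Set B :=
  {x : B | ∀ V : FFVal B, (∃ v ∈ S, V.RestrictsTo v (algebraMap K B)) → 0 < V.ord (x - 1)}

/-- A subset of a commutative ring is first-order definable in the language of rings
`{0, 1, +, ·}` with parameters from the ring. -/
def FODefinable {R : Type} [CommRing R] (X : Set R) : Prop :=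
  letI : FirstOrder.Ring.CompatibleRing R := FirstOrder.Ring.compatibleRingOfRing R
  Set.Definable₁ (Set.univ : Set R) FirstOrder.Language.ring X

/-- A subset of a commutative ring is existentially (diophantine) definable: it is cut
out by a block of existential quantifiers followed by a system of polynomial equations,
with parameters (coefficients) from the ring. -/
def ExistDefinable {R : Type} [CommRing R] (X : Set R) : Prop :=
  ∃ (k m : ℕ) (P : Fin m → MvPolynomial (Fin (k + 1)) R),
    ∀ x : R, x ∈ X ↔ ∃ y : Fin k → R, ∀ i : Fin m,
      MvPolynomial.eval (Fin.cons x y) (P i) = 0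

/-- Solvability of the norm equation `N(y) = b·x^q + b^q` over (every realization of)
the tower `L₂(a^{1/q})/L₂`, where `L₁ = F((1+(b x^q+b^q)⁻¹)^{1/q})` and
`L₂ = L₁((1+(a+a⁻¹)b⁻¹)^{1/q})`. -/
def NormTower2Solvable (q : ℕ) (F : Type) [Field F] (a b x : F) : Prop :=
  ∀ (M1 : Type) [Field M1] [Algebra F M1] (α1 : M1),
    α1 ^ q = algebraMap F M1 (1 + (b * x ^ q + b ^ q)⁻¹) →
    IntermediateField.adjoin F {α1} = ⊤ →
    ∀ (M2 : Type) [Field M2] [Algebra M1 M2] (α2 : M2),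
      α2 ^ q = algebraMap M1 M2 (algebraMap F M1 (1 + (a + a⁻¹) * b⁻¹)) →
      IntermediateField.adjoin M1 {α2} = ⊤ →
      ∀ (M3 : Type) [Field M3] [Algebra M2 M3] (α3 : M3),
        α3 ^ q = algebraMap M2 M3 (algebraMap M1 M2 (algebraMap F M1 a)) →
        IntermediateField.adjoin M2 {α3} = ⊤ →
        ∃ y : M3, Algebra.norm M2 y = algebraMap M1 M2 (algebraMap F M1 (b * x ^ q + b ^ q))

/-- Solvability of the norm equation `N(y) = b·x^q + b^q` over (every realization of)
the tower `L₄(a^{1/q})/L₄`, where `L₁ = F((1+(b x^q+b^q)⁻¹)^{1/q})`,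
`L₃ = L₁((1+x⁻¹)^{1/q})` and `L₄ = L₃((1+(a+a⁻¹)x⁻¹)^{1/q})`. -/
def NormTower4Solvable (q : ℕ) (F : Type) [Field F] (a b x : F) : Prop :=
  ∀ (M1 : Type) [Field M1] [Algebra F M1] (α1 : M1),
    α1 ^ q = algebraMap F M1 (1 + (b * x ^ q + b ^ q)⁻¹) →
    IntermediateField.adjoin F {α1} = ⊤ →
    ∀ (M3 : Type) [Field M3] [Algebra M1 M3] (α3 : M3),
      α3 ^ q = algebraMap M1 M3 (algebraMap F M1 (1 + x⁻¹)) →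
      IntermediateField.adjoin M1 {α3} = ⊤ →
      ∀ (M4 : Type) [Field M4] [Algebra M3 M4] (α4 : M4),
        α4 ^ q = algebraMap M3 M4 (algebraMap M1 M3 (algebraMap F M1 (1 + (a + a⁻¹) * x⁻¹))) →
        IntermediateField.adjoin M3 {α4} = ⊤ →
        ∀ (M5 : Type) [Field M5] [Algebra M4 M5] (α5 : M5),
          α5 ^ q = algebraMap M4 M5 (algebraMap M3 M4 (algebraMap M1 M3 (algebraMap F M1 a))) →
          IntermediateField.adjoin M4 {α5} = ⊤ →
          ∃ y : M5, Algebra.norm M4 y =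
            algebraMap M3 M4 (algebraMap M1 M3 (algebraMap F M1 (b * x ^ q + b ^ q)))

/-- Unsolvability of the norm equation `N(y) = b·x^q + b^q` over (every realization of)
the tower `L₄(a^{1/q})/L₄` as in `NormTower4Solvable`. -/
def NormTower4Unsolvable (q : ℕ) (F : Type) [Field F] (a b x : F) : Prop :=
  ∀ (M1 : Type) [Field M1] [Algebra F M1] (α1 : M1),
    α1 ^ q = algebraMap F M1 (1 + (b * x ^ q + b ^ q)⁻¹) →
    IntermediateField.adjoin F {α1} = ⊤ →
    ∀ (M3 : Type) [Field M3] [Algebra M1 M3] (α3 : M3),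
      α3 ^ q = algebraMap M1 M3 (algebraMap F M1 (1 + x⁻¹)) →
      IntermediateField.adjoin M1 {α3} = ⊤ →
      ∀ (M4 : Type) [Field M4] [Algebra M3 M4] (α4 : M4),
        α4 ^ q = algebraMap M3 M4 (algebraMap M1 M3 (algebraMap F M1 (1 + (a + a⁻¹) * x⁻¹))) →
        IntermediateField.adjoin M3 {α4} = ⊤ →
        ∀ (M5 : Type) [Field M5] [Algebra M4 M5] (α5 : M5),
          α5 ^ q = algebraMap M4 M5 (algebraMap M3 M4 (algebraMap M1 M3 (algebraMap F M1 a))) →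
          IntermediateField.adjoin M4 {α5} = ⊤ →
          ¬ ∃ y : M5, Algebra.norm M4 y =
            algebraMap M3 M4 (algebraMap M1 M3 (algebraMap F M1 (b * x ^ q + b ^ q)))



section
/-- Auxiliary: a valuation with values in an ordered group, junk at zero. -/
structure Va (K : Type) [Field K] (Γ : Type) [AddCommGroup Γ] [LinearOrder Γ]
    [IsOrderedAddMonoid Γ] where
  v : K → Γ
  mul' : ∀ x y : K, x ≠ 0 → y ≠ 0 → v (x * y) = v x + v y
  add' : ∀ x y : K, x ≠ 0 → y ≠ 0 → x + y ≠ 0 → min (v x) (v y) ≤ v (x + y)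

namespace Va

variable {K : Type} [Field K] {Γ : Type} [AddCommGroup Γ] [LinearOrder Γ]
    [IsOrderedAddMonoid Γ] (V : Va K Γ)

theorem one : V.v 1 = 0 := by
  have := V.mul' 1 1 one_ne_zero one_ne_zero
  simpa using this

theorem mul {x y : K} (hx : x ≠ 0) (hy : y ≠ 0) : V.v (x * y) = V.v x + V.v y :=
  V.mul' x y hx hy

theorem neg_one : V.v (-1) = 0 := by
  have h := V.mul (x := -1) (y := -1) (by simp) (by simp)
  rw [neg_mul_neg, one_mul, V.one] at h
  have h2 : (2 : ℕ) • V.v (-1) = 0 := by rw [two_nsmul]; exact h.symm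
  rcases lt_trichotomy (V.v (-1)) 0 with h3 | h3 | h3
  · have := add_neg h3 h3
    rw [← h] at this; exact absurd this (lt_irrefl _)
  · exact h3
  · have := add_pos h3 h3
    rw [← h] at this; exact absurd this (lt_irrefl _)

theorem neg (x : K) : V.v (-x) = V.v x := by
  by_cases hx : x = 0
  · simp [hx]
  · rw [← neg_one_mul, V.mul (by simp) hx, V.neg_one, zero_add]

theorem inv {x : K} (hx : x ≠ 0) : V.v x⁻¹ = - V.v x := by
  have h := V.mul (x := x) (y := x⁻¹) hx (inv_ne_zero hx)
  rw [mul_inv_cancel₀ hx, V.one] at h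
  exact (neg_eq_of_add_eq_zero_right h.symm).symm

theorem div {x y : K} (hx : x ≠ 0) (hy : y ≠ 0) : V.v (x / y) = V.v x - V.v y := by
  rw [div_eq_mul_inv, V.mul hx (inv_ne_zero hy), V.inv hy, sub_eq_add_neg]

theorem pow {x : K} (hx : x ≠ 0) (n : ℕ) : V.v (x ^ n) = n • V.v x := by
  induction n with
  | zero => simp [V.one]
  | succ n ih => rw [pow_succ, V.mul (pow_ne_zero _ hx) hx, ih, succ_nsmul]

theorem zpow {x : K} (hx : x ≠ 0) (n : ℤ) : V.v (x ^ n) = n • V.v x := by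
  cases n with
  | ofNat n => simp [V.pow hx]
  | negSucc n => rw [zpow_negSucc, V.inv (pow_ne_zero _ hx), V.pow hx, negSucc_zsmul]

/-- `ge n x`: `x` has valuation at least `n`. -/
def ge (n : Γ) (x : K) : Prop := x = 0 ∨ n ≤ V.v x
/-- `gt n x`: `x` has valuation more than `n`. -/
def gt (n : Γ) (x : K) : Prop := x = 0 ∨ n < V.v x

variable {V}
theorem ge_zero' (n : Γ) : V.ge n 0 := Or.inl rfl
theorem gt_zero' (n : Γ) : V.gt n 0 := Or.inl rfl
theorem gt.ge {n : Γ} {x : K} (h : V.gt n x) : V.ge n x := h.imp id le_of_lt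
theorem ge.mono {m n : Γ} {x : K} (h : V.ge n x) (hm : m ≤ n) : V.ge m x := h.imp id hm.trans
theorem gt.mono {m n : Γ} {x : K} (h : V.gt n x) (hm : m ≤ n) : V.gt m x := h.imp id hm.trans_lt
theorem ge.gt {m n : Γ} {x : K} (h : V.ge n x) (hm : m < n) : V.gt m x := h.imp id hm.trans_le
theorem ge_one : V.ge 0 1 := Or.inr V.one.ge
theorem ge_of {n : Γ} {x : K} (h : n ≤ V.v x) : V.ge n x := Or.inr h
theorem ge_self (x : K) : V.ge (V.v x) x := Or.inr le_rfl
theorem ge.le {n : Γ} {x : K} (h : V.ge n x) (hx : x ≠ 0) : n ≤ V.v x := h.resolve_left hx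
theorem gt.lt {n : Γ} {x : K} (h : V.gt n x) (hx : x ≠ 0) : n < V.v x := h.resolve_left hx

theorem ge.neg {n : Γ} {x : K} (h : V.ge n x) : V.ge n (-x) := by
  rcases h with h | h
  · left; simp [h]
  · right; rwa [V.neg]
theorem gt.neg {n : Γ} {x : K} (h : V.gt n x) : V.gt n (-x) := by
  rcases h with h | h
  · left; simp [h]
  · right; rwa [V.neg]

theorem ge.add {n : Γ} {x y : K} (hx : V.ge n x) (hy : V.ge n y) : V.ge n (x + y) := by
  by_cases hx0 : x = 0
  · simpa [hx0] using hy
  by_cases hy0 : y = 0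
  · simpa [hy0] using hx
  by_cases h : x + y = 0
  · exact Or.inl h
  · exact Or.inr ((le_min (hx.le hx0) (hy.le hy0)).trans (V.add' x y hx0 hy0 h))

theorem gt.add {n : Γ} {x y : K} (hx : V.gt n x) (hy : V.gt n y) : V.gt n (x + y) := by
  by_cases hx0 : x = 0
  · simpa [hx0] using hy
  by_cases hy0 : y = 0
  · simpa [hy0] using hx
  by_cases h : x + y = 0
  · exact Or.inl h
  · exact Or.inr ((lt_min (hx.lt hx0) (hy.lt hy0)).trans_le (V.add' x y hx0 hy0 h))

theorem ge.sub {n : Γ} {x y : K} (hx : V.ge n x) (hy : V.ge n y) : V.ge n (x - y) := by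
  rw [sub_eq_add_neg]; exact hx.add hy.neg
theorem gt.sub {n : Γ} {x y : K} (hx : V.gt n x) (hy : V.gt n y) : V.gt n (x - y) := by
  rw [sub_eq_add_neg]; exact hx.add hy.neg

theorem ge.mul {m n : Γ} {x y : K} (hx : V.ge m x) (hy : V.ge n y) : V.ge (m + n) (x * y) := by
  by_cases hx0 : x = 0
  · simp [hx0, ge_zero']
  by_cases hy0 : y = 0
  · simp [hy0, ge_zero']
  right; rw [V.mul hx0 hy0]; exact add_le_add (hx.le hx0) (hy.le hy0)

theorem ge.mul0 {n : Γ} {x y : K} (hx : V.ge 0 x) (hy : V.ge n y) : V.ge n (x * y) := by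
  simpa using hx.mul hy

theorem gt.mul {m n : Γ} {x y : K} (hx : V.gt m x) (hy : V.ge n y) : V.gt (m + n) (x * y) := by
  by_cases hx0 : x = 0
  · simp [hx0, gt_zero']
  by_cases hy0 : y = 0
  · simp [hy0, gt_zero']
  right; rw [V.mul hx0 hy0]; exact add_lt_add_of_lt_of_le (hx.lt hx0) (hy.le hy0)

theorem ge.gt_mul {n : Γ} {x y : K} (hx : V.ge 0 x) (hy : V.gt n y) : V.gt n (x * y) := by
  have := hy.mul hx
  rwa [mul_comm, add_zero] at this

theorem ge.pow {x : K} (hx : V.ge 0 x) (n : ℕ) : V.ge 0 (x ^ n) := by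
  induction n with
  | zero => simpa using ge_one
  | succ n ih => rw [pow_succ]; exact ih.mul0 hx

theorem ge.sum {ι : Type*} {n : Γ} {s : Finset ι} {f : ι → K} (h : ∀ i ∈ s, V.ge n (f i)) :
    V.ge n (∑ i ∈ s, f i) := by
  classical
  induction s using Finset.induction_on with
  | empty => exact ge_zero' n
  | insert a s ha ih =>
    rw [Finset.sum_insert ha]
    exact (h a (Finset.mem_insert_self a s)).add (ih fun i hi => h i (Finset.mem_insert_of_mem hi))

theorem gt.sum {ι : Type*} {n : Γ} {s : Finset ι} {f : ι → K} (h : ∀ i ∈ s, V.gt n (f i)) :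
    V.gt n (∑ i ∈ s, f i) := by
  classical
  induction s using Finset.induction_on with
  | empty => exact gt_zero' n
  | insert a s ha ih =>
    rw [Finset.sum_insert ha]
    exact (h a (Finset.mem_insert_self a s)).add (ih fun i hi => h i (Finset.mem_insert_of_mem hi))

theorem ge_natCast (n : ℕ) : V.ge 0 (n : K) := by
  induction n with
  | zero => simpa using ge_zero' 0
  | succ n ih => push_cast; exact ih.add ge_one

theorem ge_intCast (n : ℤ) : V.ge 0 (n : K) := by
  cases n with
  | ofNat n => simpa using ge_natCast n
  | negSucc n => rw [Int.cast_negSucc]; exact (ge_natCast _).neg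

theorem v_add_of_gt {x y : K} (hx : x ≠ 0) (hy : V.gt (V.v x) y) :
    x + y ≠ 0 ∧ V.v (x + y) = V.v x := by
  have h0 : x + y ≠ 0 := by
    intro h
    have : y = -x := by linear_combination h
    subst this
    rcases hy with h | h
    · exact hx (by simpa using h)
    · rw [V.neg] at h; exact lt_irrefl _ h
  refine ⟨h0, le_antisymm ?_ ?_⟩
  · by_contra hlt
    push Not at hlt
    have h9 : V.gt (V.v x) (x + y) := Or.inr hlt
    have : V.gt (V.v x) ((x + y) - y) := h9.sub hy
    rw [add_sub_cancel_right] at this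
    exact lt_irrefl _ (this.lt hx)
  · exact ((ge_self x).add hy.ge).le h0

theorem v_eq_of_sub {x y : K} (hx : x ≠ 0) (hy : V.gt (V.v x) (y - x)) :
    y ≠ 0 ∧ V.v y = V.v x := by
  have := v_add_of_gt hx hy
  simpa using this

/-- valuation ring -/
def O (V : Va K Γ) : ValuationSubring K where
  carrier := {x | V.ge 0 x}
  mul_mem' := fun hx hy => hx.mul0 hy
  one_mem' := ge_one
  add_mem' := fun hx hy => hx.add hy
  zero_mem' := ge_zero' 0
  neg_mem' := fun hx => hx.neg
  mem_or_inv_mem' := fun x => by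
    by_cases hx : x = 0
    · exact Or.inl (Or.inl hx)
    · rcases le_total 0 (V.v x) with h | h
      · exact Or.inl (Or.inr h)
      · right; right; rw [V.inv hx]; exact neg_nonneg.mpr h

theorem mem_O {x : K} : x ∈ V.O ↔ V.ge 0 x := Iff.rfl

theorem mem_max {x : V.O} : x ∈ IsLocalRing.maximalIdeal V.O ↔ V.gt 0 (x : K) := by
  rw [IsLocalRing.mem_maximalIdeal, mem_nonunits_iff]
  constructor
  · intro h
    by_contra hx
    apply h
    have hx0 : (x : K) ≠ 0 := fun h0 => hx (Or.inl h0)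
    have hv : V.v (x : K) = 0 := by
      refine le_antisymm ?_ (x.2.le hx0)
      by_contra h2; push Not at h2; exact hx (Or.inr h2)
    have hi : (x : K)⁻¹ ∈ V.O := Or.inr (by rw [V.inv hx0, hv, neg_zero])
    exact IsUnit.of_mul_eq_one ⟨_, hi⟩ (Subtype.ext (mul_inv_cancel₀ hx0))
  · intro h hu
    obtain ⟨y, hy⟩ := hu.exists_right_inv
    have hxy : (x : K) * (y : K) = 1 := by
      have := congrArg Subtype.val hy
      simpa using this
    have := h.mul y.2
    rw [hxy, add_zero] at this
    have h3 := this.lt one_ne_zero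
    rw [V.one] at h3; exact lt_irrefl _ h3

theorem residue_eq_zero {x : V.O} : IsLocalRing.residue V.O x = 0 ↔ V.gt 0 (x : K) := by
  rw [IsLocalRing.residue_eq_zero_iff, mem_max]

theorem residue_eq {x y : V.O} :
    IsLocalRing.residue V.O x = IsLocalRing.residue V.O y ↔ V.gt 0 ((x : K) - y) := by
  rw [← sub_eq_zero, ← map_sub, residue_eq_zero]; rfl

/-- pull back along a ring hom -/
def comap {E : Type} [Field E] (V : Va K Γ) (φ : E →+* K) : Va E Γ where
  v x := V.v (φ x)
  mul' x y hx hy := by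
    rw [map_mul, V.mul ((map_ne_zero φ).mpr hx) ((map_ne_zero φ).mpr hy)]
  add' x y hx hy h := by
    rw [map_add]
    exact V.add' _ _ ((map_ne_zero φ).mpr hx) ((map_ne_zero φ).mpr hy)
      (by rw [← map_add]; exact (map_ne_zero φ).mpr h)

/-- Newton iteration: approximate q-th roots. -/
theorem newton {q : ℕ} (hq2 : 1 ≤ q) (hq : (q : K) ≠ 0) (hqv : V.v (q : K) = 0) {e : K} {δ : Γ}
    (hδ : 0 ≤ δ) (he : V.ge δ (e - 1)) (k : ℕ) :
    ∃ s : K, V.ge δ (s - 1) ∧ V.ge ((k + 1) • δ) (s ^ q - e) := by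
  induction k with
  | zero => exact ⟨1, by simp [ge_zero'], by simpa using he.neg⟩
  | succ k ih =>
    obtain ⟨s, hs, hse⟩ := ih
    set η : K := (e - s ^ q) / q with hη
    have hqi : V.ge 0 ((q : K)⁻¹) := Or.inr (by rw [V.inv hq, hqv, neg_zero])
    have hη1 : V.ge ((k + 1) • δ) η := by
      have := hqi.mul0 hse.neg
      rwa [neg_sub, mul_comm, ← div_eq_mul_inv] at this
    have hk : δ ≤ (k + 1) • δ := by
      rw [succ_nsmul]; exact le_add_of_nonneg_left (nsmul_nonneg hδ k)
    have hs0 : V.ge 0 s := by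
      have := (hs.mono hδ).add ge_one
      simpa using this
    refine ⟨s + η, ?_, ?_⟩
    · have := hs.add (hη1.mono hk)
      convert this using 1; ring
    · -- (s+η)^q = s^q + q s^{q-1} η + η^2 c
      obtain ⟨c, hc⟩ : ∃ c : K, V.ge 0 c ∧
          (s + η) ^ q = s ^ q + q * s ^ (q - 1) * η + η ^ 2 * c := by
        have hη0 : V.ge 0 η := hη1.mono (hδ.trans hk)
        have := Polynomial.powAddExpansion (⟨s, hs0⟩ : V.O) (⟨η, hη0⟩ : V.O) q
        obtain ⟨c, hc⟩ := this
        refine ⟨c, c.2, ?_⟩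
        have := congrArg Subtype.val hc
        push_cast at this
        rw [this]; ring
      have h1 : V.ge δ (s ^ (q - 1) - 1) := by
        obtain ⟨d, hd⟩ := sub_dvd_pow_sub_pow (⟨s, hs0⟩ : V.O) 1 (q - 1)
        have := congrArg Subtype.val hd
        push_cast at this
        rw [one_pow] at this
        rw [this, mul_comm]
        exact (show V.ge 0 (d : K) from d.2).mul0 hs
      have hid : (s + η) ^ q - e = (s ^ (q - 1) - 1) * (q * η) + η * (η * c) := by
        rw [hc.2]
        have : e = s ^ q + q * η := by rw [hη]; field_simp; ring
        rw [this]; ring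
      rw [hid, succ_nsmul' , ]
      refine (h1.mul ((ge_natCast q).mul0 hη1)).add ?_
      have h3 := (hη1.mono hk).mul (hc.1.mul0 hη1)
      rwa [mul_comm c η] at h3

end Va

theorem WithTop.coe_untopD_of_ne {α : Type*} (d : α) {x : WithTop α} (h : x ≠ ⊤) :
    ((x.untopD d : α) : WithTop α) = x := by
  cases x with
  | top => exact absurd rfl h
  | coe a => rfl

namespace FFPrime
variable {K : Type} [Field K]
/-- associated `Va` -/
def va (P : FFPrime K) : Va K ℤ where
  v x := (P.ord x).untopD 0
  mul' x y hx hy := by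
    rw [P.ord_mul]
    have h1 := P.ord_ne_top x hx
    have h2 := P.ord_ne_top y hy
    lift P.ord x to ℤ using h1 with a
    lift P.ord y to ℤ using h2 with b
    rfl
  add' x y hx hy hxy := by
    have h1 := P.ord_ne_top x hx
    have h2 := P.ord_ne_top y hy
    have h3 := P.ord_ne_top _ hxy
    have h := P.ord_add x y
    lift P.ord x to ℤ using h1 with a
    lift P.ord y to ℤ using h2 with b
    lift P.ord (x + y) to ℤ using h3 with c
    have h' : ((min a b : ℤ) : WithTop ℤ) ≤ c := h
    exact WithTop.coe_le_coe.mp h'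

theorem ord_eq (P : FFPrime K) {x : K} (hx : x ≠ 0) : P.ord x = ((P.va.v x : ℤ) : WithTop ℤ) :=
  (WithTop.coe_untopD_of_ne 0 (P.ord_ne_top x hx)).symm

theorem ext_va {P P' : FFPrime K} (h : ∀ x, x ≠ 0 → P.va.v x = P'.va.v x) : P = P' := by
  have : P.ord = P'.ord := by
    funext x
    by_cases hx : x = 0
    · rw [hx, P.ord_zero, P'.ord_zero]
    · rw [P.ord_eq hx, P'.ord_eq hx, h x hx]
  cases P; cases P'; cases this; rfl

theorem exists_v (P : FFPrime K) (n : ℤ) : ∃ x, x ≠ 0 ∧ P.va.v x = n := by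
  obtain ⟨x, hx⟩ := P.ord_surj n
  refine ⟨x, ?_, ?_⟩
  · rintro rfl; rw [P.ord_zero] at hx; exact absurd hx (by simp)
  · change (P.ord x).untopD 0 = n; rw [hx]; rfl

open Classical in
/-- build from a `Va`. -/
def ofVa (V : Va K ℤ) (h : ∃ x, x ≠ 0 ∧ V.v x = 1) : FFPrime K where
  ord x := if x = 0 then ⊤ else ((V.v x : ℤ) : WithTop ℤ)
  ord_zero := by simp
  ord_ne_top x hx := by simp [hx]
  ord_one := by simp [V.one]
  ord_mul x y := by
    by_cases hx : x = 0
    · simp [hx]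
    by_cases hy : y = 0
    · simp [hy]
    simp [hx, hy, V.mul hx hy]
  ord_add x y := by
    by_cases hx : x = 0
    · simp [hx]
    by_cases hy : y = 0
    · simp [hy]
    by_cases hxy : x + y = 0
    · simp [hxy]
    simp only [hx, hy, hxy, if_false]
    have : ((min (V.v x) (V.v y) : ℤ) : WithTop ℤ) ≤ (V.v (x + y) : ℤ) :=
      WithTop.coe_le_coe.mpr (V.add' x y hx hy hxy)
    exact this
  ord_surj n := by
    obtain ⟨x, hx, h1⟩ := h
    refine ⟨x ^ n, ?_⟩
    rw [if_neg (zpow_ne_zero n hx), V.zpow hx, h1]; simp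

theorem ofVa_v (V : Va K ℤ) (h : ∃ x, x ≠ 0 ∧ V.v x = 1) {x : K} (hx : x ≠ 0) :
    (ofVa V h).va.v x = V.v x := by
  simp [va, ofVa, hx]

theorem ge_iff (P : FFPrime K) (n : ℤ) (x : K) : (n : WithTop ℤ) ≤ P.ord x ↔ P.va.ge n x := by
  by_cases hx : x = 0
  · simp [hx, P.ord_zero, Va.ge_zero']
  · rw [P.ord_eq hx]
    simp only [Va.ge, hx, false_or]
    exact WithTop.coe_le_coe

theorem gt_iff (P : FFPrime K) (n : ℤ) (x : K) : (n : WithTop ℤ) < P.ord x ↔ P.va.gt n x := by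
  by_cases hx : x = 0
  · simp [hx, P.ord_zero, Va.gt_zero']
  · rw [P.ord_eq hx]
    simp only [Va.gt, hx, false_or]
    exact WithTop.coe_lt_coe

end FFPrime

namespace FFVal
variable {K : Type} [Field K]
/-- associated `Va` -/
def va (P : FFVal K) : Va K ℚ where
  v x := (P.ord x).untopD 0
  mul' x y hx hy := by
    rw [P.ord_mul]
    have h1 := P.ord_ne_top x hx
    have h2 := P.ord_ne_top y hy
    lift P.ord x to ℚ using h1 with a
    lift P.ord y to ℚ using h2 with b
    rfl
  add' x y hx hy hxy := by
    have h1 := P.ord_ne_top x hx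
    have h2 := P.ord_ne_top y hy
    have h3 := P.ord_ne_top _ hxy
    have h := P.ord_add x y
    lift P.ord x to ℚ using h1 with a
    lift P.ord y to ℚ using h2 with b
    lift P.ord (x + y) to ℚ using h3 with c
    have h' : ((min a b : ℚ) : WithTop ℚ) ≤ c := h
    exact WithTop.coe_le_coe.mp h'

theorem ord_eq (P : FFVal K) {x : K} (hx : x ≠ 0) : P.ord x = ((P.va.v x : ℚ) : WithTop ℚ) :=
  (WithTop.coe_untopD_of_ne 0 (P.ord_ne_top x hx)).symm

open Classical in
/-- build from a `Va`. -/
def ofVa (V : Va K ℚ) (h : ∃ x, x ≠ 0 ∧ V.v x ≠ 0) : FFVal K where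
  ord x := if x = 0 then ⊤ else ((V.v x : ℚ) : WithTop ℚ)
  ord_zero := by simp
  ord_ne_top x hx := by simp [hx]
  ord_one := by simp [V.one]
  ord_mul x y := by
    by_cases hx : x = 0
    · simp [hx]
    by_cases hy : y = 0
    · simp [hy]
    simp [hx, hy, V.mul hx hy]
  ord_add x y := by
    by_cases hx : x = 0
    · simp [hx]
    by_cases hy : y = 0
    · simp [hy]
    by_cases hxy : x + y = 0
    · simp [hxy]
    simp only [hx, hy, hxy, if_false]
    have : ((min (V.v x) (V.v y) : ℚ) : WithTop ℚ) ≤ (V.v (x + y) : ℚ) :=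
      WithTop.coe_le_coe.mpr (V.add' x y hx hy hxy)
    exact this
  nontrivial := by
    obtain ⟨x, hx, h1⟩ := h
    refine ⟨x, ?_, ?_⟩
    · rw [if_neg hx]; simpa using h1
    · simp [hx]

theorem ofVa_v (V : Va K ℚ) (h : ∃ x, x ≠ 0 ∧ V.v x ≠ 0) {x : K} (hx : x ≠ 0) :
    (ofVa V h).va.v x = V.v x := by
  simp [va, ofVa, hx]

theorem restrictsTo_iff {L : Type} [Field L] (V : FFVal K) (P : FFPrime L) (φ : L →+* K) :
    V.RestrictsTo P φ ↔ ∃ c : ℚ, 0 < c ∧ ∀ x, x ≠ 0 → V.va.v (φ x) = c * P.va.v x := by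
  unfold RestrictsTo
  refine exists_congr fun c => and_congr_right fun hc => ?_
  constructor
  · intro h x hx
    have := h x
    rw [P.ord_eq hx, V.ord_eq ((map_ne_zero φ).mpr hx)] at this
    exact WithTop.coe_injective this
  · intro h x
    by_cases hx : x = 0
    · rw [hx, map_zero, V.ord_zero, P.ord_zero]
      symm
      exact WithTop.mul_top (by simpa using hc.ne')
    · rw [P.ord_eq hx, V.ord_eq ((map_ne_zero φ).mpr hx), h x hx]
      rfl
end FFVal
end

section
open Polynomial
open scoped IntermediateField.algebraAdjoinAdjoin

/-- transcendence degree one over the prime field -/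
def TD1 (p : ℕ) [Fact p.Prime] (E : Type) [Field E] [Algebra (ZMod p) E] : Prop :=
  Algebra.trdeg (ZMod p) E = 1

/-- function field in one variable over the prime field -/
structure FunF (p : ℕ) [Fact p.Prime] (E : Type) [Field E] [Algebra (ZMod p) E] : Prop where
  td : TD1 p E
  fg : Algebra.EssFiniteType (ZMod p) E

section
variable {p : ℕ} [Fact p.Prime] {E : Type} [Field E] [Algebra (ZMod p) E]

theorem TD1.algebraic (h : TD1 p E) {z : E} (hz : Transcendental (ZMod p) z) :
    Algebra.IsAlgebraic (Algebra.adjoin (ZMod p) {z}) E := by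
  have h1 : AlgebraicIndependent (ZMod p) (fun _ : Unit => z) := by
    rw [algebraicIndependent_unique_type_iff]; exact hz
  have h2 : IsTranscendenceBasis (ZMod p) (fun _ : Unit => z) :=
    h1.isTranscendenceBasis_of_trdeg_le_of_finite (by rw [h]; simp)
  have := h2.isAlgebraic
  rwa [Set.range_const] at this

theorem TD1.exists_trans (h : TD1 p E) : ∃ z : E, Transcendental (ZMod p) z := by
  by_contra hc
  have : Algebra.IsAlgebraic (ZMod p) E := ⟨fun x => by
    by_contra hx; exact hc ⟨x, hx⟩⟩
  have h0 : Algebra.trdeg (ZMod p) E = 0 := trdeg_eq_zero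
  rw [h] at h0; exact one_ne_zero h0

theorem TD1.of_algebraic {z : E} (hz : Transcendental (ZMod p) z)
    (h : ∀ y : E, IsAlgebraic (Algebra.adjoin (ZMod p) {z}) y) : TD1 p E := by
  have h1 : AlgebraicIndependent (ZMod p) (fun _ : Unit => z) := by
    rw [algebraicIndependent_unique_type_iff]; exact hz
  have h2 : IsTranscendenceBasis (ZMod p) (fun _ : Unit => z) := by
    rw [h1.isTranscendenceBasis_iff_isAlgebraic, Set.range_const]
    exact ⟨h⟩
  have := h2.cardinalMk_eq_trdeg
  simpa [TD1] using this.symm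

theorem FunF.finite (h : FunF p E) {z : E} (hz : Transcendental (ZMod p) z) :
    FiniteDimensional (IntermediateField.adjoin (ZMod p) {z}) E := by
  have := h.fg
  have h1 := h.td.algebraic hz
  have h2 : Algebra.EssFiniteType (IntermediateField.adjoin (ZMod p) {z}) E :=
    .of_comp (ZMod p) _ _
  have h3 : Algebra.IsAlgebraic (IntermediateField.adjoin (ZMod p) {z}) E :=
    ⟨fun y => (h1.isAlgebraic y).extendScalars
      (FaithfulSMul.algebraMap_injective (Algebra.adjoin (ZMod p) {z}) _)⟩
  exact Algebra.finite_of_essFiniteType_of_isAlgebraic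

/-- degree over `F_p(z)` -/
def ndeg (p : ℕ) [Fact p.Prime] {E : Type} [Field E] [Algebra (ZMod p) E] (z : E) : ℕ :=
  Module.finrank (IntermediateField.adjoin (ZMod p) {z}) E

theorem aeval_ne_zero {z : E} (hz : Transcendental (ZMod p) z) {g : (ZMod p)[X]} (hg : g ≠ 0) :
    aeval z g ≠ 0 := fun h => hg ((transcendental_iff.mp hz) g h)

theorem indep_lift {z : E} {ι : Type} {f : ι → E}
    (hf : ∀ (s : Finset ι) (g : ι → (ZMod p)[X]),
      ∑ i ∈ s, aeval z (g i) * f i = 0 → ∀ i ∈ s, g i = 0) :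
    LinearIndependent (IntermediateField.adjoin (ZMod p) {z}) f := by
  rw [← LinearIndependent.iff_fractionRing (Algebra.adjoin (ZMod p) {z})]
  rw [linearIndependent_iff']
  intro s g hg i hi
  have hG : ∀ i, ∃ G : (ZMod p)[X], aeval z G = (g i : E) := fun i => by
    have := (g i).2
    generalize (g i : E) = u at this
    rw [Algebra.adjoin_singleton_eq_range_aeval] at this
    exact this
  choose G hG using hG
  have := hf s G (by
    rw [← hg]; refine Finset.sum_congr rfl fun j _ => ?_
    rw [hG]; rfl) i hi
  have h2 := hG i
  rw [this, map_zero] at h2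
  exact Subtype.ext h2.symm

theorem dep (h : FunF p E) {z : E} (hz : Transcendental (ZMod p) z) {ι : Type} [Fintype ι]
    (hι : ndeg p z < Fintype.card ι) (f : ι → E) :
    ∃ g : ι → (ZMod p)[X], (∃ i, g i ≠ 0) ∧ ∑ i, aeval z (g i) * f i = 0 := by
  classical
  by_contra hc
  push Not at hc
  have := h.finite hz
  have h1 : LinearIndependent (IntermediateField.adjoin (ZMod p) {z}) f := by
    apply indep_lift (z := z)
    intro s g hg
    by_contra hh
    push Not at hh
    obtain ⟨i, hi, hgi⟩ := hh
    refine hc (fun j => if j ∈ s then g j else 0) ⟨i, by simpa [hi] using hgi⟩ ?_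
    rw [← hg, ← Finset.sum_subset (Finset.subset_univ s)]
    · exact Finset.sum_congr rfl fun j hj => by simp [hj]
    · intro j _ hj; simp [hj]
  have := h1.fintype_card_le_finrank
  exact absurd this (not_le.mpr hι)

theorem exists_indep (h : FunF p E) {z : E} (hz : Transcendental (ZMod p) z) :
    ∃ b : Fin (ndeg p z) → E, ∀ g : Fin (ndeg p z) → (ZMod p)[X],
      ∑ i, aeval z (g i) * b i = 0 → ∀ i, g i = 0 := by
  have := h.finite hz
  let B := Module.finBasis (IntermediateField.adjoin (ZMod p) {z}) E
  refine ⟨B, fun g hg i => ?_⟩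
  have hB := B.linearIndependent
  rw [Fintype.linearIndependent_iff] at hB
  let zz : IntermediateField.adjoin (ZMod p) {z} := IntermediateField.AdjoinSimple.gen (ZMod p) z
  have hz' : ∀ g : (ZMod p)[X], ((aeval zz g : IntermediateField.adjoin (ZMod p) {z}) : E) = aeval z g := by
    intro g
    have := aeval_algebraMap_apply E zz g
    exact this.symm
  have := hB (fun i => aeval zz (g i)) (by
    rw [← hg]; refine Finset.sum_congr rfl fun j _ => ?_
    rw [Algebra.smul_def, ← hz']; rfl) i
  by_contra hgi
  apply aeval_ne_zero hz hgi
  rw [← hz', this]; rfl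

theorem ndeg_pos (h : FunF p E) {z : E} (hz : Transcendental (ZMod p) z) : 0 < ndeg p z := by
  have := h.finite hz
  exact Module.finrank_pos

theorem alg_rel (h : TD1 p E) {z : E} (hz : Transcendental (ZMod p) z) (y : E) :
    ∃ (n : ℕ) (g : Fin n → (ZMod p)[X]), (∃ i, g i ≠ 0) ∧ ∑ i, aeval z (g i) * y ^ (i : ℕ) = 0 := by
  obtain ⟨P, hP, hPy⟩ := (h.algebraic hz).isAlgebraic y
  have hG : ∀ i, ∃ G : (ZMod p)[X], aeval z G = (P.coeff i : E) := fun i => by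
    have := (P.coeff i).2
    generalize (P.coeff i : E) = u at this
    rw [Algebra.adjoin_singleton_eq_range_aeval] at this
    exact this
  choose G hG using hG
  refine ⟨P.natDegree + 1, fun i => G i, ⟨⟨P.natDegree, by simp⟩, ?_⟩, ?_⟩
  · intro h0
    have := hG P.natDegree
    dsimp only at h0
    rw [h0, map_zero] at this
    exact hP (leadingCoeff_eq_zero.mp (Subtype.ext this.symm))
  · rw [aeval_eq_sum_range] at hPy
    rw [Fin.sum_univ_eq_sum_range (fun i => aeval z (G i) * y ^ i), ← hPy]
    refine Finset.sum_congr rfl fun j _ => ?_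
    rw [hG]; rfl
end

namespace Va
variable {p : ℕ} [Fact p.Prime] {E : Type} [Field E] [Algebra (ZMod p) E]
variable {Γ : Type} [AddCommGroup Γ] [LinearOrder Γ] [IsOrderedAddMonoid Γ]

theorem v_of_pow_eq_one (V : Va E Γ) {x : E} {n : ℕ} (hn : n ≠ 0) (h : x ^ n = 1) : V.v x = 0 := by
  have hx : x ≠ 0 := by rintro rfl; rw [zero_pow hn] at h; exact zero_ne_one h
  have := V.pow hx n
  rw [h, V.one] at this
  by_contra h0
  rcases lt_or_gt_of_ne h0 with h1 | h1
  · have := nsmul_neg h1 hn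
    rw [← V.pow hx, h, V.one] at this; exact lt_irrefl _ this
  · have := nsmul_pos h1 hn
    rw [← V.pow hx, h, V.one] at this; exact lt_irrefl _ this

theorem v_const (V : Va E Γ) {c : ZMod p} (hc : c ≠ 0) : V.v (algebraMap (ZMod p) E c) = 0 := by
  refine V.v_of_pow_eq_one (n := p - 1) ?_ ?_
  · have := (Fact.out : p.Prime).two_le; omega
  · rw [← map_pow, ZMod.pow_card_sub_one_eq_one hc, map_one]

theorem ge_const (V : Va E Γ) (c : ZMod p) : V.ge 0 (algebraMap (ZMod p) E c) := by
  by_cases hc : c = 0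
  · left; simp [hc]
  · right; rw [V.v_const hc]

theorem ge_aeval (V : Va E Γ) {z : E} (hz : V.ge 0 z) (g : (ZMod p)[X]) : V.ge 0 (aeval z g) := by
  induction g using Polynomial.induction_on' with
  | add f g hf hg => rw [map_add]; exact hf.add hg
  | monomial n c => rw [aeval_monomial]; exact (V.ge_const c).mul0 (hz.pow n)

theorem aeval_unit (V : Va E Γ) {z : E} (hz : V.gt 0 z) {g : (ZMod p)[X]} (hg : g.coeff 0 ≠ 0) :
    aeval z g ≠ 0 ∧ V.v (aeval z g) = 0 := by
  have h1 : aeval z g = algebraMap (ZMod p) E (g.coeff 0) + z * aeval z g.divX := by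
    conv_lhs => rw [← divX_mul_X_add g]
    rw [map_add, map_mul, aeval_X, aeval_C]; ring
  have hc : algebraMap (ZMod p) E (g.coeff 0) ≠ 0 := by simpa using hg
  have h2 := v_add_of_gt (V := V) hc (y := z * aeval z g.divX) (by
    rw [V.v_const hg]
    simpa using hz.mul (V.ge_aeval hz.ge g.divX))
  rw [h1]
  refine ⟨h2.1, h2.2.trans (V.v_const hg)⟩

theorem v_aeval (V : Va E Γ) {z : E} (hz0 : z ≠ 0) (hz : 0 < V.v z) {g : (ZMod p)[X]} (hg : g ≠ 0) :
    aeval z g ≠ 0 ∧ V.v (aeval z g) = g.natTrailingDegree • V.v z := by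
  obtain ⟨h, hh⟩ : ∃ h : (ZMod p)[X], g = X ^ g.natTrailingDegree * h :=
    (Polynomial.X_pow_dvd_iff.mpr fun d hd => Polynomial.coeff_eq_zero_of_lt_natTrailingDegree hd)
  have hc : h.coeff 0 ≠ 0 := by
    have h1 : g.coeff g.natTrailingDegree ≠ 0 := by
      have := Polynomial.trailingCoeff_nonzero_iff_nonzero.mpr hg
      exact this
    rw [hh] at h1
    rw [← hh] at h1
    have := Polynomial.coeff_X_pow_mul h g.natTrailingDegree 0
    rw [← hh, zero_add] at this
    rwa [this] at h1
  obtain ⟨h1, h2⟩ := V.aeval_unit (Or.inr hz) hc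
  have : aeval z g = z ^ g.natTrailingDegree * aeval z h := by
    conv_lhs => rw [hh]
    simp
  rw [this]
  exact ⟨mul_ne_zero (pow_ne_zero _ hz0) h1, by rw [V.mul (pow_ne_zero _ hz0) h1, V.pow hz0, h2, add_zero]⟩

theorem transc_of_v (V : Va E Γ) {z : E} (hz0 : z ≠ 0) (hz : V.v z ≠ 0) : Transcendental (ZMod p) z := by
  have key : ∀ y : E, y ≠ 0 → 0 < V.v y → Transcendental (ZMod p) y := fun y hy0 hy => by
    rw [transcendental_iff]
    intro g hg
    by_contra hne
    exact (V.v_aeval hy0 hy hne).1 hg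
  rcases lt_or_gt_of_ne hz with h | h
  · have := key z⁻¹ (inv_ne_zero hz0) (by rw [V.inv hz0]; exact neg_pos.mpr h)
    intro ha
    exact this ha.inv
  · exact key z hz0 h

/-- two terms in a vanishing sum have the same valuation -/
theorem exists_eq_of_sum (V : Va E Γ) {ι : Type*} (s : Finset ι) (f : ι → E) (hs : ∑ i ∈ s, f i = 0)
    (h0 : ∃ i ∈ s, f i ≠ 0) :
    ∃ i ∈ s, ∃ j ∈ s, i ≠ j ∧ f i ≠ 0 ∧ f j ≠ 0 ∧ V.v (f i) = V.v (f j) := by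
  classical
  by_contra hc
  push Not at hc
  obtain ⟨i0, hi0, hf0⟩ := h0
  obtain ⟨i, hi, hmin⟩ := Finset.exists_min_image (s.filter fun i => f i ≠ 0) (fun i => V.v (f i))
    ⟨i0, by simp [hi0, hf0]⟩
  rw [Finset.mem_filter] at hi
  have hgt : V.gt (V.v (f i)) (∑ j ∈ s.erase i, f j) := gt.sum fun j hj => by
    rw [Finset.mem_erase] at hj
    by_cases hfj : f j = 0
    · exact Or.inl hfj
    · right
      refine lt_of_le_of_ne (hmin j (by simp [hj.2, hfj])) ?_
      exact hc i hi.1 j hj.2 hj.1.symm hi.2 hfj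
  have := (v_add_of_gt hi.2 hgt).1
  rw [Finset.add_sum_erase s f hi.1] at this
  exact this hs

end Va

section VAL
variable {p : ℕ} [Fact p.Prime] {E : Type} [Field E] [Algebra (ZMod p) E]

/-- every value is commensurable with that of `z`. -/
theorem value_rel {Γ : Type} [AddCommGroup Γ] [LinearOrder Γ] [IsOrderedAddMonoid Γ] (V : Va E Γ)
    {z : E} (hz0 : z ≠ 0) (hz : 0 < V.v z) {n : ℕ} (g : Fin n → (ZMod p)[X]) {y : E} (hy : y ≠ 0)
    (hg : ∃ i, g i ≠ 0) (h : ∑ i, aeval z (g i) * y ^ (i : ℕ) = 0) :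
    ∃ k : ℕ, 0 < k ∧ k < n ∧ ∃ m : ℤ, k • V.v y = m • V.v z := by
  obtain ⟨i0, hi0⟩ := hg
  obtain ⟨i, -, j, -, hij, hfi, hfj, hv⟩ := V.exists_eq_of_sum Finset.univ _ h
    ⟨i0, Finset.mem_univ _, mul_ne_zero (V.v_aeval hz0 hz hi0).1 (pow_ne_zero _ hy)⟩
  have gi : g i ≠ 0 := fun h0 => hfi (by simp [h0])
  have gj : g j ≠ 0 := fun h0 => hfj (by simp [h0])
  rw [V.mul (V.v_aeval hz0 hz gi).1 (pow_ne_zero _ hy),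
    V.mul (V.v_aeval hz0 hz gj).1 (pow_ne_zero _ hy), (V.v_aeval hz0 hz gi).2,
    (V.v_aeval hz0 hz gj).2, V.pow hy, V.pow hy] at hv
  set a := (g i).natTrailingDegree
  set b := (g j).natTrailingDegree
  simp only [← natCast_zsmul] at hv ⊢
  rcases lt_or_gt_of_ne (fun h => hij (Fin.ext h) : (i : ℕ) ≠ j) with hlt | hlt
  · refine ⟨j - i, by omega, by omega, (a : ℤ) - b, ?_⟩
    rw [Nat.cast_sub hlt.le, sub_smul, sub_smul, sub_eq_sub_iff_add_eq_add, add_comm, ← hv]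

  · refine ⟨i - j, by omega, by omega, (b : ℤ) - a, ?_⟩
    rw [Nat.cast_sub hlt.le, sub_smul, sub_smul, sub_eq_sub_iff_add_eq_add, add_comm, hv]


open Classical in
/-- value group additive version -/
def ofValuation (B : ValuationSubring E) : Va E (Additive (B.ValueGroup)ˣ)ᵒᵈ where
  v x := if h : x = 0 then 0 else OrderDual.toDual (Additive.ofMul (Units.mk0 (B.valuation x) (by simpa using h)))
  mul' x y hx hy := by
    have : x * y ≠ 0 := mul_ne_zero hx hy
    simp only [hx, hy, this, dite_false]
    apply congrArg OrderDual.toDual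
    apply congrArg Additive.ofMul
    ext
    exact B.valuation.map_mul x y
  add' x y hx hy hxy := by
    simp only [hx, hy, hxy, dite_false]
    have := B.valuation.map_add x y
    rw [le_max_iff] at this
    rw [min_le_iff]
    rcases this with h | h
    · left; exact h
    · right; exact h
theorem toRat (h : TD1 p E) {Γ : Type} [AddCommGroup Γ] [LinearOrder Γ] [IsOrderedAddMonoid Γ]
    (V : Va E Γ) {z : E} (hz0 : z ≠ 0) (hz : 0 < V.v z) :
    ∃ W : Va E ℚ, W.v z = 1 ∧ ∀ x, x ≠ 0 → (0 ≤ W.v x ↔ 0 ≤ V.v x) := by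
  have hzt : Transcendental (ZMod p) z := V.transc_of_v hz0 hz.ne'
  have ex : ∀ y : E, y ≠ 0 → ∃ k : ℕ, 0 < k ∧ ∃ m : ℤ, k • V.v y = m • V.v z := fun y hy => by
    obtain ⟨n, g, hg, hs⟩ := alg_rel h hzt y
    obtain ⟨k, hk, -, m, hm⟩ := value_rel V hz0 hz g hy hg hs
    exact ⟨k, hk, m, hm⟩
  have hle : ∀ m m' : ℤ, m • V.v z ≤ m' • V.v z ↔ m ≤ m' := fun m m' =>
    zsmul_le_zsmul_iff_left hz
  have hinj : ∀ m m' : ℤ, m • V.v z = m' • V.v z → m = m' := fun m m' h =>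
    le_antisymm ((hle _ _).mp h.le) ((hle _ _).mp h.ge)
  have ex2 : ∀ y : E, ∃ r : ℚ, y ≠ 0 → ∀ (k : ℕ) (m : ℤ), 0 < k → k • V.v y = m • V.v z → r = m / k := by
    intro y
    by_cases hy : y = 0
    · exact ⟨0, fun h => absurd hy h⟩
    obtain ⟨k, hk, m, hm⟩ := ex y hy
    refine ⟨m / k, fun _ k' m' hk' hm' => ?_⟩
    have : (m * k' : ℤ) • V.v z = (m' * k : ℤ) • V.v z := by
      rw [mul_comm, mul_comm m', mul_smul, mul_smul, ← hm, ← hm', natCast_zsmul, natCast_zsmul,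
        smul_comm]
    have := hinj _ _ this
    have h1 : (k : ℚ) ≠ 0 := by positivity
    have h2 : (k' : ℚ) ≠ 0 := by positivity
    rw [div_eq_div_iff h1 h2]
    exact_mod_cast this
  choose w hw using ex2
  have hmul : ∀ x y : E, x ≠ 0 → y ≠ 0 → w (x * y) = w x + w y := fun x y hx hy => by
    obtain ⟨k, hk, m, hm⟩ := ex x hx
    obtain ⟨k', hk', m', hm'⟩ := ex y hy
    rw [hw x hx k m hk hm, hw y hy k' m' hk' hm', hw (x * y) (mul_ne_zero hx hy) (k * k') (m * k' + m' * k) (by positivity)]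
    · have h1 : (k : ℚ) ≠ 0 := by positivity
      have h2 : (k' : ℚ) ≠ 0 := by positivity
      push_cast; field_simp
    · rw [V.mul hx hy, smul_add, mul_comm k k', mul_smul, hm, mul_comm k' k, mul_smul, hm', add_smul,
        mul_comm m, mul_comm m', mul_smul, mul_smul, natCast_zsmul, natCast_zsmul]
  have hnn : ∀ x, x ≠ 0 → (0 ≤ w x ↔ 0 ≤ V.v x) := fun x hx => by
    obtain ⟨k, hk, m, hm⟩ := ex x hx
    have e1 : (0 ≤ V.v x ↔ 0 ≤ k • V.v x) := (nsmul_nonneg_iff hk.ne').symm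
    rw [hw x hx k m hk hm, e1, hm]
    have := hle 0 m
    rw [zero_smul] at this
    rw [this]
    constructor
    · intro h
      have hk' : (0 : ℚ) < k := by positivity
      have h2 := mul_nonneg h hk'.le
      rw [div_mul_cancel₀ _ hk'.ne'] at h2
      exact_mod_cast h2
    · intro h
      have h' : (0 : ℚ) ≤ m := by exact_mod_cast h
      positivity
  have hone : w 1 = 0 := by
    have := hmul 1 1 one_ne_zero one_ne_zero
    simpa using this
  have hdiv : ∀ x y : E, x ≠ 0 → y ≠ 0 → w (x / y) = w x - w y := fun x y hx hy => by
    have := hmul (x / y) y (div_ne_zero hx hy) hy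
    rw [div_mul_cancel₀ _ hy] at this
    rw [this]; ring
  have hle2 : ∀ x y : E, x ≠ 0 → y ≠ 0 → (w x ≤ w y ↔ V.v x ≤ V.v y) := fun x y hx hy => by
    have := hnn (y / x) (div_ne_zero hy hx)
    rwa [hdiv _ _ hy hx, V.div hy hx, sub_nonneg, sub_nonneg] at this
  refine ⟨⟨w, hmul, fun x y hx hy hxy => ?_⟩, ?_, hnn⟩
  · have := V.add' x y hx hy hxy
    rw [min_le_iff] at this ⊢
    rwa [hle2 x _ hx hxy, hle2 y _ hy hxy]
  · change w z = 1
    rw [hw z hz0 1 1 one_pos (by simp)]; simp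

/-- existence of valuations -/
theorem exists_va (h : TD1 p E) {A : Subring E} (I : Ideal A) (hI : I ≠ ⊤) (z : A) (hzI : z ∈ I)
    (hz : (z : E) ≠ 0) :
    ∃ W : Va E ℚ, W.v (z : E) = 1 ∧ (∀ x ∈ A, W.ge 0 x) ∧ ∀ x ∈ I, W.gt 0 (x : E) := by
  obtain ⟨B, hAB, hB⟩ := Ideal.image_subset_nonunits_valuationSubring I hI
  let V := ofValuation B
  have hge : ∀ x : E, x ≠ 0 → (0 ≤ V.v x ↔ x ∈ B) := fun x hx => by
    rw [← B.valuation_le_one_iff]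
    simp only [V, ofValuation, hx, dite_false]
    rfl
  have hpos : ∀ x : A, x ∈ I → (x : E) ≠ 0 → 0 < V.v (x : E) := fun x hx hx0 => by
    have h1 : (x : E) ∈ B.nonunits := hB ⟨x, hx, rfl⟩
    rw [B.mem_nonunits_iff_or] at h1
    by_contra hle
    push Not at hle
    refine h1.resolve_left hx0 ((hge _ (inv_ne_zero hx0)).mp ?_)
    rw [V.inv hx0]; exact neg_nonneg.mpr hle
  obtain ⟨W, hW, hWV⟩ := toRat h V hz (hpos z hzI hz)
  refine ⟨W, hW, fun x hx => ?_, fun x hx => ?_⟩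
  · by_cases hx0 : x = 0
    · exact Or.inl hx0
    · exact Or.inr ((hWV x hx0).mpr ((hge x hx0).mpr (hAB hx)))
  · by_cases hx0 : (x : E) = 0
    · exact Or.inl hx0
    · right
      by_contra hle
      push Not at hle
      have := (hWV _ (inv_ne_zero hx0)).mp (by rw [W.inv hx0]; linarith)
      rw [V.inv hx0] at this
      exact absurd (hpos x hx hx0) (not_lt.mpr (neg_nonneg.mp this))

theorem exists_va_zero (h : TD1 p E) {z : E} (hz : Transcendental (ZMod p) z) :
    ∃ W : Va E ℚ, W.v z = 1 := by
  let A : Subring E := (aeval (R := ZMod p) z).range.toSubring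
  let zz : A := ⟨z, X, by simp⟩
  have hz0 : z ≠ 0 := by rintro rfl; exact hz isAlgebraic_zero
  obtain ⟨W, hW, -, -⟩ := exists_va h (A := A) (Ideal.span {zz}) (by
    rw [Ne, Ideal.span_singleton_eq_top]
    intro hu
    obtain ⟨⟨y, g, rfl⟩, hy⟩ := hu.exists_right_inv
    have h1 : z * aeval z g = 1 := congrArg Subtype.val hy
    have h2 : aeval z (X * g - 1) = 0 := by simp [h1]
    have h3 := (transcendental_iff.mp hz) _ h2
    have := congrArg (fun f => Polynomial.coeff f 0) h3
    simp at this) zz (Ideal.mem_span_singleton_self zz) hz0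
  exact ⟨W, hW⟩

/-- rational valuations on function fields are discrete -/
theorem exists_prime (h : FunF p E) (V : Va E ℚ) {z : E} (hz0 : z ≠ 0) (hz : V.v z ≠ 0) :
    ∃ P : FFPrime E, ∃ c : ℚ, 0 < c ∧ ∀ x, x ≠ 0 → V.v x = c * P.va.v x := by
  wlog hpos : 0 < V.v z generalizing z
  · exact this (z := z⁻¹) (inv_ne_zero hz0) (by rw [V.inv hz0]; exact neg_ne_zero.mpr hz)
      (by rw [V.inv hz0]; exact neg_pos.mpr (lt_of_le_of_ne (not_lt.mp hpos) hz))
  have hzt : Transcendental (ZMod p) z := V.transc_of_v hz0 hz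
  set N := ndeg p z with hN
  have ex : ∀ y : E, ∃ m : ℤ, y ≠ 0 → (N.factorial : ℚ) * V.v y = m * V.v z := fun y => by
    by_cases hy : y = 0
    · exact ⟨0, fun h => absurd hy h⟩
    obtain ⟨g, hg, hs⟩ := dep h hzt (ι := Fin (N + 1)) (by simp [hN]) (fun i => y ^ (i : ℕ))
    obtain ⟨k, hk, hkN, m, hm⟩ := value_rel V hz0 hpos g hy hg hs
    obtain ⟨d, hd⟩ := Nat.dvd_factorial hk (by omega : k ≤ N)
    refine ⟨d * m, fun _ => ?_⟩
    rw [hd]; push_cast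
    rw [nsmul_eq_mul, zsmul_eq_mul] at hm
    linear_combination (d : ℚ) * hm
  choose m hm using ex
  have hNf : (N.factorial : ℚ) ≠ 0 := by positivity
  have hmul : ∀ x y : E, x ≠ 0 → y ≠ 0 → m (x * y) = m x + m y := fun x y hx hy => by
    have h1 := hm _ (mul_ne_zero hx hy)
    rw [V.mul hx hy, mul_add, hm x hx, hm y hy, ← add_mul] at h1
    have := mul_right_cancel₀ hz h1
    exact_mod_cast this.symm
  have hle : ∀ x y, x ≠ 0 → y ≠ 0 → (m x ≤ m y ↔ V.v x ≤ V.v y) := fun x y hx hy => by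
    have h1 : (m x ≤ m y) ↔ (m x : ℚ) * V.v z ≤ m y * V.v z := by
      rw [mul_le_mul_iff_left₀ hpos]; norm_cast
    rw [h1, ← hm x hx, ← hm y hy, mul_le_mul_iff_right₀ (by positivity)]
  have hone : m 1 = 0 := by
    have := hmul 1 1 one_ne_zero one_ne_zero
    simpa using this
  let G : AddSubgroup ℤ :=
    { carrier := {k | ∃ x, x ≠ 0 ∧ m x = k}
      zero_mem' := ⟨1, one_ne_zero, hone⟩
      add_mem' := by
        rintro _ _ ⟨x, hx, rfl⟩ ⟨y, hy, rfl⟩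
        exact ⟨x * y, mul_ne_zero hx hy, hmul x y hx hy⟩
      neg_mem' := by
        rintro _ ⟨x, hx, rfl⟩
        refine ⟨x⁻¹, inv_ne_zero hx, ?_⟩
        have := hmul x x⁻¹ hx (inv_ne_zero hx)
        rw [mul_inv_cancel₀ hx, hone] at this
        linarith }
  obtain ⟨d, hd⟩ := Int.subgroup_cyclic G
  have hdiv : ∀ x, x ≠ 0 → d ∣ m x := fun x hx => by
    have : m x ∈ G := ⟨x, hx, rfl⟩
    rw [hd, AddSubgroup.mem_closure_singleton] at this
    obtain ⟨n, hn⟩ := this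
    exact ⟨n, by rw [← hn, smul_eq_mul, mul_comm]⟩
  have hd0 : d ≠ 0 := by
    rintro rfl
    have h1 := hdiv z hz0
    rw [zero_dvd_iff] at h1
    have := hm z hz0
    rw [h1] at this
    simp only [Int.cast_zero, zero_mul] at this
    exact (mul_ne_zero hNf hz) this
  set D : ℤ := |d| with hD
  have hDpos : 0 < D := abs_pos.mpr hd0
  have hDdiv : ∀ x, x ≠ 0 → D ∣ m x := fun x hx => (abs_dvd _ _).mpr (hdiv x hx)
  obtain ⟨x1, hx1, hmx1⟩ : D ∈ G := by
    rw [hd, AddSubgroup.mem_closure_singleton]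
    rcases abs_choice d with h | h
    · exact ⟨1, by rw [one_smul, hD, h]⟩
    · exact ⟨-1, by rw [hD, h]; simp⟩
  let W : Va E ℤ :=
    { v := fun x => m x / D
      mul' := fun x y hx hy => by rw [hmul x y hx hy, Int.add_ediv_of_dvd_left (hDdiv x hx)]
      add' := fun x y hx hy hxy => by
        have := V.add' x y hx hy hxy
        rw [min_le_iff] at this ⊢
        rw [← hle x _ hx hxy, ← hle y _ hy hxy] at this
        exact this.imp (fun h => Int.ediv_le_ediv hDpos h) (fun h => Int.ediv_le_ediv hDpos h) }
  have hW1 : ∃ x, x ≠ 0 ∧ W.v x = 1 := ⟨x1, hx1, by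
    change m x1 / D = 1
    rw [hmx1]; exact Int.ediv_self hDpos.ne'⟩
  refine ⟨FFPrime.ofVa W hW1, D * V.v z / N.factorial, ?_, fun x hx => ?_⟩
  · have : (0 : ℚ) < D := by exact_mod_cast hDpos
    positivity
  · rw [FFPrime.ofVa_v W hW1 hx]
    have h1 : (D * (m x / D) : ℤ) = m x := Int.mul_ediv_cancel' (hDdiv x hx)
    have h2 : (D : ℚ) * ((m x / D : ℤ) : ℚ) = m x := by exact_mod_cast h1
    change V.v x = D * V.v z / N.factorial * ((m x / D : ℤ) : ℚ)
    have h3 := hm x hx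
    field_simp
    rw [mul_comm, h3, ← h2]; ring
end VAL
end

section
open Polynomial

namespace Va
variable {p : ℕ} [Fact p.Prime] {E : Type} [Field E] [Algebra (ZMod p) E]
variable {Γ : Type} [AddCommGroup Γ] [LinearOrder Γ] [IsOrderedAddMonoid Γ]

instance algO (V : Va E Γ) : Algebra (ZMod p) V.O :=
  RingHom.toAlgebra ((algebraMap (ZMod p) E).codRestrict V.O.toSubring fun c => V.ge_const c)

theorem algO_coe (V : Va E Γ) (c : ZMod p) : ((algebraMap (ZMod p) V.O c : V.O) : E) = algebraMap (ZMod p) E c := rfl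

/-- residue field -/
abbrev kap (V : Va E Γ) : Type := IsLocalRing.ResidueField V.O

open Classical in
/-- residue of an element, junk outside the valuation ring -/
def res (V : Va E Γ) (x : E) : V.kap := if h : V.ge 0 x then IsLocalRing.residue V.O ⟨x, h⟩ else 0

variable {V : Va E Γ}
theorem res_of {x : E} (h : V.ge 0 x) : V.res x = IsLocalRing.residue V.O ⟨x, h⟩ := by
  simp [res, h]
theorem res_add {x y : E} (hx : V.ge 0 x) (hy : V.ge 0 y) : V.res (x + y) = V.res x + V.res y := by
  rw [res_of hx, res_of hy, res_of (hx.add hy), ← map_add]; rfl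
theorem res_mul {x y : E} (hx : V.ge 0 x) (hy : V.ge 0 y) : V.res (x * y) = V.res x * V.res y := by
  rw [res_of hx, res_of hy, res_of (hx.mul0 hy), ← map_mul]; rfl
theorem res_one : V.res 1 = 1 := by
  rw [res_of ge_one, ← map_one (IsLocalRing.residue V.O)]; rfl
theorem res_pow {x : E} (hx : V.ge 0 x) (n : ℕ) : V.res (x ^ n) = V.res x ^ n := by
  induction n with
  | zero => simp [res_one]
  | succ n ih => rw [pow_succ, res_mul (hx.pow n) hx, ih, pow_succ]
theorem res_eq_zero {x : E} (hx : V.ge 0 x) : V.res x = 0 ↔ V.gt 0 x := by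
  rw [res_of hx, residue_eq_zero]
theorem res_eq {x y : E} (hx : V.ge 0 x) (hy : V.ge 0 y) : V.res x = V.res y ↔ V.gt 0 (x - y) := by
  rw [res_of hx, res_of hy, residue_eq]
theorem res_smul {x : E} (hx : V.ge 0 x) (c : ZMod p) : V.res (c • x) = c • V.res x := by
  rw [Algebra.smul_def, res_mul (V.ge_const c) hx, Algebra.smul_def]; congr 1
  rw [res_of (V.ge_const c)]; rfl
theorem res_surj (y : V.kap) : ∃ x, V.ge 0 x ∧ V.res x = y := by
  obtain ⟨x, rfl⟩ := IsLocalRing.residue_surjective y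
  exact ⟨x, x.2, res_of x.2⟩
theorem ge.smul {n : Γ} {x : E} (hx : V.ge n x) (c : ZMod p) : V.ge n (c • x) := by
  rw [Algebra.smul_def]; exact (V.ge_const c).mul0 hx
theorem gt.smul {n : Γ} {x : E} (hx : V.gt n x) (c : ZMod p) : V.gt n (c • x) := by
  rw [Algebra.smul_def]; exact (V.ge_const c).gt_mul hx
theorem res_sum {ι : Type*} {s : Finset ι} {f : ι → E} (h : ∀ i ∈ s, V.ge 0 (f i)) :
    V.res (∑ i ∈ s, f i) = ∑ i ∈ s, V.res (f i) := by
  classical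
  induction s using Finset.induction_on with
  | empty => simpa using (res_eq_zero (ge_zero' 0)).mpr (gt_zero' 0)
  | insert a s ha ih =>
    have h1 : ∀ i ∈ s, V.ge 0 (f i) := fun i hi => h i (Finset.mem_insert_of_mem hi)
    rw [Finset.sum_insert ha, Finset.sum_insert ha, res_add (h a (Finset.mem_insert_self a s)) (ge.sum h1), ih h1]
end Va

section
variable {p : ℕ} [Fact p.Prime] {E : Type} [Field E] [Algebra (ZMod p) E]

theorem FunF.IND (h : FunF p E) {z : E} (hz : Transcendental (ZMod p) z) {I : Type}
    (P : I → FFPrime E) (hpos : ∀ i, 0 ≤ (P i).va.v z) {ι : Type} [Fintype ι] (w : ι → E)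
    (hw : ∀ k i, (P i).va.ge 0 (w k))
    (hind : ∀ g : ι → ZMod p, (∀ i, (P i).va.ge ((P i).va.v z) (∑ k, g k • w k)) → ∀ k, g k = 0) :
    Fintype.card ι ≤ ndeg p z := by
  classical
  by_contra hc
  push Not at hc
  obtain ⟨g, ⟨k1, hk1⟩, hs⟩ := dep h hz hc w
  have hz0 : z ≠ 0 := by rintro rfl; exact hz isAlgebraic_zero
  obtain ⟨k0, hk0, hmin⟩ := Finset.exists_min_image (Finset.univ.filter fun k => g k ≠ 0)
    (fun k => (g k).natTrailingDegree) ⟨k1, by simpa using hk1⟩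
  set m := (g k0).natTrailingDegree with hm
  have hdvd : ∀ k, X ^ m ∣ g k := fun k => by
    by_cases hk : g k = 0
    · simp [hk]
    · exact Polynomial.X_pow_dvd_iff.mpr fun d hd =>
        Polynomial.coeff_eq_zero_of_lt_natTrailingDegree (hd.trans_le (hmin k (by simpa using hk)))
  choose g' hg' using hdvd
  have hk0' : (g' k0).coeff 0 ≠ 0 := by
    have h1 : (g k0).coeff m ≠ 0 :=
      Polynomial.trailingCoeff_nonzero_iff_nonzero.mpr (by simpa using hk0)
    have := Polynomial.coeff_X_pow_mul (g' k0) m 0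
    rw [← hg', zero_add] at this
    rwa [this] at h1
  have hs' : ∑ k, aeval z (g' k) * w k = 0 := by
    have : z ^ m * ∑ k, aeval z (g' k) * w k = 0 := by
      rw [Finset.mul_sum, ← hs]
      refine Finset.sum_congr rfl fun k _ => ?_
      conv_rhs => rw [hg' k]
      rw [map_mul, map_pow, aeval_X]; ring
    exact (mul_eq_zero.mp this).resolve_left (pow_ne_zero _ hz0)
  have hdec : ∀ k, aeval z (g' k) * w k = (g' k).coeff 0 • w k + z * (aeval z (g' k).divX * w k) := fun k => by
    conv_lhs => rw [← divX_mul_X_add (g' k)]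
    rw [map_add, map_mul, aeval_X, aeval_C, Algebra.smul_def]; ring
  simp only [hdec] at hs'
  rw [Finset.sum_add_distrib, ← Finset.mul_sum] at hs'
  refine hk0' (hind (fun k => (g' k).coeff 0) (fun i => ?_) k0)
  rw [eq_neg_of_add_eq_zero_left hs']
  have h1 : (P i).va.ge 0 (∑ k, aeval z (g' k).divX * w k) :=
    Va.ge.sum fun k _ => ((P i).va.ge_aeval (Or.inr (hpos i)) _).mul0 (hw k i)
  have := (h1.mul0 ((P i).va.ge_self z)).neg
  rwa [mul_comm] at this

theorem FunF.finite_kap (h : FunF p E) (P : FFPrime E) : Module.Finite (ZMod p) P.va.kap := by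
  obtain ⟨z, hz0, hz⟩ := P.exists_v 1
  have hzt : Transcendental (ZMod p) z := P.va.transc_of_v hz0 (by rw [hz]; exact one_ne_zero)
  have : Module.rank (ZMod p) P.va.kap ≤ ndeg p z := by
    refine rank_le fun s hs => ?_
    choose c hc hc' using fun y : P.va.kap => Va.res_surj (V := P.va) y
    rw [← Fintype.card_coe]
    refine h.IND hzt (I := Unit) (fun _ => P) (fun _ => by rw [hz]; exact zero_le_one)
      (fun k : s => c k) (fun k _ => hc k) fun g hg => ?_
    have h1 := hg ()
    rw [hz] at h1
    have h2 := (Va.res_eq_zero (Va.ge.sum (s := Finset.univ) fun (k : s) _ => (hc k.1).smul (g k))).mpr (h1.gt one_pos)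
    rw [Va.res_sum (fun (k : s) _ => (hc k.1).smul (g k))] at h2
    rw [Fintype.linearIndependent_iff] at hs
    refine hs g ?_
    rw [← h2]; refine Finset.sum_congr rfl fun k _ => ?_
    rw [Va.res_smul (hc k), hc']
  exact Module.rank_lt_aleph0_iff.mp (this.trans_lt Cardinal.natCast_lt_aleph0)

/-- degree of a prime over the prime field -/
def FFPrime.deg (p : ℕ) [Fact p.Prime] {E : Type} [Field E] [Algebra (ZMod p) E] (P : FFPrime E) : ℕ :=
  Module.finrank (ZMod p) P.va.kap

theorem FunF.deg_pos (h : FunF p E) (P : FFPrime E) : 0 < P.deg p := by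
  have := h.finite_kap P
  exact Module.finrank_pos

/-- real absolute value -/
def FFPrime.abv (P : FFPrime E) : AbsoluteValue E ℝ := by
  classical
  exact
  { toFun := fun x => if x = 0 then 0 else (2 : ℝ) ^ (- P.va.v x)
    map_mul' := fun x y => by
      by_cases hx : x = 0
      · simp [hx]
      by_cases hy : y = 0
      · simp [hy]
      simp only [hx, hy, mul_eq_zero, or_self, if_false]
      rw [P.va.mul hx hy, neg_add, zpow_add₀ two_ne_zero]
    nonneg' := fun x => by
      split_ifs <;> positivity
    eq_zero' := fun x => by
      split_ifs with h
      · simp [h]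
      · simp only [h, iff_false]; positivity
    add_le' := fun x y => by
      by_cases hx : x = 0
      · simp [hx]
      by_cases hy : y = 0
      · simp [hy]
      simp only [hx, hy, if_false]
      split_ifs with h
      · positivity
      · have := P.va.add' x y hx hy h
        rw [min_le_iff] at this
        have h1 : (0:ℝ) < (2 : ℝ) ^ (- P.va.v x) := by positivity
        have h2 : (0:ℝ) < (2 : ℝ) ^ (- P.va.v y) := by positivity
        rcases this with h3 | h3
        · have : (2 : ℝ) ^ (- P.va.v (x + y)) ≤ (2 : ℝ) ^ (- P.va.v x) :=
            zpow_le_zpow_right₀ one_le_two (by linarith)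
          linarith
        · have : (2 : ℝ) ^ (- P.va.v (x + y)) ≤ (2 : ℝ) ^ (- P.va.v y) :=
            zpow_le_zpow_right₀ one_le_two (by linarith)
          linarith }

theorem FFPrime.abv_of (P : FFPrime E) {x : E} (hx : x ≠ 0) : P.abv x = (2 : ℝ) ^ (- P.va.v x) := by
  simp [abv, hx]

theorem FFPrime.abv_lt (P : FFPrime E) {x : E} {n : ℤ} (h : P.abv x < (2 : ℝ) ^ (-n)) : P.va.gt n x := by
  by_cases hx : x = 0
  · exact Or.inl hx
  · rw [P.abv_of hx, zpow_lt_zpow_iff_right₀ one_lt_two] at h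
    exact Or.inr (by linarith)

/-- comparison of primes -/
theorem FFPrime.eq_of_le {P P' : FFPrime E} (h : ∀ x, x ≠ 0 → 0 ≤ P.va.v x → 0 ≤ P'.va.v x) : P = P' := by
  have h0 : ∀ x, x ≠ 0 → P.va.v x = 0 → P'.va.v x = 0 := fun x hx h0 => by
    refine le_antisymm ?_ (h x hx h0.ge)
    have := h x⁻¹ (inv_ne_zero hx) (by rw [P.va.inv hx]; linarith)
    rw [P'.va.inv hx] at this; linarith
  obtain ⟨t, ht, ht1⟩ := P.exists_v 1
  have hlin : ∀ x, x ≠ 0 → P'.va.v x = P.va.v x * P'.va.v t := fun x hx => by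
    have h2 := h0 (x / t ^ (P.va.v x)) (div_ne_zero hx (zpow_ne_zero _ ht)) (by
      rw [P.va.div hx (zpow_ne_zero _ ht), P.va.zpow ht, ht1]; simp)
    rw [P'.va.div hx (zpow_ne_zero _ ht), P'.va.zpow ht] at h2
    rw [smul_eq_mul] at h2; linarith
  obtain ⟨s, hs, hs1⟩ := P'.exists_v 1
  have h3 := hlin s hs
  rw [hs1] at h3
  have h4 : P'.va.v t = 1 := by
    rcases Int.isUnit_iff.mp (IsUnit.of_mul_eq_one (P.va.v s) (by rw [mul_comm]; exact h3.symm)) with h5 | h5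
    · exact h5
    · have := h t ht (by rw [ht1]; exact zero_le_one)
      linarith
  refine FFPrime.ext_va fun x hx => ?_
  rw [hlin x hx, h4, mul_one]

theorem weak_approx {I : Type} [Finite I] (P : I → FFPrime E) (hP : Function.Injective P)
    (f : I → E) (N : ℤ) : ∃ w, ∀ i, (P i).va.ge N (w - f i) := by
  have := Fintype.ofFinite I
  have hd := AbsoluteValue.denseRange_algebraMap_pi (F := E) (v := fun i => (P i).abv)
    (fun i => by
      obtain ⟨x, hx, h1⟩ := (P i).exists_v 1
      refine ⟨x, hx, ?_⟩
      rw [(P i).abv_of hx, h1]; norm_num)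
    (fun i j hij h => hij (hP (FFPrime.eq_of_le fun x hx hxn => by
      have := (h.le_one_iff (x := x)).mp (by
        rw [(P i).abv_of hx]; exact zpow_le_one_of_nonpos₀ one_le_two (by linarith))
      rw [(P j).abv_of hx] at this
      by_contra hlt
      push Not at hlt
      have h2 : (1:ℝ) < (2:ℝ) ^ (-(P j).va.v x) := one_lt_zpow₀ one_lt_two (by linarith)
      linarith)))
  rw [Metric.denseRange_iff] at hd
  obtain ⟨w, hw⟩ := hd (fun i => (WithAbs.equiv (P i).abv).symm (f i)) ((2 : ℝ) ^ (-N)) (by positivity)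
  refine ⟨w, fun i => (FFPrime.abv_lt _ ?_).ge⟩
  have h1 := (dist_le_pi_dist _ _ i).trans_lt hw
  rw [dist_comm, dist_eq_norm] at h1
  exact h1
end
end

section
open Polynomial

variable {p : ℕ} [Fact p.Prime] {E : Type} [Field E] [Algebra (ZMod p) E]

theorem FunF.exists_res_basis (h : FunF p E) (P : FFPrime E) :
    ∃ c : Fin (P.deg p) → E, (∀ j, P.va.ge 0 (c j)) ∧
      ∀ g : Fin (P.deg p) → ZMod p, P.va.gt 0 (∑ j, g j • c j) → ∀ j, g j = 0 := by
  have := h.finite_kap P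
  let B := Module.finBasis (ZMod p) P.va.kap
  choose c hc hc' using fun y : P.va.kap => Va.res_surj (V := P.va) y
  refine ⟨fun j => c (B j), fun j => hc _, fun g hg => ?_⟩
  have h2 := (Va.res_eq_zero (Va.ge.sum (s := Finset.univ) fun j _ => (hc (B j)).smul (g j))).mpr hg
  rw [Va.res_sum (fun j _ => (hc (B j)).smul (g j))] at h2
  have hB := B.linearIndependent
  rw [Fintype.linearIndependent_iff] at hB
  refine hB g ?_
  rw [← h2]; refine Finset.sum_congr rfl fun k _ => ?_
  rw [Va.res_smul (hc _), hc']

theorem FunF.zeros_bound (h : FunF p E) {z : E} (hz : Transcendental (ZMod p) z)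
    (S : Finset (FFPrime E)) (hS : ∀ P ∈ S, 0 ≤ P.va.v z) :
    ∑ P ∈ S, (P.va.v z).toNat * P.deg p ≤ ndeg p z := by
  classical
  choose c hc hc' using fun P : FFPrime E => h.exists_res_basis P
  choose π hπ0 hπ1 using fun P : FFPrime E => P.exists_v 1
  let ι := Σ P : S, Fin (P.1.va.v z).toNat × Fin (P.1.deg p)
  let M : ℤ := ∑ P ∈ S, P.va.v z
  have hM0 : 0 ≤ M := Finset.sum_nonneg hS
  have hM : ∀ P : S, P.1.va.v z ≤ M := fun P => Finset.single_le_sum (f := fun P : FFPrime E => P.va.v z) hS P.2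
  have hwa : ∀ k : ι, ∃ w : E, ∀ P : S, P.1.va.ge M
      (w - if P = k.1 then c k.1.1 k.2.2 * π k.1.1 ^ (k.2.1 : ℕ) else 0) := fun k =>
    weak_approx (fun P : S => P.1) Subtype.val_injective
      (fun P => if P = k.1 then c k.1.1 k.2.2 * π k.1.1 ^ (k.2.1 : ℕ) else 0) M
  choose w hw using hwa
  have hπge : ∀ P : FFPrime E, P.va.ge 0 (π P) := fun P => Or.inr (by rw [hπ1]; exact zero_le_one)
  have hcard : Fintype.card ι = ∑ P ∈ S, (P.va.v z).toNat * P.deg p := by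
    simp only [ι, Fintype.card_sigma, Fintype.card_prod, Fintype.card_fin]
    exact Finset.sum_coe_sort S (fun P => (P.va.v z).toNat * P.deg p)
  rw [← hcard]
  refine h.IND hz (fun P : S => P.1) (fun P => hS P.1 P.2) w (fun k P => ?_) fun g hg => ?_
  · have h1 := (hw k P).mono hM0
    have h2 : P.1.va.ge 0 (if P = k.1 then c k.1.1 k.2.2 * π k.1.1 ^ (k.2.1 : ℕ) else 0) := by
      split_ifs with hP
      · rw [hP]; exact (hc _ _).mul0 ((hπge _).pow _)
      · exact Va.ge_zero' 0
    simpa using h1.add h2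
  · -- reduce to a single place
    have hsing : ∀ P : S, P.1.va.ge (P.1.va.v z) (∑ x : Fin (P.1.va.v z).toNat × Fin (P.1.deg p),
        g ⟨P, x⟩ • (c P.1 x.2 * π P.1 ^ (x.1 : ℕ))) := fun P => by
      have h1 : P.1.va.ge (P.1.va.v z) (∑ k, g k • (w k - if P = k.1 then c k.1.1 k.2.2 * π k.1.1 ^ (k.2.1 : ℕ) else 0)) :=
        Va.ge.sum fun k _ => ((hw k P).mono (hM P)).smul _
      have h2 := (hg P).sub h1
      rw [← Finset.sum_sub_distrib] at h2
      convert h2 using 1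
      simp only [← smul_sub, sub_sub_cancel]
      rw [Fintype.sum_sigma, Finset.sum_eq_single P]
      · refine Finset.sum_congr rfl fun x _ => ?_
        simp
      · intro Q _ hQ
        refine Finset.sum_eq_zero fun x _ => ?_
        rw [if_neg hQ.symm, smul_zero]
      · simp
    rintro ⟨P, i, j⟩
    have key : ∀ n : ℕ, ∀ (i : Fin (P.1.va.v z).toNat), (i : ℕ) = n → ∀ j, g ⟨P, i, j⟩ = 0 := by
      intro n
      induction n using Nat.strong_induction_on with
      | _ n ih =>
      intro i hi
      have h1 := hsing P
      rw [Fintype.sum_prod_type] at h1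
      have hilt : (i : ℤ) + 1 ≤ P.1.va.v z := by have := i.2; omega
      -- other terms
      have h2 : P.1.va.ge ((i : ℤ) + 1) (∑ i' ∈ Finset.univ.erase i, ∑ j, g ⟨P, i', j⟩ • (c P.1 j * π P.1 ^ (i' : ℕ))) := by
        refine Va.ge.sum fun i' hi' => Va.ge.sum fun j _ => ?_
        rcases lt_trichotomy (i' : ℕ) i with hlt | heq | hgt
        · rw [ih i' (hi ▸ hlt) i' rfl j, zero_smul]; exact Va.ge_zero' _
        · exact absurd (Fin.ext heq) (Finset.ne_of_mem_erase hi')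
        · refine Va.ge.smul ((hc _ _).mul0 (Or.inr ?_)) _
          rw [P.1.va.pow (hπ0 _), hπ1]; simp; omega
      rw [← Finset.add_sum_erase _ _ (Finset.mem_univ i)] at h1
      have h3 := (h1.mono hilt).sub h2
      rw [add_sub_cancel_right] at h3
      have h4 : ∑ j, g ⟨P, i, j⟩ • (c P.1 j * π P.1 ^ (i : ℕ)) = (∑ j, g ⟨P, i, j⟩ • c P.1 j) * π P.1 ^ (i : ℕ) := by
        rw [Finset.sum_mul]; simp only [smul_mul_assoc]
      rw [h4] at h3
      refine hc' P.1 (fun j => g ⟨P, i, j⟩) ?_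
      have h5 := h3.mul (Va.ge_self (V := P.1.va) (π P.1 ^ (i : ℕ))⁻¹)
      rw [mul_inv_cancel_right₀ (pow_ne_zero _ (hπ0 _)), P.1.va.inv (pow_ne_zero _ (hπ0 _)), P.1.va.pow (hπ0 _), hπ1] at h5
      refine h5.gt ?_
      simp
    exact key i i rfl j

theorem FunF.finite_zeros (h : FunF p E) {z : E} (hz : Transcendental (ZMod p) z) :
    {P : FFPrime E | 0 < P.va.v z}.Finite := by
  by_contra hinf
  obtain ⟨S, hS, hcard⟩ := Set.Infinite.exists_subset_card_eq hinf (ndeg p z + 1)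
  have := h.zeros_bound hz S (fun P hP => le_of_lt (hS hP))
  have h2 : ∑ P ∈ S, 1 ≤ ∑ P ∈ S, (P.va.v z).toNat * P.deg p := Finset.sum_le_sum fun P hP => by
    have h1 : 0 < P.va.v z := hS hP
    have := h.deg_pos P
    exact Nat.mul_pos (by omega) this
  simp at h2; omega

theorem FunF.v_alg {z : E} (hz0 : z ≠ 0) (hz : IsAlgebraic (ZMod p) z) (P : FFPrime E) : P.va.v z = 0 := by
  by_contra h1; exact P.va.transc_of_v hz0 h1 hz

theorem FunF.finite_supp (h : FunF p E) {z : E} (hz0 : z ≠ 0) :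
    (Function.support fun P : FFPrime E => P.va.v z).Finite := by
  by_cases hz : IsAlgebraic (ZMod p) z
  · convert Set.finite_empty
    ext P; simp [FunF.v_alg hz0 hz P]
  · refine ((h.finite_zeros hz).union (h.finite_zeros (z := z⁻¹) fun h => hz (by simpa using h.inv))).subset ?_
    intro P hP
    rcases lt_or_gt_of_ne hP with h1 | h1
    · right; change 0 < P.va.v z⁻¹; rw [P.va.inv hz0]; simpa using h1
    · exact Or.inl h1

/-- divisors -/
abbrev Dv (E : Type) [Field E] : Type := FFPrime E →₀ ℤ

open Classical in
/-- principal divisors -/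
def FunF.div (h : FunF p E) (z : E) : Dv E :=
  if hz : z = 0 then 0 else Finsupp.ofSupportFinite (fun P => P.va.v z) (h.finite_supp hz)

theorem FunF.div_apply (h : FunF p E) {z : E} (hz : z ≠ 0) (P : FFPrime E) : h.div z P = P.va.v z := by
  simp [FunF.div, hz, Finsupp.ofSupportFinite]; rfl
theorem FunF.div_zero' (h : FunF p E) : h.div 0 = 0 := by simp [FunF.div]
theorem FunF.div_one (h : FunF p E) : h.div 1 = 0 := by
  ext P; rw [h.div_apply one_ne_zero, P.va.one]; rfl
theorem FunF.div_mul (h : FunF p E) {x y : E} (hx : x ≠ 0) (hy : y ≠ 0) : h.div (x * y) = h.div x + h.div y := by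
  ext P; rw [Finsupp.add_apply, h.div_apply hx, h.div_apply hy, h.div_apply (mul_ne_zero hx hy), P.va.mul hx hy]
theorem FunF.div_inv (h : FunF p E) (x : E) : h.div x⁻¹ = - h.div x := by
  by_cases hx : x = 0
  · simp [hx, h.div_zero']
  ext P; rw [Finsupp.neg_apply, h.div_apply hx, h.div_apply (inv_ne_zero hx), P.va.inv hx]
theorem FunF.div_pow (h : FunF p E) {x : E} (hx : x ≠ 0) (n : ℕ) : h.div (x ^ n) = n • h.div x := by
  ext P; rw [Finsupp.smul_apply, h.div_apply hx, h.div_apply (pow_ne_zero n hx), P.va.pow hx]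

/-- degree of divisors -/
def dg (p : ℕ) [Fact p.Prime] {E : Type} [Field E] [Algebra (ZMod p) E] : Dv E →+ ℤ :=
  Finsupp.liftAddHom fun P => (AddMonoidHom.mulRight (P.deg p : ℤ))

theorem dg_single (P : FFPrime E) (n : ℤ) : dg p (Finsupp.single P n) = n * P.deg p := by
  simp [dg]
theorem dg_eq (D : Dv E) : dg p D = ∑ P ∈ D.support, D P * P.deg p := by
  simp [dg, Finsupp.sum]
theorem dg_nonneg {D : Dv E} (hD : 0 ≤ D) : 0 ≤ dg p D := by
  rw [dg_eq]; exact Finset.sum_nonneg fun P _ => mul_nonneg (hD P) (by positivity)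
theorem dg_mono {D D' : Dv E} (hD : D ≤ D') : dg p D ≤ dg p D' := by
  have := dg_nonneg (p := p) (sub_nonneg.mpr hD)
  rw [map_sub] at this; linarith

/-- Riemann-Roch spaces -/
def LS (p : ℕ) [Fact p.Prime] {E : Type} [Field E] [Algebra (ZMod p) E] (D : Dv E) : Submodule (ZMod p) E where
  carrier := {x | ∀ P : FFPrime E, P.va.ge (- D P) x}
  add_mem' := fun hx hy P => (hx P).add (hy P)
  zero_mem' := fun P => Va.ge_zero' _
  smul_mem' := fun c x hx P => (hx P).smul c

theorem mem_LS {D : Dv E} {x : E} : x ∈ LS p D ↔ ∀ P : FFPrime E, P.va.ge (- D P) x := Iff.rfl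

theorem FunF.mem_LS_iff (h : FunF p E) {D : Dv E} {x : E} (hx : x ≠ 0) : x ∈ LS p D ↔ 0 ≤ h.div x + D := by
  rw [mem_LS]
  refine forall_congr' fun P => ?_
  rw [Finsupp.add_apply, h.div_apply hx]
  constructor
  · intro h1; have := h1.le hx; simp; linarith
  · intro h1; right; simp at h1; linarith

theorem LS_mono {D D' : Dv E} (hD : D ≤ D') : LS p D ≤ LS p D' := fun x hx P =>
  (hx P).mono (by have := hD P; linarith)

theorem FunF.exists_pole (h : FunF p E) {z : E} (hz : Transcendental (ZMod p) z) : ∃ P : FFPrime E, P.va.v z < 0 := by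
  have hz0 : z ≠ 0 := by rintro rfl; exact hz isAlgebraic_zero
  obtain ⟨W, hW⟩ := exists_va_zero h.td (z := z⁻¹) (fun h => hz (by simpa using h.inv))
  obtain ⟨P, c, hc, hP⟩ := exists_prime h W (inv_ne_zero hz0) (by rw [hW]; exact one_ne_zero)
  refine ⟨P, ?_⟩
  have := hP _ (inv_ne_zero hz0)
  rw [hW, P.va.inv hz0] at this
  by_contra h1
  push Not at h1
  have h2 : (0 : ℚ) ≤ P.va.v z := by exact_mod_cast h1
  push_cast at this
  nlinarith

theorem FunF.alg_of_ge (h : FunF p E) {x : E} (hx : ∀ P : FFPrime E, P.va.ge 0 x) : IsAlgebraic (ZMod p) x := by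
  by_contra hc
  obtain ⟨P, hP⟩ := h.exists_pole hc
  have hz0 : x ≠ 0 := by rintro rfl; exact hc isAlgebraic_zero
  have := (hx P).le hz0
  linarith

theorem FunF.exists_prime' (h : FunF p E) : ∃ _ : FFPrime E, True := by
  obtain ⟨z, hz⟩ := h.td.exists_trans
  obtain ⟨P, _⟩ := h.exists_pole hz
  exact ⟨P, trivial⟩

theorem FunF.LS_step (h : FunF p E) (D : Dv E) (P : FFPrime E) (hf : Module.Finite (ZMod p) (LS p D)) :
    Module.Finite (ZMod p) (LS p (D + Finsupp.single P 1)) ∧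
    Module.finrank (ZMod p) (LS p (D + Finsupp.single P 1)) ≤ Module.finrank (ZMod p) (LS p D) + P.deg p := by
  classical
  have := h.finite_kap P
  obtain ⟨π, hπ0, hπ1⟩ := P.exists_v 1
  have hge : ∀ x ∈ LS p (D + Finsupp.single P 1), P.va.ge 0 (x * π ^ (D P + 1)) := fun x hx => by
    have h1 := (hx P).mul (Va.ge_self (V := P.va) (π ^ (D P + 1)))
    rw [P.va.zpow hπ0, hπ1] at h1
    refine h1.mono ?_
    simp
  let f : LS p (D + Finsupp.single P 1) →ₗ[ZMod p] P.va.kap :=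
    { toFun := fun x => P.va.res (x * π ^ (D P + 1))
      map_add' := fun x y => by
        rw [← Va.res_add (hge x x.2) (hge y y.2), ← add_mul]; rfl
      map_smul' := fun c x => by
        rw [RingHom.id_apply, ← Va.res_smul (hge x x.2), ← smul_mul_assoc]; rfl }
  have hker : ∀ x : LS p (D + Finsupp.single P 1), f x = 0 ↔ (x : E) ∈ LS p D := fun x => by
    change P.va.res (x * π ^ (D P + 1)) = 0 ↔ _
    rw [Va.res_eq_zero (hge x x.2)]
    constructor
    · intro h1 Q
      by_cases hQ : Q = P
      · subst hQ
        have h2 := h1.mul (Va.ge_self (V := Q.va) (π ^ (D Q + 1))⁻¹)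
        rw [mul_inv_cancel_right₀ (zpow_ne_zero _ hπ0), Q.va.inv (zpow_ne_zero _ hπ0), Q.va.zpow hπ0, hπ1] at h2
        refine h2.imp id fun h3 => ?_
        simp at h3; linarith
      · have := x.2 Q
        rw [Finsupp.add_apply, Finsupp.single_eq_of_ne hQ, add_zero] at this
        exact this
    · intro h1
      have h2 := (h1 P).mul (Va.ge_self (V := P.va) (π ^ (D P + 1)))
      rw [P.va.zpow hπ0, hπ1] at h2
      exact h2.gt (by simp)
  have hle : LS p D ≤ LS p (D + Finsupp.single P 1) := LS_mono (by
    have : (0 : Dv E) ≤ Finsupp.single P 1 := by simp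
    simpa using add_le_add_right this D)
  have hkereq : LinearMap.ker f = (LS p D).submoduleOf (LS p (D + Finsupp.single P 1)) := by
    ext x; rw [LinearMap.mem_ker, hker]; rfl
  let e := Submodule.submoduleOfEquivOfLe hle
  have hfk : Module.Finite (ZMod p) (LinearMap.ker f) := by
    rw [hkereq]; exact Module.Finite.equiv e.symm
  have hfin : Module.Finite (ZMod p) (LS p (D + Finsupp.single P 1)) := by
    have : Module.Finite (ZMod p) (_ ⧸ LinearMap.ker f) := Module.Finite.equiv (f.quotKerEquivRange).symm
    exact Module.Finite.of_submodule_quotient (LinearMap.ker f)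
  refine ⟨hfin, ?_⟩
  rw [← LinearMap.finrank_range_add_finrank_ker f, add_comm, hkereq, e.finrank_eq]
  exact Nat.add_le_add_left (Submodule.finrank_le _) _
end

section
open Polynomial

variable {p : ℕ} [Fact p.Prime] {E : Type} [Field E] [Algebra (ZMod p) E]

/-- dimension of a Riemann-Roch space -/
def ell (p : ℕ) [Fact p.Prime] {E : Type} [Field E] [Algebra (ZMod p) E] (D : Dv E) : ℕ :=
  Module.finrank (ZMod p) (LS p D)

theorem FunF.LS_add (h : FunF p E) (D : Dv E) (hf : Module.Finite (ZMod p) (LS p D)) (A : Dv E) (hA : 0 ≤ A) :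
    Module.Finite (ZMod p) (LS p (D + A)) ∧ (ell p (D + A) : ℤ) ≤ ell p D + dg p A := by
  classical
  induction A using Finsupp.induction generalizing D with
  | zero => rw [add_zero, map_zero, add_zero]; exact ⟨hf, le_rfl⟩
  | single_add P b f hP hb ih =>
    have hb0 : 0 ≤ b := by
      have := hA P
      simpa [Finsupp.notMem_support_iff.mp hP] using this
    have hf0 : 0 ≤ f := fun Q => by
      have := hA Q
      by_cases hQ : Q = P
      · rw [hQ, Finsupp.notMem_support_iff.mp hP]; rfl
      · simpa [Finsupp.single_eq_of_ne hQ] using this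
    have hs : ∀ n : ℕ, Module.Finite (ZMod p) (LS p (D + Finsupp.single P (n : ℤ))) ∧
        (ell p (D + Finsupp.single P (n : ℤ)) : ℤ) ≤ ell p D + n * P.deg p := by
      intro n
      induction n with
      | zero => rw [Nat.cast_zero, Finsupp.single_zero, add_zero, zero_mul, add_zero]; exact ⟨hf, le_rfl⟩
      | succ n ihn =>
        have := h.LS_step (D + Finsupp.single P (n : ℤ)) P ihn.1
        rw [add_assoc, ← Finsupp.single_add] at this
        refine ⟨by exact_mod_cast this.1, ?_⟩
        have h2 : (ell p (D + Finsupp.single P ((n : ℤ) + 1)) : ℤ) ≤ ell p (D + Finsupp.single P (n : ℤ)) + P.deg p := by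
          exact_mod_cast this.2
        push_cast
        linarith [ihn.2]
    obtain ⟨n, rfl⟩ := Int.eq_ofNat_of_zero_le hb0
    have h1 := hs n
    have h2 := ih (D + Finsupp.single P (n : ℤ)) h1.1 hf0
    rw [add_assoc] at h2
    refine ⟨h2.1, h2.2.trans ?_⟩
    rw [map_add, dg_single]
    linarith [h1.2]

theorem FunF.LS_finite (h : FunF p E) (D : Dv E) : Module.Finite (ZMod p) (LS p D) := by
  classical
  obtain ⟨P, -⟩ := h.exists_prime'
  have h0 : LS p (-Finsupp.single P 1 : Dv E) = ⊥ := by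
    rw [eq_bot_iff]
    intro x hx
    by_contra hx0
    have hx0 : x ≠ 0 := hx0
    have halg : IsAlgebraic (ZMod p) x := h.alg_of_ge fun Q => (hx Q).mono (by
      rw [Finsupp.neg_apply, neg_neg, Finsupp.single_apply]; split_ifs <;> simp)
    have := (hx P).le hx0
    rw [FunF.v_alg hx0 halg] at this
    simp at this
  have hfin : Module.Finite (ZMod p) (LS p (-Finsupp.single P 1 : Dv E)) := by
    rw [h0]; infer_instance
  have h1 := (h.LS_add (-Finsupp.single P 1) hfin (Finsupp.single P 1 + (D ⊔ 0))
    (add_nonneg (by simp) le_sup_right)).1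
  rw [neg_add_cancel_left] at h1
  exact Submodule.finiteDimensional_of_le (LS_mono (le_sup_left : D ≤ D ⊔ 0))

theorem FunF.ell_mono (h : FunF p E) {D D' : Dv E} (hD : D ≤ D') : ell p D ≤ ell p D' := by
  have := h.LS_finite D'
  exact Submodule.finrank_mono (LS_mono hD)

theorem FunF.ell_le (h : FunF p E) {D D' : Dv E} (hD : D ≤ D') : (ell p D' : ℤ) ≤ ell p D + (dg p D' - dg p D) := by
  have := (h.LS_add D (h.LS_finite D) (D' - D) (sub_nonneg.mpr hD)).2
  rwa [add_sub_cancel, map_sub] at this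

/-- pole divisor -/
def FunF.poles (h : FunF p E) (z : E) : Dv E := (- h.div z) ⊔ 0

theorem FunF.poles_apply (h : FunF p E) {z : E} (hz : z ≠ 0) (P : FFPrime E) : h.poles z P = max (- P.va.v z) 0 := by
  simp [FunF.poles, Finsupp.sup_apply, h.div_apply hz]

theorem ndeg_inv (z : E) : ndeg p z⁻¹ = ndeg p z := by
  have : IntermediateField.adjoin (ZMod p) {z⁻¹} = IntermediateField.adjoin (ZMod p) {z} := by
    apply le_antisymm
    · rw [IntermediateField.adjoin_simple_le_iff]
      exact inv_mem (IntermediateField.mem_adjoin_simple_self _ _)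
    · rw [IntermediateField.adjoin_simple_le_iff]
      have := inv_mem (IntermediateField.mem_adjoin_simple_self (ZMod p) z⁻¹)
      simpa using this
  unfold ndeg
  rw [this]

theorem FunF.poles_le (h : FunF p E) {z : E} (hz : Transcendental (ZMod p) z) : dg p (h.poles z) ≤ ndeg p z := by
  have hz0 : z ≠ 0 := by rintro rfl; exact hz isAlgebraic_zero
  have hzi : Transcendental (ZMod p) z⁻¹ := fun h => hz (by simpa using h.inv)
  have h1 := h.zeros_bound hzi (h.poles z).support (fun P hP => by
    rw [Finsupp.mem_support_iff, h.poles_apply hz0] at hP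
    rw [P.va.inv hz0]
    by_contra hc
    exact hP (max_eq_right (by linarith)))
  rw [ndeg_inv] at h1
  rw [dg_eq]
  refine le_trans (le_of_eq ?_) (Int.ofNat_le.mpr h1)
  push_cast
  refine Finset.sum_congr rfl fun P _ => ?_
  rw [h.poles_apply hz0, P.va.inv hz0, Int.toNat_eq_max]

theorem FunF.exists_C (h : FunF p E) {z : E} (hz : Transcendental (ZMod p) z) :
    ∃ C : Dv E, 0 ≤ C ∧ ∀ k : ℕ, ndeg p z * (k + 1) ≤ ell p (k • h.poles z + C) := by
  classical
  have hz0 : z ≠ 0 := by rintro rfl; exact hz isAlgebraic_zero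
  obtain ⟨b, hb⟩ := exists_indep h hz
  have hpn : ∀ x, 0 ≤ h.poles x := fun x => le_sup_right
  refine ⟨∑ i, h.poles (b i), Finset.sum_nonneg fun i _ => hpn _, fun k => ?_⟩
  set D := k • h.poles z + ∑ i, h.poles (b i)
  have hmem : ∀ (i : Fin (ndeg p z)) (j : Fin (k + 1)), z ^ (j : ℕ) * b i ∈ LS p D := fun i j => by
    by_cases hb0 : b i = 0
    · rw [hb0, mul_zero]; exact zero_mem _
    rw [h.mem_LS_iff (mul_ne_zero (pow_ne_zero _ hz0) hb0), h.div_mul (pow_ne_zero _ hz0) hb0, h.div_pow hz0]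
    have h1 : 0 ≤ h.div z + h.poles z := by
      have : -h.div z ≤ h.poles z := le_sup_left
      exact neg_le_iff_add_nonneg'.mp this
    have h2 : 0 ≤ h.div (b i) + ∑ i, h.poles (b i) := by
      have : -h.div (b i) ≤ h.poles (b i) := le_sup_left
      have h3 : h.poles (b i) ≤ ∑ i, h.poles (b i) := Finset.single_le_sum (f := fun i => h.poles (b i)) (fun i _ => hpn _) (Finset.mem_univ i)
      exact neg_le_iff_add_nonneg'.mp (this.trans h3)
    have hj : (k : ℕ) = (j : ℕ) + (k - j) := by have := j.2; omega
    have h4 : D = (j : ℕ) • h.poles z + (k - j) • h.poles z + ∑ i, h.poles (b i) := by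
      rw [← add_smul, ← hj]
    have h5 : (j : ℕ) • h.div z + h.div (b i) + D = (j : ℕ) • (h.div z + h.poles z) + (k - j) • h.poles z + (h.div (b i) + ∑ i, h.poles (b i)) := by
      rw [h4, smul_add]; abel
    rw [h5]
    exact add_nonneg (add_nonneg (nsmul_nonneg h1 _) (nsmul_nonneg (hpn z) _)) h2
  have hfin := h.LS_finite D
  let v : Fin (ndeg p z) × Fin (k + 1) → LS p D := fun x => ⟨z ^ (x.2 : ℕ) * b x.1, hmem x.1 x.2⟩
  have hv : LinearIndependent (ZMod p) v := by
    rw [Fintype.linearIndependent_iff]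
    intro g hg
    have hg' : ∑ x : Fin (ndeg p z) × Fin (k + 1), g x • (z ^ (x.2 : ℕ) * b x.1) = 0 := by
      have := congrArg (Submodule.subtype (LS p D)) hg
      simpa [v] using this
    rw [Fintype.sum_prod_type] at hg'
    let G : Fin (ndeg p z) → (ZMod p)[X] := fun i => ∑ j : Fin (k + 1), monomial (j : ℕ) (g (i, j))
    have hG := hb G (by
      rw [← hg']
      refine Finset.sum_congr rfl fun i _ => ?_
      simp only [G, map_sum, Finset.sum_mul, aeval_monomial]
      refine Finset.sum_congr rfl fun j _ => ?_
      rw [Algebra.smul_def, mul_assoc])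
    rintro ⟨i, j⟩
    have h1 := congrArg (fun f => Polynomial.coeff f (j : ℕ)) (hG i)
    simp only [G, finsetSum_coeff, coeff_monomial, coeff_zero] at h1
    rw [Finset.sum_eq_single j] at h1
    · simpa using h1
    · intro j' _ hj'
      rw [if_neg]; exact fun h => hj' (Fin.ext h)
    · simp
  have := hv.fintype_card_le_finrank
  simpa [ell] using this

theorem FunF.poles_eq (h : FunF p E) {z : E} (hz : Transcendental (ZMod p) z) : dg p (h.poles z) = ndeg p z := by
  refine le_antisymm (h.poles_le hz) ?_
  obtain ⟨C, hC0, hC⟩ := h.exists_C hz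
  by_contra hlt
  push Not at hlt
  have hpn : ∀ x, 0 ≤ h.poles x := fun x => le_sup_right
  set k : ℕ := (dg p C).toNat + ell p (0 : Dv E)
  have h1 := hC k
  have h2 := h.ell_le (D := 0) (D' := k • h.poles z + C) (add_nonneg (nsmul_nonneg (hpn z) k) hC0)
  rw [map_add, map_nsmul, map_zero, nsmul_eq_mul] at h2
  have h3 : ((ndeg p z : ℤ)) * (k + 1) ≤ ell p (k • h.poles z + C) := by exact_mod_cast h1
  have h4 : dg p C ≤ (dg p C).toNat := Int.self_le_toNat _
  have h5 : (k : ℤ) = (dg p C).toNat + ell p (0 : Dv E) := by simp [k]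
  have h6 : 0 < (ndeg p z : ℤ) := by exact_mod_cast ndeg_pos h hz
  have h7 : (k : ℤ) * dg p (h.poles z) ≤ k * (ndeg p z - 1) := mul_le_mul_of_nonneg_left (by linarith) (by positivity)
  nlinarith

theorem FunF.dg_div (h : FunF p E) (z : E) : dg p (h.div z) = 0 := by
  by_cases hz0 : z = 0
  · rw [hz0, h.div_zero', map_zero]
  by_cases hz : IsAlgebraic (ZMod p) z
  · have : h.div z = 0 := by ext P; rw [h.div_apply hz0, FunF.v_alg hz0 hz]; rfl
    rw [this, map_zero]
  · have hzi : Transcendental (ZMod p) z⁻¹ := fun h => hz (by simpa using h.inv)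
    have h1 := h.poles_eq hz
    have h2 := h.poles_eq hzi
    rw [ndeg_inv] at h2
    have h3 : h.div z = h.poles z⁻¹ - h.poles z := by
      ext P
      rw [Finsupp.sub_apply, h.poles_apply hz0, h.poles_apply (inv_ne_zero hz0), P.va.inv hz0, h.div_apply hz0]
      rcases le_total 0 (P.va.v z) with h | h
      · rw [max_eq_left (by linarith), max_eq_right (by linarith)]; ring
      · rw [max_eq_right (by linarith), max_eq_left (by linarith)]; ring
    rw [h3, map_sub, h1, h2, sub_self]

theorem FunF.ell_add_div (h : FunF p E) (D : Dv E) {f : E} (hf : f ≠ 0) : ell p (D + h.div f) = ell p D := by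
  have key : ∀ (D : Dv E) {f : E}, f ≠ 0 → ell p (D + h.div f) ≤ ell p D := fun D f hf => by
    have := h.LS_finite D
    have := h.LS_finite (D + h.div f)
    let φ : LS p (D + h.div f) →ₗ[ZMod p] LS p D :=
      ((LinearMap.mulLeft (ZMod p) f).comp (LS p (D + h.div f)).subtype).codRestrict (LS p D) (fun x => by
        change f * (x : E) ∈ _
        by_cases hx : (x : E) = 0
        · rw [hx, mul_zero]; exact zero_mem _
        rw [h.mem_LS_iff (mul_ne_zero hf hx), h.div_mul hf hx]
        have := (h.mem_LS_iff hx).mp x.2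
        convert this using 1; abel)
    refine LinearMap.finrank_le_finrank_of_injective (f := φ) fun x y hxy => ?_
    have : f * (x : E) = f * (y : E) := congrArg Subtype.val hxy
    exact Subtype.ext (mul_left_cancel₀ hf this)
  refine le_antisymm (key D hf) ?_
  have := key (D + h.div f) (inv_ne_zero hf)
  rwa [h.div_inv, add_neg_cancel_right] at this

/-- Riemann's theorem -/
theorem FunF.riemann (h : FunF p E) : ∃ γ n0 : ℤ, ∀ D : Dv E, n0 ≤ dg p D → (ell p D : ℤ) = dg p D + γ := by
  obtain ⟨z, hz⟩ := h.td.exists_trans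
  obtain ⟨C, hC0, hC⟩ := h.exists_C hz
  set n := ndeg p z
  have hn : 0 < (n : ℤ) := by exact_mod_cast ndeg_pos h hz
  set B := h.poles z
  have hB0 : 0 ≤ B := le_sup_right
  have hB : dg p B = n := h.poles_eq hz
  -- lower bound along kB + C
  have hlow : ∀ k : ℕ, dg p (k • B + C) - ell p (k • B + C) ≤ dg p C := fun k => by
    have h1 : (n : ℤ) * (k + 1) ≤ ell p (k • B + C) := by exact_mod_cast hC k
    rw [map_add, map_nsmul, hB, nsmul_eq_mul]
    nlinarith
  have hbdd : ∀ D : Dv E, dg p D - ell p D ≤ dg p C := fun D => by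
    -- find f in L(kB + C - D)
    have hDp : D ≤ D ⊔ 0 := le_sup_left
    set k : ℕ := (dg p (D ⊔ 0)).toNat + 1 + (dg p C).toNat
    have h1 := h.ell_le (D := k • B + C - (D ⊔ 0)) (D' := k • B + C) (by
      have : 0 ≤ D ⊔ 0 := le_sup_right
      simp)
    rw [map_sub] at h1
    have h2 := hlow k
    have h3 : 0 < (ell p (k • B + C - (D ⊔ 0)) : ℤ) := by
      have h4 : dg p (D ⊔ 0) ≤ (dg p (D ⊔ 0)).toNat := Int.self_le_toNat _
      have h5 : (k : ℤ) = (dg p (D ⊔ 0)).toNat + 1 + (dg p C).toNat := by simp [k]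
      have h6 : dg p (k • B + C) = k * n + dg p C := by rw [map_add, map_nsmul, hB, nsmul_eq_mul]
      have h7 : 0 ≤ dg p C := dg_nonneg hC0
      nlinarith
    have h3' : 0 < ell p (k • B + C - (D ⊔ 0)) := by exact_mod_cast h3
    have := h.LS_finite (k • B + C - (D ⊔ 0))
    obtain ⟨⟨f, hf⟩, hf0⟩ := (Module.finrank_pos_iff_exists_ne_zero (R := ZMod p)).mp h3'
    have hf0 : f ≠ 0 := fun h => hf0 (Subtype.ext h)
    rw [h.mem_LS_iff hf0] at hf
    have hle : D ≤ k • B + C + h.div f := by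
      refine hDp.trans ?_
      have := add_le_add_right hf (D ⊔ 0)
      rw [add_zero] at this
      have e : (D ⊔ 0) + (h.div f + (k • B + C - (D ⊔ 0))) = k • B + C + h.div f := by abel
      rwa [e] at this
    have h8 := h.ell_le hle
    rw [h.ell_add_div _ hf0, map_add, h.dg_div, add_zero] at h8
    linarith [hlow k]
  -- maximum of dg D - ell D
  obtain ⟨D0, hD0⟩ : ∃ D0 : Dv E, ∀ D : Dv E, dg p D - ell p D ≤ dg p D0 - ell p D0 := by
    have := Int.exists_greatest_of_bdd (P := fun m => ∃ D : Dv E, dg p D - ell p D = m)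
      ⟨dg p C, fun m ⟨D, hD⟩ => hD ▸ hbdd D⟩ ⟨_, 0, rfl⟩
    obtain ⟨m, ⟨D0, hD0⟩, hm⟩ := this
    exact ⟨D0, fun D => hD0 ▸ hm _ ⟨D, rfl⟩⟩
  refine ⟨ell p D0 - dg p D0, dg p D0 + dg p C + 1, fun D hD => ?_⟩
  have h1 := hbdd (D - D0)
  rw [map_sub] at h1
  have h3' : 0 < ell p (D - D0) := by
    have : 0 < (ell p (D - D0) : ℤ) := by linarith
    exact_mod_cast this
  have := h.LS_finite (D - D0)
  obtain ⟨⟨f, hf⟩, hf0⟩ := (Module.finrank_pos_iff_exists_ne_zero (R := ZMod p)).mp h3'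
  have hf0 : f ≠ 0 := fun h => hf0 (Subtype.ext h)
  rw [h.mem_LS_iff hf0] at hf
  have hle : D0 ≤ D + h.div f := by
    have := add_le_add_right hf D0
    rw [add_zero] at this
    convert this using 1; abel
  have h8 := h.ell_le hle
  rw [h.ell_add_div _ hf0, map_add, h.dg_div, add_zero] at h8
  have := hD0 D
  linarith

theorem FunF.card_kap (h : FunF p E) (P : FFPrime E) : Nat.card P.va.kap = p ^ P.deg p := by
  have := h.finite_kap P
  have h1 := Module.natCard_eq_pow_finrank (K := ZMod p) (V := P.va.kap)
  rwa [Nat.card_zmod] at h1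

theorem FunF.finite_deg (h : FunF p E) (n : ℕ) : {P : FFPrime E | P.deg p ≤ n}.Finite := by
  obtain ⟨z, hz⟩ := h.td.exists_trans
  have hz0 : z ≠ 0 := by rintro rfl; exact hz isAlgebraic_zero
  have hzi : Transcendental (ZMod p) z⁻¹ := fun h => hz (by simpa using h.inv)
  have hp := (Fact.out : p.Prime)
  have htr : ∀ d : ℕ, 0 < d → Transcendental (ZMod p) (z ^ (p ^ d) - z) := fun d hd => by
    have h1 : z ^ (p ^ d) - z = aeval z (X ^ (p ^ d) - X : (ZMod p)[X]) := by simp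
    rw [h1]
    have hpd : 1 < p ^ d := Nat.one_lt_pow hd.ne' hp.one_lt
    have hdeg := FiniteField.X_pow_card_sub_X_natDegree_eq (ZMod p) hpd
    have h0 : (X ^ (p ^ d) - X : (ZMod p)[X]) ≠ 0 := fun h0 => by
      rw [h0, natDegree_zero] at hdeg; omega
    refine hz.aeval _ (by omega) (mem_nonZeroDivisors_of_ne_zero (leadingCoeff_ne_zero.mpr h0))
  refine ((h.finite_zeros hzi).union (Set.Finite.biUnion (Finset.Icc 1 n).finite_toSet fun d hd =>
    h.finite_zeros (htr d (by simp at hd; omega)))).subset ?_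
  intro P hP
  by_cases hPz : P.va.ge 0 z
  · right
    have := h.finite_kap P
    have : Finite P.va.kap := Module.finite_of_finite (ZMod p)
    have := Fintype.ofFinite P.va.kap
    have hd := h.deg_pos P
    have hP' : P.deg p ≤ n := hP
    refine Set.mem_biUnion (x := P.deg p) (by simp; omega) ?_
    have h1 := FiniteField.pow_card (P.va.res z)
    rw [← Nat.card_eq_fintype_card, h.card_kap, ← Va.res_pow hPz, Va.res_eq (hPz.pow _) hPz] at h1
    exact h1.lt fun h0 => htr _ hd (h0 ▸ isAlgebraic_zero)
  · left
    change 0 < P.va.v z⁻¹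
    rw [P.va.inv hz0]
    by_contra hc
    exact hPz (Or.inr (by linarith))
end

section
open Polynomial

variable {p : ℕ} [Fact p.Prime] {E : Type} [Field E] [Algebra (ZMod p) E]

/-- effective divisors -/
abbrev ED (E : Type) [Field E] : Type := FFPrime E →₀ ℕ

/-- an effective divisor as a divisor -/
def edZ {E : Type} [Field E] : ED E →+ Dv E := Finsupp.mapRange.addMonoidHom (Nat.castAddMonoidHom ℤ)

theorem edZ_apply (D : ED E) (P : FFPrime E) : edZ D P = (D P : ℤ) := by
  simp [edZ]
theorem edZ_inj {D D' : ED E} (h : edZ D = edZ D') : D = D' := by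
  ext P
  have := DFunLike.congr_fun h P
  rw [edZ_apply, edZ_apply] at this
  exact_mod_cast this
theorem edZ_nonneg (D : ED E) : 0 ≤ edZ D := fun P => by rw [edZ_apply]; simp
theorem exists_edZ {D : Dv E} (h : 0 ≤ D) : ∃ D', edZ D' = D := by
  refine ⟨Finsupp.mapRange Int.toNat rfl D, ?_⟩
  ext P
  rw [edZ_apply, Finsupp.mapRange_apply]
  exact Int.toNat_of_nonneg (h P)

/-- degree of effective divisors -/
def dN (p : ℕ) [Fact p.Prime] {E : Type} [Field E] [Algebra (ZMod p) E] : ED E →+ ℕ :=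
  Finsupp.liftAddHom fun P => (AddMonoidHom.mulRight (P.deg p : ℕ))

theorem dN_eq (D : ED E) : dN p D = ∑ P ∈ D.support, D P * P.deg p := by
  simp [dN, Finsupp.sum]
theorem dN_single (P : FFPrime E) (n : ℕ) : dN p (Finsupp.single P n) = n * P.deg p := by
  simp [dN]
theorem edZ_single (P : FFPrime E) (n : ℕ) : edZ (Finsupp.single P n) = Finsupp.single P (n : ℤ) := by
  simp [edZ]
theorem dg_edZ (D : ED E) : dg p (edZ D) = dN p D := by
  have : (dg p).comp edZ = (Nat.castAddMonoidHom ℤ).comp (dN p (E := E)) := by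
    ext P; simp [edZ_single, dg_single, dN_single]
  exact DFunLike.congr_fun this D

theorem FunF.finite_eff (h : FunF p E) (n : ℕ) : {D : ED E | dN p D = n}.Finite := by
  classical
  let S := (h.finite_deg n).toFinset
  refine (Finset.finite_toSet (S.finsupp fun _ => Finset.range (n + 1))).subset fun D hD => ?_
  have hD : dN p D = n := hD
  rw [dN_eq] at hD
  have hle : ∀ P, D P * P.deg p ≤ n := fun P => by
    by_cases hP : P ∈ D.support
    · rw [← hD]; exact Finset.single_le_sum (f := fun P => D P * P.deg p) (fun _ _ => Nat.zero_le _) hP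
    · rw [Finsupp.notMem_support_iff.mp hP, zero_mul]; exact Nat.zero_le _
  simp only [Finset.mem_coe, Finset.mem_finsupp_iff]
  constructor
  · intro P hP
    have h0 : 0 < D P := Nat.pos_of_ne_zero (Finsupp.mem_support_iff.mp hP)
    simp only [S, Set.Finite.mem_toFinset, Set.mem_ofPred_eq]
    exact (Nat.le_mul_of_pos_left _ h0).trans (hle P)
  · intro P _
    rw [Finset.mem_range]
    have := (Nat.le_mul_of_pos_right (D P) (h.deg_pos P)).trans (hle P)
    omega

/-- effective divisors of degree `n` -/
def FunF.eff (h : FunF p E) (n : ℕ) : Finset (ED E) := (h.finite_eff n).toFinset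

theorem FunF.mem_eff (h : FunF p E) {n : ℕ} {D : ED E} : D ∈ h.eff n ↔ dN p D = n := by
  simp [FunF.eff]

theorem card_ne_zero_submodule (S : Submodule (ZMod p) E) (hS : Module.Finite (ZMod p) S) :
    Nat.card {x : S // x ≠ 0} = p ^ Module.finrank (ZMod p) S - 1 := by
  classical
  have : Finite S := Module.finite_of_finite (ZMod p)
  have := Fintype.ofFinite S
  have h1 := Module.natCard_eq_pow_finrank (K := ZMod p) (V := S)
  rw [Nat.card_zmod] at h1
  rw [← h1, Nat.card_eq_fintype_card, Nat.card_eq_fintype_card, Fintype.card_subtype_compl, Fintype.card_subtype_eq]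

theorem FunF.class_card (h : FunF p E) (D : Dv E) :
    Nat.card {D' : ED E // ∃ f : E, f ≠ 0 ∧ edZ D' = D + h.div f} * (p ^ ell p (0 : Dv E) - 1) = p ^ ell p D - 1 := by
  unfold ell
  rw [← card_ne_zero_submodule _ (h.LS_finite D), ← card_ne_zero_submodule _ (h.LS_finite 0), ← Nat.card_prod]
  choose F hF0 hF using fun D' : {D' : ED E // ∃ f : E, f ≠ 0 ∧ edZ D' = D + h.div f} => D'.2
  have hdu : ∀ u : {x : LS p (0 : Dv E) // x ≠ 0}, (u.1 : E) ≠ 0 ∧ h.div (u.1 : E) = 0 := fun u => by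
    have hu : (u.1 : E) ≠ 0 := fun h0 => u.2 (Subtype.ext h0)
    refine ⟨hu, ?_⟩
    have halg := h.alg_of_ge fun P => by simpa using u.1.2 P
    ext P; rw [h.div_apply hu, FunF.v_alg hu halg]; rfl
  have hmem : ∀ (D' : {D' : ED E // ∃ f : E, f ≠ 0 ∧ edZ D' = D + h.div f}) (u : {x : LS p (0 : Dv E) // x ≠ 0}),
      (u.1 : E) * F D' ∈ LS p D := fun D' u => by
    rw [h.mem_LS_iff (mul_ne_zero (hdu u).1 (hF0 D')), h.div_mul (hdu u).1 (hF0 D'), (hdu u).2, zero_add, add_comm, ← hF]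
    exact edZ_nonneg _
  refine Nat.card_congr (Equiv.ofBijective (fun x => (⟨⟨(x.2.1 : E) * F x.1, hmem x.1 x.2⟩, fun h0 =>
    mul_ne_zero (hdu x.2).1 (hF0 x.1) (congrArg Subtype.val h0)⟩ : {x : LS p D // x ≠ 0})) ⟨?_, ?_⟩)
  · rintro ⟨D1, u1⟩ ⟨D2, u2⟩ h12
    have h1 : (u1.1 : E) * F D1 = u2.1 * F D2 := congrArg (fun z => ((z.1 : LS p D) : E)) h12
    have h2 : D1 = D2 := by
      apply Subtype.ext
      apply edZ_inj
      have := congrArg h.div h1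
      rw [h.div_mul (hdu u1).1 (hF0 D1), h.div_mul (hdu u2).1 (hF0 D2), (hdu u1).2, (hdu u2).2, zero_add, zero_add] at this
      rw [hF, hF, this]
    subst h2
    have h3 := mul_right_cancel₀ (hF0 D1) h1
    have h4 : u1 = u2 := Subtype.ext (Subtype.ext h3)
    rw [h4]
  · rintro ⟨⟨x, hx⟩, hx0⟩
    have hx0 : x ≠ 0 := fun h0 => hx0 (Subtype.ext h0)
    have hx' := (h.mem_LS_iff hx0).mp hx
    obtain ⟨D', hD'⟩ := exists_edZ hx'
    let D1 : {D' : ED E // ∃ f : E, f ≠ 0 ∧ edZ D' = D + h.div f} := ⟨D', x, hx0, by rw [hD', add_comm]⟩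
    have hu0 : x / F D1 ≠ 0 := div_ne_zero hx0 (hF0 D1)
    have hdiv : h.div (x / F D1) = 0 := by
      rw [div_eq_mul_inv, h.div_mul hx0 (inv_ne_zero (hF0 _)), h.div_inv]
      have h1 := hF D1
      have h2 : edZ D1.1 = D + h.div x := by change edZ D' = _; rw [hD', add_comm]
      rw [h2] at h1
      rw [add_left_cancel h1, add_neg_cancel]
    let u : {x : LS p (0 : Dv E) // x ≠ 0} := ⟨⟨x / F D1, by
      rw [h.mem_LS_iff hu0, hdiv, add_zero]⟩, fun h0 => hu0 (congrArg Subtype.val h0)⟩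
    refine ⟨(D1, u), ?_⟩
    apply Subtype.ext; apply Subtype.ext
    exact div_mul_cancel₀ x (hF0 D1)

/-- coefficient sums of the L-series -/
def FunF.A (h : FunF p E) {q : ℕ} [NeZero q] (lam : Dv E →+ ZMod q) (n : ℕ) : ℂ :=
  ∑ D ∈ h.eff n, ZMod.stdAddChar (lam (edZ D))

theorem FunF.ell_zero_pos (h : FunF p E) : 0 < ell p (0 : Dv E) := by
  have := h.LS_finite 0
  refine (Module.finrank_pos_iff_exists_ne_zero (R := ZMod p)).mpr ⟨⟨1, fun P => ?_⟩, fun h0 => ?_⟩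
  · simpa using Va.ge_one
  · exact one_ne_zero (congrArg Subtype.val h0)

theorem FunF.recursion (h : FunF p E) {q : ℕ} [NeZero q] (lam : Dv E →+ ZMod q) (hlam : ∀ f, lam (h.div f) = 0)
    (P : FFPrime E) {γ n0 : ℤ} (hR : ∀ D : Dv E, n0 ≤ dg p D → (ell p D : ℤ) = dg p D + γ) {n : ℕ} (hn : n0 ≤ n) :
    ((p : ℂ) ^ ((n : ℤ) + P.deg p + γ) - 1) * (ZMod.stdAddChar (lam (Finsupp.single P 1)) * h.A lam n) =
      ((p : ℂ) ^ ((n : ℤ) + γ) - 1) * h.A lam (n + P.deg p) := by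
  classical
  have hp := (Fact.out : p.Prime)
  have hc0 : ((p : ℂ) ^ ell p (0 : Dv E) - 1) ≠ 0 := by
    have : 1 < p ^ ell p (0 : Dv E) := Nat.one_lt_pow h.ell_zero_pos.ne' hp.one_lt
    rw [sub_ne_zero]
    exact_mod_cast this.ne'
  have hcount : ∀ (D : Dv E) (m : ℕ), dg p D = m → n0 ≤ m →
      (((h.eff m).filter fun D' => ∃ f : E, f ≠ 0 ∧ edZ D' = D + h.div f).card : ℂ) * ((p : ℂ) ^ ell p (0 : Dv E) - 1)
        = (p : ℂ) ^ ((m : ℤ) + γ) - 1 := by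
    intro D m hD hm
    have h1 := h.class_card D
    have h2 : Nat.card {D' : ED E // ∃ f : E, f ≠ 0 ∧ edZ D' = D + h.div f} =
        ((h.eff m).filter fun D' => ∃ f : E, f ≠ 0 ∧ edZ D' = D + h.div f).card := by
      refine Nat.subtype_card _ fun D' => ?_
      rw [Finset.mem_filter, h.mem_eff, and_iff_right_iff_imp]
      rintro ⟨f, hf, hfe⟩
      have h5 := dg_edZ (p := p) D'
      rw [hfe, map_add, h.dg_div, add_zero, hD] at h5
      exact_mod_cast h5.symm
    rw [h2] at h1
    have h3 : ((m : ℤ) + γ) = (ell p D : ℕ) := by rw [hR D (hD ▸ hm), hD]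
    rw [h3, zpow_natCast]
    have h4 := congrArg (Nat.cast (R := ℂ)) h1
    rw [Nat.cast_mul, Nat.cast_sub (Nat.one_le_pow _ _ hp.pos), Nat.cast_sub (Nat.one_le_pow _ _ hp.pos)] at h4
    push_cast at h4
    exact h4
  set d := P.deg p
  set Rel : ED E → ED E → Prop := fun D D' => ∃ f : E, f ≠ 0 ∧ edZ D' = edZ D + Finsupp.single P 1 + h.div f with hRel
  have e1 : ∑ D ∈ h.eff n, ∑ D' ∈ (h.eff (n + d)).filter (Rel D), (ZMod.stdAddChar (lam (edZ D')) : ℂ) * ((p : ℂ) ^ ell p (0 : Dv E) - 1)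
      = ((p : ℂ) ^ ((n : ℤ) + d + γ) - 1) * (ZMod.stdAddChar (lam (Finsupp.single P 1)) * h.A lam n) := by
    rw [FunF.A, Finset.mul_sum, Finset.mul_sum]
    refine Finset.sum_congr rfl fun D hD => ?_
    have h1 := hcount (edZ D + Finsupp.single P 1) (n + d) (by
      rw [map_add, dg_edZ, dg_single, h.mem_eff.mp hD]; simp [d]) (by push_cast; linarith [Int.natCast_nonneg d])
    rw [Finset.sum_congr rfl (g := fun _ => (ZMod.stdAddChar (lam (Finsupp.single P 1)) * ZMod.stdAddChar (lam (edZ D)) : ℂ) * ((p : ℂ) ^ ell p (0 : Dv E) - 1))]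
    · rw [Finset.sum_const, nsmul_eq_mul]
      push_cast at h1
      rw [← h1]; ring
    · intro D' hD'
      obtain ⟨f, hf, hfe⟩ := (Finset.mem_filter.mp hD').2
      rw [hfe, map_add lam, map_add lam, hlam, add_zero, AddChar.map_add_eq_mul]
      ring
  have e2 : ∑ D ∈ h.eff n, ∑ D' ∈ (h.eff (n + d)).filter (Rel D), (ZMod.stdAddChar (lam (edZ D')) : ℂ) * ((p : ℂ) ^ ell p (0 : Dv E) - 1)
      = ((p : ℂ) ^ ((n : ℤ) + γ) - 1) * h.A lam (n + d) := by
    rw [Finset.sum_comm' (t' := h.eff (n + d)) (s' := fun D' => (h.eff n).filter fun D => Rel D D') (by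
      intro D D'; simp only [Finset.mem_filter]; tauto)]
    rw [FunF.A, Finset.mul_sum]
    refine Finset.sum_congr rfl fun D' hD' => ?_
    have h1 := hcount (edZ D' - Finsupp.single P 1) n (by
      rw [map_sub, dg_edZ, dg_single, h.mem_eff.mp hD']; simp [d]) hn
    rw [Finset.sum_const, nsmul_eq_mul, ← h1]
    have : ((h.eff n).filter fun D => Rel D D') = (h.eff n).filter fun D => ∃ f : E, f ≠ 0 ∧ edZ D = edZ D' - Finsupp.single P 1 + h.div f := by
      refine Finset.filter_congr fun D _ => ?_
      constructor
      · rintro ⟨f, hf, hfe⟩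
        exact ⟨f⁻¹, inv_ne_zero hf, by rw [h.div_inv, hfe]; abel⟩
      · rintro ⟨f, hf, hfe⟩
        exact ⟨f⁻¹, inv_ne_zero hf, by rw [h.div_inv, hfe]; abel⟩
    rw [this]; ring
  rw [← e1, e2]
end

section
open Polynomial Filter Topology

section euler
variable {ι : Type} 

/-- Euler product for sums over finitely supported functions -/
theorem euler_finset (f : (ι →₀ ℕ) → ℂ) (x : ι → ℂ) (h0 : f 0 = 1)
    (hmul : ∀ D j, f (D + Finsupp.single j 1) = f D * x j) (hs : Summable f) (S : Finset ι) :
    (∑' D, Set.indicator {D : ι →₀ ℕ | D.support ⊆ S} f D) * ∏ i ∈ S, (1 - x i) = 1 := by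
  classical
  induction S using Finset.induction_on with
  | empty =>
    rw [Finset.prod_empty, mul_one, tsum_eq_single 0]
    · simp [h0]
    · intro D hD
      rw [Set.indicator_of_notMem]
      simpa using hD
  | insert j T hj ih =>
    rw [Finset.prod_insert hj, ← mul_assoc]
    refine Eq.trans ?_ ih
    congr 1
    rw [mul_sub, mul_one, sub_eq_iff_eq_add]
    have hg : ∑' D, Set.indicator {D : ι →₀ ℕ | D.support ⊆ insert j T ∧ D j ≠ 0} f D =
        (∑' D, Set.indicator {D : ι →₀ ℕ | D.support ⊆ insert j T} f D) * x j := by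
      rw [← tsum_mul_right]
      have hinj : Function.Injective fun D : ι →₀ ℕ => D + Finsupp.single j 1 := fun D D' h => add_right_cancel h
      rw [← hinj.tsum_eq]
      · refine tsum_congr fun D => ?_
        by_cases hD : D.support ⊆ insert j T
        · rw [Set.indicator_of_mem (a := D), Set.indicator_of_mem, hmul]
          · refine ⟨fun i hi => ?_, by simp⟩
            by_cases hij : i = j
            · simp [hij]
            · apply hD
              simpa [hij, Finsupp.single_apply, Ne.symm hij] using hi
          · exact hD
        · rw [Set.indicator_of_notMem (a := D), Set.indicator_of_notMem, zero_mul]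
          · rintro ⟨h1, h2⟩
            apply hD
            intro i hi
            apply h1
            have := Finsupp.mem_support_iff.mp hi
            rw [Finsupp.mem_support_iff, Finsupp.add_apply]; omega
          · exact hD
      · intro D hD
        have hD' : D ∈ {D : ι →₀ ℕ | D.support ⊆ insert j T ∧ D j ≠ 0} := by
          by_contra h; exact hD (Set.indicator_of_notMem h _)
        refine ⟨D - Finsupp.single j 1, ?_⟩
        exact tsub_add_cancel_of_le (by simpa [Finsupp.single_le_iff] using Nat.one_le_iff_ne_zero.mpr hD'.2)
    rw [← hg, ← (hs.indicator _).tsum_add (hs.indicator _)]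
    refine tsum_congr fun D => ?_
    by_cases h1 : D j = 0
    · rw [Set.indicator_of_notMem (s := {D : ι →₀ ℕ | D.support ⊆ insert j T ∧ D j ≠ 0}) (fun h => h.2 h1), add_zero]
      have : (D.support ⊆ insert j T) ↔ D.support ⊆ T := by
        rw [Finset.subset_insert_iff_of_notMem]; simpa using h1
      simp only [Set.indicator_apply, Set.mem_ofPred_eq, this]
    · have : ¬ (D.support ⊆ T) := fun h => hj (h (by simpa using h1))
      simp only [Set.indicator_apply, Set.mem_ofPred_eq, this]
      have h2 : (D.support ⊆ insert j T ∧ D j ≠ 0) ↔ D.support ⊆ insert j T := and_iff_left h1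
      simp only [h2, if_false, zero_add]

theorem euler_tendsto (f : (ι →₀ ℕ) → ℂ) (x : ι → ℂ) (h0 : f 0 = 1)
    (hmul : ∀ D j, f (D + Finsupp.single j 1) = f D * x j) (hs : Summable f) :
    Tendsto (fun S : Finset ι => ∏ i ∈ S, (1 - x i)⁻¹) atTop (𝓝 (∑' D, f D)) := by
  classical
  have h1 : ∀ S : Finset ι, ∏ i ∈ S, (1 - x i)⁻¹ = ∑' D, Set.indicator {D : ι →₀ ℕ | D.support ⊆ S} f D := fun S => by
    rw [Finset.prod_inv_distrib]
    have := euler_finset f x h0 hmul hs S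
    exact (eq_inv_of_mul_eq_one_left this).symm
  simp_rw [h1]
  refine tendsto_tsum_of_dominated_convergence (bound := fun D => ‖f D‖) hs.norm ?_ ?_
  · intro D
    refine tendsto_const_nhds.congr' ?_
    filter_upwards [eventually_ge_atTop D.support] with S hS
    rw [Set.indicator_of_mem]; exact hS
  · refine Eventually.of_forall fun S D => norm_indicator_le_norm_self _ _
end euler

section seq
/-- the abstract setting for the coefficient sequences -/
theorem seq_bdd {a : ℕ → ℂ} {c : ℕ → ℝ} {N d : ℕ} (hd : 0 < d) (hc : ∀ n, N ≤ n → 0 < c n) {ω : ℂ} (hω : ‖ω‖ = 1)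
    (hrec : ∀ n, N ≤ n → (c (n + d) : ℂ) * (ω * a n) = c n * a (n + d)) :
    ∃ C, 0 ≤ C ∧ (∀ n, n < N → ‖a n‖ ≤ C) ∧ ∀ n, N ≤ n → ‖a n‖ ≤ C * c n := by
  have hr : ∀ n, N ≤ n → ‖a (n + d)‖ / c (n + d) = ‖a n‖ / c n := fun n hn => by
    have h1 := congrArg norm (hrec n hn)
    rw [norm_mul, norm_mul, norm_mul, hω, one_mul, Complex.norm_real, Complex.norm_real, Real.norm_of_nonneg (hc n hn).le,
      Real.norm_of_nonneg (hc (n + d) (by omega)).le] at h1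
    rw [div_eq_div_iff (hc _ (by omega)).ne' (hc n hn).ne']
    linarith
  set C := ∑ n ∈ Finset.range (N + d), (‖a n‖ + |‖a n‖ / c n|)
  have hle : ∀ n, n < N + d → ‖a n‖ + |‖a n‖ / c n| ≤ C := fun n hn =>
    Finset.single_le_sum (f := fun n => ‖a n‖ + |‖a n‖ / c n|) (fun _ _ => by positivity) (Finset.mem_range.mpr hn)
  refine ⟨C, Finset.sum_nonneg fun _ _ => by positivity, fun n hn => ?_, ?_⟩
  · have := hle n (by omega); linarith [abs_nonneg (‖a n‖ / c n)]
  · intro n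
    induction n using Nat.strong_induction_on with
    | _ n ih =>
      intro hn
      rw [← div_le_iff₀ (hc n hn)]
      by_cases h : n < N + d
      · have := hle n h; linarith [le_abs_self (‖a n‖ / c n), norm_nonneg (a n)]
      · obtain ⟨m, rfl⟩ : ∃ m, n = m + d := ⟨n - d, by omega⟩
        rw [hr m (by omega), div_le_iff₀ (hc m (by omega))]
        exact ih m (by omega) (by omega)

theorem one_sub_bound {ω : ℂ} (hω : ‖ω‖ = 1) (h1 : ω ≠ 1) : ∃ δ > 0, ∀ s : ℝ, 0 ≤ s → s ≤ 1 → δ ≤ ‖1 - ω * s‖ := by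
  obtain ⟨s, hs, hmin⟩ := (isCompact_Icc (a := (0:ℝ)) (b := 1)).exists_isMinOn ⟨0, by simp⟩
    (f := fun s : ℝ => ‖1 - ω * s‖) (by fun_prop)
  refine ⟨‖1 - ω * s‖, norm_pos_iff.mpr fun h => h1 ?_, fun t h0 h1 => hmin ⟨h0, h1⟩⟩
  have h2 : ω * s = 1 := (sub_eq_zero.mp h).symm
  have h3 := congrArg norm h2
  rw [norm_mul, hω, one_mul, norm_one, Complex.norm_real, Real.norm_of_nonneg hs.1] at h3
  rw [h3] at h2; simpa using h2
end seq
end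

section
open Polynomial Filter Topology

variable {p : ℕ} [Fact p.Prime] {E : Type} [Field E] [Algebra (ZMod p) E]

theorem FunF.exists_place (h : FunF p E) : Nonempty (FFPrime E) := by
  obtain ⟨z, hz⟩ := h.td.exists_trans
  obtain ⟨P, hP⟩ := h.exists_pole hz
  exact ⟨P⟩

/-- the sequence `p^(n+γ)-1` -/
def cseq (p : ℕ) (γ : ℤ) (n : ℕ) : ℝ := (p : ℝ) ^ ((n : ℤ) + γ) - 1

theorem stdAddChar_norm {q : ℕ} [NeZero q] (x : ZMod q) : ‖(ZMod.stdAddChar x : ℂ)‖ = 1 := by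
  rw [ZMod.stdAddChar_apply]; exact Circle.norm_coe _

theorem stdAddChar_ne_one {q : ℕ} [NeZero q] {x : ZMod q} (hx : x ≠ 0) : (ZMod.stdAddChar x : ℂ) ≠ 1 := fun h =>
  hx (ZMod.injective_stdAddChar (by rw [h, AddChar.map_zero_eq_one]))

theorem FunF.setup (h : FunF p E) : ∃ (γ : ℤ) (N : ℕ), (∀ n, N ≤ n → 0 < cseq p γ n) ∧
    ∀ (q : ℕ) [NeZero q] (lam : Dv E →+ ZMod q) (_ : ∀ f, lam (h.div f) = 0) (P : FFPrime E) (n : ℕ), N ≤ n →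
      (cseq p γ (n + P.deg p) : ℂ) * (ZMod.stdAddChar (lam (Finsupp.single P 1)) * h.A lam n) =
        cseq p γ n * h.A lam (n + P.deg p) := by
  obtain ⟨γ, n0, hR⟩ := h.riemann
  have hp1 : (1:ℝ) < p := by exact_mod_cast (Fact.out : p.Prime).one_lt
  refine ⟨γ, (max n0 (1 - γ)).toNat, fun n hn => ?_, fun q _ lam hlam P n hn => ?_⟩
  · have : 1 - γ ≤ n := by omega
    exact sub_pos.mpr (one_lt_zpow₀ hp1 (by omega))
  · have := h.recursion lam hlam P hR (n := n) (by omega)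
    unfold cseq
    push_cast
    exact this

theorem cseq_le (γ : ℤ) (n : ℕ) : cseq p γ n ≤ (p : ℝ) ^ γ * (p : ℝ) ^ n := by
  have hp1 : (p : ℝ) ≠ 0 := by exact_mod_cast (Fact.out : p.Prime).ne_zero
  rw [cseq, zpow_add₀ hp1, zpow_natCast, mul_comm]; linarith

theorem cseq_add (γ : ℤ) (n d : ℕ) : cseq p γ (n + d) = (p : ℝ) ^ d * cseq p γ n + ((p : ℝ) ^ d - 1) := by
  have hp1 : (p : ℝ) ≠ 0 := by exact_mod_cast (Fact.out : p.Prime).ne_zero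
  rw [cseq, cseq, Nat.cast_add, zpow_add₀ hp1, zpow_add₀ hp1, zpow_add₀ hp1, zpow_natCast, zpow_natCast]; ring

variable (h : FunF p E) {q : ℕ} [NeZero q] (lam : Dv E →+ ZMod q)

theorem FunF.A_bound (hlam : ∀ f, lam (h.div f) = 0) : ∃ C, 0 < C ∧ ∀ n, ‖h.A lam n‖ ≤ C * (p : ℝ) ^ n := by
  obtain ⟨γ, N, hc, hrec⟩ := h.setup
  obtain ⟨P⟩ := h.exists_place
  have hp1 : (1:ℝ) < p := by exact_mod_cast (Fact.out : p.Prime).one_lt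
  obtain ⟨C, hC0, hC1, hC2⟩ := seq_bdd (h.deg_pos P) hc (stdAddChar_norm _) (hrec q lam hlam P)
  have hg : 0 < (p:ℝ) ^ γ := by positivity
  refine ⟨C * (1 + (p:ℝ) ^ γ) + 1, by positivity, fun n => ?_⟩
  have h1 : 1 ≤ (p:ℝ) ^ n := one_le_pow₀ hp1.le
  by_cases hn : n < N
  · have := hC1 n hn
    have h2 : C * 1 ≤ C * (p:ℝ) ^ n := mul_le_mul_of_nonneg_left h1 hC0
    have h3 : 0 ≤ C * (p:ℝ)^γ * (p:ℝ)^n := by positivity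
    nlinarith
  · have := hC2 n (by omega)
    have h2 := mul_le_mul_of_nonneg_left (cseq_le (p := p) γ n) hC0
    have h3 : 0 ≤ C * (p:ℝ)^n := by positivity
    nlinarith

theorem FunF.A_diff (hlam : ∀ f, lam (h.div f) = 0) (P : FFPrime E) : ∃ C, 0 < C ∧ ∀ n,
    ‖h.A lam (n + P.deg p) - ZMod.stdAddChar (lam (Finsupp.single P 1)) * (p : ℂ) ^ P.deg p * h.A lam n‖ ≤ C := by
  obtain ⟨γ, N, hc, hrec⟩ := h.setup
  have hp1 : (1:ℝ) < p := by exact_mod_cast (Fact.out : p.Prime).one_lt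
  obtain ⟨C, hC0, hC1, hC2⟩ := seq_bdd (h.deg_pos P) hc (stdAddChar_norm _) (hrec q lam hlam P)
  set d := P.deg p
  set ω : ℂ := ZMod.stdAddChar (lam (Finsupp.single P 1))
  set a := h.A lam
  set g : ℕ → ℝ := fun n => ‖a (n + d) - ω * (p : ℂ) ^ d * a n‖
  have hd1 : 0 ≤ (p:ℝ) ^ d - 1 := by linarith [one_le_pow₀ hp1.le (n := d)]
  refine ⟨∑ n ∈ Finset.range N, g n + ((p:ℝ) ^ d - 1) * C + 1, ?_, fun n => ?_⟩
  · have : 0 ≤ ∑ n ∈ Finset.range N, g n := Finset.sum_nonneg fun _ _ => norm_nonneg _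
    positivity
  by_cases hn : n < N
  · have := Finset.single_le_sum (f := g) (fun _ _ => norm_nonneg _) (Finset.mem_range.mpr hn)
    have h3 : 0 ≤ ((p:ℝ) ^ d - 1) * C := by positivity
    change g n ≤ _
    linarith
  · have hn : N ≤ n := by omega
    have h1 := hrec q lam hlam P n hn
    have h2 : (cseq p γ n : ℂ) * (a (n + d) - ω * (p : ℂ) ^ d * a n) = ((p:ℂ) ^ d - 1) * (ω * a n) := by
      have h3 := congrArg (Complex.ofReal) (cseq_add (p := p) γ n d)
      push_cast at h3
      rw [h3] at h1
      linear_combination -h1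
    have h4 := congrArg norm h2
    have h5 : ‖((p:ℂ) ^ d - 1)‖ = (p:ℝ)^d - 1 := by
      rw [← Real.norm_of_nonneg hd1, ← Complex.norm_real]; push_cast; rfl
    rw [norm_mul, norm_mul, norm_mul, h5, stdAddChar_norm, one_mul, Complex.norm_real, Real.norm_of_nonneg (hc n hn).le] at h4
    have h6 : g n ≤ ((p:ℝ) ^ d - 1) * C := by
      have := mul_le_mul_of_nonneg_left (hC2 n hn) hd1
      rw [← h4] at this
      have h7 : cseq p γ n * g n ≤ cseq p γ n * (((p:ℝ) ^ d - 1) * C) := by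
        change cseq p γ n * g n ≤ _ at this; linarith
      exact le_of_mul_le_mul_left h7 (hc n hn)
    have : 0 ≤ ∑ n ∈ Finset.range N, g n := Finset.sum_nonneg fun _ _ => norm_nonneg _
    change g n ≤ _
    linarith

theorem FunF.A_zero (n : ℕ) : h.A (0 : Dv E →+ ZMod q) n = ((h.eff n).card : ℂ) := by
  simp [FunF.A]

theorem FunF.A_lower : ∃ n1 d : ℕ, 0 < d ∧ ∀ k, (p : ℝ) ^ (k * d) ≤ ((h.eff (n1 + k * d)).card : ℝ) := by
  obtain ⟨γ, N, hc, hrec⟩ := h.setup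
  obtain ⟨P⟩ := h.exists_place
  have hp1 : (1:ℝ) < p := by exact_mod_cast (Fact.out : p.Prime).one_lt
  set d := P.deg p with hd
  have hd0 := h.deg_pos P
  refine ⟨N * d, d, hd0, fun k => ?_⟩
  induction k with
  | zero =>
    rw [zero_mul, pow_zero, add_zero]
    have : 0 < (h.eff (N * d)).card := Finset.card_pos.mpr ⟨Finsupp.single P N, h.mem_eff.mpr (dN_single _ _)⟩
    exact_mod_cast this
  | succ k ih =>
    have hn : N ≤ N * d + k * d := by nlinarith
    have h1 := hrec 1 0 (by simp) P (N * d + k * d) hn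
    rw [h.A_zero, h.A_zero, AddMonoidHom.zero_apply, AddChar.map_zero_eq_one, one_mul] at h1
    have h2 : cseq p γ (N * d + k * d + d) * (h.eff (N * d + k * d)).card = cseq p γ (N * d + k * d) * (h.eff (N * d + k * d + d)).card := by
      exact_mod_cast h1
    have h3 : N * d + (k + 1) * d = N * d + k * d + d := by ring
    rw [h3, add_mul, one_mul, pow_add]
    have h4 := hc _ hn
    refine le_of_mul_le_mul_left ?_ h4
    rw [← h2, cseq_add _ (N * d + k * d) d]
    have h5 := one_le_pow₀ hp1.le (n := d)
    have h6 : 0 ≤ ((p:ℝ) ^ d - 1) * ((h.eff (N * d + k * d)).card : ℝ) := mul_nonneg (by linarith) (Nat.cast_nonneg _)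
    have h7 : 0 ≤ (p:ℝ) ^ d * cseq p γ (N * d + k * d) := by positivity
    have h8 := mul_le_mul_of_nonneg_left ih h7
    nlinarith

/-- L-series -/
def FunF.Lz (u : ℝ) : ℂ := ∑' n, h.A lam n * (u : ℂ) ^ n

theorem FunF.Lz_summable (hlam : ∀ f, lam (h.div f) = 0) {u : ℝ} (hu0 : 0 ≤ u) (hu : p * u < 1) :
    Summable fun n => ‖h.A lam n * (u : ℂ) ^ n‖ := by
  obtain ⟨C, hC, hb⟩ := h.A_bound lam hlam
  refine Summable.of_nonneg_of_le (fun _ => norm_nonneg _) (fun n => ?_) ((summable_geometric_of_lt_one (by positivity) hu).mul_left C)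
  rw [norm_mul, norm_pow, Complex.norm_real, Real.norm_of_nonneg hu0, mul_pow, ← mul_assoc]
  exact mul_le_mul_of_nonneg_right (hb n) (by positivity)

theorem FunF.Lz_bound (hlam : ∀ f, lam (h.div f) = 0) : ∃ C, 0 < C ∧ ∀ u : ℝ, 0 ≤ u → p * u < 1 →
    ‖h.Lz lam u‖ ≤ C / (1 - p * u) := by
  obtain ⟨C, hC, hb⟩ := h.A_bound lam hlam
  refine ⟨C, hC, fun u hu0 hu => ?_⟩
  have hg := (hasSum_geometric_of_lt_one (r := p * u) (by positivity) hu).mul_left C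
  rw [div_eq_mul_inv]
  refine tsum_of_norm_bounded hg fun n => ?_
  rw [norm_mul, norm_pow, Complex.norm_real, Real.norm_of_nonneg hu0, mul_pow, ← mul_assoc]
  exact mul_le_mul_of_nonneg_right (hb n) (by positivity)

theorem FunF.Lz_bdd (hlam : ∀ f, lam (h.div f) = 0) {P : FFPrime E} (hP : lam (Finsupp.single P 1) ≠ 0) :
    ∃ C, 0 < C ∧ ∀ u : ℝ, 0 ≤ u → p * u < 1 → ‖h.Lz lam u‖ ≤ C := by
  obtain ⟨C, hC, hb⟩ := h.A_diff lam hlam P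
  set d := P.deg p
  set ω : ℂ := ZMod.stdAddChar (lam (Finsupp.single P 1)) with hω
  obtain ⟨δ, hδ, hδ'⟩ := one_sub_bound (stdAddChar_norm (lam (Finsupp.single P 1))) (stdAddChar_ne_one hP)
  set S := ∑ n ∈ Finset.range d, ‖h.A lam n‖
  have hS : 0 ≤ S := Finset.sum_nonneg fun _ _ => norm_nonneg _
  refine ⟨(S + C * 2) / δ, by positivity, fun u hu0 hu => ?_⟩
  have hp2 : (2:ℝ) ≤ p := by exact_mod_cast (Fact.out : p.Prime).two_le
  have hu2 : u ≤ 1 / 2 := by nlinarith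
  have hs := (h.Lz_summable lam hlam hu0 hu).of_norm
  have hsplit := hs.sum_add_tsum_nat_add d
  have hs' := (summable_nat_add_iff d).mpr hs
  have key : (1 - ω * (((p * u) ^ d : ℝ) : ℂ)) * h.Lz lam u = ∑ n ∈ Finset.range d, h.A lam n * (u:ℂ) ^ n +
      ∑' n, (h.A lam (n + d) - ω * (p : ℂ) ^ d * h.A lam n) * (u:ℂ) ^ (n + d) := by
    rw [sub_mul, one_mul]
    nth_rw 1 [FunF.Lz]
    rw [← hsplit, add_sub_assoc, FunF.Lz, ← tsum_mul_left, ← hs'.tsum_sub (hs.mul_left _)]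
    congr 1
    refine tsum_congr fun n => ?_
    push_cast; ring
  have h1 : ‖∑ n ∈ Finset.range d, h.A lam n * (u:ℂ) ^ n‖ ≤ S := by
    refine (norm_sum_le _ _).trans (Finset.sum_le_sum fun n _ => ?_)
    rw [norm_mul, norm_pow, Complex.norm_real, Real.norm_of_nonneg hu0]
    exact mul_le_of_le_one_right (norm_nonneg _) (pow_le_one₀ hu0 (by linarith))
  have h2 : ‖∑' n, (h.A lam (n + d) - ω * (p : ℂ) ^ d * h.A lam n) * (u:ℂ) ^ (n + d)‖ ≤ C * 2 := by
    have hg := (hasSum_geometric_two).mul_left C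
    refine tsum_of_norm_bounded hg fun n => ?_
    rw [norm_mul, norm_pow, Complex.norm_real, Real.norm_of_nonneg hu0]
    refine mul_le_mul (hb n) ?_ (by positivity) hC.le
    rw [pow_add]
    have h3 : u ^ d ≤ 1 := pow_le_one₀ hu0 (by linarith)
    have h4 : u ^ n ≤ (1/2) ^ n := pow_le_pow_left₀ hu0 hu2 n
    have h5 : 0 ≤ u ^ n := by positivity
    nlinarith
  rw [le_div_iff₀ hδ]
  have h3 := hδ' ((p * u) ^ d) (by positivity) (pow_le_one₀ (by positivity) hu.le)
  calc ‖h.Lz lam u‖ * δ ≤ ‖h.Lz lam u‖ * ‖1 - ω * (((p * u) ^ d : ℝ) : ℂ)‖ := mul_le_mul_of_nonneg_left h3 (norm_nonneg _)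
    _ = ‖(1 - ω * (((p * u) ^ d : ℝ) : ℂ)) * h.Lz lam u‖ := by rw [norm_mul, mul_comm]
    _ ≤ _ := by rw [key]; exact (norm_add_le _ _).trans (add_le_add h1 h2)

theorem FunF.Lz_zero_eq (u : ℝ) : h.Lz (0 : Dv E →+ ZMod q) u = ((∑' n, ((h.eff n).card : ℝ) * u ^ n : ℝ) : ℂ) := by
  rw [FunF.Lz, Complex.ofReal_tsum]
  refine tsum_congr fun n => ?_
  rw [h.A_zero]; push_cast; rfl

theorem FunF.Lz_lower : ∃ c, 0 < c ∧ ∀ u : ℝ, 1 / (2 * p) ≤ u → p * u < 1 →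
    c / (1 - p * u) ≤ ‖h.Lz (0 : Dv E →+ ZMod q) u‖ := by
  obtain ⟨n1, d, hd, hl⟩ := h.A_lower
  have hp0 : (0:ℝ) < p := by exact_mod_cast (Fact.out : p.Prime).pos
  refine ⟨(1 / (2 * p)) ^ n1 / d, by positivity, fun u hu1 hu => ?_⟩
  have hu0 : 0 < u := lt_of_lt_of_le (by positivity) hu1
  have hs := (h.Lz_summable (0 : Dv E →+ ZMod q) (by simp) hu0.le hu)
  have hs' : Summable fun n => ((h.eff n).card : ℝ) * u ^ n := by
    refine hs.congr fun n => ?_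
    rw [h.A_zero, norm_mul, norm_pow, Complex.norm_real, Real.norm_of_nonneg hu0.le]; simp
  have hnn : 0 ≤ ∑' n, ((h.eff n).card : ℝ) * u ^ n := tsum_nonneg fun n => by positivity
  rw [h.Lz_zero_eq, Complex.norm_real, Real.norm_of_nonneg hnn]
  have hpu0 : 0 ≤ p * u := by positivity
  have hpd : (p * u) ^ d < 1 := pow_lt_one₀ hpu0 hu hd.ne'
  have hinj : Function.Injective fun k => n1 + k * d := fun a b hab => by
    have : a * d = b * d := by simpa using hab
    exact Nat.eq_of_mul_eq_mul_right hd this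
  have h1 : ∑' k, u ^ n1 * ((p * u) ^ d) ^ k ≤ ∑' n, ((h.eff n).card : ℝ) * u ^ n := by
    refine Summable.tsum_le_tsum_of_inj _ hinj (fun n _ => by positivity) (fun k => ?_)
      ((summable_geometric_of_lt_one (by positivity) hpd).mul_left _) hs'
    have h2 := mul_le_mul_of_nonneg_right (hl k) (by positivity : 0 ≤ u ^ (n1 + k * d))
    refine le_trans (le_of_eq ?_) h2
    rw [← pow_mul, mul_pow, pow_add, mul_comm d k]; ring
  rw [tsum_mul_left, tsum_geometric_of_lt_one (by positivity) hpd] at h1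
  refine le_trans ?_ h1
  rw [div_div, ← div_eq_mul_inv]
  refine div_le_div₀ (by positivity) (pow_le_pow_left₀ (by positivity) hu1 n1) (by linarith) ?_
  have := one_add_mul_le_pow (a := p * u - 1) (by linarith) d
  rw [add_sub_cancel] at this
  linarith
end

section
open Polynomial Filter Topology

variable {p : ℕ} [Fact p.Prime] {E : Type} [Field E] [Algebra (ZMod p) E]

theorem FunF.summable_ED (h : FunF p E) {u : ℝ} (hu0 : 0 ≤ u) (hu : p * u < 1) :
    Summable fun D : ED E => u ^ dN p D := by
  classical
  have hs := (h.Lz_summable (q := 1) 0 (by simp) hu0 hu)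
  have hs' : Summable fun n => ((h.eff n).card : ℝ) * u ^ n := by
    refine hs.congr fun n => ?_
    rw [h.A_zero, norm_mul, norm_pow, Complex.norm_real, Real.norm_of_nonneg hu0]; simp
  refine summable_of_sum_le (c := ∑' n, ((h.eff n).card : ℝ) * u ^ n) (fun _ => by positivity) fun T => ?_
  set I := T.image (dN p)
  have h1 : ∑ D ∈ T, u ^ dN p D = ∑ n ∈ I, ∑ D ∈ T with dN p D = n, u ^ dN p D :=
    (Finset.sum_fiberwise_of_maps_to (fun D hD => Finset.mem_image_of_mem _ hD) _).symm
  rw [h1]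
  refine le_trans (Finset.sum_le_sum fun n _ => ?_) (hs'.sum_le_tsum I fun n _ => by positivity)
  rw [Finset.sum_congr rfl (g := fun _ => u ^ n) (fun D hD => by rw [(Finset.mem_filter.mp hD).2]), Finset.sum_const, nsmul_eq_mul]
  refine mul_le_mul_of_nonneg_right ?_ (by positivity)
  exact_mod_cast Finset.card_le_card fun D hD => h.mem_eff.mpr (Finset.mem_filter.mp hD).2

theorem FunF.Lz_euler (h : FunF p E) {q : ℕ} [NeZero q] (lam : Dv E →+ ZMod q) {u : ℝ} (hu0 : 0 ≤ u) (hu : p * u < 1) :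
    Tendsto (fun S : Finset (FFPrime E) => ∏ P ∈ S, (1 - ZMod.stdAddChar (lam (Finsupp.single P 1)) * (u : ℂ) ^ P.deg p)⁻¹)
      atTop (𝓝 (h.Lz lam u)) := by
  set f : ED E → ℂ := fun D => ZMod.stdAddChar (lam (edZ D)) * (u : ℂ) ^ dN p D with hf
  have hs : Summable f := by
    refine Summable.of_norm ((h.summable_ED hu0 hu).congr fun D => ?_)
    rw [hf, norm_mul, stdAddChar_norm, one_mul, norm_pow, Complex.norm_real, Real.norm_of_nonneg hu0]
  have h1 := euler_tendsto f (fun P => ZMod.stdAddChar (lam (Finsupp.single P 1)) * (u : ℂ) ^ P.deg p)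
    (by simp [hf]) (fun D P => by
      simp only [hf]
      rw [map_add edZ, map_add lam, AddChar.map_add_eq_mul, map_add, pow_add, dN_single, edZ_single, one_mul, Nat.cast_one]
      ring) hs
  have h2 : h.Lz lam u = ∑' D, f D := by
    rw [← (hs.hasSum.tsum_fiberwise (dN p)).tsum_eq, FunF.Lz]
    refine tsum_congr fun n => ?_
    have h3 : (dN p ⁻¹' {n} : Set (ED E)) = ((h.eff n : Finset (ED E)) : Set (ED E)) := by
      ext D; simp [h.mem_eff]
    rw [h3, Finset.tsum_subtype', FunF.A, Finset.sum_mul]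
    refine Finset.sum_congr rfl fun D hD => ?_
    simp only [hf, h.mem_eff.mp hD]
  rw [h2]; exact h1

theorem prod_one_sub_char {q : ℕ} [NeZero q] (x : ℂ) : ∏ k : ZMod q, (1 - ZMod.stdAddChar k * x) = 1 - x ^ q := by
  classical
  have hpow : ∀ (k : ZMod q) (l : ℕ), (ZMod.stdAddChar k : ℂ) ^ l = ZMod.stdAddChar (l • k) := fun k l =>
    (AddChar.map_nsmul_eq_pow _ _ _).symm
  have hprim : IsPrimitiveRoot (ZMod.stdAddChar (1 : ZMod q) : ℂ) q := by
    refine ⟨by rw [hpow]; simp, fun l hl => ?_⟩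
    rw [hpow, ← AddChar.map_zero_eq_one (ZMod.stdAddChar (N := q))] at hl
    have := ZMod.injective_stdAddChar hl
    rw [nsmul_eq_mul, mul_one] at this
    exact (ZMod.natCast_eq_zero_iff l q).mp this
  have h1 := hprim.pow_sub_pow_eq_prod_sub_mul (1:ℂ) x (NeZero.pos q)
  have himg : Finset.univ.image (fun k : ZMod q => (ZMod.stdAddChar k : ℂ)) = nthRootsFinset q (1:ℂ) := by
    apply Finset.eq_of_subset_of_card_le
    · intro z hz
      obtain ⟨k, -, rfl⟩ := Finset.mem_image.mp hz
      rw [mem_nthRootsFinset (NeZero.pos q), hpow]; simp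
    · rw [hprim.card_nthRootsFinset, Finset.card_image_of_injective _ ZMod.injective_stdAddChar, Finset.card_univ, ZMod.card]
  rw [one_pow] at h1
  rw [h1, ← himg, Finset.prod_image fun a _ b _ hab => ZMod.injective_stdAddChar hab]

theorem prod_char_le {q : ℕ} [Fact q.Prime] (a b : ZMod q) {x : ℝ} (hx0 : 0 ≤ x) (hx1 : x < 1) :
    ‖∏ ij : ZMod q × ZMod q, (1 - ZMod.stdAddChar (ij.1 * a + ij.2 * b) * (x : ℂ))‖ ≤ 1 := by
  have key : ∀ n, ‖(1 - (x : ℂ) ^ n)‖ ≤ 1 := fun n => by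
    have h1 : (1 - (x : ℂ) ^ n) = ((1 - x ^ n : ℝ) : ℂ) := by push_cast; rfl
    rw [h1, Complex.norm_real, Real.norm_eq_abs, abs_le]
    have := pow_le_one₀ hx0 hx1.le (n := n)
    have := pow_nonneg hx0 n
    constructor <;> linarith
  have bij : ∀ a c : ZMod q, a ≠ 0 → ∏ i : ZMod q, (1 - ZMod.stdAddChar (i * a + c) * (x : ℂ)) = 1 - (x:ℂ) ^ q := fun a c ha => by
    rw [← prod_one_sub_char]
    exact Fintype.prod_equiv ((Equiv.mulRight₀ a ha).trans (Equiv.addRight c)) _ _ fun i => by simp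
  by_cases ha : a = 0
  · by_cases hb : b = 0
    · subst ha hb
      simp only [mul_zero, add_zero, AddChar.map_zero_eq_one, one_mul, Finset.prod_const, norm_pow]
      exact pow_le_one₀ (norm_nonneg _) (by simpa using key 1)
    · rw [Fintype.prod_prod_type, norm_prod]
      refine Finset.prod_le_one (fun _ _ => norm_nonneg _) fun i _ => ?_
      simp_rw [add_comm (i * a)]
      rw [bij b _ hb]; exact key q
  · rw [Fintype.prod_prod_type_right, norm_prod]
    refine Finset.prod_le_one (fun _ _ => norm_nonneg _) fun i _ => ?_
    have := bij a (i * b) ha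
    simp only
    rw [this]; exact key q
end

section
open Polynomial Filter Topology

variable {p : ℕ} [Fact p.Prime] {E : Type} [Field E] [Algebra (ZMod p) E]

theorem FunF.Lz_euler_norm (h : FunF p E) {q : ℕ} [NeZero q] (lam : Dv E →+ ZMod q) {u : ℝ} (hu0 : 0 ≤ u) (hu : p * u < 1) :
    Tendsto (fun S : Finset (FFPrime E) => ∏ P ∈ S, ‖1 - ZMod.stdAddChar (lam (Finsupp.single P 1)) * (u : ℂ) ^ P.deg p‖⁻¹)
      atTop (𝓝 ‖h.Lz lam u‖) := by
  refine (h.Lz_euler lam hu0 hu).norm.congr fun S => ?_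
  rw [norm_prod]; simp_rw [norm_inv]

theorem norm_one_sub_pow {u : ℝ} (hu0 : 0 ≤ u) (hu : u ≤ 1) (n : ℕ) : ‖1 - (u : ℂ) ^ n‖ = 1 - u ^ n := by
  have h1 : (1 - (u : ℂ) ^ n) = ((1 - u ^ n : ℝ) : ℂ) := by push_cast; rfl
  rw [h1, Complex.norm_real, Real.norm_of_nonneg]
  linarith [pow_le_one₀ hu0 hu (n := n)]

theorem lt_of_pu {u : ℝ} (_hu0 : 0 ≤ u) (hu : p * u < 1) : u < 1 / 2 := by
  have hp2 : (2:ℝ) ≤ p := by exact_mod_cast (Fact.out : p.Prime).two_le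
  nlinarith

theorem FunF.Lz_euler0 (h : FunF p E) (q : ℕ) [NeZero q] {u : ℝ} (hu0 : 0 ≤ u) (hu : p * u < 1) :
    Tendsto (fun S : Finset (FFPrime E) => ∏ P ∈ S, (1 - u ^ P.deg p)⁻¹)
      atTop (𝓝 ‖h.Lz (0 : Dv E →+ ZMod q) u‖) := by
  refine (h.Lz_euler_norm (0 : Dv E →+ ZMod q) hu0 hu).congr fun S => Finset.prod_congr rfl fun P _ => ?_
  rw [AddMonoidHom.zero_apply, AddChar.map_zero_eq_one, one_mul, norm_one_sub_pow hu0 (by linarith [lt_of_pu hu0 hu])]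

theorem no_growth {c K : ℝ} (hc : 0 < c) (hK : 0 < K) {q : ℕ} (hq : 2 ≤ q)
    (H : ∀ s : ℝ, 0 < s → s ≤ 1 / 2 → (c / s) ^ q ≤ K / s) : False := by
  set s := min (1 / 2) (c ^ q / (2 * K)) with hs
  have hs0 : 0 < s := lt_min (by norm_num) (by positivity)
  have h1 := H s hs0 (min_le_left _ _)
  rw [div_pow, div_le_div_iff₀ (by positivity) hs0] at h1
  have h2 : s ≤ c ^ q / (2 * K) := min_le_right _ _
  rw [le_div_iff₀ (by positivity)] at h2
  obtain ⟨k, rfl⟩ : ∃ k, q = k + 2 := ⟨q - 2, by omega⟩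
  have h3 : s ^ k ≤ 1 := pow_le_one₀ hs0.le (by linarith [min_le_left (1 / 2 : ℝ) (c ^ (k+2) / (2 * K))])
  have h4 : K * s ^ (k + 2) = K * s * s * s ^ k := by ring
  rw [h4] at h1
  have h5 : K * s * s * s ^ k ≤ K * s * s * 1 := mul_le_mul_of_nonneg_left h3 (by positivity)
  have h6 : 0 < K * s * s := by positivity
  nlinarith

section Y
variable {L M : Type} [Field L] [Field M] [Algebra (ZMod p) L] [Algebra (ZMod p) M] {q : ℕ} [hqF : Fact q.Prime]

theorem pre_setup {res : FFPrime M → FFPrime L} (fib : FFPrime L → Finset (FFPrime M)) (hfib : ∀ v w, w ∈ fib v ↔ res w = v)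
    (g : FFPrime M → ℝ) (l : ℝ) (h : Tendsto (fun S : Finset (FFPrime M) => ∏ w ∈ S, g w) atTop (𝓝 l)) :
    Tendsto (fun S : Finset (FFPrime L) => ∏ v ∈ S, ∏ w ∈ fib v, g w) atTop (𝓝 l) := by
  classical
  have h1 : Tendsto (fun S : Finset (FFPrime L) => S.biUnion fib) atTop atTop := by
    rw [tendsto_atTop]
    intro T
    filter_upwards [eventually_ge_atTop (T.image res)] with S hS
    intro w hw
    exact Finset.mem_biUnion.mpr ⟨res w, hS (Finset.mem_image_of_mem _ hw), (hfib _ _).mpr rfl⟩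
  refine (h.comp h1).congr fun S => ?_
  rw [Function.comp_apply, Finset.prod_biUnion]
  intro v _ v' _ hvv
  rw [Function.onFun, Finset.disjoint_left]
  intro w hw hw'
  rw [hfib] at hw hw'
  exact hvv (hw.symm.trans hw')

theorem thmY_ineq (hL : FunF p L) (hM : FunF p M) {res : FFPrime M → FFPrime L} (fib : FFPrime L → Finset (FFPrime M))
    (hfib : ∀ v w, w ∈ fib v ↔ res w = v) (Sp : Set (FFPrime L))
    (hsp : ∀ v ∈ Sp, (fib v).card = q ∧ ∀ w ∈ fib v, w.deg p = v.deg p)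
    (hin : ∀ v ∉ Sp, ∃ w0, fib v = {w0} ∧ 2 * v.deg p ≤ w0.deg p)
    (l1 l2 : Dv L →+ ZMod q) (h1 : ∀ v ∈ Sp, l1 (Finsupp.single v 1) = 0) (h2 : ∀ v ∈ Sp, l2 (Finsupp.single v 1) = 0)
    {u : ℝ} (hu0 : 0 ≤ u) (hu : p * u < 1) :
    ‖hM.Lz (0 : Dv M →+ ZMod q) u‖ ^ q ≤ ‖hL.Lz (0 : Dv L →+ ZMod q) (u ^ 2)‖ ^ q *
      ∏ ij : ZMod q × ZMod q, ‖hL.Lz (ij.1.val • l1 + ij.2.val • l2) u‖ := by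
  have hu2 := lt_of_pu hu0 hu
  have hu' : p * u ^ 2 < 1 := by nlinarith
  have hq := hqF.out
  have T1 := (pre_setup fib hfib _ _ (hM.Lz_euler0 q hu0 hu)).pow q
  have T2 := (hL.Lz_euler0 q (sq_nonneg u) hu').pow q
  have T3 := tendsto_finsetProd (Finset.univ : Finset (ZMod q × ZMod q)) fun ij _ =>
    hL.Lz_euler_norm (ij.1.val • l1 + ij.2.val • l2) hu0 hu
  refine le_of_tendsto_of_tendsto' T1 (T2.mul T3) fun S => ?_
  rw [Finset.prod_comm, ← Finset.prod_pow, ← Finset.prod_pow, ← Finset.prod_mul_distrib]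
  have pos : ∀ n, 0 < n → 0 < 1 - u ^ n := fun n hn => by
    linarith [pow_lt_one₀ hu0 (by linarith) hn.ne']
  refine Finset.prod_le_prod (fun v _ => pow_nonneg (Finset.prod_nonneg fun w _ => (inv_pos.mpr (pos _ (hM.deg_pos w))).le) _) fun v _ => ?_
  have hd := hL.deg_pos v
  have hA : 1 ≤ (1 - (u ^ 2) ^ v.deg p)⁻¹ := by
    rw [← pow_mul]
    exact (one_le_inv₀ (pos _ (by omega))).mpr (by linarith [pow_nonneg hu0 (2 * v.deg p)])
  by_cases hv : v ∈ Sp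
  · obtain ⟨hc, hdeg⟩ := hsp v hv
    rw [Finset.prod_congr rfl (g := fun _ => (1 - u ^ v.deg p)⁻¹) (fun w hw => by rw [hdeg w hw]), Finset.prod_const, hc]
    have h3 : ∀ ij : ZMod q × ZMod q, ‖1 - ZMod.stdAddChar ((ij.1.val • l1 + ij.2.val • l2) (Finsupp.single v 1)) * (u : ℂ) ^ v.deg p‖⁻¹
        = (1 - u ^ v.deg p)⁻¹ := fun ij => by
      rw [AddMonoidHom.add_apply, AddMonoidHom.nsmul_apply, AddMonoidHom.nsmul_apply, h1 v hv, h2 v hv, smul_zero, smul_zero, add_zero,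
        AddChar.map_zero_eq_one, one_mul, norm_one_sub_pow hu0 (by linarith)]
    rw [Finset.prod_congr rfl fun ij _ => h3 ij, Finset.prod_const, Finset.card_univ, Fintype.card_prod, ZMod.card, ← pow_mul]
    exact le_mul_of_one_le_left (pow_nonneg (inv_pos.mpr (pos _ hd)).le _) (one_le_pow₀ hA)
  · obtain ⟨w0, hw0, hdeg⟩ := hin v hv
    rw [hw0, Finset.prod_singleton]
    have h3 : 1 ≤ ∏ ij : ZMod q × ZMod q, ‖1 - ZMod.stdAddChar ((ij.1.val • l1 + ij.2.val • l2) (Finsupp.single v 1)) * (u : ℂ) ^ v.deg p‖⁻¹ := by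
      rw [Finset.prod_inv_distrib, ← norm_prod]
      have h4 := prod_char_le (l1 (Finsupp.single v 1)) (l2 (Finsupp.single v 1)) (pow_nonneg hu0 (v.deg p))
        (pow_lt_one₀ hu0 (by linarith) hd.ne')
      have h5 : ∏ ij : ZMod q × ZMod q, (1 - ZMod.stdAddChar ((ij.1.val • l1 + ij.2.val • l2) (Finsupp.single v 1)) * (u : ℂ) ^ v.deg p) =
          ∏ ij : ZMod q × ZMod q, (1 - ZMod.stdAddChar (ij.1 * l1 (Finsupp.single v 1) + ij.2 * l2 (Finsupp.single v 1)) * ((u ^ v.deg p : ℝ) : ℂ)) := by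
        refine Finset.prod_congr rfl fun ij _ => ?_
        rw [AddMonoidHom.add_apply, AddMonoidHom.nsmul_apply, AddMonoidHom.nsmul_apply, nsmul_eq_mul, nsmul_eq_mul,
          ZMod.natCast_zmod_val, ZMod.natCast_zmod_val]
        push_cast; rfl
      rw [h5]
      refine (one_le_inv₀ (norm_pos_iff.mpr (Finset.prod_ne_zero_iff.mpr fun ij _ => ?_))).mpr h4
      intro h0
      have h6 := congrArg norm (sub_eq_zero.mp h0)
      rw [norm_one, norm_mul, stdAddChar_norm, one_mul, Complex.norm_real, Real.norm_of_nonneg (pow_nonneg hu0 _)] at h6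
      linarith [pos _ hd]
    refine le_trans ?_ (le_mul_of_one_le_right (by positivity) h3)
    refine pow_le_pow_left₀ (inv_pos.mpr (pos _ (hM.deg_pos w0))).le ?_ _
    rw [← pow_mul]
    refine inv_anti₀ (pos _ (by omega)) ?_
    linarith [pow_le_pow_of_le_one hu0 (by linarith : u ≤ 1) hdeg]

theorem thmY (hL : FunF p L) (hM : FunF p M) {res : FFPrime M → FFPrime L} (fib : FFPrime L → Finset (FFPrime M))
    (hfib : ∀ v w, w ∈ fib v ↔ res w = v) (Sp : Set (FFPrime L))
    (hsp : ∀ v ∈ Sp, (fib v).card = q ∧ ∀ w ∈ fib v, w.deg p = v.deg p)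
    (hin : ∀ v ∉ Sp, ∃ w0, fib v = {w0} ∧ 2 * v.deg p ≤ w0.deg p) :
    ∃ P0, P0 ∉ Sp ∧ ∀ l : Dv L →+ ZMod q, (∀ f, l (hL.div f) = 0) → (∀ v ∈ Sp, l (Finsupp.single v 1) = 0) →
      l (Finsupp.single P0 1) = 0 → l = 0 := by
  have hq := hqF.out
  have hp0 : (0:ℝ) < p := by exact_mod_cast (Fact.out : p.Prime).pos
  have hp2 : (2:ℝ) ≤ p := by exact_mod_cast (Fact.out : p.Prime).two_le
  by_cases hex : ∃ l1 : Dv L →+ ZMod q, (∀ f, l1 (hL.div f) = 0) ∧ (∀ v ∈ Sp, l1 (Finsupp.single v 1) = 0) ∧ l1 ≠ 0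
  · obtain ⟨l1, hd1, hs1, hne⟩ := hex
    have hP1 : ∃ P, l1 (Finsupp.single P 1) ≠ 0 := by
      by_contra hcon; push Not at hcon
      apply hne; ext P; simpa using hcon P
    obtain ⟨P1, hP1⟩ := hP1
    refine ⟨P1, fun h => hP1 (hs1 P1 h), fun l2 hd2 hs2 hP2 => ?_⟩
    by_contra hne2
    have hQ : ∃ P, l2 (Finsupp.single P 1) ≠ 0 := by
      by_contra hcon; push Not at hcon
      apply hne2; ext P; simpa using hcon P
    obtain ⟨Q, hQ⟩ := hQ
    set l : ZMod q × ZMod q → (Dv L →+ ZMod q) := fun ij => ij.1.val • l1 + ij.2.val • l2 with hl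
    have hld : ∀ ij f, l ij (hL.div f) = 0 := fun ij f => by
      simp [hl, hd1, hd2]
    have hlP : ∀ ij P, l ij (Finsupp.single P 1) = ij.1 * l1 (Finsupp.single P 1) + ij.2 * l2 (Finsupp.single P 1) := fun ij P => by
      rw [hl, AddMonoidHom.add_apply, AddMonoidHom.nsmul_apply, AddMonoidHom.nsmul_apply, nsmul_eq_mul, nsmul_eq_mul,
          ZMod.natCast_zmod_val, ZMod.natCast_zmod_val]
    have hC : ∀ ij, ∃ C, 0 < C ∧ ∀ u : ℝ, 0 ≤ u → p * u < 1 → ‖hL.Lz (l ij) u‖ ≤ C * (if ij = 0 then (1 - p * u)⁻¹ else 1) := by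
      intro ij
      by_cases h0 : ij = 0
      · simp only [h0, if_true]
        exact hL.Lz_bound (l 0) (hld 0)
      · simp only [h0, if_false, mul_one]
        by_cases hi : ij.1 = 0
        · have hj : ij.2 ≠ 0 := fun hj => h0 (Prod.ext hi hj)
          refine hL.Lz_bdd (l ij) (hld ij) (P := Q) ?_
          rw [hlP, hi, zero_mul, zero_add]; exact mul_ne_zero hj hQ
        · refine hL.Lz_bdd (l ij) (hld ij) (P := P1) ?_
          rw [hlP, hP2, mul_zero, add_zero]; exact mul_ne_zero hi hP1
    choose C hC0 hC using hC
    obtain ⟨c, hc, hlow⟩ := hM.Lz_lower (q := q)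
    obtain ⟨C1, hC1, hup⟩ := hL.Lz_bound (0 : Dv L →+ ZMod q) (by simp)
    have hPC : 0 < ∏ ij, C ij := Finset.prod_pos fun ij _ => hC0 ij
    refine no_growth hc (K := (C1 * 2) ^ q * ∏ ij, C ij) (by positivity) hq.two_le fun s hs0 hsh => ?_
    set u := (1 - s) / p with hu
    have hpu : p * u = 1 - s := by rw [hu]; field_simp
    have hu0 : 0 ≤ u := by rw [hu]; apply div_nonneg <;> linarith
    have hu1 : p * u < 1 := by linarith
    have hul : 1 / (2 * p) ≤ u := by
      rw [hu, div_le_div_iff₀ (by positivity) hp0]; nlinarith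
    have e1 := hlow u hul hu1
    have hs' : 1 - p * u = s := by linarith
    rw [hs'] at e1
    have e2 := thmY_ineq hL hM fib hfib Sp hsp hin l1 l2 hs1 hs2 hu0 hu1
    have hu2 := lt_of_pu hu0 hu1
    have e3 : ‖hL.Lz (0 : Dv L →+ ZMod q) (u ^ 2)‖ ≤ C1 * 2 := by
      have hpu2 : p * u ^ 2 ≤ 1 / 2 := by nlinarith
      refine (hup (u ^ 2) (sq_nonneg u) (by linarith)).trans ?_
      rw [div_le_iff₀ (by linarith)]; nlinarith
    have e4 : ∏ ij : ZMod q × ZMod q, ‖hL.Lz (l ij) u‖ ≤ (∏ ij, C ij) * s⁻¹ := by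
      refine (Finset.prod_le_prod (fun _ _ => norm_nonneg _) fun ij _ => hC ij u hu0 hu1).trans ?_
      rw [Finset.prod_mul_distrib, Finset.prod_ite_eq' Finset.univ (0 : ZMod q × ZMod q), if_pos (Finset.mem_univ _), hs']
    calc (c / s) ^ q ≤ _ := pow_le_pow_left₀ (by positivity) e1 q
      _ ≤ _ := e2
      _ ≤ (C1 * 2) ^ q * ((∏ ij, C ij) * s⁻¹) :=
        mul_le_mul (pow_le_pow_left₀ (norm_nonneg _) e3 q) e4 (Finset.prod_nonneg fun _ _ => norm_nonneg _) (by positivity)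
      _ = _ := by rw [div_eq_mul_inv, mul_assoc]
  · have hin' : ∃ P0, P0 ∉ Sp := by
      by_contra hcon; push Not at hcon
      obtain ⟨c, hc, hlow⟩ := hL.Lz_lower (q := q)
      obtain ⟨C1, hC1, hup⟩ := hM.Lz_bound (0 : Dv M →+ ZMod q) (by simp)
      refine no_growth hc hC1 hq.two_le fun s hs0 hsh => ?_
      set u := (1 - s) / p with hu
      have hpu : p * u = 1 - s := by rw [hu]; field_simp
      have hu0 : 0 ≤ u := by rw [hu]; apply div_nonneg <;> linarith
      have hu1 : p * u < 1 := by linarith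
      have hul : 1 / (2 * p) ≤ u := by
        rw [hu, div_le_div_iff₀ (by positivity) hp0]; nlinarith
      have e1 := hlow u hul hu1
      have e2 := hup u hu0 hu1
      have hs' : 1 - p * u = s := by linarith
      rw [hs'] at e1 e2
      have T1 := pre_setup fib hfib _ _ (hM.Lz_euler0 q hu0 hu1)
      have T2 := (hL.Lz_euler0 q hu0 hu1).pow q
      have : ‖hM.Lz (0 : Dv M →+ ZMod q) u‖ = ‖hL.Lz (0 : Dv L →+ ZMod q) u‖ ^ q := by
        refine tendsto_nhds_unique T1 (T2.congr fun S => ?_)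
        rw [← Finset.prod_pow]
        refine Finset.prod_congr rfl fun v _ => ?_
        obtain ⟨hc, hdeg⟩ := hsp v (hcon v)
        rw [Finset.prod_congr rfl (g := fun _ => (1 - u ^ v.deg p)⁻¹) (fun w hw => by rw [hdeg w hw]), Finset.prod_const, hc]
      rw [this] at e2
      exact (pow_le_pow_left₀ (by positivity) e1 q).trans e2
    obtain ⟨P0, hP0⟩ := hin'
    refine ⟨P0, hP0, fun l h1 h2 _ => ?_⟩
    by_contra hne
    exact hex ⟨l, h1, h2, hne⟩
end Y
end

section
open Polynomial

variable {p : ℕ} [Fact p.Prime] {L M : Type} [Field L] [Field M] [Algebra (ZMod p) L] [Algebra (ZMod p) M] [Algebra L M]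

theorem Va.exists_iota {K K' : Type} [Field K] [Field K'] {Γ Γ' : Type} [AddCommGroup Γ] [LinearOrder Γ] [IsOrderedAddMonoid Γ]
    [AddCommGroup Γ'] [LinearOrder Γ'] [IsOrderedAddMonoid Γ'] (V : Va K Γ) (W : Va K' Γ') (φ : K →+* K')
    (h0 : ∀ x, V.ge 0 x → W.ge 0 (φ x)) (h1 : ∀ x, V.gt 0 x → W.gt 0 (φ x)) :
    ∃ ι : V.kap →+* W.kap, ∀ x, V.ge 0 x → ι (V.res x) = W.res (φ x) := by
  let f : V.O →+* W.O := (φ.comp V.O.subtype).codRestrict W.O.toSubring fun x => h0 x x.2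
  let ι : V.kap →+* W.kap := Ideal.Quotient.lift (IsLocalRing.maximalIdeal V.O) ((IsLocalRing.residue W.O).comp f) fun x hx => by
    rw [Va.mem_max] at hx
    rw [RingHom.comp_apply, Va.residue_eq_zero]
    exact h1 _ hx
  refine ⟨ι, fun x hx => ?_⟩
  rw [Va.res_of hx, Va.res_of (h0 x hx)]
  rfl

/-- `w` lies over `v` -/
def Over (w : FFPrime M) (v : FFPrime L) (e : ℤ) : Prop := 0 < e ∧ ∀ x : L, x ≠ 0 → w.va.v (algebraMap L M x) = e * v.va.v x

theorem Over.ge {w : FFPrime M} {v : FFPrime L} {e : ℤ} (h : Over w v e) {n : ℤ} {x : L} (hx : v.va.ge n x) :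
    w.va.ge (e * n) (algebraMap L M x) := by
  by_cases h0 : x = 0
  · left; rw [h0, map_zero]
  · right; rw [h.2 x h0]; exact mul_le_mul_of_nonneg_left (hx.le h0) h.1.le

theorem Over.ge0 {w : FFPrime M} {v : FFPrime L} {e : ℤ} (h : Over w v e) {x : L} (hx : v.va.ge 0 x) :
    w.va.ge 0 (algebraMap L M x) := by simpa using h.ge hx

theorem Over.gt0 {w : FFPrime M} {v : FFPrime L} {e : ℤ} (h : Over w v e) {x : L} (hx : v.va.gt 0 x) :
    w.va.gt 0 (algebraMap L M x) := by
  by_cases h0 : x = 0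
  · left; rw [h0, map_zero]
  · right; rw [h.2 x h0]; exact mul_pos h.1 (hx.lt h0)

theorem Over.eq {w : FFPrime M} {v v' : FFPrime L} {e e' : ℤ} (h : Over w v e) (h' : Over w v' e') : v = v' := by
  refine FFPrime.eq_of_le fun x hx0 hx => ?_
  have h1 := h.2 x hx0
  rw [h'.2 x hx0] at h1
  have h2 : 0 ≤ e' * v'.va.v x := h1 ▸ mul_nonneg h.1.le hx
  exact nonneg_of_mul_nonneg_right h2 h'.1

theorem FFPrime.exists_min {q : ℕ} (v : FFPrime L) (x : Fin q → L) (hx : ∃ i, x i ≠ 0) :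
    ∃ m : ℤ, (∀ i, v.va.ge m (x i)) ∧ ∃ i, x i ≠ 0 ∧ v.va.v (x i) = m := by
  classical
  obtain ⟨i0, hi0⟩ := hx
  obtain ⟨i, hi, hmin⟩ := Finset.exists_min_image (Finset.univ.filter fun i => x i ≠ 0) (fun i => v.va.v (x i)) ⟨i0, by simp [hi0]⟩
  refine ⟨v.va.v (x i), fun j => ?_, i, (Finset.mem_filter.mp hi).2, rfl⟩
  by_cases hj : x j = 0
  · exact Or.inl hj
  · exact Or.inr (hmin j (by simp [hj]))

theorem caseA_unit {q : ℕ} (hq : q.Prime) {w : FFPrime M} {v : FFPrime L} {e : ℤ} (h : Over w v e) {a : L} {α : M}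
    (ha : v.va.ge 0 a) (hαq : α ^ q = algebraMap L M a) (hα : w.va.ge 0 α)
    (hna : ∀ y : v.va.kap, y ^ q ≠ v.va.res a) (x : Fin q → L) (hx : ∀ i, v.va.ge 0 (x i)) (hx1 : ∃ i, x i ≠ 0 ∧ v.va.v (x i) = 0) :
    (∑ i, algebraMap L M (x i) * α ^ (i : ℕ)) ≠ 0 ∧ w.va.v (∑ i, algebraMap L M (x i) * α ^ (i : ℕ)) = 0 := by
  set z := ∑ i, algebraMap L M (x i) * α ^ (i : ℕ) with hz
  obtain ⟨ι, hι⟩ := v.va.exists_iota w.va (algebraMap L M) (fun x hx => h.ge0 hx) (fun x hx => h.gt0 hx)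
  have hzge : w.va.ge 0 z := Va.ge.sum fun i _ => (h.ge0 (hx i)).mul0 (hα.pow _)
  by_cases hgt : w.va.gt 0 z
  · exfalso
    set g : (v.va.kap)[X] := ∑ i : Fin q, C (v.va.res (x i)) * X ^ (i : ℕ) with hg
    have hirr : Irreducible (X ^ q - C (v.va.res a)) := X_pow_sub_C_irreducible_of_prime hq hna
    have hg0 : g ≠ 0 := by
      obtain ⟨i, hi0, hi⟩ := hx1
      intro h0
      have h1 : g.coeff i = v.va.res (x i) := by
        rw [hg, finsetSum_coeff, Finset.sum_eq_single i]
        · simp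
        · intro j _ hj
          rw [coeff_C_mul_X_pow, if_neg]
          intro h; exact hj (Fin.ext h.symm)
        · simp
      rw [h0, coeff_zero] at h1
      have := (Va.res_eq_zero (hx i)).mp h1.symm
      exact absurd (this.lt hi0) (by rw [hi]; exact lt_irrefl _)
    have hdeg : g.natDegree < q := by
      refine lt_of_le_of_lt (natDegree_sum_le_of_forall_le (n := q - 1) _ _ fun i _ => ?_) (Nat.sub_lt hq.pos one_pos)
      refine (natDegree_C_mul_X_pow_le _ _).trans ?_
      have := i.2; omega
    have hcop : IsCoprime (X ^ q - C (v.va.res a)) g := by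
      refine (hirr.coprime_iff_not_dvd).mpr fun hd => ?_
      have := natDegree_le_of_dvd hd hg0
      rw [natDegree_X_pow_sub_C] at this
      omega
    obtain ⟨A, B, hAB⟩ := hcop
    have h1 := congrArg (eval₂ ι (w.va.res α)) hAB
    rw [eval₂_add, eval₂_mul, eval₂_mul, eval₂_sub, eval₂_X_pow, eval₂_C, eval₂_one, hι a ha, ← hαq, Va.res_pow hα, sub_self, mul_zero,
      zero_add] at h1
    have h2 : eval₂ ι (w.va.res α) g = w.va.res z := by
      rw [hz, Va.res_sum fun i _ => (h.ge0 (hx i)).mul0 (hα.pow _), hg, eval₂_finsetSum]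
      refine Finset.sum_congr rfl fun i _ => ?_
      rw [eval₂_mul, eval₂_C, eval₂_X_pow, Va.res_mul (h.ge0 (hx i)) (hα.pow _), Va.res_pow hα, hι _ (hx i)]
    rw [h2, (Va.res_eq_zero hzge).mpr hgt, mul_zero] at h1
    exact zero_ne_one h1
  · have hz0 : z ≠ 0 := fun h0 => hgt (Or.inl h0)
    refine ⟨hz0, le_antisymm ?_ (hzge.le hz0)⟩
    by_contra hlt
    exact hgt (Or.inr (not_le.mp hlt))

theorem caseA {q : ℕ} (hq : q.Prime) {w : FFPrime M} {v : FFPrime L} {e : ℤ} (h : Over w v e) {a : L} {α : M}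
    (ha : v.va.ge 0 a) (hαq : α ^ q = algebraMap L M a) (hα : w.va.ge 0 α)
    (hna : ∀ y : v.va.kap, y ^ q ≠ v.va.res a) (x : Fin q → L) {m : ℤ} (hx : ∀ i, v.va.ge m (x i)) (hx1 : ∃ i, x i ≠ 0 ∧ v.va.v (x i) = m) :
    w.va.v (∑ i, algebraMap L M (x i) * α ^ (i : ℕ)) = e * m := by
  obtain ⟨π, hπ0, hπ⟩ := v.exists_v m
  have hπi : v.va.ge (-m) π⁻¹ := Or.inr (by rw [v.va.inv hπ0, hπ])
  have h1 := caseA_unit hq h ha hαq hα hna (fun i => π⁻¹ * x i) (fun i => by simpa using hπi.mul (hx i)) (by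
    obtain ⟨i, hi0, hi⟩ := hx1
    exact ⟨i, mul_ne_zero (inv_ne_zero hπ0) hi0, by rw [v.va.mul (inv_ne_zero hπ0) hi0, v.va.inv hπ0, hπ, hi]; ring⟩)
  have h2 : ∑ i, algebraMap L M (x i) * α ^ (i : ℕ) = algebraMap L M π * ∑ i, algebraMap L M (π⁻¹ * x i) * α ^ (i : ℕ) := by
    rw [Finset.mul_sum]
    refine Finset.sum_congr rfl fun i _ => ?_
    rw [← mul_assoc, ← map_mul, mul_inv_cancel_left₀ hπ0]
  rw [h2, w.va.mul ((_root_.map_ne_zero _).mpr hπ0) h1.1, h1.2, h.2 π hπ0, hπ, add_zero]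

theorem caseB {q : ℕ} (hq : q.Prime) (hqp : (q : ZMod p) ≠ 0) {w : FFPrime M} {v : FFPrime L} {e : ℤ} (h : Over w v e) {a : L} {α : M}
    (hαq : α ^ q = algebraMap L M a) (hα : w.va.gt 0 (α - 1)) (x : Fin q → L)
    (hz0 : (∑ i, algebraMap L M (x i) * α ^ (i : ℕ)) ≠ 0) :
    ∃ n0 : ℕ, ∀ n : ℕ, n0 ≤ n → ∀ s : L, v.va.ge 1 (s - 1) → v.va.ge n (s ^ q - a) →
      (∑ i, x i * s ^ (i : ℕ)) ≠ 0 ∧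
      w.va.v (∑ i, algebraMap L M (x i) * α ^ (i : ℕ)) = e * v.va.v (∑ i, x i * s ^ (i : ℕ)) ∧
      w.va.gt (w.va.v (∑ i, algebraMap L M (x i) * α ^ (i : ℕ))) ((∑ i, algebraMap L M (x i) * α ^ (i : ℕ)) - algebraMap L M (∑ i, x i * s ^ (i : ℕ))) := by
  set z := ∑ i, algebraMap L M (x i) * α ^ (i : ℕ) with hz
  have hxne : ∃ i, x i ≠ 0 := by
    by_contra hcon; push Not at hcon
    apply hz0; rw [hz]; simp [hcon]
  obtain ⟨m, hm, -⟩ := v.exists_min x hxne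
  refine ⟨(w.va.v z - e * m + 1).toNat, fun n hn s hs hsa => ?_⟩
  set s' := algebraMap L M s with hs'
  have hα0 : w.va.ge 0 α := by simpa using hα.ge.add Va.ge_one
  have hs1 : w.va.gt 0 (s' - 1) := by
    rw [hs', ← map_one (algebraMap L M), ← map_sub]; exact h.gt0 (hs.gt one_pos)
  have hs0 : w.va.ge 0 s' := by simpa using hs1.ge.add Va.ge_one
  have hdvd : ∀ n : ℕ, ∃ c, w.va.ge 0 c ∧ α ^ n - s' ^ n = c * (α - s') := fun n =>
    ⟨_, Va.ge.sum fun i _ => (hα0.pow _).mul0 (hs0.pow _), (Commute.geom_sum₂_mul (Commute.all α s') n).symm⟩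
  have hgeom : ∀ x : M, w.va.gt 0 (x - 1) → ∀ k, w.va.gt 0 (x ^ k - 1) := fun x hx k => by
    have hx0 : w.va.ge 0 x := by simpa using hx.ge.add Va.ge_one
    have := (Va.ge.sum (V := w.va) (n := 0) (s := Finset.range k) (f := fun i => x ^ i) fun i _ => hx0.pow _).gt_mul hx
    rwa [geom_sum_mul] at this
  -- the geometric sum is a unit
  set G := ∑ i ∈ Finset.range q, α ^ i * s' ^ (q - 1 - i) with hG
  have hGM : G * (α - s') = α ^ q - s' ^ q := Commute.geom_sum₂_mul (Commute.all α s') q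
  have hGq : w.va.gt 0 (G - q) := by
    have : G - q = ∑ i ∈ Finset.range q, ((α ^ i - 1) * s' ^ (q - 1 - i) + (s' ^ (q - 1 - i) - 1)) := by
      rw [hG]
      have h1 : (q : M) = ∑ i ∈ Finset.range q, (1 : M) := by simp
      rw [h1, ← Finset.sum_sub_distrib]
      refine Finset.sum_congr rfl fun i _ => by ring
    rw [this]
    refine Va.gt.sum fun i _ => Va.gt.add ?_ (hgeom _ hs1 _)
    rw [mul_comm]; exact (hs0.pow _).gt_mul (hgeom _ hα _)
  have hqM : (q : M) = algebraMap (ZMod p) M (q : ZMod p) := by simp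
  have hq0 : (q : M) ≠ 0 := by rw [hqM]; exact (_root_.map_ne_zero _).mpr hqp
  have hqv : w.va.v (q : M) = 0 := by rw [hqM]; exact w.va.v_const hqp
  have hGv := Va.v_eq_of_sub (V := w.va) hq0 (y := G) (by rw [hqv]; exact hGq)
  rw [hqv] at hGv
  have hαs : w.va.ge (e * n) (α - s') := by
    by_cases h0 : α - s' = 0
    · exact Or.inl h0
    right
    have h1 : w.va.v (G * (α - s')) = w.va.v (α - s') := by rw [w.va.mul hGv.1 h0, hGv.2, zero_add]
    rw [← h1]
    refine Va.ge.le (n := e * n) ?_ (mul_ne_zero hGv.1 h0)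
    rw [hGM, hαq, hs', ← map_pow, ← map_sub, ← neg_sub, map_neg]
    exact (h.ge hsa).neg
  have hdiff : w.va.gt (w.va.v z) (z - algebraMap L M (∑ i, x i * s ^ (i : ℕ))) := by
    have h1 : z - algebraMap L M (∑ i, x i * s ^ (i : ℕ)) = ∑ i, algebraMap L M (x i) * (α ^ (i : ℕ) - s' ^ (i : ℕ)) := by
      rw [hz, map_sum, ← Finset.sum_sub_distrib]
      refine Finset.sum_congr rfl fun i _ => ?_
      rw [map_mul, map_pow, mul_sub]
    rw [h1]
    refine Va.gt.sum fun i _ => ?_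
    obtain ⟨c, hc, hce⟩ := hdvd i
    rw [hce]
    have h2 : w.va.ge (e * m + e * n) (algebraMap L M (x i) * (c * (α - s'))) := (h.ge (hm i)).mul (hc.mul0 hαs)
    refine h2.gt ?_
    have h3 : w.va.v z - e * m + 1 ≤ n := by omega
    have h4 : (n : ℤ) ≤ e * n := le_mul_of_one_le_left (by positivity) h.1
    linarith
  have h5 := Va.v_eq_of_sub (V := w.va) hz0 (y := algebraMap L M (∑ i, x i * s ^ (i : ℕ))) (by
    rw [← neg_sub]; exact hdiff.neg)
  have h6 : (∑ i, x i * s ^ (i : ℕ)) ≠ 0 := fun h0 => h5.1 (by rw [h0, map_zero])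
  exact ⟨h6, by rw [← h5.2, h.2 _ h6], hdiff⟩

theorem Va.ge_of_integral {R : Type} [CommRing R] {K : Type} [Field K] {Γ : Type} [AddCommGroup Γ] [LinearOrder Γ] [IsOrderedAddMonoid Γ]
    (V : Va K Γ) (ψ : R →+* K) (hψ : ∀ x, V.ge 0 (ψ x)) {z : K} (hz : ψ.IsIntegralElem z) : V.ge 0 z := by
  obtain ⟨f, hf, hfz⟩ := hz
  let ψ' : R →+* V.O := ψ.codRestrict V.O.toSubring hψ
  have h1 : IsIntegral V.O z := by
    refine ⟨f.map ψ', hf.map _, ?_⟩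
    rw [eval₂_map]
    exact hfz
  obtain ⟨y, hy⟩ := (IsIntegrallyClosed.isIntegral_iff (R := V.O) (K := K)).mp h1
  rw [← hy]
  exact y.2

/-- an integer-valued valuation seen as a rational-valued one -/
def Va.rat {K : Type} [Field K] (V : Va K ℤ) : Va K ℚ where
  v x := (V.v x : ℚ)
  mul' x y hx hy := by rw [V.mul hx hy]; push_cast; rfl
  add' x y hx hy hxy := by
    have := V.add' x y hx hy hxy
    rw [← Int.cast_min]; exact_mod_cast this

theorem exists_over (hL : FunF p L) [Algebra.IsAlgebraic L M] (w : FFPrime M) : ∃ v : FFPrime L, ∃ e, Over w v e := by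
  by_cases htriv : ∃ x : L, x ≠ 0 ∧ w.va.v (algebraMap L M x) ≠ 0
  · obtain ⟨x, hx0, hx⟩ := htriv
    obtain ⟨v, c, hc, hv⟩ := exists_prime hL ((w.va.comap (algebraMap L M)).rat) hx0 (by
      change ((w.va.v (algebraMap L M x) : ℤ) : ℚ) ≠ 0
      exact_mod_cast hx)
    replace hv : ∀ x : L, x ≠ 0 → ((w.va.v (algebraMap L M x) : ℤ) : ℚ) = c * v.va.v x := hv
    obtain ⟨y, hy0, hy⟩ := v.exists_v 1
    have h1 : ((w.va.v (algebraMap L M y) : ℤ) : ℚ) = c := by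
      have := hv y hy0
      rw [hy] at this
      simpa using this
    refine ⟨v, w.va.v (algebraMap L M y), by exact_mod_cast (h1 ▸ hc), fun x hx => ?_⟩
    have := hv x hx
    rw [← h1] at this
    exact_mod_cast this
  · exfalso
    push Not at htriv
    obtain ⟨z, hz0, hz⟩ := w.exists_v (-1)
    have := w.va.ge_of_integral (algebraMap L M) (fun x => by
      by_cases h0 : x = 0
      · left; rw [h0, map_zero]
      · right; rw [htriv x h0]) (Algebra.IsIntegral.isIntegral (R := L) z)
    have := this.le hz0
    omega

theorem exists_above (hL : FunF p L) (hM : FunF p M) [Algebra.IsAlgebraic L M] (v : FFPrime L) : ∃ w : FFPrime M, ∃ e, Over w v e := by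
  let ψ : v.va.O →+* M := (algebraMap L M).comp v.va.O.subtype
  letI : Algebra v.va.O M := ψ.toAlgebra
  let A : Subring M := (integralClosure v.va.O M).toSubring
  have hAψ : ∀ x, v.va.ge 0 x → algebraMap L M x ∈ A := fun x hx => (isIntegral_algebraMap (R := v.va.O) (A := M) (x := ⟨x, hx⟩))
  obtain ⟨π, hπ0, hπ⟩ := v.exists_v 1
  have hπA : algebraMap L M π ∈ A := hAψ π (Or.inr (by rw [hπ]; exact zero_le_one))
  have hφ0 : ∀ x : L, x ≠ 0 → algebraMap L M x ≠ 0 := fun x hx => (_root_.map_ne_zero _).mpr hx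
  let z : A := ⟨_, hπA⟩
  obtain ⟨W, hW1, hWA, -⟩ := exists_va hM.td (A := A) (Ideal.span {z}) (by
    rw [Ne, Ideal.span_singleton_eq_top]
    intro hu
    obtain ⟨y, hy⟩ := hu.exists_right_inv
    have hy1 : algebraMap L M π * (y : M) = 1 := congrArg Subtype.val hy
    have hy2 : (y : M) = algebraMap L M π⁻¹ := by
      rw [map_inv₀]; exact eq_inv_of_mul_eq_one_right hy1
    have hIntg : IsIntegral v.va.O (y : M) := y.2
    obtain ⟨f, hf, hfz⟩ := hIntg
    rw [hy2] at hfz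
    have hfz' : eval₂ ((algebraMap L M).comp v.va.O.subtype) (algebraMap L M π⁻¹) f = 0 := hfz
    rw [← hom_eval₂, map_eq_zero] at hfz'
    have := v.va.ge_of_integral v.va.O.subtype (fun x => x.2) ⟨f, hf, hfz'⟩
    have := this.le (inv_ne_zero hπ0)
    rw [v.va.inv hπ0, hπ] at this
    omega) z (Ideal.mem_span_singleton_self z) (hφ0 π hπ0)
  obtain ⟨w, c, hc, hw⟩ := exists_prime hM W (hφ0 π hπ0) (by
    have : W.v (algebraMap L M π) = 1 := hW1
    rw [this]; exact one_ne_zero)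
  obtain ⟨v', e, hv'⟩ := exists_over hL w
  have : v = v' := by
    refine FFPrime.eq_of_le fun x hx0 hx => ?_
    have h1 := (hWA _ (hAψ x (Or.inr hx))).le (hφ0 x hx0)
    rw [hw _ (hφ0 x hx0), hv'.2 x hx0] at h1
    have h2 := nonneg_of_mul_nonneg_right h1 hc
    have h3 : (0:ℤ) ≤ e * v'.va.v x := by exact_mod_cast h2
    exact nonneg_of_mul_nonneg_right h3 hv'.1
  exact ⟨w, e, this ▸ hv'⟩
end

section
open Polynomial

/-- Kummer extension data -/
structure Kum (p q : ℕ) [Fact p.Prime] (L M : Type) [Field L] [Field M] [Algebra (ZMod p) L] [Algebra (ZMod p) M] [Algebra L M] where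
  hL : FunF p L
  hM : FunF p M
  hq : q.Prime
  hqp : (q : ZMod p) ≠ 0
  alg : Algebra.IsAlgebraic L M
  ζ : L
  hζ : IsPrimitiveRoot ζ q
  a : L
  ha0 : a ≠ 0
  hav : ∀ v : FFPrime L, (q : ℤ) ∣ v.va.v a
  α : M
  hα : α ^ q = algebraMap L M a
  gen : ∀ z : M, ∃ x : Fin q → L, z = ∑ i, algebraMap L M (x i) * α ^ (i : ℕ)
  σ : M ≃ₐ[L] M
  hσ : σ α = algebraMap L M ζ * α

variable {p q : ℕ} [Fact p.Prime] {L M : Type} [Field L] [Field M] [Algebra (ZMod p) L] [Algebra (ZMod p) M] [Algebra L M]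

/-- conjugate place -/
def pl (τ : M ≃ₐ[L] M) (w : FFPrime M) : FFPrime M := FFPrime.ofVa (w.va.comap τ.toAlgHom.toRingHom) (by
  obtain ⟨x, hx0, hx⟩ := w.exists_v 1
  refine ⟨τ.symm x, by simpa using hx0, ?_⟩
  change w.va.v (τ (τ.symm x)) = 1
  rw [τ.apply_symm_apply, hx])

theorem pl_v (τ : M ≃ₐ[L] M) (w : FFPrime M) {z : M} (hz : z ≠ 0) : (pl τ w).va.v z = w.va.v (τ z) := by
  unfold pl; rw [FFPrime.ofVa_v _ _ hz]; rfl

theorem pl_mul (τ τ' : M ≃ₐ[L] M) (w : FFPrime M) : pl (τ * τ') w = pl τ' (pl τ w) := by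
  refine FFPrime.ext_va fun z hz => ?_
  rw [pl_v _ _ hz, pl_v _ _ hz, pl_v _ _ (by simpa using hz)]; rfl

theorem pl_one (w : FFPrime M) : pl (1 : M ≃ₐ[L] M) w = w := by
  refine FFPrime.ext_va fun z hz => ?_
  rw [pl_v _ _ hz]; rfl

theorem pl_over {τ : M ≃ₐ[L] M} {w : FFPrime M} {v : FFPrime L} {e : ℤ} (h : Over w v e) : Over (pl τ w) v e := by
  refine ⟨h.1, fun x hx => ?_⟩
  rw [pl_v _ _ ((_root_.map_ne_zero _).mpr hx), AlgEquiv.commutes, h.2 x hx]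

theorem pl_gt {τ : M ≃ₐ[L] M} {w : FFPrime M} {n : ℤ} {z : M} : (pl τ w).va.gt n z ↔ w.va.gt n (τ z) := by
  by_cases hz : z = 0
  · subst hz
    simp only [map_zero]
    exact ⟨fun _ => Or.inl rfl, fun _ => Or.inl rfl⟩
  · have h1 : τ z ≠ 0 := by simpa using hz
    unfold Va.gt
    rw [pl_v _ _ hz]
    simp [hz]

theorem Over.uniq {w : FFPrime M} {v : FFPrime L} {e e' : ℤ} (h : Over w v e) (h' : Over w v e') : e = e' := by
  obtain ⟨x, hx0, hx⟩ := v.exists_v 1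
  have h1 := h.2 x hx0
  rw [h'.2 x hx0, hx] at h1
  linarith

namespace Kum
variable (K : Kum p q L M)

/-- rescaling of the Kummer generator -/
def scale (β : L) (hβ : β ≠ 0) : Kum p q L M where
  hL := K.hL
  hM := K.hM
  hq := K.hq
  hqp := K.hqp
  alg := K.alg
  ζ := K.ζ
  hζ := K.hζ
  a := K.a * β ^ q
  ha0 := mul_ne_zero K.ha0 (pow_ne_zero _ hβ)
  hav v := by
    rw [v.va.mul K.ha0 (pow_ne_zero _ hβ), v.va.pow hβ, nsmul_eq_mul]
    exact dvd_add (K.hav v) (dvd_mul_right _ _)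
  α := K.α * algebraMap L M β
  hα := by rw [mul_pow, K.hα, map_mul, map_pow]
  gen z := by
    obtain ⟨x, hx⟩ := K.gen z
    refine ⟨fun i => x i * β⁻¹ ^ (i : ℕ), hx.trans (Finset.sum_congr rfl fun i _ => ?_)⟩
    have : algebraMap L M β ≠ 0 := (_root_.map_ne_zero _).mpr hβ
    rw [map_mul, map_pow, map_inv₀, mul_pow]
    rw [inv_pow]
    field_simp
  σ := K.σ
  hσ := by rw [map_mul, K.hσ, AlgEquiv.commutes, mul_assoc]

theorem σ_pow (k : ℕ) : (K.σ ^ k) K.α = algebraMap L M (K.ζ ^ k) * K.α := by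
  induction k with
  | zero => simp
  | succ k ih => rw [pow_succ, AlgEquiv.mul_apply, K.hσ, map_mul, AlgEquiv.commutes, ih, ← mul_assoc, ← map_mul, pow_succ, mul_comm K.ζ]

theorem σ_q : K.σ ^ q = 1 := by
  ext z
  obtain ⟨x, rfl⟩ := K.gen z
  rw [map_sum, map_sum]
  refine Finset.sum_congr rfl fun i _ => ?_
  rw [map_mul, map_pow, AlgEquiv.commutes, K.σ_pow, K.hζ.pow_eq_one]
  simp

theorem α_ne : K.α ≠ 0 := by
  intro h
  have := K.hα
  rw [h, zero_pow K.hq.ne_zero] at this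
  exact K.ha0 ((map_eq_zero _).mp this.symm)

theorem fixed {z : M} (hz : K.σ z = z) : ∃ x : L, z = algebraMap L M x := by
  obtain ⟨x, hx⟩ := K.gen z
  have hzk : ∀ k, (K.σ ^ k) z = z := fun k => by
    induction k with
    | zero => simp
    | succ k ih => rw [pow_succ, AlgEquiv.mul_apply, hz, ih]
  have h1 : (q : M) * z = ∑ k ∈ Finset.range q, (K.σ ^ k) z := by
    simp [hzk]
  have h2 : ∑ k ∈ Finset.range q, (K.σ ^ k) z = ∑ i : Fin q, algebraMap L M (x i * ∑ k ∈ Finset.range q, (K.ζ ^ (i : ℕ)) ^ k) * K.α ^ (i : ℕ) := by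
    have : ∀ k, (K.σ ^ k) z = ∑ i : Fin q, algebraMap L M (x i * (K.ζ ^ (i : ℕ)) ^ k) * K.α ^ (i : ℕ) := fun k => by
      conv_lhs => rw [hx]
      rw [map_sum]
      refine Finset.sum_congr rfl fun i _ => ?_
      rw [map_mul, map_pow, AlgEquiv.commutes, K.σ_pow, mul_pow, ← map_pow, ← mul_assoc, ← map_mul, ← pow_mul, ← pow_mul, mul_comm k]
    simp_rw [this]
    rw [Finset.sum_comm]
    refine Finset.sum_congr rfl fun i _ => ?_
    rw [← Finset.sum_mul, ← map_sum, ← Finset.mul_sum]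
  have h3 : ∑ i : Fin q, algebraMap L M (x i * ∑ k ∈ Finset.range q, (K.ζ ^ (i : ℕ)) ^ k) * K.α ^ (i : ℕ) = algebraMap L M (x ⟨0, K.hq.pos⟩ * q) := by
    rw [Finset.sum_eq_single (⟨0, K.hq.pos⟩ : Fin q)]
    · simp
    · intro i _ hi
      have hi0 : (i : ℕ) ≠ 0 := fun h => hi (Fin.ext h)
      have h4 : K.ζ ^ (i : ℕ) ≠ 1 := K.hζ.pow_ne_one_of_pos_of_lt hi0 i.2
      have h5 : (∑ k ∈ Finset.range q, (K.ζ ^ (i : ℕ)) ^ k) * (K.ζ ^ (i : ℕ) - 1) = 0 := by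
        rw [geom_sum_mul, ← pow_mul, mul_comm, pow_mul, K.hζ.pow_eq_one, one_pow, sub_self]
      rw [(mul_eq_zero.mp h5).resolve_right (sub_ne_zero.mpr h4), mul_zero, map_zero, zero_mul]
    · simp
  have hq0 : (q : M) ≠ 0 := by
    have : (q : M) = algebraMap (ZMod p) M (q : ZMod p) := by simp
    rw [this]; exact (_root_.map_ne_zero _).mpr K.hqp
  refine ⟨x ⟨0, K.hq.pos⟩, mul_left_cancel₀ hq0 ?_⟩
  rw [h1, h2, h3, map_mul, map_natCast, mul_comm]

theorem v_α {w : FFPrime M} {v : FFPrime L} {e : ℤ} (h : Over w v e) (hv : v.va.v K.a = 0) : w.va.v K.α = 0 := by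
  have h1 := h.2 K.a K.ha0
  rw [← K.hα, w.va.pow K.α_ne, hv, mul_zero, nsmul_eq_mul] at h1
  exact (mul_eq_zero.mp h1).resolve_left (by exact_mod_cast K.hq.ne_zero)

theorem e_one {w : FFPrime M} {e : ℤ} (he : 0 < e) (h : ∀ z : M, z ≠ 0 → ∃ m, w.va.v z = e * m) : e = 1 := by
  obtain ⟨z, hz0, hz⟩ := w.exists_v 1
  obtain ⟨m, hm⟩ := h z hz0
  rw [hz] at hm
  exact Int.eq_one_of_dvd_one he.le ⟨m, hm⟩

theorem A_form {v : FFPrime L} (hv : v.va.v K.a = 0) (hna : ∀ y : v.va.kap, y ^ q ≠ v.va.res K.a) {z : M} (hz : z ≠ 0) :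
    ∃ m : ℤ, ∀ (w : FFPrime M) e, Over w v e → w.va.v z = e * m := by
  obtain ⟨x, hx⟩ := K.gen z
  have hxne : ∃ i, x i ≠ 0 := by
    by_contra hcon; push Not at hcon
    apply hz; rw [hx]; simp [hcon]
  obtain ⟨m, hm, hm1⟩ := v.exists_min x hxne
  refine ⟨m, fun w e h => ?_⟩
  rw [hx]
  exact caseA K.hq h (Or.inr hv.ge) K.hα (Or.inr (K.v_α h hv).ge) hna x hm hm1

theorem A_deg {v : FFPrime L} (hv : v.va.v K.a = 0) (hna : ∀ y : v.va.kap, y ^ q ≠ v.va.res K.a) {w : FFPrime M} {e : ℤ} (h : Over w v e) :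
    2 * v.deg p ≤ w.deg p := by
  obtain ⟨ι, hι⟩ := v.va.exists_iota w.va (algebraMap L M) (fun x hx => h.ge0 hx) (fun x hx => h.gt0 hx)
  have hα0 : w.va.ge 0 K.α := Or.inr (K.v_α h hv).ge
  let f : (v.va.kap × v.va.kap) →+ w.va.kap :=
    { toFun := fun s => ι s.1 + ι s.2 * w.va.res K.α
      map_zero' := by simp
      map_add' := fun s t => by simp only [Prod.fst_add, Prod.snd_add, map_add]; ring }
  let g : (v.va.kap × v.va.kap) →ₗ[ZMod p] w.va.kap := f.toZModLinearMap p
  have hg : Function.Injective g := by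
    rw [injective_iff_map_eq_zero]
    rintro ⟨s, t⟩ hst
    have hst' : ι s + ι t * w.va.res K.α = 0 := hst
    by_cases ht : t = 0
    · subst ht
      rw [map_zero, zero_mul, add_zero, map_eq_zero] at hst'
      rw [hst']; rfl
    · exfalso
      have h1 : ι t ≠ 0 := (_root_.map_ne_zero _).mpr ht
      have h2 : w.va.res K.α = ι (-s / t) := by
        rw [map_div₀, map_neg, eq_div_iff h1]; linear_combination hst'
      apply hna (-s / t)
      apply ι.injective
      rw [map_pow, ← h2, ← Va.res_pow hα0, K.hα, hι _ (Or.inr hv.ge)]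
  have := K.hM.finite_kap w
  have := K.hL.finite_kap v
  have h3 := LinearMap.finrank_le_finrank_of_injective hg
  rw [Module.finrank_prod] at h3
  unfold FFPrime.deg
  omega

theorem res_ζ (w : FFPrime M) : IsPrimitiveRoot (w.va.res (algebraMap L M K.ζ)) q := by
  haveI := Fact.mk K.hq
  have hζ0 : algebraMap L M K.ζ ≠ 0 := (_root_.map_ne_zero _).mpr (K.hζ.ne_zero K.hq.ne_zero)
  have hvζ : w.va.v (algebraMap L M K.ζ) = 0 := w.va.v_of_pow_eq_one K.hq.ne_zero (by rw [← map_pow, K.hζ.pow_eq_one, map_one])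
  have hge : w.va.ge 0 (algebraMap L M K.ζ) := Or.inr hvζ.ge
  have h := IsPrimitiveRoot.orderOf (w.va.res (algebraMap L M K.ζ))
  rwa [orderOf_eq_prime (p := q)] at h
  · rw [← Va.res_pow hge, ← map_pow, K.hζ.pow_eq_one, map_one, Va.res_one]
  · intro h1
    rw [← Va.res_one, Va.res_eq hge Va.ge_one] at h1
    have h2 : algebraMap L M K.ζ - 1 ≠ 0 := by
      rw [← map_one (algebraMap L M), ← map_sub]
      exact (_root_.map_ne_zero _).mpr (sub_ne_zero.mpr (K.hζ.ne_one K.hq.one_lt))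
    have h3 : IsAlgebraic (ZMod p) (algebraMap L M K.ζ) := ⟨X ^ q - 1, by
      intro h0
      have := congrArg (fun f => coeff f q) h0
      simp [coeff_one, K.hq.ne_zero] at this, by
      rw [map_sub, map_pow, aeval_X, map_one, ← map_pow, K.hζ.pow_eq_one, map_one, sub_self]⟩
    have h4 := FunF.v_alg h2 (h3.sub isAlgebraic_one) w
    have := h1.lt h2
    omega

theorem exists_newton {v : FFPrime L} (hv : v.va.gt 0 (K.a - 1)) (n : ℕ) : ∃ s, v.va.ge 1 (s - 1) ∧ v.va.ge n (s ^ q - K.a) := by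
  have hqM : (q : L) = algebraMap (ZMod p) L (q : ZMod p) := by simp
  have hq0 : (q : L) ≠ 0 := by rw [hqM]; exact (_root_.map_ne_zero _).mpr K.hqp
  have hqv : v.va.v (q : L) = 0 := by rw [hqM]; exact v.va.v_const K.hqp
  obtain ⟨s, hs, hs1⟩ := Va.newton (V := v.va) (e := K.a) (δ := 1) K.hq.pos hq0 hqv zero_le_one (hv.imp id fun h => h) n
  refine ⟨s, hs, hs1.mono ?_⟩
  simp

/-- form in the split case for places with `α ≡ 1` -/
theorem B_form {v : FFPrime L} (hv : v.va.gt 0 (K.a - 1)) {z : M} (hz : z ≠ 0) {w w' : FFPrime M} {e e' : ℤ} (h : Over w v e) (h' : Over w' v e')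
    (hw : w.va.gt 0 (K.α - 1)) (hw' : w'.va.gt 0 (K.α - 1)) :
    ∃ u : L, u ≠ 0 ∧ w.va.v z = e * v.va.v u ∧ w'.va.v z = e' * v.va.v u ∧ w.va.gt (w.va.v z) (z - algebraMap L M u) := by
  obtain ⟨x, hx⟩ := K.gen z
  rw [hx] at hz
  obtain ⟨n0, h1⟩ := caseB K.hq K.hqp h K.hα hw x hz
  obtain ⟨n1, h2⟩ := caseB K.hq K.hqp h' K.hα hw' x hz
  obtain ⟨s, hs, hs1⟩ := K.exists_newton hv (max n0 n1)
  have h3 := h1 _ (le_max_left _ _) s hs hs1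
  have h4 := h2 _ (le_max_right _ _) s hs hs1
  rw [← hx] at h3 h4
  exact ⟨_, h3.1, h3.2.1, h4.2.1, h3.2.2⟩

theorem B_unique {v : FFPrime L} (hv : v.va.gt 0 (K.a - 1)) {w w' : FFPrime M} {e e' : ℤ} (h : Over w v e) (h' : Over w' v e')
    (hw : w.va.gt 0 (K.α - 1)) (hw' : w'.va.gt 0 (K.α - 1)) : w = w' ∧ e = 1 := by
  have h1 : e = 1 := e_one h.1 fun z hz => by
    obtain ⟨u, _, h2, _⟩ := K.B_form hv hz h h' hw hw'
    exact ⟨_, h2⟩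
  have h1' : e' = 1 := e_one h'.1 fun z hz => by
    obtain ⟨u, _, h2, _⟩ := K.B_form hv hz h' h hw' hw
    exact ⟨_, h2⟩
  refine ⟨FFPrime.ext_va fun z hz => ?_, h1⟩
  obtain ⟨u, _, h2, h3, _⟩ := K.B_form hv hz h h' hw hw'
  rw [h2, h3, h1, h1']

theorem B_deg {v : FFPrime L} (hv : v.va.gt 0 (K.a - 1)) {w : FFPrime M} {e : ℤ} (h : Over w v e)
    (hw : w.va.gt 0 (K.α - 1)) : w.deg p = v.deg p := by
  obtain ⟨ι, hι⟩ := v.va.exists_iota w.va (algebraMap L M) (fun x hx => h.ge0 hx) (fun x hx => h.gt0 hx)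
  let g : v.va.kap →ₗ[ZMod p] w.va.kap := ι.toAddMonoidHom.toZModLinearMap p
  have hinj : Function.Injective g := ι.injective
  have hsurj : Function.Surjective g := by
    intro y
    obtain ⟨z, hz, rfl⟩ := Va.res_surj y
    by_cases hgt : w.va.gt 0 z
    · exact ⟨0, by rw [map_zero, (Va.res_eq_zero hz).mpr hgt]⟩
    · have hz0 : z ≠ 0 := fun h0 => hgt (Or.inl h0)
      have hwz : w.va.v z = 0 := le_antisymm (by
        by_contra hlt
        exact hgt (Or.inr (not_le.mp hlt))) (hz.le hz0)
      obtain ⟨u, hu0, h2, _, h3⟩ := K.B_form hv hz0 h h hw hw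
      rw [hwz] at h2 h3
      have hu : v.va.ge 0 u := Or.inr (by
        rcases mul_eq_zero.mp h2.symm with h | h'
        · exact absurd h (ne_of_gt ‹Over w v e›.1)
        · exact h'.ge)
      refine ⟨v.va.res u, ?_⟩
      have : ι (v.va.res u) = w.va.res z := by
        rw [hι u hu, eq_comm, Va.res_eq hz (h.ge0 hu)]
        exact h3
      exact this
  exact (LinearEquiv.finrank_eq (LinearEquiv.ofBijective g ⟨hinj, hsurj⟩)).symm

theorem res_cases {v : FFPrime L} (hv : v.va.gt 0 (K.a - 1)) {w : FFPrime M} {e : ℤ} (h : Over w v e) :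
    ∃ i, i < q ∧ w.va.gt 0 (algebraMap L M (K.ζ ^ i) * K.α - 1) := by
  have h10 : v.va.v K.a = 0 := by
    have := Va.v_eq_of_sub (V := v.va) one_ne_zero (y := K.a) (by rw [v.va.one]; exact hv)
    rw [this.2, v.va.one]
  have hα0 : w.va.ge 0 K.α := Or.inr (K.v_α h h10).ge
  have hζ := K.res_ζ w
  have hζ0 : algebraMap L M K.ζ ≠ 0 := (_root_.map_ne_zero _).mpr (K.hζ.ne_zero K.hq.ne_zero)
  have hvζ : w.va.v (algebraMap L M K.ζ) = 0 := w.va.v_of_pow_eq_one K.hq.ne_zero (by rw [← map_pow, K.hζ.pow_eq_one, map_one])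
  have hge : w.va.ge 0 (algebraMap L M K.ζ) := Or.inr hvζ.ge
  have hne : w.va.res K.α ≠ 0 := by
    rw [Ne, Va.res_eq_zero hα0]
    intro hh
    have := hh.lt K.α_ne
    rw [K.v_α h h10] at this
    exact lt_irrefl _ this
  have h1 : (w.va.res K.α)⁻¹ ^ q = 1 := by
    rw [inv_pow, ← Va.res_pow hα0, K.hα, inv_eq_one, ← Va.res_one, Va.res_eq (h.ge0 (Or.inr h10.ge)) Va.ge_one, ← map_one (algebraMap L M),
      ← map_sub]
    exact h.gt0 hv
  haveI : NeZero q := ⟨K.hq.ne_zero⟩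
  obtain ⟨i, hi, h2⟩ := hζ.eq_pow_of_pow_eq_one h1
  refine ⟨i, hi, ?_⟩
  rw [map_pow, ← Va.res_eq ((hge.pow i).mul0 hα0) Va.ge_one, Va.res_mul (hge.pow i) hα0, Va.res_pow hge, h2, Va.res_one, inv_mul_cancel₀ hne]

theorem res_inj {w : FFPrime M} (hw : w.va.ge 0 K.α) {i j : ℕ} (hi : i < q) (hj : j < q) 
   (h1 : w.va.gt 0 (algebraMap L M (K.ζ ^ i) * K.α - 1)) (h2 : w.va.gt 0 (algebraMap L M (K.ζ ^ j) * K.α - 1)) : i = j := by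
  have hζ := K.res_ζ w
  have hvζ : w.va.v (algebraMap L M K.ζ) = 0 := w.va.v_of_pow_eq_one K.hq.ne_zero (by rw [← map_pow, K.hζ.pow_eq_one, map_one])
  have hge : w.va.ge 0 (algebraMap L M K.ζ) := Or.inr hvζ.ge
  rw [map_pow, ← Va.res_eq ((hge.pow _).mul0 hw) Va.ge_one, Va.res_mul (hge.pow _) hw, Va.res_pow hge, Va.res_one] at h1 h2
  refine hζ.pow_inj hi hj ?_
  have h3 : w.va.res K.α ≠ 0 := fun h0 => by rw [h0, mul_zero] at h1; exact zero_ne_one h1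
  exact mul_right_cancel₀ h3 (h1.trans h2.symm)

theorem B_all {v : FFPrime L} (hv : v.va.gt 0 (K.a - 1)) {w0 : FFPrime M} {e : ℤ} (h0 : Over w0 v e) :
    e = 1 ∧ (∀ i j, i < q → j < q → pl (K.σ ^ i) w0 = pl (K.σ ^ j) w0 → i = j) ∧
      (∀ w e, Over w v e → ∃ i, i < q ∧ pl (K.σ ^ i) w0 = w) ∧ w0.deg p = v.deg p := by
  obtain ⟨i0, -, hi0⟩ := K.res_cases hv h0
  have hζ0 := K.hζ.ne_zero K.hq.ne_zero
  -- normalise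
  let K' := K.scale (K.ζ ^ i0) (pow_ne_zero _ hζ0)
  have hK'a : K'.a = K.a := by
    change K.a * (K.ζ ^ i0) ^ q = K.a
    rw [← pow_mul, mul_comm i0, pow_mul, K.hζ.pow_eq_one, one_pow, mul_one]
  have hv' : v.va.gt 0 (K'.a - 1) := by rw [hK'a]; exact hv
  have hw0 : w0.va.gt 0 (K'.α - 1) := by
    change w0.va.gt 0 (K.α * algebraMap L M (K.ζ ^ i0) - 1)
    rw [mul_comm]; exact hi0
  have hα0 : w0.va.ge 0 K'.α := by simpa using hw0.ge.add Va.ge_one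
  have key : ∀ k w, (pl (K.σ ^ k) w).va.gt 0 (K'.α - 1) ↔ w.va.gt 0 (algebraMap L M (K.ζ ^ k) * K'.α - 1) := fun k w => by
    rw [pl_gt, map_sub, map_one]
    have := K'.σ_pow k
    rw [show K.σ = K'.σ from rfl, this]; rfl
  refine ⟨(K'.B_unique hv' h0 h0 hw0 hw0).2, fun i j hi hj hij => ?_, fun w e hw => ?_, K'.B_deg hv' h0 hw0⟩
  · -- use the inverse exponents
    have hpow : ∀ i ≤ q, pl (K.σ ^ (q - i)) (pl (K.σ ^ i) w0) = w0 := fun i hi => by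
      rw [← pl_mul, ← pow_add, Nat.add_sub_cancel' hi, K.σ_q, pl_one]
    have h1 : (pl (K.σ ^ (q - i)) (pl (K.σ ^ i) w0)).va.gt 0 (K'.α - 1) := by rw [hpow i hi.le]; exact hw0
    have h2 : (pl (K.σ ^ (q - j)) (pl (K.σ ^ i) w0)).va.gt 0 (K'.α - 1) := by rw [hij, hpow j hj.le]; exact hw0
    rw [key] at h1 h2
    have hge : (pl (K.σ ^ i) w0).va.ge 0 K'.α := by
      right
      rw [K'.v_α (pl_over h0)]
      have := Va.v_eq_of_sub (V := v.va) one_ne_zero (y := K'.a) (by rw [v.va.one]; exact hv')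
      rw [this.2, v.va.one]
    have hmod : ∀ i, K.ζ ^ (q - i) = K.ζ ^ ((q - i) % q) := fun i => by 
      conv_lhs => rw [← Nat.div_add_mod (q - i) q, pow_add, pow_mul, K.hζ.pow_eq_one, one_pow, one_mul]
    rw [hmod] at h1 h2
    have := K'.res_inj hge (Nat.mod_lt _ K.hq.pos) (Nat.mod_lt _ K.hq.pos) h1 h2
    rcases Nat.eq_zero_or_pos i with hi' | hi' <;> rcases Nat.eq_zero_or_pos j with hj' | hj'
    · omega
    · rw [hi', Nat.sub_zero, Nat.mod_self, Nat.mod_eq_of_lt (by omega)] at this; omega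
    · rw [hj', Nat.sub_zero, Nat.mod_self, Nat.mod_eq_of_lt (by omega)] at this; omega
    · rw [Nat.mod_eq_of_lt (by omega), Nat.mod_eq_of_lt (by omega)] at this; omega
  · obtain ⟨i, hi, h1⟩ := K'.res_cases hv' hw
    rw [show K'.ζ = K.ζ from rfl, ← key] at h1
    have h2 := (K'.B_unique hv' h0 (pl_over hw) hw0 h1).1
    refine ⟨(q - i) % q, Nat.mod_lt _ K.hq.pos, ?_⟩
    have : K.σ ^ ((q - i) % q) = K.σ ^ (q - i) := by
      conv_rhs => rw [← Nat.div_add_mod (q - i) q, pow_add, pow_mul, K.σ_q, one_pow, one_mul]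
    rw [this, h2, ← pl_mul, ← pow_add, Nat.add_sub_cancel' hi.le, K.σ_q, pl_one]

theorem places (v : FFPrime L) :
    (∃ w0 : FFPrime M, Over w0 v 1 ∧ (∀ (w : FFPrime M) e, Over w v e → w = w0) ∧ 2 * v.deg p ≤ w0.deg p) ∨
    (∃ w0 : FFPrime M, Over w0 v 1 ∧ (∀ i j, i < q → j < q → pl (K.σ ^ i) w0 = pl (K.σ ^ j) w0 → i = j) ∧
      (∀ w e, Over w v e → ∃ i, i < q ∧ pl (K.σ ^ i) w0 = w) ∧ ∀ (w : FFPrime M) e, Over w v e → w.deg p = v.deg p) := by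
  haveI := K.alg
  obtain ⟨w0, e, h0⟩ := exists_above K.hL K.hM v
  obtain ⟨m, hm⟩ := K.hav v
  obtain ⟨β, hβ0, hβ⟩ := v.exists_v (-m)
  let K1 := K.scale β hβ0
  have hK1 : v.va.v K1.a = 0 := by
    change v.va.v (K.a * β ^ q) = 0
    rw [v.va.mul K.ha0 (pow_ne_zero _ hβ0), v.va.pow hβ0, hβ, hm, nsmul_eq_mul]; ring
  by_cases hres : ∃ y : v.va.kap, y ^ q = v.va.res K1.a
  · right
    obtain ⟨y, hy⟩ := hres
    obtain ⟨ρ, hρ, rfl⟩ := Va.res_surj y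
    have hKa : v.va.res K1.a ≠ 0 := by
      rw [Ne, Va.res_eq_zero (Or.inr hK1.ge)]
      intro hh
      have := hh.lt K1.ha0
      rw [hK1] at this
      exact lt_irrefl _ this
    have hρr : v.va.res ρ ≠ 0 := fun h => hKa (by rw [← hy, h, zero_pow K.hq.ne_zero])
    have hρ0 : ρ ≠ 0 := fun h => hρr ((Va.res_eq_zero hρ).mpr (Or.inl h))
    have hvρ : v.va.v ρ = 0 := le_antisymm (by
      by_contra hlt
      exact hρr ((Va.res_eq_zero hρ).mpr (Or.inr (not_le.mp hlt)))) (hρ.le hρ0)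
    have hρi : v.va.ge 0 ρ⁻¹ := Or.inr (by rw [v.va.inv hρ0, hvρ, neg_zero])
    let K2 := K1.scale ρ⁻¹ (inv_ne_zero hρ0)
    have hK2 : v.va.gt 0 (K2.a - 1) := by
      change v.va.gt 0 (K1.a * ρ⁻¹ ^ q - 1)
      rw [← Va.res_eq ((Va.ge_of hK1.ge).mul0 (hρi.pow q)) Va.ge_one, Va.res_mul (Or.inr hK1.ge) (hρi.pow q), ← hy, ← Va.res_pow hρ,
        ← Va.res_mul (hρ.pow q) (hρi.pow q), ← mul_pow, mul_inv_cancel₀ hρ0, one_pow]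
    obtain ⟨he, h1, h2, -⟩ := K2.B_all hK2 h0
    exact ⟨w0, he ▸ h0, h1, h2, fun w e hw => (K2.B_all hK2 hw).2.2.2⟩
  · left
    push Not at hres
    have he : ∀ (w : FFPrime M) e, Over w v e → e = 1 := fun w e h => e_one h.1 fun z hz => by
      obtain ⟨m, hm⟩ := K1.A_form hK1 hres hz
      exact ⟨m, hm w e h⟩
    refine ⟨w0, he _ _ h0 ▸ h0, fun w e' hw => FFPrime.ext_va fun z hz => ?_, K1.A_deg hK1 hres h0⟩
    obtain ⟨m, hm⟩ := K1.A_form hK1 hres hz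
    rw [hm w e' hw, hm w0 e h0, he _ _ hw, he _ _ h0]

end Kum
end

section
open Polynomial

variable {p q : ℕ} [Fact p.Prime] {L M : Type} [Field L] [Field M] [Algebra (ZMod p) L] [Algebra (ZMod p) M] [Algebra L M]

theorem exists_functional0 [Fact q.Prime] {B : Type} [AddCommGroup B] [Module (ZMod q) B] {x : B} (hx : x ≠ 0) :
    ∃ l : B →+ ZMod q, l x ≠ 0 := by
  have hb := (Module.Basis.ofVectorSpace (ZMod q) B).repr.map_ne_zero_iff.mpr hx
  obtain ⟨i, hi⟩ := Finsupp.ne_iff.mp hb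
  exact ⟨((Module.Basis.ofVectorSpace (ZMod q) B).coord i).toAddMonoidHom, hi⟩

theorem exists_functional (hq : q.Prime) {A : Type} [AddCommGroup A] (H : AddSubgroup A) (hH : ∀ x, q • x ∈ H) {x : A} (hx : x ∉ H) :
    ∃ l : A →+ ZMod q, (∀ h ∈ H, l h = 0) ∧ l x ≠ 0 := by
  have := Fact.mk hq
  letI : Module (ZMod q) (A ⧸ H) := AddCommGroup.zmodModule (n := q) (by
    intro x
    induction x using QuotientAddGroup.induction_on with
    | H x =>
      rw [← QuotientAddGroup.mk_nsmul, QuotientAddGroup.eq_zero_iff]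
      exact hH x)
  have hx' : (QuotientAddGroup.mk x : A ⧸ H) ≠ 0 := by rwa [Ne, QuotientAddGroup.eq_zero_iff]
  obtain ⟨f, hf⟩ := exists_functional0 (q := q) hx'
  refine ⟨f.comp (QuotientAddGroup.mk' H), fun h hh => ?_, hf⟩
  have : (QuotientAddGroup.mk' H) h = 0 := by rwa [QuotientAddGroup.mk'_apply, QuotientAddGroup.eq_zero_iff]
  rw [AddMonoidHom.comp_apply, this, map_zero]

namespace Kum

theorem exists_res (K : Kum p q L M) (w : FFPrime M) : ∃ v : FFPrime L, Over w v 1 := by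
  haveI := K.alg
  obtain ⟨v, e, h⟩ := exists_over K.hL w
  refine ⟨v, ?_⟩
  rcases K.places v with ⟨w0, h0, h1, -⟩ | ⟨w0, h0, -, h1, -⟩
  · rw [h1 w e h]; exact h0
  · obtain ⟨i, -, hi⟩ := h1 w e h
    rw [← hi]; exact pl_over h0

variable (K : Kum p q L M)

/-- the place below -/
def res (w : FFPrime M) : FFPrime L := (K.exists_res w).choose
theorem res_over (w : FFPrime M) : Over w (K.res w) 1 := (K.exists_res w).choose_spec
theorem res_eq {w : FFPrime M} {v : FFPrime L} {e : ℤ} (h : Over w v e) : K.res w = v := (K.res_over w).eq h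
theorem res_pl (τ : M ≃ₐ[L] M) (w : FFPrime M) : K.res (pl τ w) = K.res w := K.res_eq (pl_over (K.res_over w))
theorem res_v (w : FFPrime M) {x : L} (hx : x ≠ 0) : w.va.v (algebraMap L M x) = (K.res w).va.v x := by
  rw [(K.res_over w).2 x hx, one_mul]

/-- split places -/
def Sp : Set (FFPrime L) := {v | ∃ w0 : FFPrime M, Over w0 v 1 ∧ (∀ i j, i < q → j < q → pl (K.σ ^ i) w0 = pl (K.σ ^ j) w0 → i = j) ∧
      (∀ w e, Over w v e → ∃ i, i < q ∧ pl (K.σ ^ i) w0 = w) ∧ ∀ (w : FFPrime M) e, Over w v e → w.deg p = v.deg p}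

theorem inert {v : FFPrime L} (hv : v ∉ K.Sp) : ∃ w0 : FFPrime M, K.res w0 = v ∧ (∀ (w : FFPrime M), K.res w = v → w = w0) ∧ 2 * v.deg p ≤ w0.deg p := by
  rcases K.places v with ⟨w0, h0, h1, h2⟩ | h
  · exact ⟨w0, K.res_eq h0, fun w hw => h1 w 1 (hw ▸ K.res_over w), h2⟩
  · exact absurd h hv

/-- every fibre is an orbit -/
theorem orbit (v : FFPrime L) : ∃ w0 : FFPrime M, K.res w0 = v ∧ ∀ w, K.res w = v → ∃ i, i < q ∧ pl (K.σ ^ i) w0 = w := by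
  rcases K.places v with ⟨w0, h0, h1, -⟩ | ⟨w0, h0, -, h1, -⟩
  · exact ⟨w0, K.res_eq h0, fun w hw => ⟨0, K.hq.pos, by rw [pow_zero, pl_one, h1 w 1 (hw ▸ K.res_over w)]⟩⟩
  · exact ⟨w0, K.res_eq h0, fun w hw => h1 w 1 (hw ▸ K.res_over w)⟩

theorem fib_finite (v : FFPrime L) : {w | K.res w = v}.Finite := by
  obtain ⟨w0, -, h⟩ := K.orbit v
  refine ((Finset.range q).finite_toSet.image fun i => pl (K.σ ^ i) w0).subset fun w hw => ?_
  obtain ⟨i, hi, rfl⟩ := h w hw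
  exact ⟨i, by simpa using hi, rfl⟩

/-- the fibre over a place -/
def fib (v : FFPrime L) : Finset (FFPrime M) := (K.fib_finite v).toFinset
theorem mem_fib {v : FFPrime L} {w : FFPrime M} : w ∈ K.fib v ↔ K.res w = v := by simp [fib]

theorem fib_split {v : FFPrime L} {w0 : FFPrime M} (h1 : ∀ w, K.res w = v → ∃ i, i < q ∧ pl (K.σ ^ i) w0 = w)
    (h0 : K.res w0 = v) [DecidableEq (FFPrime M)] : K.fib v = (Finset.range q).image fun i => pl (K.σ ^ i) w0 := by
  ext w
  rw [K.mem_fib, Finset.mem_image]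
  constructor
  · intro h
    obtain ⟨i, hi, h⟩ := h1 w h
    exact ⟨i, by simpa using hi, h⟩
  · rintro ⟨i, -, rfl⟩
    rw [K.res_pl, h0]

theorem thmY' : ∃ P0, P0 ∉ K.Sp ∧ ∀ l : Dv L →+ ZMod q, (∀ f, l (K.hL.div f) = 0) → (∀ v ∈ K.Sp, l (Finsupp.single v 1) = 0) →
      l (Finsupp.single P0 1) = 0 → l = 0 := by
  classical
  haveI := Fact.mk K.hq
  refine thmY K.hL K.hM (res := K.res) K.fib (fun v w => K.mem_fib) K.Sp ?_ ?_
  · rintro v ⟨w0, h0, h1, h2, h3⟩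
    refine ⟨?_, fun w hw => h3 w 1 (by rw [← K.mem_fib.mp hw]; exact K.res_over w)⟩
    rw [K.fib_split (v := v) (fun w hw => h2 w 1 (hw ▸ K.res_over w)) (K.res_eq h0), Finset.card_image_of_injOn, Finset.card_range]
    intro i hi j hj hij
    exact h1 i j (by simpa using hi) (by simpa using hj) hij
  · intro v hv
    obtain ⟨w0, h0, h1, h2⟩ := K.inert hv
    refine ⟨w0, ?_, h2⟩
    ext w
    rw [K.mem_fib, Finset.mem_singleton]
    exact ⟨h1 w, fun h => h ▸ h0⟩

/-- permutation of places -/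
def plE : FFPrime M ≃ FFPrime M where
  toFun := pl K.σ
  invFun := pl K.σ⁻¹
  left_inv w := by rw [← pl_mul, mul_inv_cancel, pl_one]
  right_inv w := by rw [← pl_mul, inv_mul_cancel, pl_one]

/-- action on divisors -/
def s : Dv M →+ Dv M := (Finsupp.domCongr K.plE.symm : Dv M ≃+ Dv M).toAddMonoidHom
theorem s_apply (D : Dv M) (w : FFPrime M) : K.s D w = D (pl K.σ w) := by
  simp [s, Finsupp.domCongr, plE, Finsupp.equivMapDomain_apply]
theorem s_iter (D : Dv M) (k : ℕ) (w : FFPrime M) : (K.s^[k] D) w = D (pl (K.σ ^ k) w) := by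
  induction k generalizing w with
  | zero => simp [pl_one]
  | succ k ih => rw [Function.iterate_succ_apply', s_apply, ih, ← pl_mul, ← pow_succ']

def N : Dv M →+ Dv M where
  toFun D := ∑ k ∈ Finset.range q, K.s^[k] D
  map_zero' := by simp
  map_add' A B := by
    rw [← Finset.sum_add_distrib]
    exact Finset.sum_congr rfl fun k _ => iterate_map_add _ _ _ _
theorem N_eq (D : Dv M) : K.N D = ∑ k ∈ Finset.range q, K.s^[k] D := rfl
theorem N_apply (D : Dv M) (w : FFPrime M) : K.N D w = ∑ k ∈ Finset.range q, D (pl (K.σ ^ k) w) := by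
  rw [N_eq, Finsupp.finsetSum_apply]
  exact Finset.sum_congr rfl fun k _ => K.s_iter D k w
theorem shift (K : Kum p q L M) {A : Type*} [AddCommMonoid A] (f : ℕ → A) (h : f q = f 0) : ∑ k ∈ Finset.range q, f (k + 1) = ∑ k ∈ Finset.range q, f k := by
  obtain ⟨n, hn⟩ : ∃ n, q = n + 1 := ⟨q - 1, by have := K.hq.pos; omega⟩
  rw [hn] at h ⊢
  rw [Finset.sum_range_succ, Finset.sum_range_succ', h]
theorem N_s (D : Dv M) : K.N (K.s D) = K.N D := by
  ext w
  rw [N_apply, N_apply]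
  simp_rw [s_apply, ← pl_mul, ← pow_succ]
  exact K.shift (fun k => D (pl (K.σ ^ k) w)) (by rw [K.σ_q, pow_zero])
theorem s_N (D : Dv M) : K.s (K.N D) = K.N D := by
  ext w
  rw [s_apply, N_apply, N_apply]
  simp_rw [← pl_mul, ← pow_succ']
  exact K.shift (fun k => D (pl (K.σ ^ k) w)) (by rw [K.σ_q, pow_zero])

theorem div_σ {z : M} (hz : z ≠ 0) : K.hM.div (K.σ z) = K.s (K.hM.div z) := by
  ext w
  rw [K.hM.div_apply (by simpa using hz), s_apply, K.hM.div_apply hz, pl_v _ _ hz]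

/-- the norm on elements -/
def nm (z : M) : M := ∏ k ∈ Finset.range q, (K.σ ^ k) z
theorem nm_ne {z : M} (hz : z ≠ 0) : K.nm z ≠ 0 := Finset.prod_ne_zero_iff.mpr fun k _ => (_root_.map_ne_zero _).mpr hz
theorem nm_mul (x y : M) : K.nm (x * y) = K.nm x * K.nm y := by
  unfold nm; rw [← Finset.prod_mul_distrib]; exact Finset.prod_congr rfl fun k _ => map_mul _ _ _
theorem nm_inv (x : M) : K.nm x⁻¹ = (K.nm x)⁻¹ := by
  unfold nm; rw [← Finset.prod_inv_distrib]; exact Finset.prod_congr rfl fun k _ => map_inv₀ _ _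
theorem nm_alg (x : L) : K.nm (algebraMap L M x) = algebraMap L M (x ^ q) := by
  simp [nm]
theorem σ_nm (z : M) : K.σ (K.nm z) = K.nm z := by
  unfold nm
  rw [map_prod]
  simp_rw [← AlgEquiv.mul_apply, ← pow_succ']
  exact K.shift (A := Additive M) (fun k => Additive.ofMul ((K.σ ^ k) z)) (by rw [K.σ_q, pow_zero])
theorem div_iter {z : M} (hz : z ≠ 0) (k : ℕ) : K.hM.div ((K.σ ^ k) z) = K.s^[k] (K.hM.div z) := by
  ext w
  rw [K.hM.div_apply ((_root_.map_ne_zero _).mpr hz), s_iter, K.hM.div_apply hz, pl_v _ _ hz]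
theorem div_prod {ι : Type} (t : Finset ι) (f : ι → M) (hf : ∀ i, f i ≠ 0) : K.hM.div (∏ i ∈ t, f i) = ∑ i ∈ t, K.hM.div (f i) := by
  classical
  induction t using Finset.induction_on with
  | empty => simp [K.hM.div_one]
  | insert i t hi ih => rw [Finset.prod_insert hi, Finset.sum_insert hi, K.hM.div_mul (hf i) (Finset.prod_ne_zero_iff.mpr fun j _ => hf j), ih]
theorem div_nm {z : M} (hz : z ≠ 0) : K.hM.div (K.nm z) = K.N (K.hM.div z) := by
  rw [N_eq, nm, K.div_prod _ _ fun k => (_root_.map_ne_zero _).mpr hz]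
  exact Finset.sum_congr rfl fun k _ => K.div_iter hz k

/-- conorm -/
def C : Dv L →+ Dv M := Finsupp.liftAddHom fun v => (zmultiplesHom (Dv M)) (∑ w ∈ K.fib v, Finsupp.single w 1)
theorem C_single (v : FFPrime L) (n : ℤ) : K.C (Finsupp.single v n) = n • ∑ w ∈ K.fib v, Finsupp.single w 1 := by
  simp [C]
theorem C_apply (D : Dv L) (w : FFPrime M) : K.C D w = D (K.res w) := by
  classical
  induction D using Finsupp.induction_linear with
  | zero => simp
  | add f g hf hg => rw [map_add, Finsupp.add_apply, hf, hg, Finsupp.add_apply]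
  | single v n =>
    rw [C_single, Finsupp.smul_apply, Finsupp.finsetSum_apply]
    simp only [Finsupp.single_apply, Finset.sum_ite_eq', K.mem_fib]
    by_cases h : v = K.res w
    · simp [h]
    · simp [h, Ne.symm h]
theorem C_div {x : L} (hx : x ≠ 0) : K.C (K.hL.div x) = K.hM.div (algebraMap L M x) := by
  ext w
  rw [C_apply, K.hL.div_apply hx, K.hM.div_apply ((_root_.map_ne_zero _).mpr hx), K.res_v w hx]
theorem N_C (D : Dv L) : K.N (K.C D) = q • K.C D := by
  ext w
  rw [N_apply, Finsupp.smul_apply]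
  simp [C_apply, res_pl]
theorem exists_C {D : Dv M} (hD : K.s D = D) : ∃ D' : Dv L, K.C D' = D := by
  classical
  have h1 : ∀ k w, D (pl (K.σ ^ k) w) = D w := fun k w => by
    rw [← s_iter]
    have : K.s^[k] D = D := Function.iterate_fixed hD k
    rw [this]
  choose f hf hf' using K.orbit
  refine ⟨Finsupp.onFinset (D.support.image K.res) (fun v => D (f v)) fun v hv => ?_, ?_⟩
  · exact Finset.mem_image.mpr ⟨f v, by simpa using hv, hf v⟩
  · ext w
    rw [C_apply, Finsupp.onFinset_apply]
    obtain ⟨i, -, hi⟩ := hf' (K.res w) w rfl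
    rw [← h1 i (f (K.res w)), hi]
theorem N_split {v : FFPrime L} (hv : v ∈ K.Sp) : ∃ w, K.N (Finsupp.single w 1) = K.C (Finsupp.single v 1) := by
  classical
  obtain ⟨w0, h0, h1, h2, -⟩ := hv
  refine ⟨w0, ?_⟩
  ext w
  rw [N_apply, C_apply]
  simp only [Finsupp.single_apply]
  by_cases h : v = K.res w
  · obtain ⟨i, hi, hw⟩ := h2 w 1 (h ▸ K.res_over w)
    rw [if_pos h, ← hw, Finset.sum_eq_single ((q - i) % q)]
    · rw [if_pos]
      rw [← pl_mul, ← pow_add]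
      conv_lhs => rw [← pl_one (L := L) w0]
      congr 1
      rw [eq_comm, ← pow_mod_orderOf]
      have : (i + (q - i) % q) % q = 0 := by rw [Nat.add_mod_mod, Nat.add_sub_cancel' hi.le, Nat.mod_self]
      rw [pow_mod_orderOf]
      obtain ⟨m, hm⟩ := Nat.dvd_of_mod_eq_zero this
      rw [hm, pow_mul, K.σ_q, one_pow]
    · intro j hj hne
      rw [if_neg]
      intro hcon
      rw [← pl_mul, ← pow_add] at hcon
      have h3 : K.σ ^ (i + j) = K.σ ^ ((i + j) % q) := by
        conv_lhs => rw [← Nat.div_add_mod (i + j) q, pow_add, pow_mul, K.σ_q, one_pow, one_mul]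
      rw [h3] at hcon
      have h4 := h1 0 ((i + j) % q) K.hq.pos (Nat.mod_lt _ K.hq.pos) (by rw [pow_zero, pl_one]; exact hcon)
      apply hne
      have hj' : j < q := by simpa using hj
      have h5 : (i + j) % q = 0 := h4.symm
      rcases Nat.eq_zero_or_pos i with hi0 | hi0
      · subst hi0; rw [zero_add, Nat.mod_eq_of_lt hj'] at h5; simp [h5]
      · rw [Nat.mod_eq_of_lt (a := q - i) (by omega)]
        have h6 := Nat.dvd_of_mod_eq_zero h5
        obtain ⟨m, hm⟩ := h6
        have : m = 1 := by
          rcases m with _ | _ | m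
          · omega
          · rfl
          · exfalso
            have : q * (m + 1 + 1) = q * m + 2 * q := by ring
            omega
        subst this; omega
    · intro hcon; exact absurd (Finset.mem_range.mpr (Nat.mod_lt _ K.hq.pos)) hcon
  · rw [if_neg h]
    refine Finset.sum_eq_zero fun k _ => if_neg fun hk => h ?_
    rw [← K.res_pl (K.σ ^ k) w, ← hk, K.res_eq h0]

/-- consequence of the analytic theorem -/
theorem exists_base : ∃ w0 : FFPrime M, pl K.σ w0 = w0 ∧ ∀ D : Dv M, K.s D = D → ∃ g : L, g ≠ 0 ∧ ∃ E : Dv M, ∃ m : ℤ,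
    D = K.hM.div (algebraMap L M g) + K.N E + Finsupp.single w0 m := by
  classical
  haveI := Fact.mk K.hq
  obtain ⟨P0, hP0, hY⟩ := K.thmY'
  obtain ⟨w0, h0, h1, -⟩ := K.inert hP0
  refine ⟨w0, h1 _ (by rw [K.res_pl, h0]), fun D hD => ?_⟩
  obtain ⟨D', rfl⟩ := K.exists_C hD
  let H : AddSubgroup (Dv L) :=
    { carrier := {D | ∃ g : L, g ≠ 0 ∧ ∃ E : Dv M, ∃ m : ℤ, K.C D = K.hM.div (algebraMap L M g) + K.N E + Finsupp.single w0 m}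
      zero_mem' := ⟨1, one_ne_zero, 0, 0, by simp [K.hM.div_one]⟩
      add_mem' := by
        rintro A B ⟨g, hg, E, m, h⟩ ⟨g', hg', E', m', h'⟩
        refine ⟨g * g', mul_ne_zero hg hg', E + E', m + m', ?_⟩
        rw [map_add, h, h', map_mul, K.hM.div_mul ((_root_.map_ne_zero _).mpr hg) ((_root_.map_ne_zero _).mpr hg'), map_add, Finsupp.single_add]
        abel
      neg_mem' := by
        rintro A ⟨g, hg, E, m, h⟩
        refine ⟨g⁻¹, inv_ne_zero hg, -E, -m, ?_⟩
        rw [map_neg, h, map_inv₀, K.hM.div_inv, map_neg, Finsupp.single_neg]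
        abel }
  change D' ∈ H
  by_contra hcon
  obtain ⟨l, hl, hlx⟩ := exists_functional K.hq H (fun x => ⟨1, one_ne_zero, K.C x, 0, by rw [map_nsmul, ← K.N_C]; simp [K.hM.div_one]⟩) hcon
  apply hlx
  refine DFunLike.congr_fun (hY l (fun g => ?_) (fun v hv => ?_) ?_) D'
  · by_cases hg : g = 0
    · rw [hg, K.hL.div_zero', map_zero]
    exact hl _ ⟨g, hg, 0, 0, by rw [K.C_div hg]; simp⟩
  · obtain ⟨w, hw⟩ := K.N_split hv
    exact hl _ ⟨1, one_ne_zero, Finsupp.single w 1, 0, by rw [hw]; simp [K.hM.div_one]⟩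
  · refine hl _ ⟨1, one_ne_zero, 0, 1, ?_⟩
    have : K.fib P0 = {w0} := by
      ext w
      rw [K.mem_fib, Finset.mem_singleton]
      exact ⟨h1 w, fun h => h ▸ h0⟩
    rw [C_single, this]
    simp [K.hM.div_one]

end Kum
end

section
open Polynomial

theorem ends_herbrand {G : Type} [AddCommGroup G] [Finite G] (f g : G →+ G) :
    Nat.card f.ker * Nat.card f.range = Nat.card g.ker * Nat.card g.range := by
  rw [← AddSubgroup.index_ker f, ← AddSubgroup.index_ker g, AddSubgroup.card_mul_index, AddSubgroup.card_mul_index]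

theorem ker_le_range {G : Type} [AddCommGroup G] [Finite G] (f g : G →+ G) (hfg : ∀ x, f (g x) = 0)
    (h : g.ker ≤ f.range) : f.ker ≤ g.range := by
  have h1 := ends_herbrand f g
  have h2 : Nat.card g.ker ≤ Nat.card f.range := AddSubgroup.card_le_of_le h
  have h3 : g.range ≤ f.ker := by rintro _ ⟨x, rfl⟩; exact hfg x
  have h4 : 0 < Nat.card f.range := Nat.card_pos
  have h5 : Nat.card f.ker ≤ Nat.card g.range := by
    by_contra hc
    push Not at hc
    have := Nat.mul_le_mul_right (Nat.card g.range) h2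
    nlinarith
  exact (AddSubgroup.eq_of_le_of_card_ge h3 h5).ge

theorem herbrand_bij {G U : Type} [AddCommGroup G] [Finite G] [CommGroup U] [Finite U] (Λ : Subgroup U) (f g : G →+ G)
    (hfg : ∀ x, f (g x) = 0) (hgf : ∀ x, g (f x) = 0) (h : G → U)
    (hh : ∀ x y, g x = 0 → g y = 0 → (h x)⁻¹ * h y ∈ Λ → x - y ∈ f.range) :
    g.range.relIndex f.ker ≤ Λ.index ∧ (Λ.index ≤ g.range.relIndex f.ker → ∀ u, ∃ x, g x = 0 ∧ u⁻¹ * h x ∈ Λ) := by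
  have h3 : g.range ≤ f.ker := by rintro _ ⟨x, rfl⟩; exact hfg x
  have h3' : f.range ≤ g.ker := by rintro _ ⟨x, rfl⟩; exact hgf x
  have key : g.range.relIndex f.ker = f.range.relIndex g.ker := by
    have h1 := ends_herbrand f g
    have e1 : Nat.card g.range * g.range.relIndex f.ker = Nat.card f.ker := by
      rw [← AddSubgroup.relIndex_bot_left, ← AddSubgroup.relIndex_bot_left, AddSubgroup.relIndex_mul_relIndex _ _ _ bot_le h3]
    have e2 : Nat.card f.range * f.range.relIndex g.ker = Nat.card g.ker := by
      rw [← AddSubgroup.relIndex_bot_left, ← AddSubgroup.relIndex_bot_left, AddSubgroup.relIndex_mul_relIndex _ _ _ bot_le h3']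
    have h4 : 0 < Nat.card f.range := Nat.card_pos
    have h5 : 0 < Nat.card g.range := Nat.card_pos
    rw [← e1, ← e2] at h1
    have : (Nat.card g.range * Nat.card f.range) * g.range.relIndex f.ker = (Nat.card g.range * Nat.card f.range) * f.range.relIndex g.ker := by linarith
    exact Nat.eq_of_mul_eq_mul_left (Nat.mul_pos h5 h4) this
  rw [key]
  let φ : (g.ker ⧸ f.range.addSubgroupOf g.ker) → U ⧸ Λ := fun x => QuotientGroup.mk (h (Quotient.out x : g.ker))
  have hφ : Function.Injective φ := by
    intro x y hxy
    have hxy := QuotientGroup.eq.mp hxy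
    have h6 := hh _ _ (Quotient.out x : g.ker).2 (Quotient.out y : g.ker).2 hxy
    rw [← QuotientAddGroup.out_eq' x, ← QuotientAddGroup.out_eq' y, QuotientAddGroup.eq, AddSubgroup.mem_addSubgroupOf]
    have := f.range.neg_mem h6
    simpa [add_comm, sub_eq_add_neg] using this
  refine ⟨Nat.card_le_card_of_injective φ hφ, fun hle u => ?_⟩
  have hb := hφ.bijective_of_nat_card_le hle
  obtain ⟨x, hx⟩ := hb.2 (QuotientGroup.mk u)
  exact ⟨_, (Quotient.out x : g.ker).2, QuotientGroup.eq.mp hx.symm⟩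

theorem mem_of_relIndex_le {G : Type} [AddCommGroup G] [Finite G] {q : ℕ} (hq : q.Prime) {A B : AddSubgroup G} (hAB : A ≤ B)
    (hle : A.relIndex B ≤ q) {e : G} (heB : e ∈ B) (heA : e ∉ A) (hqe : q • e ∈ A) :
    A.relIndex B = q ∧ ∀ x ∈ B, ∃ i, i < q ∧ x - i • e ∈ A := by
  let ψ : Fin q → B ⧸ A.addSubgroupOf B := fun i => QuotientAddGroup.mk ((i : ℕ) • ⟨e, heB⟩ : B)
  have hord : addOrderOf (QuotientAddGroup.mk (⟨e, heB⟩ : B) : B ⧸ A.addSubgroupOf B) = q := by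
    haveI := Fact.mk hq
    refine addOrderOf_eq_prime ?_ ?_
    · rw [← QuotientAddGroup.mk_nsmul, QuotientAddGroup.eq_zero_iff, AddSubgroup.mem_addSubgroupOf]
      simpa using hqe
    · rw [Ne, QuotientAddGroup.eq_zero_iff, AddSubgroup.mem_addSubgroupOf]
      exact heA
  have hψ : Function.Injective ψ := by
    intro i j hij
    simp only [ψ, QuotientAddGroup.mk_nsmul] at hij
    have := nsmul_injOn_Iio_addOrderOf (x := (QuotientAddGroup.mk (⟨e, heB⟩ : B) : B ⧸ A.addSubgroupOf B))
      (by rw [hord]; exact i.2) (by rw [hord]; exact j.2) hij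
    exact Fin.ext this
  have hb := hψ.bijective_of_nat_card_le (by rw [Nat.card_fin]; exact hle)
  refine ⟨?_, fun x hx => ?_⟩
  · have := Nat.card_congr (Equiv.ofBijective _ hb)
    rw [Nat.card_fin] at this
    exact this.symm
  · obtain ⟨i, hi⟩ := hb.2 (QuotientAddGroup.mk ⟨x, hx⟩)
    refine ⟨i, i.2, ?_⟩
    have := QuotientAddGroup.eq.mp hi
    rw [AddSubgroup.mem_addSubgroupOf] at this
    simpa [add_comm, sub_eq_add_neg] using this

theorem ring_h90 {F : Type} [Field F] {q : ℕ} (hq : q.Prime) (s : F →+* F) (hs : s ^ q = 1) (hs1 : s ≠ 1) {z : F}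
    (hz : ∏ k ∈ Finset.range q, (s ^ k) z = 1) : ∃ y, y ≠ 0 ∧ z * s y = y := by
  haveI := Fact.mk hq
  let u : (F →+* F)ˣ := Units.ofPowEqOne s q hs hq.ne_zero
  have hu : orderOf u = q := by
    refine orderOf_eq_prime ?_ ?_
    · ext1; simpa [u] using hs
    · intro h; apply hs1; simpa [u] using congrArg Units.val h
  have hinj : Function.Injective (fun k : Fin q => ((s ^ (k : ℕ) : F →+* F) : F →* F)) := by
    intro i j hij
    have h1 : (s ^ (i : ℕ) : F →+* F) = s ^ (j : ℕ) := by
      ext x; exact DFunLike.congr_fun hij x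
    have h2 : u ^ (i : ℕ) = u ^ (j : ℕ) := by ext1; simpa [u] using h1
    exact Fin.ext (pow_injOn_Iio_orderOf (by rw [hu]; exact i.2) (by rw [hu]; exact j.2) h2)
  have hli := (linearIndependent_monoidHom F F).comp _ hinj
  let c : ℕ → F := fun k => ∏ j ∈ Finset.range k, (s ^ j) z
  have hne : ∃ y, ∑ k : Fin q, c k * (s ^ (k : ℕ)) y ≠ 0 := by
    by_contra hc
    push Not at hc
    rw [Fintype.linearIndependent_iff] at hli
    have := hli (fun k => c k) (by
      ext y
      simpa using hc y) ⟨0, hq.pos⟩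
    simp [c] at this
  obtain ⟨y, hy⟩ := hne
  refine ⟨_, hy, ?_⟩
  rw [Fin.sum_univ_eq_sum_range (fun k => c k * (s ^ k) y) q]
  have hc : ∀ k, z * s (c k) = c (k + 1) := by
    intro k
    simp only [c, map_prod, Finset.prod_range_succ', pow_zero]
    rw [mul_comm]
    congr 1
    refine Finset.prod_congr rfl fun j _ => ?_
    rw [pow_succ']; rfl
  rw [map_sum, Finset.mul_sum]
  have e : ∀ k, z * s (c k * (s ^ k) y) = c (k + 1) * (s ^ (k + 1)) y := by
    intro k
    rw [map_mul, ← mul_assoc, hc, pow_succ']; rfl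
  simp only [e]
  have h1 := Finset.sum_range_succ (fun k => c k * (s ^ k) y) q
  have h2 := Finset.sum_range_succ' (fun k => c k * (s ^ k) y) q
  rw [h1] at h2
  have h3 : c q * (s ^ q) y = c 0 * (s ^ 0) y := by
    rw [hs, pow_zero]; simp only [c]; rw [hz]; simp
  rw [h3] at h2
  exact (add_right_cancel h2).symm
end

section
open Polynomial

variable {p q : ℕ} [Fact p.Prime] {L M : Type} [Field L] [Field M] [Algebra (ZMod p) L] [Algebra (ZMod p) M] [Algebra L M]

theorem FunF.finite_const {E : Type} [Field E] [Algebra (ZMod p) E] (h : FunF p E) : Finite (algebraicClosure (ZMod p) E) := by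
  have h1 := h.LS_finite (0 : Dv E)
  have h2 : Finite (LS p (0 : Dv E)) := Module.finite_of_finite (ZMod p)
  refine Finite.of_injective (β := LS p (0 : Dv E)) (fun x => ⟨x.1, fun P => ?_⟩) (fun x y hxy => Subtype.ext (congrArg (fun z : LS p (0 : Dv E) => (z : E)) hxy))
  by_cases hx : x.1 = 0
  · exact Or.inl hx
  · right
    rw [FunF.v_alg hx (mem_algebraicClosure_iff.mp x.2) P]
    simp

theorem isAlg_ringHom {E F : Type} [Field E] [Field F] [Algebra (ZMod p) E] [Algebra (ZMod p) F] (φ : E →+* F) {x : E} :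
    IsAlgebraic (ZMod p) (φ x) ↔ IsAlgebraic (ZMod p) x := by
  let φ' : E →ₐ[ZMod p] F := { φ with commutes' := fun r => DFunLike.congr_fun (Subsingleton.elim (φ.comp (algebraMap (ZMod p) E)) (algebraMap (ZMod p) F)) r }
  exact isAlgebraic_algHom_iff φ' φ.injective

namespace Kum
variable (K : Kum p q L M)

theorem σ_ne : K.σ ≠ 1 := by
  intro h
  have h1 := K.hσ
  rw [h, AlgEquiv.one_apply] at h1
  have h2 : algebraMap L M K.ζ = 1 := by
    have := mul_right_cancel₀ K.α_ne ((one_mul K.α).trans h1)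
    exact this.symm
  exact K.hζ.ne_one K.hq.one_lt ((algebraMap L M).injective (by rw [h2, map_one]))

theorem h90 {z : M} (hz : K.nm z = 1) : ∃ y, y ≠ 0 ∧ z * K.σ y = y := by
  have e : ∀ k, ((K.σ : M →+* M) ^ k) = ((K.σ ^ k : M ≃ₐ[L] M) : M →+* M) := by
    intro k
    induction k with
    | zero => rfl
    | succ k ih => rw [pow_succ, ih, pow_succ]; rfl
  refine ring_h90 K.hq (K.σ : M →+* M) ?_ ?_ ?_
  · rw [e, K.σ_q]; rfl
  · intro h
    exact K.σ_ne (AlgEquiv.ext fun x => DFunLike.congr_fun h x)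
  · rw [← hz]
    unfold nm
    refine Finset.prod_congr rfl fun k _ => ?_
    rw [e]; rfl

theorem inv_const {z : M} (hz : IsAlgebraic (ZMod p) z) (hz0 : z ≠ 0) (hs : K.σ z = z) :
    ∃ u : (algebraicClosure (ZMod p) L)ˣ, algebraMap L M (u : algebraicClosure (ZMod p) L) = z := by
  obtain ⟨x, rfl⟩ := K.fixed hs
  have hx : IsAlgebraic (ZMod p) x := (isAlg_ringHom (algebraMap L M)).mp hz
  have hx0 : x ≠ 0 := by rintro rfl; simp at hz0
  exact ⟨Units.mk0 ⟨x, mem_algebraicClosure_iff.mpr hx⟩ (fun h => hx0 (congrArg Subtype.val h)), rfl⟩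

theorem div_const {z : M} (hz : IsAlgebraic (ZMod p) z) : K.hM.div z = 0 := by
  by_cases hz0 : z = 0
  · rw [hz0, K.hM.div_zero']
  ext P; rw [K.hM.div_apply hz0, FunF.v_alg hz0 hz]; rfl

theorem const_of_div {z : M} (hz0 : z ≠ 0) {w : FFPrime M} {m : ℤ} (h : K.hM.div z = Finsupp.single w m) : IsAlgebraic (ZMod p) z ∧ m = 0 := by
  have hm : m = 0 := by
    have h1 := K.hM.dg_div z
    rw [h, dg_single] at h1
    have := K.hM.deg_pos w
    rcases mul_eq_zero.mp h1 with h2 | h2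
    · exact h2
    · exact absurd h2 (by exact_mod_cast this.ne')
  refine ⟨K.hM.alg_of_ge fun P => Or.inr ?_, hm⟩
  rw [← K.hM.div_apply hz0, h, hm]; simp

/-- norm subgroup in the constants -/
def Lam : Subgroup (algebraicClosure (ZMod p) L)ˣ where
  carrier := {u | ∃ c : M, c ≠ 0 ∧ IsAlgebraic (ZMod p) c ∧ K.nm c = algebraMap L M (u : algebraicClosure (ZMod p) L)}
  one_mem' := ⟨1, one_ne_zero, isAlgebraic_one, by simp [nm]⟩
  mul_mem' := by
    rintro u v ⟨c, hc, hca, hcu⟩ ⟨d, hd, hda, hdv⟩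
    refine ⟨c * d, mul_ne_zero hc hd, hca.mul hda, ?_⟩
    rw [K.nm_mul, hcu, hdv, ← map_mul]; rfl
  inv_mem' := by
    rintro u ⟨c, hc, hca, hcu⟩
    refine ⟨c⁻¹, inv_ne_zero hc, hca.inv, ?_⟩
    rw [K.nm_inv, hcu, ← map_inv₀]; simp

theorem Lam_mem {u : (algebraicClosure (ZMod p) L)ˣ} : u ∈ K.Lam ↔ ∃ c : M, c ≠ 0 ∧ IsAlgebraic (ZMod p) c ∧ K.nm c = algebraMap L M (u : algebraicClosure (ZMod p) L) := Iff.rfl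

theorem Lam_index : K.Lam.index ≤ q := by
  have := K.hL.finite_const
  obtain ⟨g, hg⟩ := IsCyclic.exists_generator (α := (algebraicClosure (ZMod p) L)ˣ)
  let ψ : Fin q → (algebraicClosure (ZMod p) L)ˣ ⧸ K.Lam := fun i => QuotientGroup.mk (g ^ (i : ℕ))
  have hψ : Function.Surjective ψ := by
    intro x
    induction x using QuotientGroup.induction_on with
    | H x =>
      obtain ⟨n, rfl⟩ := hg x
      have hq0 : (q : ℤ) ≠ 0 := by exact_mod_cast K.hq.ne_zero
      have h1 := Int.emod_nonneg n hq0
      have h2 := Int.emod_lt_of_pos n (by exact_mod_cast K.hq.pos : (0:ℤ) < q)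
      refine ⟨⟨(n % q).toNat, by omega⟩, ?_⟩
      refine QuotientGroup.eq.mpr ?_
      have h3 : (g ^ (n % q).toNat)⁻¹ * g ^ n = (g ^ (n / q)) ^ q := by
        have h4 : n = (n % q) + (n / q) * q := by rw [mul_comm, Int.emod_add_mul_ediv]
        rw [← zpow_natCast, Int.toNat_of_nonneg h1, ← zpow_natCast, ← zpow_mul, ← zpow_neg, ← zpow_add]
        congr 1; linarith
      show (g ^ (n % q).toNat)⁻¹ * g ^ n ∈ K.Lam
      rw [h3, K.Lam_mem]
      set u := g ^ (n / q)
      refine ⟨algebraMap L M (u : algebraicClosure (ZMod p) L), ?_, ?_, ?_⟩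
      · exact (_root_.map_ne_zero _).mpr (fun h => u.ne_zero (Subtype.ext h))
      · exact (isAlg_ringHom (algebraMap L M)).mpr (mem_algebraicClosure_iff.mp u.1.2)
      · rw [K.nm_alg]; simp
  have := Nat.card_le_card_of_surjective ψ hψ
  rwa [Nat.card_fin] at this

theorem Lam_top (h : ∃ c : M, IsAlgebraic (ZMod p) c ∧ K.σ c ≠ c) : K.Lam = ⊤ := by
  obtain ⟨c0, hc0, hc1⟩ := h
  have := K.hM.finite_const
  let τ : algebraicClosure (ZMod p) M →+* algebraicClosure (ZMod p) M :=
    (K.σ : M →+* M).restrict (algebraicClosure (ZMod p) M) (algebraicClosure (ZMod p) M) (fun x hx =>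
      mem_algebraicClosure_iff.mpr ((isAlg_ringHom (K.σ : M →+* M)).mpr (mem_algebraicClosure_iff.mp hx)))
  have hτ : ∀ k (x : algebraicClosure (ZMod p) M), ((τ ^ k) x : M) = (K.σ ^ k) (x : M) := by
    intro k
    induction k with
    | zero => intro x; rfl
    | succ k ih => intro x; rw [pow_succ, pow_succ]; exact ih (τ x)
  have hτq : τ ^ q = 1 := by
    ext x; rw [hτ, K.σ_q]; rfl
  have hτ1 : τ ≠ 1 := by
    intro h
    have h1 := DFunLike.congr_fun h ⟨c0, mem_algebraicClosure_iff.mpr hc0⟩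
    exact hc1 (congrArg Subtype.val h1)
  let A := (algebraicClosure (ZMod p) M)ˣ
  let f0 : A →* A := { toFun := fun x => ∏ k ∈ Finset.range q, Units.map ((τ ^ k : _ →+* _) : _ →* _) x
                       map_one' := by simp
                       map_mul' := by intro x y; simp [Finset.prod_mul_distrib] }
  let g0 : A →* A := { toFun := fun x => Units.map (τ : _ →* _) x * x⁻¹
                       map_one' := by simp
                       map_mul' := by intro x y; rw [map_mul, mul_inv]; exact mul_mul_mul_comm _ _ _ _ }
  have hv : ∀ x, ((f0 x : A) : algebraicClosure (ZMod p) M) = ∏ k ∈ Finset.range q, (τ ^ k) (x : algebraicClosure (ZMod p) M) := by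
    intro x
    exact map_prod (Units.coeHom (algebraicClosure (ZMod p) M)) _ _
  have hf0 : ∀ x, (((f0 x : A) : algebraicClosure (ZMod p) M) : M) = K.nm ((x : algebraicClosure (ZMod p) M) : M) := by
    intro x
    rw [hv]
    exact (map_prod (algebraicClosure (ZMod p) M).val _ _).trans (Finset.prod_congr rfl fun k _ => hτ k x)
  have key := ker_le_range (G := Additive A) (MonoidHom.toAdditive g0) (MonoidHom.toAdditive f0) ?_ ?_
  · rw [eq_top_iff]
    intro u _
    rw [K.Lam_mem]
    let x0 : algebraicClosure (ZMod p) M := ⟨algebraMap L M (u : algebraicClosure (ZMod p) L), mem_algebraicClosure_iff.mpr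
      ((isAlg_ringHom (algebraMap L M)).mpr (mem_algebraicClosure_iff.mp u.1.2))⟩
    have hx0 : x0 ≠ 0 := fun h => u.ne_zero (Subtype.ext ((algebraMap L M).injective ((congrArg Subtype.val h).trans (map_zero _).symm)))
    let x : A := Units.mk0 x0 hx0
    have hx : Additive.ofMul x ∈ (MonoidHom.toAdditive g0).ker := by
      change g0 x = 1
      change Units.map (τ : _ →* _) x * x⁻¹ = 1
      rw [mul_inv_eq_one]
      ext
      exact K.σ.commutes _
    obtain ⟨y, hy⟩ := key hx
    have hy' : f0 y.toMul = x := hy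
    refine ⟨((y.toMul : A) : algebraicClosure (ZMod p) M), fun h => y.toMul.ne_zero (Subtype.ext h), mem_algebraicClosure_iff.mp (y.toMul : A).1.2, ?_⟩
    rw [← hf0, hy']; rfl
  · intro x
    change g0 (f0 x.toMul) = 1
    change Units.map (τ : _ →* _) (f0 x.toMul) * (f0 x.toMul)⁻¹ = 1
    rw [mul_inv_eq_one]
    ext
    change K.σ ((f0 x.toMul : A) : algebraicClosure (ZMod p) M) = _
    rw [hf0, K.σ_nm]
  · intro x hx
    have hx' : f0 x.toMul = 1 := hx
    obtain ⟨y, hy0, hy⟩ := ring_h90 K.hq τ hτq hτ1 (z := (x.toMul : A)) (by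
      rw [← hv, hx']; rfl)
    refine ⟨Additive.ofMul (Units.mk0 y hy0)⁻¹, ?_⟩
    change g0 (Units.mk0 y hy0)⁻¹ = x.toMul
    change Units.map (τ : _ →* _) (Units.mk0 y hy0)⁻¹ * ((Units.mk0 y hy0)⁻¹)⁻¹ = x.toMul
    rw [inv_inv, map_inv, inv_mul_eq_iff_eq_mul]
    ext
    rw [mul_comm]
    exact congrArg Subtype.val hy.symm

end Kum
end

section
open Polynomial

variable {p q : ℕ} [Fact p.Prime] {L M : Type} [Field L] [Field M] [Algebra (ZMod p) L] [Algebra (ZMod p) M] [Algebra L M]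

namespace Kum
variable (K : Kum p q L M)

/-- principal divisors and multiples of a place -/
def BB (w0 : FFPrime M) : AddSubgroup (Dv M) where
  carrier := {D | ∃ f : M, f ≠ 0 ∧ ∃ m : ℤ, D = K.hM.div f + Finsupp.single w0 m}
  zero_mem' := ⟨1, one_ne_zero, 0, by rw [K.hM.div_one]; simp⟩
  add_mem' := by
    rintro _ _ ⟨f, hf, m, rfl⟩ ⟨g, hg, n, rfl⟩
    refine ⟨f * g, mul_ne_zero hf hg, m + n, ?_⟩
    rw [K.hM.div_mul hf hg, Finsupp.single_add]; abel
  neg_mem' := by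
    rintro _ ⟨f, hf, m, rfl⟩
    refine ⟨f⁻¹, inv_ne_zero hf, -m, ?_⟩
    rw [K.hM.div_inv, Finsupp.single_neg]; abel

theorem mem_BB {w0 : FFPrime M} {D : Dv M} : D ∈ K.BB w0 ↔ ∃ f : M, f ≠ 0 ∧ ∃ m : ℤ, D = K.hM.div f + Finsupp.single w0 m := Iff.rfl

theorem finite_Cl (w0 : FFPrime M) : Finite (Dv M ⧸ K.BB w0) := by
  classical
  obtain ⟨γ, n0, hr⟩ := K.hM.riemann
  set d : ℤ := (w0.deg p : ℤ) with hd
  have hd0 : 0 < d := by rw [hd]; exact_mod_cast K.hM.deg_pos w0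
  set n1 := max n0 (1 - γ) with hn1
  have hfin : (⋃ n ∈ Finset.range ((n1 + d).toNat + 1), {D : ED M | dN p D = n}).Finite :=
    Set.Finite.biUnion (Finset.finite_toSet _) fun n _ => K.hM.finite_eff n
  rw [← Set.finite_univ_iff]
  refine (hfin.image fun D => (QuotientAddGroup.mk (edZ D) : Dv M ⧸ K.BB w0)).subset fun x _ => ?_
  induction x using QuotientAddGroup.induction_on with
  | H D =>
    have h1 := Int.emod_nonneg (n1 - dg p D) hd0.ne'
    have h2 := Int.emod_lt_of_pos (n1 - dg p D) hd0
    have h3 := Int.emod_add_mul_ediv (n1 - dg p D) d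
    set m := (n1 - dg p D) / d + 1 with hm
    have h4 : dg p (D + Finsupp.single w0 m) = dg p D + m * d := by rw [map_add, dg_single]
    have h5 : n1 ≤ dg p (D + Finsupp.single w0 m) := by rw [h4, hm]; nlinarith
    have h6 : dg p (D + Finsupp.single w0 m) ≤ n1 + d := by rw [h4, hm]; nlinarith
    have h7 := hr _ ((le_max_left _ _).trans h5)
    have h8 : 1 - γ ≤ n1 := le_max_right _ _
    have h9 : 0 < ell p (D + Finsupp.single w0 m) := by omega
    have := K.hM.LS_finite (D + Finsupp.single w0 m)
    unfold ell at h9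
    obtain ⟨x, hx⟩ := (Module.finrank_pos_iff_exists_ne_zero (R := ZMod p)).mp h9
    have hx0 : (x : M) ≠ 0 := fun h => hx (Subtype.ext h)
    have h10 := (K.hM.mem_LS_iff hx0).mp x.2
    obtain ⟨D', hD'⟩ := exists_edZ h10
    refine ⟨D', ?_, ?_⟩
    · have h11 := dg_edZ (p := p) D'
      rw [hD', map_add, K.hM.dg_div, zero_add] at h11
      simp only [Set.mem_iUnion, Finset.mem_range]
      exact ⟨dN p D', by omega, rfl⟩
    · refine QuotientAddGroup.eq.mpr ?_
      rw [hD', K.mem_BB]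
      refine ⟨(x : M)⁻¹, inv_ne_zero hx0, -m, ?_⟩
      rw [K.hM.div_inv, Finsupp.single_neg]; abel

theorem s_single {w0 : FFPrime M} (h0 : pl K.σ w0 = w0) (m : ℤ) : K.s (Finsupp.single w0 m) = Finsupp.single w0 m := by
  classical
  ext w
  rw [K.s_apply, Finsupp.single_apply, Finsupp.single_apply]
  have : w0 = pl K.σ w ↔ w0 = w := by
    constructor
    · intro h
      have : K.plE w0 = K.plE w := h0.trans h
      exact K.plE.injective this
    · rintro rfl; exact h0.symm
  simp only [this]

theorem N_single {w0 : FFPrime M} (h0 : pl K.σ w0 = w0) (m : ℤ) : K.N (Finsupp.single w0 m) = Finsupp.single w0 (q * m) := by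
  rw [K.N_eq]
  have : ∀ k, K.s^[k] (Finsupp.single w0 m) = Finsupp.single w0 m := by
    intro k
    exact Function.iterate_fixed (K.s_single h0 m) k
  simp only [this, Finset.sum_const, Finset.card_range]
  rw [Finsupp.smul_single, nsmul_eq_mul]

theorem s_BB {w0 : FFPrime M} (h0 : pl K.σ w0 = w0) : K.BB w0 ≤ (K.BB w0).comap K.s := by
  rintro _ ⟨f, hf, m, rfl⟩
  refine ⟨K.σ f, (_root_.map_ne_zero _).mpr hf, m, ?_⟩
  rw [map_add, K.s_single h0, K.div_σ hf]

theorem N_BB {w0 : FFPrime M} (h0 : pl K.σ w0 = w0) : K.BB w0 ≤ (K.BB w0).comap K.N := by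
  rintro _ ⟨f, hf, m, rfl⟩
  refine ⟨K.nm f, K.nm_ne hf, q * m, ?_⟩
  rw [map_add, K.N_single h0, K.div_nm hf]

theorem N_sub (D : Dv M) : ∃ T, q • D = K.N D + (K.s T - T) := by
  refine ⟨- ∑ k ∈ Finset.range q, ∑ j ∈ Finset.range k, K.s^[j] D, ?_⟩
  rw [map_neg, map_sum, ← neg_sub', ← Finset.sum_sub_distrib, K.N_eq]
  have : ∀ k, K.s (∑ j ∈ Finset.range k, K.s^[j] D) - ∑ j ∈ Finset.range k, K.s^[j] D = K.s^[k] D - D := by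
    intro k
    rw [map_sum, ← Finset.sum_sub_distrib]
    simp only [← Function.iterate_succ_apply']
    rw [Finset.sum_range_sub (fun j => K.s^[j] D)]
    rfl
  simp only [this, Finset.sum_sub_distrib, Finset.sum_const, Finset.card_range]
  abel

theorem cocycle {w0 : FFPrime M} (h0 : pl K.σ w0 = w0) {D : Dv M} (hD : K.s D - D ∈ K.BB w0) :
    ∃ f : M, f ≠ 0 ∧ K.s D - D = K.hM.div f ∧ ∃ u : (algebraicClosure (ZMod p) L)ˣ, K.nm f = algebraMap L M (u : algebraicClosure (ZMod p) L) := by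
  obtain ⟨f, hf, m, h1⟩ := hD
  have h2 := congrArg K.N h1
  rw [map_sub, K.N_s, sub_self, map_add, K.N_single h0, ← K.div_nm hf] at h2
  have h3 : K.hM.div (K.nm f) = Finsupp.single w0 (-(q * m)) := by
    rw [Finsupp.single_neg]; exact eq_neg_of_add_eq_zero_left h2.symm
  obtain ⟨h4, h5⟩ := K.const_of_div (K.nm_ne hf) h3
  have hm : m = 0 := by
    have : (q : ℤ) ≠ 0 := by exact_mod_cast K.hq.ne_zero
    have := neg_eq_zero.mp h5
    simpa [K.hq.ne_zero] using this
  obtain ⟨u, hu⟩ := K.inv_const h4 (K.nm_ne hf) (K.σ_nm f)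
  refine ⟨f, hf, ?_, u, hu.symm⟩
  rw [h1, hm]; simp

theorem main_norm {b : L} (hb0 : b ≠ 0) (hb : ∀ v : FFPrime L, (q : ℤ) ∣ v.va.v b) : ∃ y, K.nm y = algebraMap L M b := by
  classical
  have hUf := K.hL.finite_const
  obtain ⟨w0, h0, hbase⟩ := K.exists_base
  have hfin := K.finite_Cl w0
  let mk := QuotientAddGroup.mk' (K.BB w0)
  have hmk : ∀ D, mk D = 0 ↔ D ∈ K.BB w0 := fun D => QuotientAddGroup.eq_zero_iff D
  let f : (Dv M ⧸ K.BB w0) →+ (Dv M ⧸ K.BB w0) := QuotientAddGroup.map _ _ K.N (K.N_BB h0)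
  let g : (Dv M ⧸ K.BB w0) →+ (Dv M ⧸ K.BB w0) := QuotientAddGroup.map _ _ K.s (K.s_BB h0) - AddMonoidHom.id _
  have hf : ∀ D, f (mk D) = mk (K.N D) := fun D => rfl
  have hg : ∀ D, g (mk D) = mk (K.s D - D) := fun D => rfl
  have hsurj : ∀ x, ∃ D, mk D = x := QuotientAddGroup.mk'_surjective _
  have hfg : ∀ x, f (g x) = 0 := by
    intro x
    obtain ⟨D, rfl⟩ := hsurj x
    rw [hg, hf, map_sub, K.N_s, sub_self, map_zero]
  have hgf : ∀ x, g (f x) = 0 := by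
    intro x
    obtain ⟨D, rfl⟩ := hsurj x
    rw [hf, hg, K.s_N, sub_self, map_zero]
  have hch : ∀ x, ∃ u : (algebraicClosure (ZMod p) L)ˣ, g x = 0 → ∃ D, mk D = x ∧ ∃ f : M, f ≠ 0 ∧ K.s D - D = K.hM.div f ∧
      K.nm f = algebraMap L M (u : algebraicClosure (ZMod p) L) := by
    intro x
    by_cases hx : g x = 0
    · obtain ⟨D, rfl⟩ := hsurj x
      rw [hg, hmk] at hx
      obtain ⟨f, hf, h1, u, hu⟩ := K.cocycle h0 hx
      exact ⟨u, fun _ => ⟨D, rfl, f, hf, h1, hu⟩⟩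
    · exact ⟨1, fun h => absurd h hx⟩
  choose h hh using hch
  obtain ⟨hle, hbij⟩ := herbrand_bij K.Lam f g hfg hgf h (by
    intro x y hx hy hxy
    obtain ⟨D1, rfl, f1, hf1, hd1, hn1⟩ := hh x hx
    obtain ⟨D2, rfl, f2, hf2, hd2, hn2⟩ := hh y hy
    obtain ⟨c, hc0, hca, hc⟩ := hxy
    have hz : K.nm (f2 * f1⁻¹ * c⁻¹) = 1 := by
      rw [K.nm_mul, K.nm_mul, K.nm_inv, K.nm_inv, hc, hn1, hn2, ← map_inv₀, ← map_inv₀, ← map_mul, ← map_mul, ← map_one (algebraMap L M)]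
      congr 1
      have : (((h (mk D1))⁻¹ * h (mk D2) : (algebraicClosure (ZMod p) L)ˣ) : algebraicClosure (ZMod p) L) =
        ((h (mk D1) : algebraicClosure (ZMod p) L))⁻¹ * (h (mk D2) : algebraicClosure (ZMod p) L) := by push_cast; rfl
      rw [this]
      have e1 : ((h (mk D1) : algebraicClosure (ZMod p) L) : L) ≠ 0 := fun h' => (h (mk D1)).ne_zero (Subtype.ext h')
      have e2 : ((h (mk D2) : algebraicClosure (ZMod p) L) : L) ≠ 0 := fun h' => (h (mk D2)).ne_zero (Subtype.ext h')
      push_cast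
      field_simp
    obtain ⟨y, hy0, hy⟩ := K.h90 hz
    have hd := congrArg K.hM.div hy
    rw [K.hM.div_mul (by simp [hf1, hf2, hc0]) (by simpa using hy0), K.hM.div_mul (by simp [hf1, hf2]) (by simpa using hc0),
      K.hM.div_mul hf2 (by simpa using hf1), K.hM.div_inv, K.hM.div_inv, K.div_const hca, ← hd1, ← hd2, K.div_σ hy0] at hd
    obtain ⟨g', hg0, E, m, hE⟩ := hbase (D2 - D1 + K.hM.div y) (by
      rw [map_add, map_sub]
      rw [← sub_eq_zero] at hd ⊢
      rw [← hd]; abel)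
    refine ⟨mk (-E), ?_⟩
    rw [hf, ← map_sub, map_neg, ← sub_eq_zero, ← map_sub, hmk]
    refine ⟨y⁻¹ * algebraMap L M g', mul_ne_zero (inv_ne_zero hy0) ((_root_.map_ne_zero _).mpr hg0), m, ?_⟩
    rw [K.hM.div_mul (inv_ne_zero hy0) ((_root_.map_ne_zero _).mpr hg0), K.hM.div_inv]
    rw [← sub_eq_zero] at hE ⊢
    rw [← hE]; abel)
  have hunit : K.Lam.index ≤ g.range.relIndex f.ker → ∀ u : (algebraicClosure (ZMod p) L)ˣ, ∃ y, K.nm y = algebraMap L M (u : algebraicClosure (ZMod p) L) := by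
    intro hi u
    obtain ⟨x, hx, c, hc0, hca, hc⟩ := hbij hi u
    obtain ⟨D1, rfl, f1, hf1, hd1, hn1⟩ := hh x hx
    refine ⟨f1 * c⁻¹, ?_⟩
    rw [K.nm_mul, K.nm_inv, hc, hn1, ← map_inv₀, ← map_mul]
    congr 1
    have : ((u⁻¹ * h (mk D1) : (algebraicClosure (ZMod p) L)ˣ) : algebraicClosure (ZMod p) L) =
        ((u : algebraicClosure (ZMod p) L))⁻¹ * (h (mk D1) : algebraicClosure (ZMod p) L) := by push_cast; rfl
    rw [this]
    have e1 : ((h (mk D1) : algebraicClosure (ZMod p) L) : L) ≠ 0 := fun h' => (h (mk D1)).ne_zero (Subtype.ext h')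
    have e2 : ((u : algebraicClosure (ZMod p) L) : L) ≠ 0 := fun h' => u.ne_zero (Subtype.ext h')
    push_cast
    field_simp
  -- the divisor of `b`
  have hbM : algebraMap L M b ≠ 0 := (_root_.map_ne_zero _).mpr hb0
  obtain ⟨Eb, hEb⟩ : ∃ Eb, K.N Eb = K.hM.div (algebraMap L M b) := by
    refine ⟨K.C (Finsupp.mapRange (fun n : ℤ => n / q) (by simp) (K.hL.div b)), ?_⟩
    rw [K.N_C, ← map_nsmul, ← K.C_div hb0]
    congr 1
    ext v
    rw [Finsupp.smul_apply, Finsupp.mapRange_apply, K.hL.div_apply hb0, nsmul_eq_mul]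
    exact Int.mul_ediv_cancel' (hb v)
  have hEbk : f (mk Eb) = 0 := by
    rw [hf, hmk, hEb]
    exact ⟨_, hbM, 0, by simp⟩
  -- reduction to one fact
  have hfinish : K.Lam.index ≤ g.range.relIndex f.ker → mk Eb ∈ g.range → ∃ y, K.nm y = algebraMap L M b := by
    rintro hi ⟨x, hx⟩
    obtain ⟨T, rfl⟩ := hsurj x
    rw [hg, ← sub_eq_zero, ← map_sub, hmk] at hx
    obtain ⟨y, hy0, m, hy⟩ := hx
    have h1 := congrArg K.N hy
    rw [map_sub, map_sub, K.N_s, sub_self, zero_sub, hEb, map_add, ← K.div_nm hy0, K.N_single h0] at h1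
    have h2 : K.hM.div (algebraMap L M b * K.nm y) = Finsupp.single w0 (-(q * m)) := by
      rw [K.hM.div_mul hbM (K.nm_ne hy0), Finsupp.single_neg]
      rw [← sub_eq_zero] at h1 ⊢
      rw [← neg_eq_zero, ← h1]; abel
    obtain ⟨h3, -⟩ := K.const_of_div (mul_ne_zero hbM (K.nm_ne hy0)) h2
    obtain ⟨u, hu⟩ := K.inv_const h3 (mul_ne_zero hbM (K.nm_ne hy0)) (by rw [map_mul, K.σ_nm, AlgEquiv.commutes])
    obtain ⟨y', hy'⟩ := hunit hi u
    refine ⟨y' * y⁻¹, ?_⟩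
    rw [K.nm_mul, K.nm_inv, hy', hu, mul_inv_cancel_right₀ (K.nm_ne hy0)]
  have h3 : g.range ≤ f.ker := by rintro _ ⟨x, rfl⟩; exact hfg x
  by_cases hcase : ∃ c : M, IsAlgebraic (ZMod p) c ∧ K.σ c ≠ c
  · have hi : K.Lam.index = 1 := by rw [K.Lam_top hcase, Subgroup.index_top]
    have hpos : g.range.relIndex f.ker ≠ 0 := by
      unfold AddSubgroup.relIndex
      exact AddSubgroup.index_ne_zero_of_finite
    refine hfinish (by omega) ?_
    exact AddSubgroup.relIndex_eq_one.mp (by omega : g.range.relIndex f.ker = 1) hEbk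
  · push Not at hcase
    obtain ⟨a', ha0, E, m, hE⟩ := hbase (K.hM.div K.α) (by
      rw [← K.div_σ K.α_ne, K.hσ, K.hM.div_mul ((_root_.map_ne_zero _).mpr (K.hζ.ne_zero K.hq.ne_zero)) K.α_ne, K.div_const, zero_add]
      refine (isAlg_ringHom (algebraMap L M)).mpr ?_
      refine IsAlgebraic.of_pow K.hq.pos ?_
      rw [K.hζ.pow_eq_one]; exact isAlgebraic_one)
    have haM : algebraMap L M a' ≠ 0 := (_root_.map_ne_zero _).mpr ha0
    have hζ1 : ∀ i, i < q → K.ζ ^ i = 1 → i = 0 := by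
      intro i hi h1
      by_contra h2
      exact absurd (Nat.le_of_dvd (Nat.pos_of_ne_zero h2) (K.hζ.dvd_of_pow_eq_one i h1)) (by omega)
    -- key computation
    have hkey : ∀ (i : ℕ) (z y : M) (T : Dv M) (n : ℤ), z ≠ 0 → K.σ z = z → y ≠ 0 → K.hM.div z = K.N (i • E) + K.hM.div (K.nm y) + Finsupp.single w0 n →
        K.ζ ^ i = 1 := by
      intro i z y T n hz0 hz hy0 hd
      have hE' : K.N E = K.hM.div K.α - K.hM.div (algebraMap L M a') - Finsupp.single w0 m := by rw [hE]; abel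
      have hαi := pow_ne_zero i K.α_ne
      have hai := pow_ne_zero i haM
      have h2 : K.hM.div (K.α ^ i * (z * algebraMap L M a' ^ i * (K.nm y)⁻¹)⁻¹) = Finsupp.single w0 (i * m - n) := by
        have e1 : z * algebraMap L M a' ^ i ≠ 0 := mul_ne_zero hz0 hai
        have e2 : z * algebraMap L M a' ^ i * (K.nm y)⁻¹ ≠ 0 := mul_ne_zero e1 (inv_ne_zero (K.nm_ne hy0))
        rw [K.hM.div_mul hαi (inv_ne_zero e2), K.hM.div_inv, K.hM.div_mul e1 (inv_ne_zero (K.nm_ne hy0)), K.hM.div_mul hz0 hai, K.hM.div_inv, hd,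
          K.hM.div_pow haM, K.hM.div_pow K.α_ne, map_nsmul, hE', Finsupp.single_sub]
        have : (Finsupp.single w0 ((i : ℤ) * m) : Dv M) = i • Finsupp.single w0 m := by
          rw [Finsupp.smul_single, nsmul_eq_mul]
        rw [this, smul_sub, smul_sub]; abel
      have e2 : z * algebraMap L M a' ^ i * (K.nm y)⁻¹ ≠ 0 := mul_ne_zero (mul_ne_zero hz0 hai) (inv_ne_zero (K.nm_ne hy0))
      obtain ⟨h3, -⟩ := K.const_of_div (mul_ne_zero hαi (inv_ne_zero e2)) h2
      have h4 := hcase _ h3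
      have h5 : K.σ (z * algebraMap L M a' ^ i * (K.nm y)⁻¹) = z * algebraMap L M a' ^ i * (K.nm y)⁻¹ := by
        rw [map_mul, map_mul, map_inv₀, map_pow, K.σ_nm, hz, AlgEquiv.commutes]
      rw [map_mul, map_inv₀, h5, map_pow, K.hσ] at h4
      have h6 := mul_right_cancel₀ (inv_ne_zero e2) h4
      rw [mul_pow] at h6
      have h7 := mul_right_cancel₀ hαi (h6.trans (one_mul _).symm)
      rw [← map_pow] at h7
      exact (algebraMap L M).injective (by rw [h7, map_one])
    have heker : mk E ∈ f.ker := by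
      change f (mk E) = 0
      rw [hf, hmk]
      refine ⟨K.α * (algebraMap L M a')⁻¹, mul_ne_zero K.α_ne (inv_ne_zero haM), -m, ?_⟩
      rw [K.hM.div_mul K.α_ne (inv_ne_zero haM), K.hM.div_inv, hE, Finsupp.single_neg]; abel
    have heran : mk E ∉ g.range := by
      rintro ⟨x, hx⟩
      obtain ⟨T, rfl⟩ := hsurj x
      rw [hg, ← sub_eq_zero, ← map_sub, hmk] at hx
      obtain ⟨y, hy0, n, hy⟩ := hx
      have h1 := congrArg K.N hy
      rw [map_sub, map_sub, K.N_s, sub_self, zero_sub, map_add, ← K.div_nm hy0, K.N_single h0] at h1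
      have h2 := hkey 1 1 y T (q * n) one_ne_zero (map_one _) hy0 (by
        rw [K.hM.div_one, one_smul, add_assoc, ← h1, add_neg_cancel])
      have := hζ1 1 K.hq.one_lt h2; omega
    have hqe : q • mk E ∈ g.range := by
      obtain ⟨T, hT⟩ := K.N_sub E
      refine ⟨mk T, ?_⟩
      rw [hg, ← map_nsmul, hT, map_add]
      have : mk (K.N E) = 0 := heker
      rw [this, zero_add]
    obtain ⟨hr, hmem⟩ := mem_of_relIndex_le K.hq h3 (hle.trans K.Lam_index) heker heran hqe
    have hidx : K.Lam.index ≤ g.range.relIndex f.ker := by rw [hr]; exact K.Lam_index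
    obtain ⟨i, hi, hEi⟩ := hmem (mk Eb) hEbk
    have hi0 : i = 0 := by
      refine hζ1 i hi ?_
      obtain ⟨x, hx⟩ := hEi
      obtain ⟨T, rfl⟩ := hsurj x
      rw [hg, ← map_nsmul, ← map_sub, ← sub_eq_zero, ← map_sub, hmk] at hx
      obtain ⟨y, hy0, n, hy⟩ := hx
      have h1 := congrArg K.N hy
      rw [map_sub, map_sub, K.N_s, sub_self, zero_sub, map_add, ← K.div_nm hy0, K.N_single h0, map_sub, hEb] at h1
      refine hkey i _ y⁻¹ T (-(q * n)) hbM (AlgEquiv.commutes _ _) (inv_ne_zero hy0) ?_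
      rw [K.nm_inv, K.hM.div_inv, Finsupp.single_neg, add_assoc, ← neg_add, ← h1]; abel
    rw [hi0, zero_nsmul, sub_zero] at hEi
    exact hfinish hidx hEi

end Kum
end

section
open Polynomial

/-- companion matrix of `X^q - a` -/
def cmat {R : Type} [CommRing R] (q : ℕ) (a : R) : Matrix (Fin q) (Fin q) R :=
  fun i j => if (i : ℕ) = j + 1 then 1 else if (i : ℕ) = 0 ∧ (j : ℕ) + 1 = q then a else 0

/-- the norm form -/
def normForm {R : Type} [CommRing R] (q : ℕ) (a : R) (y : Fin q → R) : R := (∑ i, y i • cmat q a ^ (i : ℕ)).det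

theorem cmat_map {R S : Type} [CommRing R] [CommRing S] (φ : R →+* S) (q : ℕ) (a : R) : φ.mapMatrix (cmat q a) = cmat q (φ a) := by
  ext i j
  simp only [cmat, RingHom.mapMatrix_apply, Matrix.map_apply]
  split_ifs <;> simp

theorem normForm_map {R S : Type} [CommRing R] [CommRing S] (φ : R →+* S) (q : ℕ) (a : R) (y : Fin q → R) :
    φ (normForm q a y) = normForm q (φ a) (fun i => φ (y i)) := by
  unfold normForm
  rw [RingHom.map_det, map_sum]
  congr 1
  refine Finset.sum_congr rfl fun i _ => ?_
  rw [← cmat_map, ← map_pow]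
  ext k l
  simp

theorem normForm_smul {R : Type} [CommRing R] (q : ℕ) (a c : R) (y : Fin q → R) :
    normForm q a (fun i => c * y i) = c ^ q * normForm q a y := by
  unfold normForm
  have : ∑ i, (c * y i) • cmat q a ^ (i : ℕ) = c • ∑ i, y i • cmat q a ^ (i : ℕ) := by
    rw [Finset.smul_sum]
    exact Finset.sum_congr rfl fun i _ => mul_smul _ _ _
  rw [this, Matrix.det_smul, Fintype.card_fin]

theorem cmat_pow_zero {R : Type} [CommRing R] {q : ℕ} (hq : 0 < q) (a : R) (n : ℕ) (hn : n < q) (i : Fin q) :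
    (cmat q a ^ n) i ⟨0, hq⟩ = if (i : ℕ) = n then 1 else 0 := by
  induction n generalizing i with
  | zero =>
    rw [pow_zero, Matrix.one_apply]
    simp [Fin.ext_iff]
  | succ n ih =>
    rw [pow_succ', Matrix.mul_apply, Finset.sum_eq_single ⟨n, by omega⟩]
    · rw [ih (by omega)]
      simp only [cmat]
      have : ¬ (n + 1 = q) := by omega
      simp [this]
    · intro l _ hl
      rw [ih (by omega), if_neg (fun h => hl (Fin.ext h)), mul_zero]
    · simp

theorem cmat_pow_q {R : Type} [CommRing R] {q : ℕ} (hq : 0 < q) (a : R) : cmat q a ^ q = a • (1 : Matrix (Fin q) (Fin q) R) := by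
  have h0 : ∀ i, (cmat q a ^ q) i ⟨0, hq⟩ = if (i : ℕ) = 0 then a else 0 := by
    intro i
    obtain ⟨n, rfl⟩ : ∃ n, q = n + 1 := ⟨q - 1, by omega⟩
    rw [pow_succ', Matrix.mul_apply, Finset.sum_eq_single ⟨n, by omega⟩]
    · rw [cmat_pow_zero hq _ _ (by omega)]
      have := i.2
      have h : ¬ ((i : ℕ) = n + 1) := by omega
      simp [cmat, h]
    · intro l _ hl
      rw [cmat_pow_zero hq _ _ (by omega), if_neg (fun h => hl (Fin.ext h)), mul_zero]
    · simp
  ext i j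
  have h1 : (cmat q a ^ q * cmat q a ^ (j : ℕ)) i ⟨0, hq⟩ = (cmat q a ^ q) i j := by
    rw [Matrix.mul_apply, Finset.sum_eq_single j]
    · rw [cmat_pow_zero hq _ _ j.2]; simp
    · intro l _ hl
      rw [cmat_pow_zero hq _ _ j.2, if_neg (fun h => hl (Fin.ext h)), mul_zero]
    · simp
  have h2 : (cmat q a ^ (j : ℕ) * cmat q a ^ q) i ⟨0, hq⟩ = if i = j then a else 0 := by
    rw [Matrix.mul_apply, Finset.sum_eq_single ⟨0, hq⟩]
    · rw [cmat_pow_zero hq _ _ j.2, h0]; simp [Fin.ext_iff]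
    · intro l _ hl
      rw [h0, if_neg (fun h => hl (Fin.ext h)), mul_zero]
    · simp
  rw [← h1, ← pow_add, add_comm, pow_add, h2]
  simp [Matrix.one_apply]

theorem normForm_ne_zero {F : Type} [Field F] {q : ℕ} (hq : 0 < q) {a : F} (hirr : Irreducible (X ^ q - C a : F[X])) {y : Fin q → F} {i : Fin q} (hi : y i ≠ 0) :
    normForm q a y ≠ 0 := by
  set f : F[X] := ∑ i : Fin q, C (y i) * X ^ (i : ℕ) with hf
  have hfi : ∀ i : Fin q, f.coeff i = y i := by
    intro i
    rw [hf, finsetSum_coeff, Finset.sum_eq_single i]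
    · simp
    · intro j _ hj
      rw [coeff_C_mul_X_pow, if_neg (fun h => hj (Fin.ext h.symm))]
    · simp
  have hf0 : f ≠ 0 := by
    intro h; apply hi; rw [← hfi, h, coeff_zero]
  have hdeg : f.degree < q := by
    refine (degree_sum_le _ _).trans_lt ?_
    rw [Finset.sup_lt_iff (by exact_mod_cast WithBot.bot_lt_coe q)]
    intro j _
    exact (degree_C_mul_X_pow_le _ _).trans_lt (by exact_mod_cast j.2)
  have hcop : IsCoprime (X ^ q - C a : F[X]) f := by
    rw [hirr.coprime_iff_not_dvd]
    intro hd
    have := degree_le_of_dvd hd hf0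
    rw [degree_X_pow_sub_C hq] at this
    exact absurd hdeg (not_lt.mpr this)
  obtain ⟨u, v, huv⟩ := hcop
  have h1 := congrArg (aeval (cmat q a)) huv
  rw [map_add, map_mul, map_mul, map_one, map_sub, map_pow, aeval_X, cmat_pow_q hq, aeval_C, Algebra.algebraMap_eq_smul_one, sub_self, mul_zero, zero_add] at h1
  have h2 : aeval (cmat q a) f = ∑ i, y i • cmat q a ^ (i : ℕ) := by
    rw [hf, map_sum]
    refine Finset.sum_congr rfl fun i _ => ?_
    rw [map_mul, aeval_C, map_pow, aeval_X, Algebra.algebraMap_eq_smul_one, smul_mul_assoc, one_mul]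
  rw [h2] at h1
  have h3 := congrArg Matrix.det h1
  rw [Matrix.det_mul, Matrix.det_one] at h3
  exact right_ne_zero_of_mul_eq_one h3

theorem normForm_prod {F : Type} [Field F] {q : ℕ} (hq : 0 < q) {a : F} (v : Fin q → F) (hinj : Function.Injective v) (hv : ∀ k, v k ^ q = a) (y : Fin q → F) :
    normForm q a y = ∏ k, ∑ i, y i * v k ^ (i : ℕ) := by
  have h1 : Matrix.vandermonde v * cmat q a = Matrix.diagonal v * Matrix.vandermonde v := by
    ext k j
    rw [Matrix.diagonal_mul, Matrix.mul_apply]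
    simp only [Matrix.vandermonde_apply]
    by_cases hj : (j : ℕ) + 1 = q
    · rw [Finset.sum_eq_single ⟨0, hq⟩]
      · simp only [cmat, pow_zero, hj, and_true, one_mul]
        rw [if_neg (by omega), if_pos trivial, ← hv k, ← pow_succ', hj]
      · intro l _ hl
        have h1 := l.2
        have h2 : ¬ ((l : ℕ) = 0) := fun h => hl (Fin.ext h)
        simp only [cmat]
        rw [if_neg (by omega), if_neg (by omega), mul_zero]
      · simp
    · have h2 := j.2
      rw [Finset.sum_eq_single ⟨(j : ℕ) + 1, by omega⟩]
      · simp [cmat, pow_succ']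
      · intro l _ hl
        have h2 : ¬ ((l : ℕ) = j + 1) := fun h => hl (Fin.ext h)
        simp only [cmat]
        rw [if_neg h2, if_neg (by tauto), mul_zero]
      · simp
  have h2 : ∀ n, Matrix.vandermonde v * cmat q a ^ n = Matrix.diagonal (fun k => v k ^ n) * Matrix.vandermonde v := by
    intro n
    induction n with
    | zero => simp
    | succ n ih =>
      rw [pow_succ, ← mul_assoc, ih, mul_assoc, h1, ← mul_assoc, Matrix.diagonal_mul_diagonal]
      simp only [pow_succ]
  have h3 : Matrix.vandermonde v * (∑ i, y i • cmat q a ^ (i : ℕ)) = Matrix.diagonal (fun k => ∑ i, y i * v k ^ (i : ℕ)) * Matrix.vandermonde v := by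
    rw [Finset.mul_sum]
    ext k j
    rw [Matrix.diagonal_mul, Matrix.sum_apply, Finset.sum_mul]
    refine Finset.sum_congr rfl fun i _ => ?_
    rw [Matrix.mul_smul, h2, Matrix.smul_apply, Matrix.diagonal_mul, smul_eq_mul, mul_assoc]
  have h4 := congrArg Matrix.det h3
  rw [Matrix.det_mul, Matrix.det_mul, Matrix.det_diagonal, mul_comm] at h4
  exact mul_right_cancel₀ (Matrix.det_vandermonde_ne_zero_iff.mpr hinj) h4

theorem normForm_split {F : Type} [Field F] {q : ℕ} (hq : 0 < q) {ζ g : F} (hζ : IsPrimitiveRoot ζ q) (hg : g ≠ 0) (b : F) :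
    ∃ y, normForm q (g ^ q) y = b := by
  let v : Fin q → F := fun k => ζ ^ (k : ℕ) * g
  have hinj : Function.Injective v := by
    intro i j hij
    exact Fin.ext (hζ.pow_inj i.2 j.2 (mul_right_cancel₀ hg hij))
  have hv : ∀ k, v k ^ q = g ^ q := by
    intro k
    simp only [v]
    rw [mul_pow, ← pow_mul, mul_comm (k : ℕ), pow_mul, hζ.pow_eq_one, one_pow, one_mul]
  have hdet : IsUnit (Matrix.vandermonde v).det := (Matrix.det_vandermonde_ne_zero_iff.mpr hinj).isUnit
  let t : Fin q → F := fun k => if k = ⟨0, hq⟩ then b else 1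
  refine ⟨(Matrix.vandermonde v)⁻¹.mulVec t, ?_⟩
  rw [normForm_prod hq v hinj hv]
  have h1 : ∀ k, ∑ i, ((Matrix.vandermonde v)⁻¹.mulVec t) i * v k ^ (i : ℕ) = t k := by
    intro k
    have : (Matrix.vandermonde v).mulVec ((Matrix.vandermonde v)⁻¹.mulVec t) = t := by
      rw [Matrix.mulVec_mulVec, Matrix.mul_nonsing_inv _ hdet, Matrix.one_mulVec]
    conv_rhs => rw [← this]
    rw [Matrix.mulVec, dotProduct]
    exact Finset.sum_congr rfl fun i _ => mul_comm _ _
  simp only [h1, t]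
  simp

variable {p q : ℕ} [Fact p.Prime]

theorem FunF.of_finite {L M : Type} [Field L] [Field M] [Algebra (ZMod p) L] [Algebra (ZMod p) M] [Algebra L M] [IsScalarTower (ZMod p) L M]
    (h : FunF p L) [Module.Finite L M] : FunF p M := by
  refine ⟨?_, ?_⟩
  · have h1 := h.td
    unfold TD1 at h1 ⊢
    rw [← _root_.trdeg_add_eq (ZMod p) L (A := M), h1, _root_.trdeg_eq_zero, add_zero]
  · have := h.fg
    exact Algebra.EssFiniteType.comp (ZMod p) L M

theorem thmH {L : Type} [Field L] [Algebra (ZMod p) L] (hL : FunF p L) (hq : q.Prime) (hqp : (q : ZMod p) ≠ 0) {ζ : L} (hζ : IsPrimitiveRoot ζ q)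
    {a b : L} (ha0 : a ≠ 0) (hb0 : b ≠ 0) (ha : ∀ v : FFPrime L, (q : ℤ) ∣ v.va.v a) (hb : ∀ v : FFPrime L, (q : ℤ) ∣ v.va.v b) :
    ∃ y : Fin q → L, normForm q a y = b := by
  by_cases hg : ∃ g, g ^ q = a
  · obtain ⟨g, rfl⟩ := hg
    exact normForm_split hq.pos hζ (by rintro rfl; simp [hq.ne_zero] at ha0) b
  push Not at hg
  have hirr := X_pow_sub_C_irreducible_of_prime hq hg
  have := Fact.mk hirr
  have hmon : (X ^ q - C a : L[X]).Monic := monic_X_pow_sub_C a hq.ne_zero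
  have hfin : Module.Finite L (AdjoinRoot (X ^ q - C a)) := hmon.finite_adjoinRoot
  have : NeZero q := ⟨hq.ne_zero⟩
  let η : rootsOfUnity q L := rootsOfUnity.mkOfPowEq ζ hζ.pow_eq_one
  have hroot : (AdjoinRoot.root (X ^ q - C a)) ^ q = algebraMap L (AdjoinRoot (X ^ q - C a)) a := root_X_pow_sub_C_pow q a
  let K : Kum p q L (AdjoinRoot (X ^ q - C a)) :=
    { hL := hL
      hM := hL.of_finite
      hq := hq
      hqp := hqp
      alg := inferInstance
      ζ := ζ
      hζ := hζ
      a := a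
      ha0 := ha0
      hav := ha
      α := AdjoinRoot.root _
      hα := hroot
      gen := by
        intro z
        obtain ⟨f, rfl⟩ := AdjoinRoot.mk_surjective z
        have h1 : AdjoinRoot.mk (X ^ q - C a) f = AdjoinRoot.mk (X ^ q - C a) (f %ₘ (X ^ q - C a)) := by
          rw [AdjoinRoot.mk_eq_mk]
          exact ⟨f /ₘ (X ^ q - C a), by rw [sub_eq_iff_eq_add, add_comm]; exact (modByMonic_add_div f _).symm⟩
        refine ⟨fun i => (f %ₘ (X ^ q - C a)).coeff i, ?_⟩
        have h2 : (f %ₘ (X ^ q - C a)).natDegree < q := by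
          have := natDegree_modByMonic_lt f hmon (by intro h; have := congrArg natDegree h; rw [natDegree_X_pow_sub_C, natDegree_one] at this; exact hq.ne_zero this)
          rwa [natDegree_X_pow_sub_C] at this
        rw [h1]
        conv_lhs => rw [as_sum_range_C_mul_X_pow' _ h2]
        rw [map_sum, Fin.sum_univ_eq_sum_range (fun i => algebraMap L (AdjoinRoot (X ^ q - C a)) ((f %ₘ (X ^ q - C a)).coeff i) * AdjoinRoot.root (X ^ q - C a) ^ i)]
        refine Finset.sum_congr rfl fun i _ => ?_
        rw [map_mul, map_pow, AdjoinRoot.mk_X, AdjoinRoot.mk_C]; rfl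
      σ := autAdjoinRootXPowSubC q a η
      hσ := by
        rw [autAdjoinRootXPowSubC_root, Algebra.smul_def]; rfl }
  obtain ⟨z, hz⟩ := K.main_norm hb0 hb
  obtain ⟨x, rfl⟩ := K.gen z
  refine ⟨x, (algebraMap L (AdjoinRoot (X ^ q - C a))).injective ?_⟩
  rw [← hz, normForm_map]
  rw [normForm_prod hq.pos (fun k : Fin q => algebraMap L _ (ζ ^ (k : ℕ)) * K.α)]
  · unfold Kum.nm
    rw [← Fin.prod_univ_eq_prod_range (fun k => (K.σ ^ k) (∑ i, algebraMap L _ (x i) * K.α ^ (i : ℕ)))]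
    refine Finset.prod_congr rfl fun k _ => ?_
    rw [map_sum]
    refine Finset.sum_congr rfl fun i _ => ?_
    rw [map_mul, AlgEquiv.commutes, map_pow (K.σ ^ (k : ℕ)), K.σ_pow]
  · intro i j hij
    have := mul_right_cancel₀ K.α_ne hij
    exact Fin.ext (hζ.pow_inj i.2 j.2 ((algebraMap L _).injective this))
  · intro k
    rw [mul_pow, K.hα, ← map_pow, ← pow_mul, mul_comm (k : ℕ), pow_mul, hζ.pow_eq_one, one_pow, map_one, one_mul]
end

section
open Polynomial

section M18
variable {p q : ℕ} [Fact p.Prime]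

/-- Passing to a function field inside `E`. -/
theorem exists_funF {E : Type} [Field E] [Algebra (ZMod p) E] (h : TD1 p E) (s : Finset E) :
    ∃ L : IntermediateField (ZMod p) E, FunF p L ∧ ∀ x ∈ s, x ∈ L := by
  classical
  obtain ⟨z, hz⟩ := h.exists_trans
  let L := IntermediateField.adjoin (ZMod p) ((insert z s : Finset E) : Set E)
  have hsub : ∀ x ∈ insert z s, x ∈ L := fun x hx => IntermediateField.subset_adjoin _ _ hx
  refine ⟨L, ⟨?_, ?_⟩, fun x hx => hsub x (Finset.mem_insert_of_mem hx)⟩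
  · have h1 := _root_.trdeg_add_eq (ZMod p) L (A := E)
    unfold TD1 at h ⊢
    rw [h] at h1
    have h2 : Algebra.trdeg (ZMod p) L ≠ 0 := by
      intro h0
      have : Algebra.IsAlgebraic (ZMod p) L := trdeg_eq_zero_iff.1 h0
      have := this.isAlgebraic (⟨z, hsub z (Finset.mem_insert_self _ _)⟩ : L)
      exact hz ((isAlg_ringHom (L.val : L →+* E)).2 this)
    refine le_antisymm ?_ (Cardinal.one_le_iff_ne_zero.2 h2)
    rw [← h1]; exact self_le_add_right _ _
  · rw [IntermediateField.essFiniteType_iff]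
    exact ⟨_, rfl⟩

theorem dvd_of_pow_eq {L : Type} [Field L] [Algebra (ZMod p) L] (w : FFPrime L) {x a r : L} (hx0 : x ≠ 0)
    (hx : IsAlgebraic (ZMod p) x) (ha : a ≠ 0) (hr : r ^ q = 1 + x⁻¹ ^ q * (a + a⁻¹)) : (q : ℤ) ∣ w.va.v a := by
  have hvx : w.va.v (x⁻¹ ^ q) = 0 := by
    rw [w.va.pow (inv_ne_zero hx0), w.va.inv hx0, FunF.v_alg hx0 hx]; simp
  have hxq : x⁻¹ ^ q ≠ 0 := pow_ne_zero _ (inv_ne_zero hx0)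
  have key : ∀ c : L, c ≠ 0 → w.va.v c < 0 → r ^ q = 1 + x⁻¹ ^ q * (c + c⁻¹) → (q : ℤ) ∣ w.va.v c := by
    intro c hc hlt hr
    have hc' : c⁻¹ ≠ 0 := inv_ne_zero hc
    have h1 : w.va.gt (w.va.v c) (c⁻¹) := Or.inr (by rw [w.va.inv hc]; omega)
    obtain ⟨h2, h3⟩ := w.va.v_eq_of_sub (x := c) (y := c + c⁻¹) hc (by rw [add_sub_cancel_left]; exact h1)
    have h4 : w.va.v (x⁻¹ ^ q * (c + c⁻¹)) = w.va.v c := by rw [w.va.mul hxq h2, hvx, h3, zero_add]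
    obtain ⟨h5, h6⟩ := w.va.v_eq_of_sub (x := x⁻¹ ^ q * (c + c⁻¹)) (y := r ^ q) (mul_ne_zero hxq h2) (by
      rw [hr, add_sub_cancel_right, h4]
      exact Or.inr (by rw [w.va.one]; exact hlt))
    have hr0 : r ≠ 0 ∨ q = 0 := by
      by_contra hh
      push Not at hh
      rw [hh.1, zero_pow hh.2] at h5; exact h5 rfl
    rcases hr0 with hr0 | hr0
    · rw [w.va.pow hr0, h4] at h6
      exact ⟨w.va.v r, by rw [← h6]; simp⟩
    · subst hr0
      rw [pow_zero, w.va.one, h4] at h6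
      rw [← h6]; exact dvd_zero _
  rcases lt_trichotomy (w.va.v a) 0 with h | h | h
  · exact key a ha h hr
  · rw [h]; exact dvd_zero _
  · have := key a⁻¹ (inv_ne_zero ha) (by rw [w.va.inv ha]; omega) (by rw [hr, inv_inv, add_comm a])
    rw [w.va.inv ha] at this
    exact (dvd_neg.1 this)

theorem const_field {E : Type} [Field E] [Algebra (ZMod p) E] (h : TD1 p E) (hq : q.Prime) (hqp : (q : ZMod p) ≠ 0)
    {ζ : E} (hζ : IsPrimitiveRoot ζ q) {x a b r1 r2 : E} (hx0 : x ≠ 0) (hx : IsAlgebraic (ZMod p) x) (ha : a ≠ 0) (hb : b ≠ 0)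
    (h1 : r1 ^ q = 1 + x⁻¹ ^ q * (a + a⁻¹)) (h2 : r2 ^ q = 1 + x⁻¹ ^ q * (b + b⁻¹)) :
    ∃ y : Fin q → E, normForm q a y = b := by
  classical
  obtain ⟨L, hL, hs⟩ := exists_funF h {ζ, x, a, b, r1, r2}
  lift ζ to L using hs _ (by simp)
  lift x to L using hs _ (by simp)
  lift a to L using hs _ (by simp)
  lift b to L using hs _ (by simp)
  lift r1 to L using hs _ (by simp)
  lift r2 to L using hs _ (by simp)
  have hζ' : IsPrimitiveRoot ζ q := IsPrimitiveRoot.of_map_of_injective (f := L.val) hζ L.val.injective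
  have hx' : IsAlgebraic (ZMod p) x := (isAlg_ringHom (L.val : L →+* E)).1 hx
  have hx0' : x ≠ 0 := by rintro rfl; exact hx0 rfl
  have ha' : a ≠ 0 := by rintro rfl; exact ha rfl
  have hb' : b ≠ 0 := by rintro rfl; exact hb rfl
  obtain ⟨y, hy⟩ := thmH hL hq hqp hζ' ha' hb'
    (fun v => dvd_of_pow_eq v hx0' hx' ha' (Subtype.ext (by simpa using h1)))
    (fun v => dvd_of_pow_eq v hx0' hx' hb' (Subtype.ext (by simpa using h2)))
  refine ⟨fun i => (y i : E), ?_⟩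
  have := normForm_map (L.val : L →+* E) (q := q) a y
  rw [hy] at this
  exact this.symm

theorem adjoinRoot_unramified {R : Type} [CommRing R] {e : R} (hq : IsUnit (q : R)) (he : IsUnit e) :
    Algebra.FormallyUnramified R (AdjoinRoot (X ^ q - C e)) := by
  rw [Algebra.FormallyUnramified.iff_comp_injective]
  intro B _ _ I hI g1 g2 hg
  have hI2 : ∀ u ∈ I, ∀ v ∈ I, u * v = 0 := by
    intro u hu v hv
    have : u * v ∈ I ^ 2 := by rw [pow_two]; exact Ideal.mul_mem_mul hu hv
    rw [hI] at this; exact this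
  apply AdjoinRoot.algHom_ext
  set ρ := AdjoinRoot.root (X ^ q - C e) with hρ
  have hroot : ρ ^ q = algebraMap R _ e := by
    have := AdjoinRoot.eval₂_root (X ^ q - C e)
    rw [eval₂_sub, eval₂_X_pow, eval₂_C, sub_eq_zero] at this
    exact this
  have hmem : g1 ρ - g2 ρ ∈ I := by
    rw [← Ideal.Quotient.eq]
    exact DFunLike.congr_fun hg ρ
  set ε := g1 ρ - g2 ρ with hε
  have h1 : g1 ρ = g2 ρ + ε := by rw [hε]; ring
  have h2 : g1 ρ ^ q = g2 ρ ^ q := by rw [← map_pow, ← map_pow, hroot, AlgHom.commutes, AlgHom.commutes]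
  have h3 : (g2 ρ + ε) ^ q = g2 ρ ^ q + q * g2 ρ ^ (q - 1) * ε := by
    obtain ⟨k, hk⟩ := Polynomial.binomExpansion (X ^ q : B[X]) (g2 ρ) ε
    rw [eval_pow, eval_X, derivative_X_pow, eval_mul, eval_pow, eval_X, eval_pow, eval_X, pow_two ε, hI2 ε hmem ε hmem] at hk
    rw [hk]; simp
  rw [h1, h3, add_eq_left] at h2
  have hu : IsUnit ((q : B) * g2 ρ ^ (q - 1)) := by
    refine IsUnit.mul (by simpa using hq.map (algebraMap R B)) ?_
    rcases Nat.eq_zero_or_pos q with h0 | h0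
    · subst h0; simp
    · refine IsUnit.pow _ ?_
      rw [← isUnit_pow_iff h0.ne', ← map_pow, hroot, AlgHom.commutes]
      exact he.map _
  have := hu.mul_right_eq_zero.1 h2
  rw [h1, this, add_zero]

/-- The ring `R[e1^{1/q}, e2^{1/q}]`. -/
abbrev TT1 (q : ℕ) {R : Type} [CommRing R] (e1 : R) : Type := AdjoinRoot (X ^ q - C e1 : R[X])
abbrev TT (q : ℕ) {R : Type} [CommRing R] (e1 e2 : R) : Type :=
  AdjoinRoot (X ^ q - C (AdjoinRoot.of (X ^ q - C e1 : R[X]) e2) : (TT1 q e1)[X])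
def ofTT (q : ℕ) {R : Type} [CommRing R] (e1 e2 : R) : R →+* TT q e1 e2 :=
  (AdjoinRoot.of (X ^ q - C (AdjoinRoot.of (X ^ q - C e1 : R[X]) e2) : (TT1 q e1)[X])).comp (AdjoinRoot.of (X ^ q - C e1 : R[X]))

theorem AdjoinRoot.root_pow' {R : Type} [CommRing R] (e : R) :
    AdjoinRoot.root (X ^ q - C e) ^ q = AdjoinRoot.of _ e := by
  have := AdjoinRoot.eval₂_root (X ^ q - C e)
  rw [eval₂_sub, eval₂_X_pow, eval₂_C, sub_eq_zero] at this
  exact this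

theorem const_alg_field {F E : Type} [Field F] [Algebra (ZMod p) F] [Field E] [Algebra F E] [Module.Finite F E] (h : TD1 p F) (hq : q.Prime)
    (hqp : (q : ZMod p) ≠ 0) {ζ : F} (hζ : IsPrimitiveRoot ζ q) {x a b : F} (hx0 : x ≠ 0) (hx : IsAlgebraic (ZMod p) x) (ha : a ≠ 0) (hb : b ≠ 0)
    {r1 r2 : E} (h1 : r1 ^ q = algebraMap F E (1 + x⁻¹ ^ q * (a + a⁻¹))) (h2 : r2 ^ q = algebraMap F E (1 + x⁻¹ ^ q * (b + b⁻¹))) :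
    ∃ y : Fin q → E, normForm q (algebraMap F E a) y = algebraMap F E b := by
  let φ := algebraMap F E
  let i1 : Algebra (ZMod p) E := (φ.comp (algebraMap (ZMod p) F)).toAlgebra
  have hst : IsScalarTower (ZMod p) F E := IsScalarTower.of_algebraMap_eq fun _ => rfl
  have hE : TD1 p E := by
    unfold TD1 at h ⊢
    rw [← _root_.trdeg_add_eq (ZMod p) F (A := E), h, _root_.trdeg_eq_zero, add_zero]
  exact const_field (E := E) hE hq hqp (ζ := φ ζ) (hζ.map_of_injective φ.injective)
      (x := φ x) (a := φ a) (b := φ b) (r1 := r1) (r2 := r2)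
      ((_root_.map_ne_zero φ).2 hx0) ((isAlg_ringHom φ).2 hx) ((_root_.map_ne_zero φ).2 ha) ((_root_.map_ne_zero φ).2 hb)
      (by rw [h1]; simp [φ]) (by rw [h2]; simp [φ])

theorem const_alg {F T : Type} [Field F] [Algebra (ZMod p) F] [CommRing T] [Algebra F T] [Module.Finite F T] [IsReduced T] (h : TD1 p F) (hq : q.Prime)
    (hqp : (q : ZMod p) ≠ 0) {ζ : F} (hζ : IsPrimitiveRoot ζ q) {x a b : F} (hx0 : x ≠ 0) (hx : IsAlgebraic (ZMod p) x) (ha : a ≠ 0) (hb : b ≠ 0)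
    {r1 r2 : T} (h1 : r1 ^ q = algebraMap F T (1 + x⁻¹ ^ q * (a + a⁻¹))) (h2 : r2 ^ q = algebraMap F T (1 + x⁻¹ ^ q * (b + b⁻¹))) :
    ∃ y : Fin q → T, normForm q (algebraMap F T a) y = algebraMap F T b := by
  have hart : IsArtinianRing T := IsArtinianRing.of_finite F _
  have hm : ∀ m : MaximalSpectrum T, ∃ y : Fin q → T ⧸ m.asIdeal,
      normForm q (algebraMap F (T ⧸ m.asIdeal) a) y = algebraMap F (T ⧸ m.asIdeal) b := by
    intro m
    have := m.isMaximal
    let i1 : Field (T ⧸ m.asIdeal) := Ideal.Quotient.field _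
    exact const_alg_field (E := T ⧸ m.asIdeal) h hq hqp hζ hx0 hx ha hb
      (r1 := Ideal.Quotient.mk _ r1) (r2 := Ideal.Quotient.mk _ r2)
      (by rw [← map_pow, h1]; rfl) (by rw [← map_pow, h2]; rfl)
  choose y hy using hm
  let ψ := IsArtinianRing.equivPi T
  refine ⟨fun i => ψ.symm (fun m => y m i), ψ.injective ?_⟩
  funext m
  have := normForm_map (Ideal.Quotient.mk m.asIdeal) (q := q) (algebraMap F T a) (fun i => ψ.symm (fun m => y m i))
  refine Eq.trans this ?_
  have h5 : (fun i => Ideal.Quotient.mk m.asIdeal (ψ.symm (fun m => y m i))) = y m := by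
    funext i
    change ψ (ψ.symm (fun m => y m i)) m = _
    rw [AlgEquiv.apply_symm_apply]
  rw [h5]
  exact hy m

theorem const_case {F : Type} [Field F] [Algebra (ZMod p) F] (h : TD1 p F) (hq : q.Prime) (hqp : (q : ZMod p) ≠ 0)
    {ζ : F} (hζ : IsPrimitiveRoot ζ q) {x a b e1 e2 : F} (hx0 : x ≠ 0) (hx : IsAlgebraic (ZMod p) x) (ha : a ≠ 0) (hb : b ≠ 0)
    (h1 : e1 = 1 + x⁻¹ ^ q * (a + a⁻¹)) (h2 : e2 = 1 + x⁻¹ ^ q * (b + b⁻¹)) (he1 : e1 ≠ 0) (he2 : e2 ≠ 0) :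
    ∃ Y : Fin q → TT q e1 e2, normForm q (ofTT q e1 e2 a) Y = ofTT q e1 e2 b := by
  have hqF : (q : F) ≠ 0 := by
    have := (_root_.map_ne_zero (algebraMap (ZMod p) F)).2 hqp
    simpa using this
  have u1 : Algebra.FormallyUnramified F (TT1 q e1) := adjoinRoot_unramified (Ne.isUnit hqF) (Ne.isUnit he1)
  have u2 : Algebra.FormallyUnramified (TT1 q e1) (TT q e1 e2) :=
    adjoinRoot_unramified (by simpa using (Ne.isUnit hqF).map (algebraMap F (TT1 q e1))) ((Ne.isUnit he2).map _)
  have u3 : Algebra.FormallyUnramified F (TT q e1 e2) := Algebra.FormallyUnramified.comp F (TT1 q e1) _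
  have f1 : Module.Finite F (TT1 q e1) := (monic_X_pow_sub_C e1 hq.ne_zero).finite_adjoinRoot
  have f2 : Module.Finite (TT1 q e1) (TT q e1 e2) := (monic_X_pow_sub_C _ hq.ne_zero).finite_adjoinRoot
  have f3 : Module.Finite F (TT q e1 e2) := Module.Finite.trans (TT1 q e1) _
  have hred : IsReduced (TT q e1 e2) := Algebra.FormallyUnramified.isReduced_of_field F _
  exact const_alg (F := F) (T := TT q e1 e2) h hq hqp hζ hx0 hx ha hb
    (r1 := AdjoinRoot.of _ (AdjoinRoot.root (X ^ q - C e1))) (r2 := AdjoinRoot.root _)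
    (by rw [← map_pow, AdjoinRoot.root_pow', ← h1]; rfl)
    (by rw [AdjoinRoot.root_pow', ← h2]; rfl)

end M18
end

section
open Polynomial

section M19
variable {F : Type} [Field F] {q : ℕ}

theorem normForm_val (V : Va F ℚ) (hq : q.Prime) {a : F} (ha0 : V.ge 0 a)
    (ha : ∀ c, V.ge 0 c → ¬ V.gt 0 (c ^ q - a)) {y : Fin q → F} (hy : ∃ i, y i ≠ 0) :
    ∃ c, c ≠ 0 ∧ normForm q a y ≠ 0 ∧ V.v (normForm q a y) = q * V.v c := by
  classical
  obtain ⟨i0, hi0⟩ := hy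
  obtain ⟨i, hi, hmin⟩ := Finset.exists_min_image (Finset.univ.filter fun i => y i ≠ 0) (fun i => V.v (y i)) ⟨i0, by simpa using hi0⟩
  simp only [Finset.mem_filter, Finset.mem_univ, true_and] at hi hmin
  refine ⟨y i, hi, ?_⟩
  have hge : ∀ j, V.ge 0 (y j / y i) := by
    intro j
    by_cases hj : y j = 0
    · left; rw [hj, zero_div]
    · right; rw [V.div hj hi]; linarith [hmin j hj]
  let y' : Fin q → V.O := fun j => ⟨y j / y i, hge j⟩
  let a' : V.O := ⟨a, ha0⟩
  have h1 : normForm q a y = y i ^ q * normForm q a (fun j => y j / y i) := by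
    rw [← normForm_smul]; congr 1; funext j; field_simp
  have h2 : ((normForm q a' y' : V.O) : F) = normForm q a (fun j => y j / y i) :=
    normForm_map V.O.subtype q a' y'
  have h3 : IsLocalRing.residue V.O (normForm q a' y') ≠ 0 := by
    rw [normForm_map]
    refine normForm_ne_zero hq.pos (X_pow_sub_C_irreducible_of_prime hq ?_) (i := i) ?_
    · intro b hb
      obtain ⟨c, rfl⟩ := IsLocalRing.residue_surjective b
      rw [← map_pow, Va.residue_eq] at hb
      exact ha c c.2 hb
    · have : y' i = 1 := Subtype.ext (div_self hi)
      rw [this, map_one]; exact one_ne_zero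
  rw [Ne, Va.residue_eq_zero, h2] at h3
  have h4 : normForm q a (fun j => y j / y i) ≠ 0 := fun h => h3 (Or.inl h)
  have h5 : V.v (normForm q a (fun j => y j / y i)) = 0 := by
    refine le_antisymm (not_lt.1 fun h => h3 (Or.inr h)) ?_
    have : V.ge 0 (normForm q a (fun j => y j / y i)) := by rw [← h2]; exact (normForm q a' y').2
    exact this.le h4
  rw [h1]
  refine ⟨mul_ne_zero (pow_ne_zero _ hi) h4, ?_⟩
  rw [V.mul (pow_ne_zero _ hi) h4, V.pow hi, h5]; simp

theorem eval_bound (V : Va F ℚ) (g : F[X]) : ∃ B : ℚ, ∀ s, V.ge 0 s → V.ge B (g.eval s) := by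
  induction g using Polynomial.induction_on' with
  | add f g hf hg =>
    obtain ⟨B, hB⟩ := hf
    obtain ⟨B', hB'⟩ := hg
    refine ⟨min B B', fun s hs => ?_⟩
    rw [eval_add]
    exact ((hB s hs).mono (min_le_left _ _)).add ((hB' s hs).mono (min_le_right _ _))
  | monomial n c =>
    refine ⟨V.v c, fun s hs => ?_⟩
    rw [eval_monomial, mul_comm]
    exact (hs.pow n).mul0 (Va.ge_self c)

theorem evalEval_bound (V : Va F ℚ) (g : F[X][X]) : ∃ B : ℚ, ∀ s t, V.ge 0 s → V.ge 0 t → V.ge B (g.evalEval s t) := by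
  induction g using Polynomial.induction_on' with
  | add f g hf hg =>
    obtain ⟨B, hB⟩ := hf
    obtain ⟨B', hB'⟩ := hg
    refine ⟨min B B', fun s t hs ht => ?_⟩
    rw [evalEval_add]
    exact ((hB s t hs ht).mono (min_le_left _ _)).add ((hB' s t hs ht).mono (min_le_right _ _))
  | monomial n c =>
    obtain ⟨B, hB⟩ := eval_bound V c
    refine ⟨B, fun s t hs ht => ?_⟩
    rw [evalEval, eval_monomial, eval_mul, eval_pow, eval_C, mul_comm]
    exact (ht.pow n).mul0 (hB s hs)

/-- The projection `F[X][X] → TT`. -/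
def prTT (q : ℕ) {R : Type} [CommRing R] (e1 e2 : R) : R[X][X] →+* TT q e1 e2 :=
  (AdjoinRoot.mk (X ^ q - C (AdjoinRoot.of (X ^ q - C e1 : R[X]) e2) : (TT1 q e1)[X])).comp
    (mapRingHom (AdjoinRoot.mk (X ^ q - C e1 : R[X])))

theorem prTT_surj {R : Type} [CommRing R] (e1 e2 : R) : Function.Surjective (prTT q e1 e2) := by
  intro t
  obtain ⟨f, rfl⟩ := AdjoinRoot.mk_surjective t
  obtain ⟨g, rfl⟩ := Polynomial.map_surjective _ (AdjoinRoot.mk_surjective (g := (X ^ q - C e1 : R[X]))) f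
  exact ⟨g, rfl⟩

theorem prTT_C {R : Type} [CommRing R] (e1 e2 a : R) : prTT q e1 e2 (C (C a)) = ofTT q e1 e2 a := by
  unfold prTT ofTT
  simp only [RingHom.comp_apply, coe_mapRingHom, map_C, AdjoinRoot.mk_C]

theorem prTT_ker {R : Type} [CommRing R] {e1 e2 : R} {f : R[X][X]} (h : prTT q e1 e2 f = 0) :
    ∃ g k : R[X][X], f = (X ^ q - C (C e2)) * g + C (X ^ q - C e1) * k := by
  unfold prTT at h
  rw [RingHom.comp_apply, AdjoinRoot.mk_eq_zero, coe_mapRingHom] at h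
  obtain ⟨g', hg'⟩ := h
  obtain ⟨g, rfl⟩ := Polynomial.map_surjective _ (AdjoinRoot.mk_surjective (g := (X ^ q - C e1 : R[X]))) g'
  have h1 : (f - (X ^ q - C (C e2)) * g).map (AdjoinRoot.mk (X ^ q - C e1 : R[X])) = 0 := by
    rw [Polynomial.map_sub, hg', Polynomial.map_mul, Polynomial.map_sub, Polynomial.map_pow, map_X, map_C, AdjoinRoot.mk_C, sub_self]
  have h2 : C (X ^ q - C e1) ∣ f - (X ^ q - C (C e2)) * g := by
    rw [C_dvd_iff_dvd_coeff]
    intro i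
    rw [← AdjoinRoot.mk_eq_zero, ← coeff_map, h1, coeff_zero]
  obtain ⟨k, hk⟩ := h2
  exact ⟨g, k, by rw [← hk]; ring⟩

theorem pole_case (V : Va F ℚ) (hq : q.Prime) (hqF : (q : F) ≠ 0) (hqv : V.v (q : F) = 0) {x : F} (hx0 : x ≠ 0) (hx : V.v x < 0)
    (hb : ∃ b, b ≠ 0 ∧ ∀ c, c ≠ 0 → V.v b ≠ q * V.v c)
    (ha : ∃ a, a ≠ 0 ∧ V.v a = 0 ∧ ∀ c, V.ge 0 c → ¬ V.gt 0 (c ^ q - a)) :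
    ∃ a b e1 e2 : F, a ≠ 0 ∧ b ≠ 0 ∧ e1 = 1 + x⁻¹ ^ q * (a + a⁻¹) ∧ e2 = 1 + x⁻¹ ^ q * (b + b⁻¹) ∧ e1 ≠ 0 ∧ e2 ≠ 0 ∧
      ¬ ∃ Y : Fin q → TT q e1 e2, normForm q (ofTT q e1 e2 a) Y = ofTT q e1 e2 b := by
  obtain ⟨a, ha0, hva, han⟩ := ha
  have hqpos : (0 : ℚ) < q := by exact_mod_cast hq.pos
  obtain ⟨b, hb0, hbn, hb1, hb2⟩ : ∃ b, b ≠ 0 ∧ (∀ c, c ≠ 0 → V.v b ≠ q * V.v c) ∧ 0 ≤ V.v b ∧ V.v b < q * (- V.v x) := by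
    obtain ⟨b, hb0, hbn⟩ := hb
    set P : ℚ := q * (- V.v x) with hP
    have hPpos : 0 < P := mul_pos hqpos (by linarith)
    set j : ℤ := ⌊V.v b / P⌋ with hj
    have hxj : x ^ ((q : ℤ) * j) ≠ 0 := zpow_ne_zero _ hx0
    have hv : V.v (b * x ^ ((q : ℤ) * j)) = V.v b - j * P := by
      rw [V.mul hb0 hxj, V.zpow hx0, hP]; simp; ring
    refine ⟨b * x ^ ((q : ℤ) * j), mul_ne_zero hb0 hxj, ?_, ?_, ?_⟩
    · intro c hc heq
      rw [hv] at heq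
      refine hbn (c * x ^ (-j)) (mul_ne_zero hc (zpow_ne_zero _ hx0)) ?_
      rw [V.mul hc (zpow_ne_zero _ hx0), V.zpow hx0]
      simp only [zsmul_eq_mul, Int.cast_neg]
      rw [hP] at heq
      linarith
    · rw [hv]
      have := (le_div_iff₀ hPpos).1 (Int.floor_le (V.v b / P))
      linarith
    · rw [hv]
      have := (div_lt_iff₀ hPpos).1 (Int.lt_floor_add_one (V.v b / P))
      linarith
  set δ : ℚ := q * (- V.v x) - V.v b with hδ
  have hδpos : 0 < δ := by rw [hδ]; linarith
  have hxq0 : x⁻¹ ^ q ≠ 0 := pow_ne_zero _ (inv_ne_zero hx0)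
  have hxq : V.v (x⁻¹ ^ q) = q * (- V.v x) := by
    rw [V.pow (inv_ne_zero hx0), V.inv hx0]; simp
  have key : ∀ c, c ≠ 0 → 0 ≤ V.v c → V.v c ≤ V.v b → V.ge δ (1 + x⁻¹ ^ q * (c + c⁻¹) - 1) := by
    intro c hc0 hc hcb
    rw [add_sub_cancel_left]
    have h1 : V.ge (- V.v b) (c + c⁻¹) := by
      refine Va.ge.add (Va.ge_of (by linarith)) (Va.ge_of ?_)
      rw [V.inv hc0]; linarith
    have := (Va.ge_self (V := V) (x⁻¹ ^ q)).mul h1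
    rw [hxq] at this
    exact this.mono (by rw [hδ]; linarith)
  have hne : ∀ e, V.ge δ (e - 1) → e ≠ 0 := by
    intro e he
    refine (V.v_eq_of_sub (x := 1) one_ne_zero ?_).1
    rw [V.one]; exact he.gt hδpos
  have k1 := key a ha0 hva.ge (by rw [hva]; exact hb1)
  have k2 := key b hb0 hb1 le_rfl
  refine ⟨a, b, _, _, ha0, hb0, rfl, rfl, hne _ k1, hne _ k2, ?_⟩
  set e1 := 1 + x⁻¹ ^ q * (a + a⁻¹) with he1
  set e2 := 1 + x⁻¹ ^ q * (b + b⁻¹) with he2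
  rintro ⟨Y, hY⟩
  choose y hy using fun i => prTT_surj (q := q) e1 e2 (Y i)
  have h1 : prTT q e1 e2 (normForm q (C (C a)) y - C (C b)) = 0 := by
    rw [map_sub, normForm_map, prTT_C, prTT_C]
    simp only [hy, hY, sub_self]
  obtain ⟨g, k, hgk⟩ := prTT_ker h1
  obtain ⟨B1, hB1⟩ := evalEval_bound V g
  obtain ⟨B2, hB2⟩ := evalEval_bound V k
  obtain ⟨n, hn⟩ := exists_nat_gt ((V.v b - min B1 B2) / δ)
  rw [div_lt_iff₀ hδpos] at hn
  obtain ⟨s1, hs1, hs1'⟩ := V.newton hq.one_le hqF hqv hδpos.le k1 n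
  obtain ⟨s2, hs2, hs2'⟩ := V.newton hq.one_le hqF hqv hδpos.le k2 n
  have g1 : V.ge 0 s1 := by simpa using (hs1.mono hδpos.le).add Va.ge_one
  have g2 : V.ge 0 s2 := by simpa using (hs2.mono hδpos.le).add Va.ge_one
  have h2 := congrArg (evalEvalRingHom s1 s2) hgk
  rw [map_sub, normForm_map] at h2
  simp only [coe_evalEvalRingHom, evalEval_add, evalEval_mul, evalEval_sub, evalEval_pow, evalEval_C, evalEval_X, eval_C, eval_sub, eval_pow, eval_X] at h2
  have h3 : V.gt (V.v b) (normForm q a (fun i => (y i).evalEval s1 s2) - b) := by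
    rw [h2]
    have hk : ((n + 1) • δ) = n * δ + δ := by rw [nsmul_eq_mul]; push_cast; ring
    rw [hk] at hs1' hs2'
    refine Va.gt.add ((hs2'.mul (hB1 _ _ g1 g2)).gt ?_) ((hs1'.mul (hB2 _ _ g1 g2)).gt ?_)
    · linarith [min_le_left B1 B2]
    · linarith [min_le_right B1 B2]
  obtain ⟨h4, h5⟩ := V.v_eq_of_sub hb0 h3
  have h6 : ∃ i, (y i).evalEval s1 s2 ≠ 0 := by
    by_contra hc
    push Not at hc
    apply h4
    have := normForm_smul q a 0 (fun i => (y i).evalEval s1 s2)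
    rw [zero_pow hq.ne_zero, zero_mul] at this
    rw [← this]; congr 1; funext i; rw [hc i, zero_mul]
  obtain ⟨c, hc0, -, hc⟩ := normForm_val V hq (Va.ge_of hva.ge) han h6
  exact hbn c hc0 (by rw [← h5, hc])

end M19
end

section
open Polynomial

section M20
variable {p q : ℕ} [Fact p.Prime]

theorem FFPrime.hasResidueCard_unique {E : Type} [Field E] (P : FFPrime E) {n : ℕ} (h : P.HasResidueCard n) :
    n = Nat.card P.va.kap := by
  obtain ⟨s, rfl, h1, h2, h3⟩ := h
  have g1 : ∀ x ∈ s, P.va.ge 0 x := fun x hx => (P.ge_iff 0 x).1 (h1 x hx)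
  have hbij : Function.Bijective (fun x : s => P.va.res (x : E)) := by
    constructor
    · intro x y hxy
      by_contra hne
      refine h2 x x.2 y y.2 (fun h => hne (Subtype.ext h)) ?_
      exact (P.gt_iff 0 _).2 ((Va.res_eq (g1 _ x.2) (g1 _ y.2)).1 hxy)
    · intro y
      obtain ⟨x, hx, rfl⟩ := Va.res_surj y
      obtain ⟨z, hz, hz'⟩ := h3 x ((P.ge_iff 0 x).2 hx)
      exact ⟨⟨z, hz⟩, ((Va.res_eq hx (g1 _ hz)).2 ((P.gt_iff 0 _).1 hz')).symm⟩
  rw [← Nat.card_eq_of_bijective _ hbij]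
  simp

theorem FFPrime.hasResidueCard {E : Type} [Field E] (P : FFPrime E) [Finite P.va.kap] :
    P.HasResidueCard (Nat.card P.va.kap) := by
  classical
  choose g hg hg' using fun y : P.va.kap => Va.res_surj y
  have := Fintype.ofFinite P.va.kap
  have ginj : Function.Injective g := fun a b h => by rw [← hg' a, ← hg' b, h]
  refine ⟨Finset.univ.image g, ?_, ?_, ?_, ?_⟩
  · rw [Finset.card_image_of_injective _ ginj, Finset.card_univ, Nat.card_eq_fintype_card]
  · intro x hx
    obtain ⟨y, -, rfl⟩ := Finset.mem_image.1 hx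
    exact (P.ge_iff 0 _).2 (hg y)
  · intro x hx y hy hne hlt
    obtain ⟨x, -, rfl⟩ := Finset.mem_image.1 hx
    obtain ⟨y, -, rfl⟩ := Finset.mem_image.1 hy
    have := (Va.res_eq (hg x) (hg y)).2 ((P.gt_iff 0 _).1 hlt)
    rw [hg', hg'] at this
    exact hne (by rw [this])
  · intro z hz
    have hz' := (P.ge_iff 0 z).1 hz
    refine ⟨g (P.va.res z), Finset.mem_image_of_mem _ (Finset.mem_univ _), (P.gt_iff 0 _).2 ?_⟩
    rw [← Va.res_eq hz' (hg _), hg']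

theorem FFPrime.ramIdx_spec {K L : Type} [Field K] [Field L] (w : FFPrime L) (v : FFPrime K) (φ : K →+* L) {c0 c1 : ℚ} (h0 : 0 < c0) (h1 : 0 < c1)
    (h : ∀ x, x ≠ 0 → c1 * w.va.v (φ x) = c0 * v.va.v x) : 0 < w.ramIdx v φ ∧ c0 = w.ramIdx v φ * c1 := by
  have hex : ∃ e : ℕ, w.LiesOverWith v φ e := by
    obtain ⟨π, hπ0, hπ⟩ := v.exists_v 1
    have h2 := h π hπ0
    rw [hπ] at h2
    have hpos : 0 < w.va.v (φ π) := by
      have : (0 : ℚ) < c1 * w.va.v (φ π) := by rw [h2]; simpa using h0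
      have := (mul_pos_iff_of_pos_left h1).1 this
      exact_mod_cast this
    refine ⟨(w.va.v (φ π)).toNat, by omega, ?_⟩
    rw [Int.toNat_of_nonneg hpos.le]
    intro x
    by_cases hx : x = 0
    · rw [hx, map_zero, w.ord_zero, v.ord_zero, WithTop.mul_top]
      exact_mod_cast hpos.ne'
    · rw [w.ord_eq ((_root_.map_ne_zero φ).2 hx), v.ord_eq hx, ← WithTop.coe_mul]
      congr 1
      have h3 := h x hx
      have : (c1 : ℚ) * (w.va.v (φ x) : ℚ) = c1 * ((w.va.v (φ π)) * (v.va.v x) : ℚ) := by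
        rw [h3, ← mul_assoc, h2]; simp
      exact_mod_cast mul_left_cancel₀ h1.ne' this
  have hs := hex.choose_spec
  have hr : w.ramIdx v φ = hex.choose := by unfold FFPrime.ramIdx; rw [dif_pos hex]
  rw [← hr] at hs
  refine ⟨hs.1, ?_⟩
  obtain ⟨π, hπ0, hπ⟩ := v.exists_v 1
  have h2 := h π hπ0
  have h3 := hs.2 π
  rw [w.ord_eq ((_root_.map_ne_zero φ).2 hπ0), v.ord_eq hπ0, ← WithTop.coe_mul, WithTop.coe_inj, hπ, mul_one] at h3
  rw [hπ, h3] at h2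
  simpa [mul_comm] using h2.symm

theorem FFPrime.resDeg_spec {K L : Type} [Field K] [Field L] (w : FFPrime L) (v : FFPrime K) [Finite v.va.kap] [Finite w.va.kap]
    (ι : v.va.kap →+* w.va.kap) : 0 < w.resDeg v ∧ Nat.card w.va.kap = Nat.card v.va.kap ^ w.resDeg v := by
  have hex : ∃ f : ℕ, 0 < f ∧ ∃ m n : ℕ, 1 < m ∧ v.HasResidueCard m ∧
      w.HasResidueCard n ∧ n = m ^ f := by
    let i1 : Algebra v.va.kap w.va.kap := ι.toAlgebra
    have hf : Module.Finite v.va.kap w.va.kap := Module.Finite.of_finite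
    exact ⟨Module.finrank v.va.kap w.va.kap, Module.finrank_pos, _, _, Finite.one_lt_card, v.hasResidueCard, w.hasResidueCard,
      Module.natCard_eq_pow_finrank⟩
  have hs := hex.choose_spec
  have hr : w.resDeg v = hex.choose := by unfold FFPrime.resDeg; rw [dif_pos hex]
  rw [← hr] at hs
  obtain ⟨h1, m, n, -, hm, hn, hmn⟩ := hs
  rw [v.hasResidueCard_unique hm, w.hasResidueCard_unique hn] at hmn
  exact ⟨h1, hmn⟩

theorem val_nontrivial {F0 K : Type} [Field F0] [Field K] [Algebra F0 K] [Algebra.IsAlgebraic F0 K] (V : Va K ℚ) {x : K} (hx0 : x ≠ 0) (hx : V.v x ≠ 0) :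
    ∃ z : F0, z ≠ 0 ∧ V.v (algebraMap F0 K z) ≠ 0 := by
  obtain ⟨g, hg0, hg⟩ := Algebra.IsAlgebraic.isAlgebraic (R := F0) x
  rw [aeval_eq_sum_range] at hg
  simp only [Algebra.smul_def] at hg
  have hne : ∀ i, g.coeff i ≠ 0 → algebraMap F0 K (g.coeff i) ≠ 0 := fun i h => (_root_.map_ne_zero _).2 h
  obtain ⟨i, -, j, -, hij, hi, hj, heq⟩ := V.exists_eq_of_sum _ _ hg
    ⟨g.natDegree, by simp, mul_ne_zero (hne _ (by simpa using hg0)) (pow_ne_zero _ hx0)⟩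
  have hi' := left_ne_zero_of_mul hi
  have hj' := left_ne_zero_of_mul hj
  by_contra hc
  push Not at hc
  rw [V.mul hi' (pow_ne_zero _ hx0), V.mul hj' (pow_ne_zero _ hx0), V.pow hx0, V.pow hx0, hc _ (fun h => hi' (by rw [h, map_zero])),
    hc _ (fun h => hj' (by rw [h, map_zero])), zero_add, zero_add, nsmul_eq_mul, nsmul_eq_mul] at heq
  exact hij (by exact_mod_cast mul_right_cancel₀ hx heq)

theorem qb_data {F0 K : Type} [Field F0] [Algebra (ZMod p) F0] (hF0 : FunF p F0) [Field K] [Algebra F0 K] [Algebra.IsAlgebraic F0 K]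
    (hqb : IsQBounded q F0 K) (V : Va K ℚ) {x : K} (hx0 : x ≠ 0) (hx : V.v x ≠ 0) :
    ∃ C : ℕ, ∃ v0 : FFPrime F0, ∃ c0 : ℚ, 0 < c0 ∧ (∀ y, y ≠ 0 → V.v (algebraMap F0 K y) = c0 * v0.va.v y) ∧
      ∀ s : Finset K, ∃ L : Subfield K, (∀ x ∈ s, x ∈ L) ∧ ∃ vL : FFPrime L, Finite vL.va.kap ∧ ∃ c1 : ℚ, 0 < c1 ∧
        (∀ y : L, y ≠ 0 → V.v (y : K) = c1 * vL.va.v y) ∧ (∃ e : ℕ, 0 < e ∧ c0 = e * c1 ∧ padicValNat q e ≤ C) ∧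
        (∃ f : ℕ, 0 < f ∧ Nat.card vL.va.kap = Nat.card v0.va.kap ^ f ∧ padicValNat q f ≤ C) := by
  classical
  obtain ⟨C, hC⟩ := hqb (FFVal.ofVa V ⟨x, hx0, hx⟩)
  obtain ⟨z, hz0, hz⟩ := val_nontrivial (F0 := F0) V hx0 hx
  obtain ⟨v0, c0, hc0, hv0⟩ := exists_prime hF0 (V.comap (algebraMap F0 K)) hz0 hz
  refine ⟨C, v0, c0, hc0, hv0, fun s => ?_⟩
  let L := IntermediateField.adjoin F0 (s : Set K)
  have hfin : FiniteDimensional F0 L := IntermediateField.finiteDimensional_adjoin fun x _ => Algebra.IsIntegral.isIntegral x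
  let i1 : Algebra (ZMod p) L := ((algebraMap F0 L).comp (algebraMap (ZMod p) F0)).toAlgebra
  have i2 : IsScalarTower (ZMod p) F0 L := IsScalarTower.of_algebraMap_eq fun _ => rfl
  have hL : FunF p L := hF0.of_finite
  have hzL : algebraMap F0 L z ≠ 0 := (_root_.map_ne_zero _).2 hz0
  obtain ⟨vL, c1, hc1, hvL⟩ := exists_prime hL (V.comap (L.val : L →+* K)) hzL hz
  obtain ⟨hA, hB⟩ := hC L hfin v0 vL
    ((FFVal.restrictsTo_iff _ _ _).2 ⟨c0, hc0, fun y hy => by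
      rw [FFVal.ofVa_v _ _ ((_root_.map_ne_zero _).2 hy)]; exact hv0 y hy⟩)
    ((FFVal.restrictsTo_iff _ _ _).2 ⟨c1, hc1, fun y hy => by
      rw [FFVal.ofVa_v _ _ ((_root_.map_ne_zero _).2 hy)]; exact hvL y hy⟩)
  have hcomp : ∀ y, y ≠ 0 → c1 * vL.va.v (algebraMap F0 L y) = c0 * v0.va.v y := by
    intro y hy
    rw [← hvL _ ((_root_.map_ne_zero _).2 hy), ← hv0 y hy]; rfl
  have hk0 : Module.Finite (ZMod p) v0.va.kap := hF0.finite_kap v0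
  have hkL : Module.Finite (ZMod p) vL.va.kap := hL.finite_kap vL
  have f0 : Finite v0.va.kap := Module.finite_of_finite (ZMod p)
  have fL : Finite vL.va.kap := Module.finite_of_finite (ZMod p)
  have hsgn : ∀ y, y ≠ 0 → (0 ≤ v0.va.v y → 0 ≤ vL.va.v (algebraMap F0 L y)) ∧ (0 < v0.va.v y → 0 < vL.va.v (algebraMap F0 L y)) := by
    intro y hy
    have h1 := hcomp y hy
    constructor
    · intro h
      have h2 : (0 : ℚ) ≤ c0 * v0.va.v y := mul_nonneg hc0.le (by exact_mod_cast h)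
      rw [← h1] at h2
      have := nonneg_of_mul_nonneg_right h2 hc1
      exact_mod_cast this
    · intro h
      have h2 : (0 : ℚ) < c0 * v0.va.v y := mul_pos hc0 (by exact_mod_cast h)
      rw [← h1] at h2
      have := (mul_pos_iff_of_pos_left hc1).1 h2
      exact_mod_cast this
  obtain ⟨ι, -⟩ := v0.va.exists_iota vL.va (algebraMap F0 L)
    (fun y hy => by
      by_cases h : y = 0
      · left; rw [h, map_zero]
      · exact Or.inr ((hsgn y h).1 (hy.le h)))
    (fun y hy => by
      by_cases h : y = 0
      · left; rw [h, map_zero]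
      · exact Or.inr ((hsgn y h).2 (hy.lt h)))
  obtain ⟨he, he'⟩ := vL.ramIdx_spec v0 (algebraMap F0 L) hc0 hc1 hcomp
  obtain ⟨hf, hf'⟩ := vL.resDeg_spec v0 ι
  exact ⟨L.toSubfield, fun y hy => IntermediateField.subset_adjoin _ _ hy, vL, fL, c1, hc1, hvL, ⟨_, he, he', hA⟩, ⟨_, hf, hf', hB⟩⟩

end M20
end

section
open Polynomial

section M21
variable {p q : ℕ} [Fact p.Prime]

theorem lin_rel {K K' : Type} [Field K] [Field K'] [Algebra K K'] [Module.Finite K K'] (h : Module.finrank K K' < q) (z : K') :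
    ∃ k : Fin q → K, (∃ i, k i ≠ 0) ∧ ∑ i, algebraMap K K' (k i) * z ^ (i : ℕ) = 0 := by
  have h1 : ¬ LinearIndependent K (fun i : Fin q => z ^ (i : ℕ)) := by
    intro hl
    have := hl.fintype_card_le_finrank
    rw [Fintype.card_fin] at this
    omega
  rw [Fintype.not_linearIndependent_iff] at h1
  obtain ⟨k, hk, hi⟩ := h1
  refine ⟨k, hi, ?_⟩
  simpa [Algebra.smul_def] using hk

theorem exists_ram {F0 K K' : Type} [Field F0] [Algebra (ZMod p) F0] (hF0 : FunF p F0) [Field K] [Algebra F0 K] [Algebra.IsAlgebraic F0 K]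
    (hq : q.Prime) (hqb : IsQBounded q F0 K) [Field K'] [Algebra K K'] [Module.Finite K K'] (hd : Module.finrank K K' < q)
    (V : Va K' ℚ) {x : K} (hx0 : x ≠ 0) (hx : V.v (algebraMap K K' x) ≠ 0) :
    ∃ b, b ≠ 0 ∧ ∀ c, c ≠ 0 → V.v b ≠ q * V.v c := by
  have := Fact.mk hq
  obtain ⟨C, v0, c0, hc0, hv0, hL⟩ := qb_data hF0 hqb (V.comap (algebraMap K K')) hx0 hx
  by_contra hcon
  push Not at hcon
  have hiter : ∀ n : ℕ, ∀ b : K', b ≠ 0 → ∃ c, c ≠ 0 ∧ V.v b = q ^ n * V.v c := by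
    intro n
    induction n with
    | zero => intro b hb; exact ⟨b, hb, by simp⟩
    | succ n ih =>
      intro b hb
      obtain ⟨c, hc, h1⟩ := ih b hb
      obtain ⟨d, hd, h2⟩ := hcon c hc
      exact ⟨d, hd, by rw [h1, h2]; ring⟩
  obtain ⟨π, hπ0, hπ⟩ := v0.exists_v 1
  have hπ0' : algebraMap K K' (algebraMap F0 K π) ≠ 0 := (_root_.map_ne_zero _).2 ((_root_.map_ne_zero _).2 hπ0)
  obtain ⟨c, hc, hcv⟩ := hiter (C + 1) _ hπ0'
  have hπv : V.v (algebraMap K K' (algebraMap F0 K π)) = c0 := by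
    have := hv0 π hπ0
    rw [hπ, Int.cast_one, mul_one] at this; exact this
  rw [hπv] at hcv
  obtain ⟨k, ⟨i0, hi0⟩, hk⟩ := lin_rel hd c
  have hne : ∀ y : K, y ≠ 0 → algebraMap K K' y ≠ 0 := fun y hy => (_root_.map_ne_zero _).2 hy
  obtain ⟨i, -, j, -, hij, hi, hj, heq⟩ := V.exists_eq_of_sum _ _ hk ⟨i0, Finset.mem_univ _, mul_ne_zero (hne _ hi0) (pow_ne_zero _ hc)⟩
  wlog hlt : j < i generalizing i j
  · exact this j i hij.symm hj hi heq.symm (lt_of_le_of_ne (not_lt.1 hlt) hij)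
  have hi' := left_ne_zero_of_mul hi
  have hj' := left_ne_zero_of_mul hj
  rw [V.mul hi' (pow_ne_zero _ hc), V.mul hj' (pow_ne_zero _ hc), V.pow hc, V.pow hc] at heq
  have hki : k i ≠ 0 := fun h => hi' (by rw [h, map_zero])
  have hkj : k j ≠ 0 := fun h => hj' (by rw [h, map_zero])
  set g := k j / k i with hg
  have hg0 : g ≠ 0 := div_ne_zero hkj hki
  have hgv : V.v (algebraMap K K' g) = ((i : ℕ) - (j : ℕ) : ℕ) * V.v c := by
    rw [hg, map_div₀, V.div hj' hi']
    simp only [nsmul_eq_mul] at heq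
    rw [Nat.cast_sub (le_of_lt hlt)]
    linarith
  obtain ⟨L, hsL, vL, -, c1, hc1, hvL, ⟨e, he, hce, hev⟩, -⟩ := hL {g}
  have h1 := hvL ⟨g, hsL g (by simp)⟩ (fun h => hg0 (congrArg Subtype.val h))
  change V.v (algebraMap K K' g) = _ at h1
  set m := (i : ℕ) - (j : ℕ) with hm
  set u := vL.va.v ⟨g, hsL g (by simp)⟩ with hu
  have h2 : ((q ^ (C + 1) : ℕ) : ℤ) * u = ((m * e : ℕ) : ℤ) := by
    have : c1 * ((q : ℚ) ^ (C + 1) * u) = c1 * (m * e) := by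
      calc c1 * ((q : ℚ) ^ (C + 1) * u) = q ^ (C + 1) * (c1 * u) := by ring
        _ = m * c0 := by rw [← h1, hgv, hcv]; ring
        _ = _ := by rw [hce]; ring
    have := mul_left_cancel₀ hc1.ne' this
    exact_mod_cast this
  have h3 : q ^ (C + 1) ∣ m * e := by
    have : ((q ^ (C + 1) : ℕ) : ℤ) ∣ ((m * e : ℕ) : ℤ) := ⟨u, h2.symm⟩
    exact_mod_cast this
  have hmq : ¬ q ∣ m := by
    intro h
    have := Nat.le_of_dvd (by have : (j : ℕ) < i := hlt; omega) h
    have := i.2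
    omega
  have h4 : q ^ (C + 1) ∣ e := Nat.Coprime.dvd_of_dvd_mul_left (Nat.Coprime.pow_left _ ((Nat.Prime.coprime_iff_not_dvd hq).2 hmq)) h3
  rw [padicValNat_dvd_iff_le he.ne'] at h4
  omega

theorem arith_bound (hq : q.Prime) {M0 C u n : ℕ} (hM : Nat.Coprime M0 q) (hM1 : 1 < M0) (hu : 0 < u) (hpv : padicValNat q u ≤ C)
    (h : q ^ n ∣ M0 ^ u - 1) : q ^ n < M0 ^ (q ^ C * (q - 1)) := by
  have := Fact.mk hq
  obtain ⟨w, hw⟩ : q ^ padicValNat q u ∣ u := pow_padicValNat_dvd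
  set v := padicValNat q u with hv
  have hqw : ¬ q ∣ w := by
    rintro ⟨w', rfl⟩
    have : q ^ (v + 1) ∣ u := ⟨w', by rw [hw, pow_succ, mul_assoc]⟩
    rw [padicValNat_dvd_iff_le hu.ne'] at this
    omega
  set M := M0 ^ (q ^ C * (q - 1)) with hMdef
  have hdvd : u ∣ (q ^ C * (q - 1)) * w := by
    rw [hw]
    have h1 : q ^ v ∣ q ^ C := pow_dvd_pow _ hpv
    have h2 : q ^ v ∣ q ^ C * (q - 1) := h1.mul_right _
    exact Nat.mul_dvd_mul h2 dvd_rfl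
  have hMge : 1 < M := by
    refine Nat.one_lt_pow ?_ hM1
    have := hq.two_le
    exact (Nat.mul_pos (pow_pos hq.pos _) (by omega)).ne'
  obtain ⟨t, ht⟩ := hdvd
  have e1 : ((q ^ n : ℕ) : ℤ) ∣ (M0 : ℤ) ^ u - 1 := by
    have h1 : ((q ^ n : ℕ) : ℤ) ∣ ((M0 ^ u - 1 : ℕ) : ℤ) := by exact_mod_cast h
    rwa [Nat.cast_sub (Nat.one_le_pow _ _ (by omega)), Nat.cast_pow, Nat.cast_one] at h1
  have e2 : (M0 : ℤ) ^ u - 1 ∣ (M : ℤ) ^ w - 1 := by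
    have h1 := sub_dvd_pow_sub_pow ((M0 : ℤ) ^ u) 1 t
    rw [one_pow, ← pow_mul, ← ht, pow_mul] at h1
    rw [hMdef, Nat.cast_pow]; exact h1
  have e3 := e1.trans e2
  rw [← geom_sum_mul] at e3
  have hMq : (M : ZMod q) = 1 := by
    rw [hMdef, Nat.cast_pow, mul_comm, pow_mul, ZMod.pow_card_sub_one_eq_one, one_pow]
    intro h0
    rw [ZMod.natCast_eq_zero_iff] at h0
    exact (Nat.Prime.coprime_iff_not_dvd hq).1 hM.symm h0
  have e4 : ¬ (q : ℤ) ∣ ∑ i ∈ Finset.range w, (M : ℤ) ^ i := by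
    intro h0
    rw [← ZMod.intCast_zmod_eq_zero_iff_dvd] at h0
    push_cast at h0
    rw [hMq] at h0
    simp only [one_pow, Finset.sum_const, Finset.card_range, nsmul_eq_mul, mul_one] at h0
    rw [ZMod.natCast_eq_zero_iff] at h0
    exact hqw h0
  have e5 : ((q ^ n : ℕ) : ℤ) ∣ (M : ℤ) - 1 := by
    refine IsCoprime.dvd_of_dvd_mul_left ?_ e3
    rw [Nat.cast_pow]
    exact IsCoprime.pow_left (((Nat.prime_iff_prime_int.1 hq).coprime_iff_not_dvd).2 e4)
  have e6 := Int.le_of_dvd (by omega) e5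
  omega

theorem exists_inert {F0 K K' : Type} [Field F0] [Algebra (ZMod p) F0] (hF0 : FunF p F0) [Field K] [Algebra F0 K] [Algebra.IsAlgebraic F0 K]
    (hq : q.Prime) (hpq : p ≠ q) (hqb : IsQBounded q F0 K) [Field K'] [Algebra (ZMod p) K'] [Algebra K K'] [Module.Finite K K'] (hd : Module.finrank K K' < q)
    (V : Va K' ℚ) {x : K} (hx0 : x ≠ 0) (hx : V.v (algebraMap K K' x) ≠ 0) {ζ : K'} (hζ : IsPrimitiveRoot ζ q) :
    ∃ a, a ≠ 0 ∧ V.v a = 0 ∧ ∀ c, V.ge 0 c → ¬ V.gt 0 (c ^ q - a) := by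
  classical
  have := Fact.mk hq
  obtain ⟨C, v0, c0, hc0, hv0, hL⟩ := qb_data hF0 hqb (V.comap (algebraMap K K')) hx0 hx
  by_contra hcon
  push Not at hcon
  have hroot : ∀ r : V.kap, r ≠ 0 → ∃ s, s ^ q = r := by
    intro r hr
    obtain ⟨a, ha, rfl⟩ := Va.res_surj r
    rw [Ne, Va.res_eq_zero ha] at hr
    have ha0 : a ≠ 0 := fun h => hr (Or.inl h)
    have hva : V.v a = 0 := le_antisymm (not_lt.1 fun h => hr (Or.inr h)) (ha.le ha0)
    obtain ⟨c, hc, hc'⟩ := hcon a ha0 hva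
    exact ⟨V.res c, by rw [← Va.res_pow hc, Va.res_eq (hc.pow _) ha]; exact hc'⟩
  have hζ0 : V.ge 0 ζ := Va.ge_of (V.v_of_pow_eq_one hq.ne_zero hζ.pow_eq_one).ge
  have hζq : V.res ζ ^ q = 1 := by rw [← Va.res_pow hζ0, hζ.pow_eq_one, Va.res_one]
  have hζ1 : V.res ζ ≠ 1 := by
    rw [← Va.res_one, Ne, Va.res_eq hζ0 Va.ge_one]
    intro hgt
    have hne : ζ - 1 ≠ 0 := sub_ne_zero.2 (hζ.ne_one hq.one_lt)
    have halg : IsAlgebraic (ZMod p) (ζ - 1) := by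
      refine IsAlgebraic.sub ?_ isAlgebraic_one
      refine ⟨X ^ q - 1, (monic_X_pow_sub_C (1 : ZMod p) hq.ne_zero).ne_zero, ?_⟩
      simp [hζ.pow_eq_one]
    exact V.transc_of_v (p := p) hne (hgt.lt hne).ne' halg
  have hiter : ∀ n : ℕ, ∃ s : V.kap, s ^ q ^ n = V.res ζ := by
    intro n
    induction n with
    | zero => exact ⟨V.res ζ, by rw [pow_zero, pow_one]⟩
    | succ n ih =>
      obtain ⟨s, hs⟩ := ih
      have hs0 : s ≠ 0 := by
        rintro rfl
        rw [zero_pow (pow_ne_zero _ hq.ne_zero)] at hs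
        rw [← hs, zero_pow hq.ne_zero] at hζq
        exact zero_ne_one hζq
      obtain ⟨r, hr⟩ := hroot s hs0
      exact ⟨r, by rw [pow_succ', pow_mul, hr, hs]⟩
  set M0 := Nat.card v0.va.kap with hM0
  set N := M0 ^ (q ^ C * (q - 1)) with hN
  obtain ⟨s, hs⟩ := hiter N
  have hord : orderOf s = q ^ (N + 1) := by
    refine orderOf_eq_prime_pow ?_ ?_
    · rw [hs]; exact hζ1
    · rw [pow_succ, pow_mul, hs, hζq]
  obtain ⟨z, hz, rfl⟩ := Va.res_surj s
  obtain ⟨k, ⟨i0, hi0⟩, hk⟩ := lin_rel hd z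
  obtain ⟨i, hi, hmin⟩ := Finset.exists_min_image (Finset.univ.filter fun i => k i ≠ 0) (fun i => V.v (algebraMap K K' (k i))) ⟨i0, by simpa using hi0⟩
  simp only [Finset.mem_filter, Finset.mem_univ, true_and] at hi hmin
  obtain ⟨L, hsL, vL, fL, c1, hc1, hvL, -, ⟨f, hf0, hf, hfv⟩⟩ := hL (Finset.univ.image fun j => k j / k i)
  let y : Fin q → L := fun j => ⟨k j / k i, hsL _ (Finset.mem_image_of_mem _ (Finset.mem_univ j))⟩
  have hsgn : ∀ u : L, u ≠ 0 → V.v (algebraMap K K' (u : K)) = c1 * vL.va.v u := hvL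
  have hyge : ∀ j, vL.va.ge 0 (y j) := by
    intro j
    by_cases hj : k j = 0
    · left; exact Subtype.ext (by simp [y, hj])
    · right
      have hyj : y j ≠ 0 := fun h => div_ne_zero hj hi (congrArg Subtype.val h)
      have h1 := hsgn _ hyj
      have h2 : 0 ≤ c1 * vL.va.v (y j) := by
        rw [← h1]
        change 0 ≤ V.v (algebraMap K K' (k j / k i))
        rw [map_div₀, V.div ((_root_.map_ne_zero _).2 hj) ((_root_.map_ne_zero _).2 hi)]
        linarith [hmin j hj]
      have := nonneg_of_mul_nonneg_right h2 hc1
      exact_mod_cast this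
  let φ : L →+* K' := (algebraMap K K').comp L.subtype
  have hφ0 : ∀ u, vL.va.ge 0 u → V.ge 0 (φ u) := by
    intro u hu
    by_cases h : u = 0
    · left; rw [h, map_zero]
    · right
      have h2 : (0 : ℚ) ≤ vL.va.v u := by exact_mod_cast hu.le h
      change 0 ≤ V.v (algebraMap K K' (u : K))
      rw [hsgn u h]; exact mul_nonneg hc1.le h2
  have hφ1 : ∀ u, vL.va.gt 0 u → V.gt 0 (φ u) := by
    intro u hu
    by_cases h : u = 0
    · left; rw [h, map_zero]
    · right
      have h2 : (0 : ℚ) < vL.va.v u := by exact_mod_cast hu.lt h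
      change 0 < V.v (algebraMap K K' (u : K))
      rw [hsgn u h]; exact mul_pos hc1 h2
  obtain ⟨ι, hι⟩ := vL.va.exists_iota V φ hφ0 hφ1
  let i1 : Algebra vL.va.kap V.kap := ι.toAlgebra
  set g : (vL.va.kap)[X] := ∑ j : Fin q, Polynomial.C (vL.va.res (y j)) * X ^ (j : ℕ) with hg
  have hgi : g.coeff i = 1 := by
    rw [hg, finsetSum_coeff, Finset.sum_eq_single i]
    · have : y i = 1 := Subtype.ext (div_self hi)
      rw [coeff_C_mul_X_pow, if_pos rfl, this, Va.res_one]
    · intro j _ hj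
      rw [coeff_C_mul_X_pow, if_neg (fun h => hj (Fin.ext h.symm))]
    · intro h; exact absurd (Finset.mem_univ _) h
  have hg0 : g ≠ 0 := by intro h; rw [h, coeff_zero] at hgi; exact zero_ne_one hgi
  have hgdeg : g.degree < q := by
    refine lt_of_le_of_lt (degree_sum_le _ _) ?_
    rw [Finset.sup_lt_iff (by exact WithBot.bot_lt_coe _)]
    intro j _
    exact lt_of_le_of_lt (degree_C_mul_X_pow_le _ _) (by exact_mod_cast j.2)
  have hgz : aeval (V.res z) g = 0 := by
    rw [hg, map_sum]
    have h1 : V.res (∑ j, φ (y j) * z ^ (j : ℕ)) = 0 := by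
      have : ∑ j, φ (y j) * z ^ (j : ℕ) = 0 := by
        have h2 : ∀ j, φ (y j) * z ^ (j : ℕ) = (algebraMap K K' (k i))⁻¹ * (algebraMap K K' (k j) * z ^ (j : ℕ)) := by
          intro j
          change algebraMap K K' (k j / k i) * _ = _
          rw [map_div₀]; ring
        simp only [h2]
        rw [← Finset.mul_sum, hk, mul_zero]
      rw [this, Va.res_eq_zero (Va.ge_zero' _)]; exact Va.gt_zero' _
    rw [Va.res_sum (fun j _ => (hφ0 _ (hyge j)).mul0 (hz.pow _))] at h1
    rw [← h1]
    refine Finset.sum_congr rfl fun j _ => ?_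
    rw [map_mul, aeval_C, map_pow, aeval_X, Va.res_mul (hφ0 _ (hyge j)) (hz.pow _), Va.res_pow hz, ← hι _ (hyge j)]
    rfl
  have hIntg : IsIntegral vL.va.kap (V.res z) := IsAlgebraic.isIntegral ⟨g, hg0, hgz⟩
  set d := (minpoly vL.va.kap (V.res z)).natDegree with hdd
  have hd0 : 0 < d := minpoly.natDegree_pos hIntg
  have hdq : d < q := by
    have h1 := minpoly.degree_le_of_ne_zero _ _ hg0 hgz
    have h2 := lt_of_le_of_lt h1 hgdeg
    rw [degree_eq_natDegree (minpoly.ne_zero hIntg)] at h2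
    exact_mod_cast h2
  let S := IntermediateField.adjoin vL.va.kap {V.res z}
  have hSfin : FiniteDimensional vL.va.kap S := IntermediateField.adjoin.finiteDimensional hIntg
  have hScard : Nat.card S = M0 ^ (f * d) := by
    rw [Module.natCard_eq_pow_finrank (K := vL.va.kap) (V := S), IntermediateField.adjoin.finrank hIntg, hf, pow_mul]
  have hSf : Finite S := Module.finite_of_finite vL.va.kap
  have := Fintype.ofFinite S
  have hpow : V.res z ^ (M0 ^ (f * d) - 1) = 1 := by
    have h1 : (⟨V.res z, IntermediateField.mem_adjoin_simple_self _ _⟩ : S) ≠ 0 := by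
      intro h
      have h2 : V.res z = 0 := congrArg Subtype.val h
      rw [h2, zero_pow (pow_ne_zero _ hq.ne_zero)] at hs
      rw [← hs, zero_pow hq.ne_zero] at hζq
      exact zero_ne_one hζq
    have h2 := FiniteField.pow_card_sub_one_eq_one _ h1
    rw [← Nat.card_eq_fintype_card, hScard] at h2
    exact congrArg Subtype.val h2
  have hdvd := orderOf_dvd_of_pow_eq_one hpow
  rw [hord] at hdvd
  have hk0 : Module.Finite (ZMod p) v0.va.kap := hF0.finite_kap v0
  have f0 : Finite v0.va.kap := Module.finite_of_finite (ZMod p)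
  have hbound := arith_bound hq (C := C) (M0 := M0)
    (by rw [hM0, hF0.card_kap]; exact Nat.Coprime.pow_left _ ((Nat.coprime_primes Fact.out hq).2 hpq))
    Finite.one_lt_card (Nat.mul_pos hf0 hd0)
    (by rw [padicValNat.mul hf0.ne' hd0.ne', padicValNat.eq_zero_of_not_dvd (fun h => absurd (Nat.le_of_dvd hd0 h) (by omega))]; exact hfv) hdvd
  have : N + 1 < q ^ (N + 1) := Nat.lt_pow_self hq.one_lt
  omega

end M21
end

section
open Polynomial

section M22
variable {p q : ℕ} [Fact p.Prime]

theorem funF_ratFunc : FunF p (RatFunc (ZMod p)) := by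
  refine ⟨?_, ?_⟩
  · refine TD1.of_algebraic (z := RatFunc.X) RatFunc.transcendental_X ?_
    intro y
    let A := Algebra.adjoin (ZMod p) {(RatFunc.X : RatFunc (ZMod p))}
    have hmem : ∀ f : (ZMod p)[X], algebraMap (ZMod p)[X] (RatFunc (ZMod p)) f ∈ A := by
      intro f
      have : algebraMap (ZMod p)[X] (RatFunc (ZMod p)) f = aeval RatFunc.X f := by
        rw [RatFunc.aeval_X_left_eq_algebraMap]
      rw [this]; exact aeval_mem_adjoin_singleton _ _
    have halg : ∀ f : (ZMod p)[X], IsAlgebraic A (algebraMap (ZMod p)[X] (RatFunc (ZMod p)) f) :=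
      fun f => isAlgebraic_algebraMap (⟨_, hmem f⟩ : A)
    rw [← RatFunc.num_div_denom y, div_eq_mul_inv]
    exact (halg _).mul (halg _).inv
  · have h1 : Algebra.EssFiniteType (ZMod p)[X] (RatFunc (ZMod p)) :=
      Algebra.EssFiniteType.of_isLocalization _ (nonZeroDivisors (ZMod p)[X])
    exact Algebra.EssFiniteType.comp (ZMod p) (ZMod p)[X] (RatFunc (ZMod p))

/-- The condition on `x`. -/
def Cond (q : ℕ) {F : Type} [Field F] (x : F) : Prop :=
  ∀ a b e1 e2 : F, a ≠ 0 → b ≠ 0 → e1 = 1 + x⁻¹ ^ q * (a + a⁻¹) → e2 = 1 + x⁻¹ ^ q * (b + b⁻¹) → e1 ≠ 0 → e2 ≠ 0 →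
    ∃ Y : Fin q → TT q e1 e2, normForm q (ofTT q e1 e2 a) Y = ofTT q e1 e2 b

theorem cond_iff {F0 K K' : Type} [Field F0] [Algebra (ZMod p) F0] (hF0 : FunF p F0) [Field K] [Algebra F0 K] [Algebra.IsAlgebraic F0 K]
    [Algebra (ZMod p) K] [IsScalarTower (ZMod p) F0 K]
    (hq : q.Prime) (hpq : p ≠ q) (hqb : IsQBounded q F0 K) [Field K'] [Algebra K K'] [Module.Finite K K'] (hd : Module.finrank K K' < q)
    {ζ : K'} (hζ : IsPrimitiveRoot ζ q) {x : K} (hx0 : x ≠ 0) :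
    IsAlgebraic (ZMod p) x ↔ Cond q (algebraMap K K' x) := by
  have hqp : (q : ZMod p) ≠ 0 := by
    rw [Ne, ZMod.natCast_eq_zero_iff, Nat.prime_dvd_prime_iff_eq Fact.out hq]
    exact hpq
  let i1 : Algebra (ZMod p) K' := ((algebraMap K K').comp (algebraMap (ZMod p) K)).toAlgebra
  have i2 : IsScalarTower (ZMod p) K K' := IsScalarTower.of_algebraMap_eq fun _ => rfl
  have hK : TD1 p K := by
    have h := hF0.td
    unfold TD1 at h ⊢
    rw [← _root_.trdeg_add_eq (ZMod p) F0 (A := K), h, _root_.trdeg_eq_zero, add_zero]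
  have hK' : TD1 p K' := by
    have h := hK
    unfold TD1 at h ⊢
    rw [← _root_.trdeg_add_eq (ZMod p) K (A := K'), h, _root_.trdeg_eq_zero, add_zero]
  have hx0' : algebraMap K K' x ≠ 0 := (_root_.map_ne_zero _).2 hx0
  constructor
  · intro hx a b e1 e2 ha hb h1 h2 he1 he2
    exact const_case hK' hq hqp hζ hx0' ((isAlg_ringHom _).2 hx) ha hb h1 h2 he1 he2
  · intro hc
    by_contra hx
    have htr : Transcendental (ZMod p) (algebraMap K K' x)⁻¹ := fun h => hx ((isAlg_ringHom _).1 (by simpa using h.inv))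
    obtain ⟨V, hV⟩ := exists_va_zero hK' htr
    have hVx : V.v (algebraMap K K' x) = -1 := by
      rw [V.inv hx0'] at hV; linarith
    have hVx' : V.v (algebraMap K K' x) ≠ 0 := by rw [hVx]; norm_num
    have hq' : algebraMap (ZMod p) K' (q : ZMod p) = (q : K') := by simp
    obtain ⟨a, b, e1, e2, ha, hb, h1, h2, he1, he2, hno⟩ := pole_case V hq (by rw [← hq']; exact (_root_.map_ne_zero _).2 hqp)
      (by rw [← hq']; exact V.v_const hqp) hx0' (by rw [hVx]; norm_num)
      (exists_ram hF0 hq hqb hd V hx0 hVx') (exists_inert hF0 hq hpq hqb hd V hx0 hVx' hζ)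
    exact hno (hc a b e1 e2 ha hb h1 h2 he1 he2)

theorem exists_cyc {K : Type} [Field K] (hq : q.Prime) (hqK : (q : K) ≠ 0) :
    ∃ (K' : Type) (_ : Field K') (_ : Algebra K K') (_ : Module.Finite K K') (ζ : K'), Module.finrank K K' < q ∧ IsPrimitiveRoot ζ q := by
  have : NeZero q := ⟨hq.ne_zero⟩
  have : NeZero (q : K) := ⟨hqK⟩
  have hfin : Module.Finite K (CyclotomicField q K) := IsCyclotomicExtension.finiteDimensional {q} K _
  have hζ := IsCyclotomicExtension.zeta_spec q K (CyclotomicField q K)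
  refine ⟨CyclotomicField q K, inferInstance, inferInstance, hfin, _, ?_, hζ⟩
  rw [(hζ.powerBasis K).finrank, IsPrimitiveRoot.powerBasis_dim]
  have h1 : (minpoly K (IsCyclotomicExtension.zeta q K (CyclotomicField q K))).natDegree ≤ (cyclotomic q K).natDegree := by
    refine natDegree_le_of_dvd (minpoly.dvd _ _ ?_) (cyclotomic_ne_zero _ _)
    rw [aeval_def, ← eval_map, map_cyclotomic]
    exact hζ.isRoot_cyclotomic hq.pos
  rw [natDegree_cyclotomic] at h1
  exact lt_of_le_of_lt h1 (Nat.totient_lt _ hq.one_lt)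

end M22
end

section
open Polynomial

section M23
open Module

/-- decode coordinates -/
def dec {K K' : Type} [Field K] [Field K'] [Algebra K K'] {d : ℕ} (B : Basis (Fin d) K K') {α : Type} (u : α × Fin d → K) : α → K' :=
  fun i => ∑ k, u (i, k) • B k

/-- definability of a subset of `K'^α` over `K` -/
def Dfn {K K' : Type} [Field K] [Field K'] [Algebra K K'] {d : ℕ} (B : Basis (Fin d) K K') {α : Type} (S : Set (α → K')) : Prop :=
  letI : FirstOrder.Ring.CompatibleRing K := FirstOrder.Ring.compatibleRingOfRing K
  Set.Definable (Set.univ : Set K) FirstOrder.Language.ring {u : α × Fin d → K | dec B u ∈ S}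

variable {K K' : Type} [Field K] [Field K'] [Algebra K K'] {d : ℕ} (B : Basis (Fin d) K K') {α β : Type}

theorem dec_surj (v : α → K') : ∃ u, dec B u = v :=
  ⟨fun x => B.repr (v x.1) x.2, funext fun i => B.sum_repr (v i)⟩

theorem Dfn.inter {S T : Set (α → K')} (hS : Dfn B S) (hT : Dfn B T) : Dfn B (S ∩ T) := by
  unfold Dfn at *
  let : FirstOrder.Ring.CompatibleRing K := FirstOrder.Ring.compatibleRingOfRing K
  exact Set.Definable.inter hS hT

theorem Dfn.compl {S : Set (α → K')} (hS : Dfn B S) : Dfn B Sᶜ := by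
  unfold Dfn at *
  let : FirstOrder.Ring.CompatibleRing K := FirstOrder.Ring.compatibleRingOfRing K
  exact Set.Definable.compl hS

theorem Dfn.exists [Finite β] {S : Set (α ⊕ β → K')} (hS : Dfn B S) : Dfn B {v | ∃ w : β → K', Sum.elim v w ∈ S} := by
  unfold Dfn at *
  letI : FirstOrder.Ring.CompatibleRing K := FirstOrder.Ring.compatibleRingOfRing K
  have h1 := Set.Definable.exists_of_finite (Set.Definable.preimage_comp (Equiv.sumProdDistrib α β (Fin d)) hS)
  convert h1 using 1
  ext u
  have key : ∀ w : β × Fin d → K, dec B (Sum.elim u w ∘ Equiv.sumProdDistrib α β (Fin d)) = Sum.elim (dec B u) (dec B w) := by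
    intro w; funext i; rcases i with i | i <;> simp [dec]
  constructor
  · rintro ⟨w, hw⟩
    obtain ⟨w', rfl⟩ := dec_surj B w
    refine ⟨w', ?_⟩
    change dec B (Sum.elim u w' ∘ Equiv.sumProdDistrib α β (Fin d)) ∈ S
    rw [key]; exact hw
  · rintro ⟨w, hw⟩
    refine ⟨dec B w, ?_⟩
    change dec B (Sum.elim u w ∘ Equiv.sumProdDistrib α β (Fin d)) ∈ S at hw
    rwa [key] at hw

theorem coord_poly (P : MvPolynomial α K') : ∃ Q : Fin d → MvPolynomial (α × Fin d) K,
    ∀ u, MvPolynomial.eval (dec B u) P = ∑ k, MvPolynomial.eval u (Q k) • B k := by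
  classical
  induction P using MvPolynomial.induction_on with
  | C c => exact ⟨fun k => MvPolynomial.C (B.repr c k), fun u => by simp [B.sum_repr]⟩
  | add P P' h h' =>
    obtain ⟨Q, hQ⟩ := h
    obtain ⟨Q', hQ'⟩ := h'
    exact ⟨fun k => Q k + Q' k, fun u => by simp [hQ, hQ', add_smul, Finset.sum_add_distrib]⟩
  | mul_X P i h =>
    obtain ⟨Q, hQ⟩ := h
    refine ⟨fun k => ∑ m, ∑ n, Q m * MvPolynomial.X (i, n) * MvPolynomial.C (B.repr (B m * B n) k), fun u => ?_⟩
    simp only [map_mul, MvPolynomial.eval_X, hQ, map_sum, MvPolynomial.eval_C, dec, Finset.sum_smul]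
    rw [Finset.sum_mul_sum, Finset.sum_comm (s := Finset.univ (α := Fin d)) (t := Finset.univ (α := Fin d)) (f := fun k m => ∑ n, _)]
    refine Finset.sum_congr rfl fun m _ => ?_
    rw [Finset.sum_comm]
    refine Finset.sum_congr rfl fun n _ => ?_
    simp only [mul_smul, ← Finset.smul_sum, B.sum_repr]
    rw [smul_mul_smul_comm, mul_smul]

theorem def_poly {ι : Type} (P : Finset (MvPolynomial ι K)) :
    letI : FirstOrder.Ring.CompatibleRing K := FirstOrder.Ring.compatibleRingOfRing K
    Set.Definable (Set.univ : Set K) FirstOrder.Language.ring {u : ι → K | ∀ Q ∈ P, MvPolynomial.eval u Q = 0} := by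
  letI : FirstOrder.Ring.CompatibleRing K := FirstOrder.Ring.compatibleRingOfRing K
  have h := (FirstOrder.Ring.mvPolynomial_zeroLocus_definable P).mono (Set.subset_univ _)
  rw [MvPolynomial.zeroLocus_span] at h
  exact h

theorem Dfn.poly (P : MvPolynomial α K') : Dfn B {v | MvPolynomial.eval v P = 0} := by
  classical
  obtain ⟨Q, hQ⟩ := coord_poly B P
  unfold Dfn
  convert def_poly (Finset.univ.image Q) using 1
  ext u
  change MvPolynomial.eval (dec B u) P = 0 ↔ ∀ R ∈ Finset.univ.image Q, MvPolynomial.eval u R = 0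
  rw [hQ]
  simp only [Finset.mem_image, Finset.mem_univ, true_and, forall_exists_index, forall_apply_eq_imp_iff]
  constructor
  · exact Fintype.linearIndependent_iff.1 B.linearIndependent (fun k => MvPolynomial.eval u (Q k))
  · intro h; simp [h]

theorem Dfn.polys (P : Finset (MvPolynomial α K')) : Dfn B {v | ∀ Q ∈ P, MvPolynomial.eval v Q = 0} := by
  classical
  induction P using Finset.induction_on with
  | empty =>
    convert Dfn.poly B (0 : MvPolynomial α K') using 1
    ext; simp
  | insert Q P _ ih =>
    convert Dfn.inter B (Dfn.poly B Q) ih using 1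
    ext; simp

theorem Dfn.pullback {S : Set (Unit → K')} (hS : Dfn B S) : FODefinable {x : K | (fun _ => algebraMap K K' x) ∈ S} := by
  classical
  unfold FODefinable Dfn Set.Definable₁ at *
  letI : FirstOrder.Ring.CompatibleRing K := FirstOrder.Ring.compatibleRingOfRing K
  have h1 := Set.Definable.preimage_comp (Sum.inr : _ → Fin 1 ⊕ (Unit × Fin d)) hS
  have h2 := def_poly (K := K) (ι := Fin 1 ⊕ (Unit × Fin d))
    (Finset.univ.image fun k => MvPolynomial.X (Sum.inr ((), k)) - MvPolynomial.X (Sum.inl 0) * MvPolynomial.C (B.repr 1 k))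
  convert Set.Definable.exists_of_finite (Set.Definable.inter h1 h2) using 1
  ext x
  have key : ∀ w : Unit × Fin d → K, (∀ k, w ((), k) = x 0 * B.repr 1 k) → dec B w = fun _ => algebraMap K K' (x 0) := by
    intro w hw
    funext i
    simp only [dec, hw, mul_smul, ← Finset.smul_sum, B.sum_repr, Algebra.algebraMap_eq_smul_one]
  constructor
  · intro hx
    refine ⟨fun y => x 0 * B.repr 1 y.2, ?_, ?_⟩
    · change dec B _ ∈ S
      have h3 := key (fun y : Unit × Fin d => x 0 * B.repr 1 y.2) (fun _ => rfl)
      have h4 : dec B (fun y : Unit × Fin d => x 0 * B.repr 1 y.2) ∈ S := by rw [h3]; exact hx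
      exact h4
    · intro Q hQ
      obtain ⟨k, _, rfl⟩ := Finset.mem_image.1 hQ
      simp
  · rintro ⟨w, h, h'⟩
    change dec B w ∈ S at h
    have : ∀ k, w ((), k) = x 0 * B.repr 1 k := by
      intro k
      have := h' _ (Finset.mem_image_of_mem _ (Finset.mem_univ k))
      simpa [sub_eq_zero] using this
    rw [key w this] at h
    exact h

end M23
end

section
open Polynomial

section M24
variable {q : ℕ}

theorem mk_eq_zero_monic {R : Type} [CommRing R] {m : R[X]} (hm : m.Monic) (f : R[X]) : AdjoinRoot.mk m f = 0 ↔ f %ₘ m = 0 := by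
  rw [AdjoinRoot.mk_eq_zero, modByMonic_eq_zero_iff_dvd hm]

theorem prTT_zero_iff (hq : q ≠ 0) {A : Type} [CommRing A] (e1 e2 : A) (f : A[X][X]) :
    ∃ S : Finset A, ∀ (R : Type) [CommRing R] (φ : A →+* R),
      prTT q (φ e1) (φ e2) (f.map (mapRingHom φ)) = 0 ↔ ∀ c ∈ S, φ c = 0 := by
  classical
  let f' := f %ₘ (X ^ q - C (C e2))
  let r : ℕ → A[X] := fun k => f'.coeff k %ₘ (X ^ q - C e1)
  refine ⟨f'.support.biUnion fun k => (r k).support.image (r k).coeff, fun R _ φ => ?_⟩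
  have h1 : prTT q (φ e1) (φ e2) (f.map (mapRingHom φ)) = 0 ↔
      (f'.map (mapRingHom φ)).map (AdjoinRoot.mk (X ^ q - C (φ e1) : R[X])) = 0 := by
    unfold prTT
    rw [RingHom.comp_apply, mk_eq_zero_monic (monic_X_pow_sub_C _ hq), coe_mapRingHom]
    simp only [f']
    rw [map_modByMonic _ (monic_X_pow_sub_C _ hq), map_modByMonic _ ((monic_X_pow_sub_C _ hq).map _)]
    simp [Polynomial.map_sub, Polynomial.map_pow, AdjoinRoot.mk_C]
  have h2 : ∀ k, AdjoinRoot.mk (X ^ q - C (φ e1) : R[X]) ((f'.coeff k).map φ) = 0 ↔ ∀ j, φ ((r k).coeff j) = 0 := by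
    intro k
    rw [mk_eq_zero_monic (monic_X_pow_sub_C _ hq)]
    have : (f'.coeff k).map φ %ₘ (X ^ q - C (φ e1)) = (r k).map φ := by
      simp only [r]
      rw [map_modByMonic _ (monic_X_pow_sub_C _ hq)]
      simp
    rw [this, Polynomial.ext_iff]
    simp
  rw [h1, Polynomial.ext_iff]
  simp only [coeff_map, coeff_zero, coe_mapRingHom, h2]
  constructor
  · intro h c hc
    simp only [Finset.mem_biUnion, Finset.mem_image] at hc
    obtain ⟨k, _, j, _, rfl⟩ := hc
    exact h k j
  · intro h k j
    by_cases hj : (r k).coeff j = 0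
    · rw [hj, map_zero]
    · refine h _ (Finset.mem_biUnion.2 ⟨k, ?_, Finset.mem_image.2 ⟨j, mem_support_iff.2 hj, rfl⟩⟩)
      rw [mem_support_iff]
      intro hk
      apply hj
      simp only [r, hk, zero_modByMonic, coeff_zero]

/-- generic element -/
def gel (q : ℕ) {R : Type} [CommRing R] (y : Fin q → Fin q → R) : R[X][X] :=
  ∑ j, C (∑ k, C (y j k) * X ^ (k : ℕ)) * X ^ (j : ℕ)

theorem gel_map {R R' : Type} [CommRing R] [CommRing R'] (φ : R →+* R') (y : Fin q → Fin q → R) :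
    (gel q y).map (mapRingHom φ) = gel q (fun j k => φ (y j k)) := by
  simp [gel, Polynomial.map_sum]

theorem sum_fin_of_natDegree_lt {R : Type} [CommRing R] {f : R[X]} (h : f.natDegree < q) :
    f = ∑ k : Fin q, C (f.coeff k) * X ^ (k : ℕ) := by
  conv_lhs => rw [as_sum_range_C_mul_X_pow' _ h]
  rw [Fin.sum_univ_eq_sum_range (fun i => C (f.coeff i) * X ^ i)]

theorem natDegree_mod_lt {R : Type} [CommRing R] [Nontrivial R] (hq : q ≠ 0) (e : R) (f : R[X]) : (f %ₘ (X ^ q - C e)).natDegree < q := by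
  have := natDegree_modByMonic_lt f (monic_X_pow_sub_C e hq)
    (by intro h; have := congrArg natDegree h; rw [natDegree_X_pow_sub_C, natDegree_one] at this; exact hq this)
  rwa [natDegree_X_pow_sub_C] at this

theorem prTT_gel (hq : q ≠ 0) {R : Type} [CommRing R] [Nontrivial R] (e1 e2 : R) (t : TT q e1 e2) :
    ∃ y : Fin q → Fin q → R, prTT q e1 e2 (gel q y) = t := by
  obtain ⟨f, rfl⟩ := prTT_surj e1 e2 t
  let f' := f %ₘ (X ^ q - C (C e2))
  have k1 : prTT q e1 e2 (X ^ q - C (C e2)) = 0 := by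
    unfold prTT
    rw [RingHom.comp_apply, AdjoinRoot.mk_eq_zero, coe_mapRingHom]
    simp [Polynomial.map_sub, Polynomial.map_pow, AdjoinRoot.mk_C]
  have k2 : prTT q e1 e2 (C (X ^ q - C e1)) = 0 := by
    unfold prTT
    rw [RingHom.comp_apply, coe_mapRingHom, map_C, AdjoinRoot.mk_self, C_0, map_zero]
  have h1 : prTT q e1 e2 f = prTT q e1 e2 f' := by
    conv_lhs => rw [← modByMonic_add_div f (X ^ q - C (C e2))]
    rw [map_add, map_mul, k1, zero_mul, add_zero]
  refine ⟨fun j k => (f'.coeff j %ₘ (X ^ q - C e1)).coeff k, ?_⟩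
  rw [h1]
  have hf' : f'.natDegree < q := natDegree_mod_lt hq _ f
  conv_rhs => rw [sum_fin_of_natDegree_lt hf']
  unfold gel
  rw [map_sum, map_sum]
  refine Finset.sum_congr rfl fun j _ => ?_
  rw [map_mul, map_mul, ← sum_fin_of_natDegree_lt (natDegree_mod_lt hq _ (f'.coeff j))]
  congr 1
  conv_rhs => rw [← modByMonic_add_div (f'.coeff j) (X ^ q - C e1)]
  rw [C_add, C_mul, map_add, map_mul, k2, zero_mul, add_zero]

/-- solvable part -/
theorem dfn_solv {K K' : Type} [Field K] [Field K'] [Algebra K K'] {d : ℕ} (B : Module.Basis (Fin d) K K') (hq : q ≠ 0) {α : Type}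
    (a b e1 e2 : MvPolynomial α K') :
    Dfn B {v | ∃ Y : Fin q → TT q (MvPolynomial.eval v e1) (MvPolynomial.eval v e2),
      normForm q (ofTT q _ _ (MvPolynomial.eval v a)) Y = ofTT q _ _ (MvPolynomial.eval v b)} := by
  let A := MvPolynomial (α ⊕ (Fin q × Fin q × Fin q)) K'
  let ρ : MvPolynomial α K' → A := MvPolynomial.rename Sum.inl
  let g : Fin q → A[X][X] := fun i => gel q (fun j k => MvPolynomial.X (Sum.inr (i, j, k)))
  obtain ⟨S, hS⟩ := prTT_zero_iff hq (ρ e1) (ρ e2) (normForm q (C (C (ρ a))) g - C (C (ρ b)))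
  convert Dfn.exists B (Dfn.polys B S) using 1
  ext v
  have key : ∀ w : Fin q × Fin q × Fin q → K', Sum.elim v w ∈ {v | ∀ Q ∈ S, MvPolynomial.eval v Q = 0} ↔
      normForm q (ofTT q _ _ (MvPolynomial.eval v a)) (fun i => prTT q (MvPolynomial.eval v e1) (MvPolynomial.eval v e2) (gel q fun j k => w (i, j, k)))
       = ofTT q _ _ (MvPolynomial.eval v b) := by
    intro w
    have hρ : ∀ P, MvPolynomial.eval (Sum.elim v w) (ρ P) = MvPolynomial.eval v P := by
      intro P
      simp only [ρ, MvPolynomial.eval_rename]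
      rfl
    refine (hS K' (MvPolynomial.eval (Sum.elim v w))).symm.trans ?_
    rw [hρ, hρ, Polynomial.map_sub, map_sub, sub_eq_zero, ← coe_mapRingHom, normForm_map, normForm_map]
    simp only [coe_mapRingHom, map_C, hρ, prTT_C, g, gel_map]
    have hX : ∀ i, MvPolynomial.eval (Sum.elim v w) (MvPolynomial.X (Sum.inr i) : A) = w i := fun i => by
      exact MvPolynomial.eval_X _
    simp only [hX]
  constructor
  · rintro ⟨Y, hY⟩
    choose y hy using fun i => prTT_gel hq _ _ (Y i)
    refine ⟨fun x => y x.1 x.2.1 x.2.2, (key _).2 ?_⟩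
    simp only [hy]
    exact hY
  · rintro ⟨w, hw⟩
    exact ⟨_, (key w).1 hw⟩

open MvPolynomial in
theorem fodef_cond {K K' : Type} [Field K] [Field K'] [Algebra K K'] {d : ℕ} (B : Module.Basis (Fin d) K K') (hq : q ≠ 0) :
    FODefinable {x : K | x = 0 ∨ Cond q (algebraMap K K' x)} := by
  let x : MvPolynomial (Unit ⊕ Fin 7) K' := MvPolynomial.X (Sum.inl ())
  let z : Fin 7 → MvPolynomial (Unit ⊕ Fin 7) K' := fun i => MvPolynomial.X (Sum.inr i)
  let E1 := 1 + z 4 ^ q * (z 0 + z 1)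
  let E2 := 1 + z 4 ^ q * (z 2 + z 3)
  have h1 := Dfn.compl B (dfn_solv B hq (z 0) (z 2) E1 E2)
  have h2 := Dfn.inter B (Dfn.poly B (z 0 * z 1 - 1)) <| Dfn.inter B (Dfn.poly B (z 2 * z 3 - 1)) <|
    Dfn.inter B (Dfn.poly B (x * z 4 - 1)) <| Dfn.inter B (Dfn.poly B (E1 * z 5 - 1)) <|
    Dfn.inter B (Dfn.poly B (E2 * z 6 - 1)) h1
  have h3 := Dfn.pullback B (Dfn.compl B (Dfn.exists B h2))
  convert h3 using 1
  ext s
  simp only [Set.mem_ofPred_eq, Set.mem_compl_iff, Set.mem_inter_iff, not_exists, not_and]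
  have ex : ∀ w, MvPolynomial.eval (Sum.elim (fun _ => algebraMap K K' s) w) x = algebraMap K K' s := by
    intro w; simp [x]
  have ez : ∀ w i, MvPolynomial.eval (Sum.elim (fun _ => algebraMap K K' s) w) (z i) = w i := by
    intro w i; simp [z]
  have e1 : ∀ w, MvPolynomial.eval (Sum.elim (fun _ => algebraMap K K' s) w) E1 = 1 + w 4 ^ q * (w 0 + w 1) := by
    intro w; simp only [E1, map_add, map_mul, map_pow, map_one, ez]
  have e2 : ∀ w, MvPolynomial.eval (Sum.elim (fun _ => algebraMap K K' s) w) E2 = 1 + w 4 ^ q * (w 2 + w 3) := by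
    intro w; simp only [E2, map_add, map_mul, map_pow, map_one, ez]
  simp only [map_sub, map_mul, map_one, ex, ez, sub_eq_zero]
  constructor
  · intro h w w1 w2 w3 w4 w5
    have hs : s ≠ 0 := by rintro rfl; simp at w3
    refine not_forall_not.2 ((h.resolve_left hs) (w 0) (w 2) _ _ (left_ne_zero_of_mul_eq_one w1) (left_ne_zero_of_mul_eq_one w2) ?_ ?_
      (left_ne_zero_of_mul_eq_one w4) (left_ne_zero_of_mul_eq_one w5))
    · rw [e1, eq_inv_of_mul_eq_one_right w3, eq_inv_of_mul_eq_one_right w1]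
    · rw [e2, eq_inv_of_mul_eq_one_right w3, eq_inv_of_mul_eq_one_right w2]
  · intro h
    by_cases hs : s = 0
    · exact Or.inl hs
    right
    have hs' : algebraMap K K' s ≠ 0 := (_root_.map_ne_zero _).2 hs
    intro a b f1 f2 ha hb hf1 hf2 h1 h2
    have := h ![a, a⁻¹, b, b⁻¹, (algebraMap K K' s)⁻¹, f1⁻¹, f2⁻¹]
    have g1 := e1 ![a, a⁻¹, b, b⁻¹, (algebraMap K K' s)⁻¹, f1⁻¹, f2⁻¹]
    have g2 := e2 ![a, a⁻¹, b, b⁻¹, (algebraMap K K' s)⁻¹, f1⁻¹, f2⁻¹]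
    have g1' := g1.trans hf1.symm
    have g2' := g2.trans hf2.symm
    rw [g1', g2'] at this
    exact not_forall_not.1 (this (mul_inv_cancel₀ ha) (mul_inv_cancel₀ hb) (mul_inv_cancel₀ hs') (mul_inv_cancel₀ h1) (mul_inv_cancel₀ h2))

end M24
end

/-- If `BK` is a `q`-bounded algebraic extension of `𝔽_p(t)`
(`p ≠ q` primes), then the set of elements of `BK` algebraic over `𝔽_p` (the constant
field of `BK`) is first-order definable over `BK`. -/
theorem statement4 (p q : ℕ) [Fact p.Prime] (hq : q.Prime) (hpq : p ≠ q)
    (BK : Type) [Field BK] [Algebra (RatFunc (ZMod p)) BK]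
    [Algebra.IsAlgebraic (RatFunc (ZMod p)) BK]
    [Algebra (ZMod p) BK] [IsScalarTower (ZMod p) (RatFunc (ZMod p)) BK]
    (hqb : IsQBounded q (RatFunc (ZMod p)) BK) :
    FODefinable {x : BK | IsAlgebraic (ZMod p) x} := by
  have hqp : (q : ZMod p) ≠ 0 := by
    rw [Ne, ZMod.natCast_eq_zero_iff, Nat.prime_dvd_prime_iff_eq Fact.out hq]
    exact hpq
  have hqK : (q : BK) ≠ 0 := by
    rw [← map_natCast (algebraMap (ZMod p) BK)]
    exact (_root_.map_ne_zero _).2 hqp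
  obtain ⟨K', i1, i2, i3, ζ, hd, hζ⟩ := exists_cyc hq hqK
  have h := fodef_cond (q := q) (Module.finBasis BK K') hq.ne_zero
  convert h using 1
  ext x
  change IsAlgebraic (ZMod p) x ↔ x = 0 ∨ Cond q (algebraMap BK K' x)
  by_cases hx : x = 0
  · subst hx
    simp [isAlgebraic_zero]
  · rw [cond_iff funF_ratFunc hq hpq hqb hd hζ hx]
    simp [hx]
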